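/- For every irrational number α, every real number β, every real number c satisfying 1 < c < 9/8 and every positive real number θ satisfying θ < (9/c − 8)/10, there exist infinitely many prime numbers p such that p = ⌊n^c⌋ for some positive integer n and ‖αp + β‖ < p^{−θ}. -/

import Mathlib

open Finset

noncomputable def e (z : ℝ) : ℂ := Complex.exp (2 * Real.pi * Complex.I * z)

noncomputable def nint (x : ℝ) : ℝ := |x - round x|

noncomputable def dyN (Y : ℝ) : Finset ℕ :=
  (Finset.range (⌈Y⌉₊ + 1)).filter fun m => Y/2 ≤ (m:ℝ) ∧ (m:ℝ) < Y

noncomputable def dyZ (Y : ℝ) : Finset ℤ :=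
  (Finset.Icc (-(⌈Y⌉₊:ℤ)) (⌈Y⌉₊:ℤ)).filter fun l => l ≠ 0 ∧ Y/2 ≤ |(l:ℝ)| ∧ |(l:ℝ)| < Y

lemma e_add (x y : ℝ) : e (x + y) = e x * e y := by
  simp only [e, ← Complex.exp_add]; push_cast; ring_nf

lemma e_zero : e 0 = 1 := by simp [e]

lemma e_eq (x : ℝ) : e x = Complex.exp (((2 * Real.pi * x : ℝ) : ℂ) * Complex.I) := by
  simp only [e]; push_cast; ring_nf

@[simp] lemma norm_e (x : ℝ) : ‖e x‖ = 1 := by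
  rw [e_eq, Complex.norm_exp_ofReal_mul_I]

lemma conj_e (x : ℝ) : (starRingEnd ℂ) (e x) = e (-x) := by
  rw [e_eq, e_eq, ← Complex.exp_conj, map_mul, Complex.conj_ofReal, Complex.conj_I]
  push_cast; ring_nf

lemma e_sub (x y : ℝ) : e (x - y) = e x * (starRingEnd ℂ) (e y) := by
  rw [conj_e, ← e_add, sub_eq_add_neg]

lemma e_int (n : ℤ) : e n = 1 := by
  rw [e]
  have := Complex.exp_int_mul_two_pi_mul_I n
  rw [← this]; push_cast; ring_nf

lemma e_add_int (x : ℝ) (n : ℤ) : e (x + n) = e x := by rw [e_add, e_int, mul_one]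

lemma e_nat_mul (n : ℕ) (x : ℝ) : e (n * x) = e x ^ n := by
  rw [e, e, ← Complex.exp_nat_mul]; push_cast; ring_nf

/-- Summation by parts. -/
lemma norm_sum_mul_sub_le (G z : ℕ → ℂ) (hz : ∀ n, ‖z n‖ ≤ 1) (M : ℕ) :
    ‖∑ n ∈ range (M + 1), G n * (z n - z (n + 1)) + G M * z (M + 1)‖ ≤
      ‖G 0‖ + ∑ n ∈ range M, ‖G (n + 1) - G n‖ := by
  induction M with
  | zero =>
    simp only [zero_add, range_one, sum_singleton, range_zero, sum_empty, add_zero]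
    have : G 0 * (z 0 - z 1) + G 0 * z 1 = G 0 * z 0 := by ring
    rw [this, norm_mul]
    exact mul_le_of_le_one_right (norm_nonneg _) (hz 0)
  | succ M ih =>
    rw [sum_range_succ, sum_range_succ (fun n => ‖G (n + 1) - G n‖)]
    have : ∑ n ∈ range (M + 1), G n * (z n - z (n + 1)) +
        G (M + 1) * (z (M + 1) - z (M + 1 + 1)) + G (M + 1) * z (M + 1 + 1) =
      (∑ n ∈ range (M + 1), G n * (z n - z (n + 1)) + G M * z (M + 1)) +
        (G (M + 1) - G M) * z (M + 1) := by ring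
    rw [this, ← add_assoc]
    refine (norm_add_le _ _).trans (add_le_add ih ?_)
    rw [norm_mul]
    exact mul_le_of_le_one_right (norm_nonneg _) (hz _)

/-- `1 / (1 - e d)` in terms of the cotangent. -/
lemma one_sub_e_mul (d : ℝ) (hd : Real.sin (Real.pi * d) ≠ 0) :
    ((1 + Complex.I * ((Real.cos (Real.pi * d) / Real.sin (Real.pi * d) : ℝ) : ℂ)) / 2) *
      (1 - e d) = 1 := by
  have h2 : e d = ((Real.cos (Real.pi * d) : ℝ) + (Real.sin (Real.pi * d) : ℝ) * Complex.I) ^ 2 := by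
    have : e d = e (d / 2) ^ 2 := by rw [sq, ← e_add]; ring_nf
    rw [this, e_eq]
    rw [Complex.exp_mul_I, ← Complex.ofReal_cos, ← Complex.ofReal_sin]
    have : 2 * Real.pi * (d / 2) = Real.pi * d := by ring
    rw [this]
  set s := Real.sin (Real.pi * d)
  set k := Real.cos (Real.pi * d)
  have hs : (s : ℂ) ≠ 0 := by exact_mod_cast hd
  have hsk : (s : ℂ) ^ 2 + (k : ℂ) ^ 2 = 1 := by
    exact_mod_cast Real.sin_sq_add_cos_sq (Real.pi * d)
  have hI : Complex.I ^ 2 = -1 := Complex.I_sq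
  have h3 : 1 - ((k : ℂ) + (s : ℂ) * Complex.I) ^ 2 = 2 * s * (s - k * Complex.I) := by
    linear_combination (-1) * hsk - (s : ℂ) ^ 2 * hI
  rw [h2, h3]; push_cast
  field_simp
  linear_combination hsk - (k : ℂ) ^ 2 * hI

lemma two_mul_le_sin_pi {d δ : ℝ} (h1 : δ ≤ d) (h2 : d ≤ 1 - δ) (hδ : 0 ≤ δ) :
    2 * δ ≤ Real.sin (Real.pi * d) := by
  have hpi := Real.pi_pos
  rcases le_total d (1 / 2) with h | h
  · have := Real.mul_le_sin (x := Real.pi * d) (mul_nonneg hpi.le (by linarith)) (by nlinarith)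
    have h3 : 2 / Real.pi * (Real.pi * d) = 2 * d := by field_simp
    linarith
  · have := Real.mul_le_sin (x := Real.pi * (1 - d)) (by apply mul_nonneg <;> linarith) (by nlinarith)
    have h3 : 2 / Real.pi * (Real.pi * (1 - d)) = 2 * (1 - d) := by field_simp
    have h4 : Real.sin (Real.pi * (1 - d)) = Real.sin (Real.pi * d) := by
      rw [← Real.sin_pi_sub]; ring_nf
    linarith

lemma cot_sub_cot_nonneg {a b : ℝ} (ha : 0 < a) (hab : a ≤ b) (hb : b < 1) :
    0 ≤ Real.cos (Real.pi * a) / Real.sin (Real.pi * a) -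
      Real.cos (Real.pi * b) / Real.sin (Real.pi * b) := by
  have hpi := Real.pi_pos
  have hsa : 0 < Real.sin (Real.pi * a) :=
    Real.sin_pos_of_pos_of_lt_pi (by positivity) (by nlinarith)
  have hsb : 0 < Real.sin (Real.pi * b) :=
    Real.sin_pos_of_pos_of_lt_pi (mul_pos hpi (by linarith)) (by nlinarith)
  have hsab : 0 ≤ Real.sin (Real.pi * b - Real.pi * a) :=
    Real.sin_nonneg_of_nonneg_of_le_pi (by nlinarith) (by nlinarith)
  rw [Real.sin_sub] at hsab
  rw [div_sub_div _ _ hsa.ne' hsb.ne']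
  apply div_nonneg _ (by positivity)
  linarith

/-- The Kusmin-Landau inequality, on an initial segment of `ℕ`. -/
lemma kusmin_landau_range (x : ℕ → ℝ) (N : ℕ) (δ : ℝ) (hδ : 0 < δ) (k : ℤ)
    (hd1 : ∀ i, i + 1 < N → k + δ ≤ x (i + 1) - x i)
    (hd2 : ∀ i, i + 1 < N → x (i + 1) - x i ≤ k + 1 - δ)
    (hmono : (∀ i, i + 2 < N → x (i + 1) - x i ≤ x (i + 2) - x (i + 1)) ∨
      (∀ i, i + 2 < N → x (i + 2) - x (i + 1) ≤ x (i + 1) - x i)) :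
    ‖∑ i ∈ range N, e (x i)‖ ≤ 1 + 1 / δ := by
  have hone : (0:ℝ) ≤ 1 / δ := by positivity
  rcases Nat.lt_or_ge N 2 with hN | hN
  · calc ‖∑ i ∈ range N, e (x i)‖ ≤ ∑ i ∈ range N, ‖e (x i)‖ := norm_sum_le _ _
      _ = N := by simp
      _ ≤ 1 := by exact_mod_cast (by omega)
      _ ≤ _ := by linarith
  obtain ⟨M, rfl⟩ : ∃ M, N = M + 2 := ⟨N - 2, by omega⟩
  set d : ℕ → ℝ := fun i => x (i + 1) - x i - k with hd
  set c : ℕ → ℝ := fun i => Real.cos (Real.pi * d i) / Real.sin (Real.pi * d i) with hc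
  set G : ℕ → ℂ := fun i => (1 + Complex.I * ((c i : ℝ) : ℂ)) / 2 with hG
  have hsin : ∀ i, i < M + 1 → 2 * δ ≤ Real.sin (Real.pi * d i) := fun i hi =>
    two_mul_le_sin_pi (by have := hd1 i (by omega); simp only [hd]; linarith)
      (by have := hd2 i (by omega); simp only [hd]; linarith) hδ.le
  have hG1 : ∀ i, i < M + 1 → G i * (e (x i) - e (x (i + 1))) = e (x i) := by
    intro i hi
    have h1 := one_sub_e_mul (d i) (by have := hsin i hi; intro h; linarith)
    have h2 : e (x (i + 1)) = e (x i) * e (d i) := by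
      rw [← e_add, ← e_add_int (x i + d i) k]; congr 1; simp only [hd]; ring
    rw [h2]
    calc G i * (e (x i) - e (x i) * e (d i)) = (G i * (1 - e (d i))) * e (x i) := by ring
      _ = e (x i) := by rw [hG]; simp only [hc]; rw [h1, one_mul]
  have hc1 : ∀ i, i < M + 1 → |c i| ≤ 1 / (2 * δ) := by
    intro i hi
    have h1 := hsin i hi
    simp only [hc]
    rw [abs_div, abs_of_pos (a := Real.sin _) (by linarith)]
    exact div_le_div₀ (by norm_num) (Real.abs_cos_le_one _) (by positivity) h1
  have hGn : ∀ i, i < M + 1 → ‖G i‖ ≤ 1 / 2 + 1 / (4 * δ) := by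
    intro i hi
    simp only [hG, norm_div, Complex.norm_ofNat]
    have : ‖1 + Complex.I * (c i : ℂ)‖ ≤ 1 + 1 / (2 * δ) := by
      refine (norm_add_le _ _).trans ?_
      rw [norm_mul, Complex.norm_I, Complex.norm_real, Real.norm_eq_abs, norm_one, one_mul]
      linarith [hc1 i hi]
    have h4 : 1 / 2 + 1 / (4 * δ) = (1 + 1 / (2 * δ)) / 2 := by field_simp; ring
    rw [h4]; linarith
  have hdiff : ∀ i, ‖G (i + 1) - G i‖ = |c (i + 1) - c i| / 2 := by
    intro i
    have : G (i + 1) - G i = Complex.I * ((c (i + 1) - c i : ℝ) : ℂ) / 2 := by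
      simp only [hG]; push_cast; ring
    rw [this, norm_div, norm_mul, Complex.norm_I, Complex.norm_real, Real.norm_eq_abs]; simp
  have hdpos : ∀ i, i < M + 1 → 0 < d i ∧ d i < 1 := by
    intro i hi
    have h1 := hd1 i (by omega)
    have h2 := hd2 i (by omega)
    simp only [hd]
    constructor <;> linarith
  have htel : ∑ n ∈ range M, |c (n + 1) - c n| ≤ 1 / δ := by
    have hend : |c M - c 0| ≤ 1 / δ := by
      have h1 := abs_sub (c M) (c 0)
      have h2 := hc1 M (by omega)
      have h3 := hc1 0 (by omega)
      have h4 : 1 / δ = 1 / (2 * δ) + 1 / (2 * δ) := by field_simp; ring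
      linarith
    rcases hmono with h | h
    · have : ∀ n ∈ range M, |c (n + 1) - c n| = -(c (n + 1) - c n) := by
        intro n hn
        have hn' := mem_range.1 hn
        rw [abs_of_nonpos]
        have := cot_sub_cot_nonneg (hdpos n (by omega)).1
          (b := d (n + 1)) (by have := h n (by omega); simp only [hd]; linarith)
          (hdpos (n + 1) (by omega)).2
        simp only [hc]; linarith
      rw [sum_congr rfl this, sum_neg_distrib, sum_range_sub]
      exact (neg_le_abs _).trans hend
    · have : ∀ n ∈ range M, |c (n + 1) - c n| = (c (n + 1) - c n) := by
        intro n hn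
        have hn' := mem_range.1 hn
        rw [abs_of_nonneg]
        have := cot_sub_cot_nonneg (hdpos (n + 1) (by omega)).1
          (b := d n) (by have := h n (by omega); simp only [hd]; linarith)
          (hdpos n (by omega)).2
        simp only [hc]; linarith
      rw [sum_congr rfl this, sum_range_sub]
      exact (le_abs_self _).trans hend
  have key := norm_sum_mul_sub_le G (fun i => e (x i)) (fun i => (norm_e _).le) M
  have hsum : ∑ i ∈ range (M + 2), e (x i) =
      (∑ n ∈ range (M + 1), G n * (e (x n) - e (x (n + 1))) + G M * e (x (M + 1))) +
        (1 - G M) * e (x (M + 1)) := by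
    rw [sum_range_succ, sum_congr rfl (fun i hi => hG1 i (mem_range.1 hi))]; ring
  rw [hsum]
  have h1G : ‖1 - G M‖ ≤ 1 / 2 + 1 / (4 * δ) := by
    have : 1 - G M = (starRingEnd ℂ) (G M) := by
      simp only [hG, map_div₀, map_add, map_one, map_mul, Complex.conj_I, Complex.conj_ofReal,
        map_ofNat]
      ring
    rw [this, RCLike.norm_conj]
    exact hGn M (by omega)
  have hlast : ‖(1 - G M) * e (x (M + 1))‖ ≤ 1 / 2 + 1 / (4 * δ) := by
    rw [norm_mul, norm_e, mul_one]; exact h1G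
  refine (norm_add_le _ _).trans ((add_le_add key hlast).trans ?_)
  simp only [hdiff]
  rw [← Finset.sum_div]
  have h0 := hGn 0 (by omega)
  have h5 : 1 / (4 * δ) = (1 / δ) / 4 := by field_simp
  rw [h5] at h0 ⊢
  linarith

lemma ordConnected_eq_image (T : Finset ℤ) (hT : (T : Set ℤ).OrdConnected) :
    ∃ (a : ℤ) (N : ℕ), T = (range N).image (fun i : ℕ => a + (i : ℤ)) := by
  rcases T.eq_empty_or_nonempty with rfl | hne
  · exact ⟨0, 0, by simp⟩
  · refine ⟨T.min' hne, (T.max' hne - T.min' hne + 1).toNat, ?_⟩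
    ext z
    simp only [mem_image, mem_range]
    constructor
    · intro hz
      have h1 := T.min'_le z hz
      have h2 := T.le_max' z hz
      exact ⟨(z - T.min' hne).toNat, by omega, by omega⟩
    · rintro ⟨i, hi, rfl⟩
      exact hT.out (T.min'_mem hne) (T.max'_mem hne) ⟨by omega, by omega⟩

/-- The Kusmin-Landau inequality over an interval of integers. -/
lemma kusmin_landau (T : Finset ℤ) (hT : (T : Set ℤ).OrdConnected) (x : ℤ → ℝ) (δ : ℝ)
    (hδ : 0 < δ) (k : ℤ)
    (hd1 : ∀ i, i ∈ T → i + 1 ∈ T → k + δ ≤ x (i + 1) - x i)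
    (hd2 : ∀ i, i ∈ T → i + 1 ∈ T → x (i + 1) - x i ≤ k + 1 - δ)
    (hmono : (∀ i, i ∈ T → i + 1 ∈ T → i + 2 ∈ T → x (i + 1) - x i ≤ x (i + 2) - x (i + 1)) ∨
      (∀ i, i ∈ T → i + 1 ∈ T → i + 2 ∈ T → x (i + 2) - x (i + 1) ≤ x (i + 1) - x i)) :
    ‖∑ i ∈ T, e (x i)‖ ≤ 1 + 1 / δ := by
  obtain ⟨a, N, rfl⟩ := ordConnected_eq_image T hT
  have hmem : ∀ i : ℕ, i < N → a + (i : ℤ) ∈ (range N).image (fun i : ℕ => a + (i : ℤ)) :=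
    fun i hi => mem_image_of_mem _ (mem_range.2 hi)
  have hmem1 : ∀ i : ℕ, i + 1 < N → a + (i : ℤ) + 1 ∈ (range N).image (fun i : ℕ => a + (i : ℤ)) :=
    fun i hi => by have := hmem (i + 1) hi; push_cast at this; rwa [add_assoc]
  have hmem2 : ∀ i : ℕ, i + 2 < N → a + (i : ℤ) + 2 ∈ (range N).image (fun i : ℕ => a + (i : ℤ)) :=
    fun i hi => by have := hmem (i + 2) hi; push_cast at this; rwa [add_assoc]
  rw [sum_image (fun i _ j _ h => by simpa using h)]
  refine kusmin_landau_range (fun i => x (a + i)) N δ hδ k ?_ ?_ ?_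
  · intro i hi
    have := hd1 _ (hmem i (by omega)) (hmem1 i hi)
    push_cast; rwa [add_assoc] at this
  · intro i hi
    have := hd2 _ (hmem i (by omega)) (hmem1 i hi)
    push_cast; rwa [add_assoc] at this
  · rcases hmono with h | h
    · left; intro i hi
      have := h _ (hmem i (by omega)) (hmem1 i (by omega)) (hmem2 i hi)
      push_cast; simpa only [add_assoc] using this
    · right; intro i hi
      have := h _ (hmem i (by omega)) (hmem1 i (by omega)) (hmem2 i hi)
      push_cast; simpa only [add_assoc] using this

/-- The Kusmin-Landau inequality for first differences of one sign that are at most `1/2`. -/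
lemma kusmin_landau_half (T : Finset ℤ) (hT : (T : Set ℤ).OrdConnected) (x : ℤ → ℝ) (δ : ℝ)
    (hδ : 0 < δ)
    (hd : (∀ i, i ∈ T → i + 1 ∈ T → δ ≤ x (i + 1) - x i ∧ x (i + 1) - x i ≤ 1 / 2) ∨
      (∀ i, i ∈ T → i + 1 ∈ T → δ ≤ -(x (i + 1) - x i) ∧ -(x (i + 1) - x i) ≤ 1 / 2))
    (hmono : (∀ i, i ∈ T → i + 1 ∈ T → i + 2 ∈ T → x (i + 1) - x i ≤ x (i + 2) - x (i + 1)) ∨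
      (∀ i, i ∈ T → i + 1 ∈ T → i + 2 ∈ T → x (i + 2) - x (i + 1) ≤ x (i + 1) - x i)) :
    ‖∑ i ∈ T, e (x i)‖ ≤ 2 + 1 / δ := by
  have hone : (0:ℝ) ≤ 1 / δ := by positivity
  rcases le_or_gt δ (1 / 2) with hδ2 | hδ2
  · rcases hd with h | h
    · have := kusmin_landau T hT x δ hδ 0 (fun i h1 h2 => by have := h i h1 h2; push_cast; linarith)
        (fun i h1 h2 => by have := h i h1 h2; push_cast; linarith) hmono
      linarith
    · have := kusmin_landau T hT x δ hδ (-1)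
        (fun i h1 h2 => by have := h i h1 h2; push_cast; linarith)
        (fun i h1 h2 => by have := h i h1 h2; push_cast; linarith) hmono
      linarith
  · have := kusmin_landau T hT x (1/4) (by norm_num) 0 (fun i h1 h2 => by
        exfalso; rcases hd with h | h <;> · have := h i h1 h2; linarith)
      (fun i h1 h2 => by
        exfalso; rcases hd with h | h <;> · have := h i h1 h2; linarith) hmono
    have hcard : T.card ≤ 1 := by
      rw [Finset.card_le_one]
      intro a ha b hb
      have aux : ∀ a ∈ T, ∀ b ∈ T, ¬ a < b := by
        intro a ha b hb hab
        have h1 : a + 1 ∈ T := hT.out ha hb ⟨by omega, by omega⟩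
        rcases hd with h | h <;> · have := h a ha h1; linarith
      have h1 := aux a ha b hb
      have h2 := aux b hb a ha
      omega
    calc ‖∑ i ∈ T, e (x i)‖ ≤ ∑ i ∈ T, ‖e (x i)‖ := norm_sum_le _ _
      _ = T.card := by simp
      _ ≤ 1 := by exact_mod_cast hcard
      _ ≤ _ := by linarith

lemma norm_sum_e_le_card {ι : Type*} (T : Finset ι) (x : ι → ℝ) : ‖∑ i ∈ T, e (x i)‖ ≤ T.card := by
  calc ‖∑ i ∈ T, e (x i)‖ ≤ ∑ i ∈ T, ‖e (x i)‖ := norm_sum_le _ _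
      _ = T.card := by simp

/-- The second derivative test in terms of second differences. -/
lemma second_difference_test (T : Finset ℤ) (hT : (T : Set ℤ).OrdConnected) (x : ℤ → ℝ)
    (lam C : ℝ) (hlam : 0 < lam) (hC : 1 ≤ C)
    (h1 : ∀ i, i ∈ T → i + 1 ∈ T → i + 2 ∈ T →
      lam ≤ (x (i + 2) - x (i + 1)) - (x (i + 1) - x i))
    (h2 : ∀ i, i ∈ T → i + 1 ∈ T → i + 2 ∈ T →
      (x (i + 2) - x (i + 1)) - (x (i + 1) - x i) ≤ C * lam) :
    ‖∑ i ∈ T, e (x i)‖ ≤ 20 * C * (T.card * √lam + 1 / √lam) := by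
  set s := √lam with hs
  have hspos : 0 < s := Real.sqrt_pos.2 hlam
  have hss : s * s = lam := Real.mul_self_sqrt hlam.le
  rcases le_or_gt (1/2) s with hbig | hsmall
  · have h3 := norm_sum_e_le_card T x
    have : (0:ℝ) ≤ 1 / s := by positivity
    have hT0 : (0:ℝ) ≤ T.card := by positivity
    nlinarith [mul_nonneg hT0 (sub_nonneg.2 hbig), mul_nonneg (sub_nonneg.2 hC) (add_nonneg (mul_nonneg hT0 hspos.le) this)]
  rcases T.eq_empty_or_nonempty with rfl | hne
  · simp; positivity
  -- all the points except the last
  set T' := T.filter (fun i => i + 1 ∈ T) with hT'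
  set d : ℤ → ℝ := fun i => x (i + 1) - x i with hd
  have hstep : ∀ n : ℕ, ∀ i, i ∈ T' → i + n ∈ T' →
      lam * n ≤ d (i + n) - d i ∧ d (i + n) - d i ≤ C * lam * n := by
    intro n
    induction n with
    | zero => intro i _ _; simp
    | succ n ih =>
      intro i hi hin
      push_cast at hin ⊢
      have hi1 := (mem_filter.1 hi)
      have hin1 := (mem_filter.1 hin)
      have hm : ∀ j : ℤ, i ≤ j → j ≤ i + (n + 1) + 1 → j ∈ T := fun j h h' =>
        hT.out hi1.1 hin1.2 ⟨h, h'⟩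
      have hmid : i + n ∈ T' := mem_filter.2 ⟨hm _ (by omega) (by omega), hm _ (by omega) (by omega)⟩
      have ih' := ih i hi hmid
      have e1 := h1 (i + n) (hm _ (by omega) (by omega)) (hm _ (by omega) (by omega))
        (hm _ (by omega) (by omega))
      have e2 := h2 (i + n) (hm _ (by omega) (by omega)) (hm _ (by omega) (by omega))
        (hm _ (by omega) (by omega))
      have e3 : d (i + (n + 1)) = x (i + n + 2) - x (i + n + 1) := by
        simp only [hd]; ring_nf
      have e4 : d (i + n) = x (i + n + 1) - x (i + n) := by
        simp only [hd]
      rw [e3]; rw [e4] at ih'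
      constructor <;> nlinarith
  have hT'ord : (T' : Set ℤ).OrdConnected := by
    constructor
    intro a ha b hb z hz
    simp only [hT', coe_filter, Set.mem_ofPred_eq] at ha hb ⊢
    exact ⟨hT.out ha.1 hb.1 hz, hT.out ha.1 hb.2 ⟨by have := hz.1; omega, by have := hz.2; omega⟩⟩
  have hmono : ∀ i ∈ T', ∀ j ∈ T', i ≤ j → d i ≤ d j := by
    intro i hi j hj hij
    obtain ⟨n, rfl⟩ : ∃ n : ℕ, j = i + n := ⟨(j - i).toNat, by omega⟩
    have := (hstep n i hi hj).1
    have h0 : 0 ≤ lam * n := by positivity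
    linarith
  set κ : ℤ → ℤ := fun i => ⌊d i + s⌋ with hκ
  have hκmono : ∀ i ∈ T', ∀ j ∈ T', i ≤ j → κ i ≤ κ j := fun i hi j hj hij =>
    Int.floor_le_floor (by have := hmono i hi j hj hij; linarith)
  -- the fibres
  have hfib : ∀ k : ℤ, ‖∑ i ∈ T'.filter (fun i => κ i = k), e (x i)‖ ≤ 5 / s := by
    intro k
    set A := T'.filter (fun i => κ i = k) with hA
    have hAord : (A : Set ℤ).OrdConnected := by
      constructor
      intro a ha b hb z hz
      simp only [hA, coe_filter, Set.mem_ofPred_eq] at ha hb ⊢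
      have hz' : z ∈ T' := hT'ord.out ha.1 hb.1 hz
      refine ⟨hz', le_antisymm ?_ ?_⟩
      · rw [← hb.2]; exact hκmono _ hz' _ hb.1 hz.2
      · rw [← ha.2]; exact hκmono _ ha.1 _ hz' hz.1
    have hAd : ∀ i ∈ A, k ≤ d i + s ∧ d i + s < k + 1 := by
      intro i hi
      have := (mem_filter.1 hi).2
      simp only [hκ] at this
      rw [Int.floor_eq_iff] at this
      exact this
    rw [← sum_filter_add_sum_filter_not A (fun i => d i < k + s)]
    have hB : ‖∑ i ∈ A.filter (fun i => d i < k + s), e (x i)‖ ≤ 2 / s + 1 := by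
      refine (norm_sum_e_le_card _ _).trans ?_
      rcases (A.filter (fun i => d i < k + s)).eq_empty_or_nonempty with h0 | hne
      · rw [h0]; simp; positivity
      set B := A.filter (fun i => d i < k + s) with hB
      have hmin := mem_filter.1 (B.min'_mem hne)
      have hmax := mem_filter.1 (B.max'_mem hne)
      have hle := B.min'_le_max' hne
      set a := B.min' hne
      set b := B.max' hne
      obtain ⟨n, hn⟩ : ∃ n : ℕ, b = a + n := ⟨(b - a).toNat, by omega⟩
      have hcard : B.card ≤ n + 1 := by
        calc B.card ≤ (Icc a b).card := card_le_card (fun z hz =>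
              mem_Icc.2 ⟨B.min'_le z hz, B.le_max' z hz⟩)
          _ = n + 1 := by rw [Int.card_Icc, hn]; omega
      have h5 := (hstep n a (mem_filter.1 hmin.1).1 (hn ▸ (mem_filter.1 hmax.1).1)).1
      rw [← hn] at h5
      have h6 := hAd a hmin.1
      have h7 := hmax.2
      have h8 : lam * n ≤ 2 * s := by linarith
      have h9 : (n:ℝ) ≤ 2 / s := by
        rw [le_div_iff₀ hspos]; nlinarith
      calc (B.card : ℝ) ≤ n + 1 := by exact_mod_cast hcard
        _ ≤ _ := by linarith
    have hG : ‖∑ i ∈ A.filter (fun i => ¬ d i < k + s), e (x i)‖ ≤ 1 + 1 / s := by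
      refine kusmin_landau _ ?_ x s hspos k ?_ ?_ ?_
      · constructor
        intro a ha b hb z hz
        simp only [coe_filter, Set.mem_ofPred_eq, not_lt] at ha hb ⊢
        have hz' : z ∈ A := hAord.out ha.1 hb.1 hz
        exact ⟨hz', ha.2.trans (hmono _ (mem_filter.1 ha.1).1 _ (mem_filter.1 hz').1 hz.1)⟩
      · intro i hi _
        exact not_lt.1 (mem_filter.1 hi).2
      · intro i hi _
        have := (hAd i (mem_filter.1 hi).1).2
        simp only [hd] at this; linarith
      · left
        intro i hi hi1 _
        have := hmono i (mem_filter.1 (mem_filter.1 hi).1).1 (i + 1)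
          (mem_filter.1 (mem_filter.1 hi1).1).1 (by omega)
        simp only [hd] at this
        rwa [add_assoc] at this
    refine (norm_add_le _ _).trans ((add_le_add hB hG).trans ?_)
    have : 2 ≤ 1 / s := by rw [le_div_iff₀ hspos]; linarith
    have h3 : 2 / s = 2 * (1 / s) := by ring
    have h5 : 5 / s = 5 * (1 / s) := by ring
    rw [h3, h5]; linarith
  have hT'sum : ‖∑ i ∈ T', e (x i)‖ ≤ (C * lam * T.card + 2) * (5 / s) := by
    rcases T'.eq_empty_or_nonempty with h0 | hne'
    · rw [h0]; simp; positivity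
    have hmin := T'.min'_mem hne'
    have hmax := T'.max'_mem hne'
    have hle := T'.min'_le_max' hne'
    set a := T'.min' hne'
    set b := T'.max' hne'
    obtain ⟨n, hn⟩ : ∃ n : ℕ, b = a + n := ⟨(b - a).toNat, by omega⟩
    have himg : ∀ i ∈ T', κ i ∈ Icc (κ a) (κ b) := fun i hi => mem_Icc.2
      ⟨hκmono _ hmin _ hi (T'.min'_le i hi), hκmono _ hi _ hmax (T'.le_max' i hi)⟩
    rw [← sum_fiberwise_of_maps_to himg]
    have h5 := (hstep n a hmin (hn ▸ hmax)).2
    rw [← hn] at h5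
    have hncard : n ≤ T.card := by
      have : Icc a b ⊆ T := by
        intro z hz
        exact (mem_filter.1 (hT'ord.out hmin hmax (mem_Icc.1 hz))).1
      have := card_le_card this
      rw [Int.card_Icc, hn] at this; omega
    have hcnt : ((Icc (κ a) (κ b)).card : ℝ) ≤ C * lam * T.card + 2 := by
      rw [Int.card_Icc]
      have h6 := hκmono a hmin b hmax hle
      have h7 : (((κ b + 1 - κ a).toNat : ℤ) : ℝ) = κ b + 1 - κ a := by
        rw [Int.toNat_of_nonneg (by omega)]; push_cast; ring
      have h8 : ((κ b + 1 - κ a).toNat : ℝ) = κ b + 1 - κ a := by exact_mod_cast h7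
      rw [h8]
      have h9 : (κ b : ℝ) ≤ d b + s := Int.floor_le _
      have h10 : d a + s < κ a + 1 := Int.lt_floor_add_one _
      have h11 : C * lam * n ≤ C * lam * T.card := by
        apply mul_le_mul_of_nonneg_left (by exact_mod_cast hncard) (by positivity)
      linarith
    calc ‖∑ k ∈ Icc (κ a) (κ b), ∑ i ∈ T' with κ i = k, e (x i)‖
        ≤ ∑ k ∈ Icc (κ a) (κ b), 5 / s := norm_sum_le_of_le _ (fun k _ => hfib k)
      _ = (Icc (κ a) (κ b)).card * (5 / s) := by rw [sum_const, nsmul_eq_mul]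
      _ ≤ _ := by gcongr
  rw [← sum_filter_add_sum_filter_not T (fun i => i + 1 ∈ T)]
  have hlast : ‖∑ i ∈ T.filter (fun i => ¬ (i + 1 ∈ T)), e (x i)‖ ≤ 1 := by
    refine (norm_sum_e_le_card _ _).trans ?_
    have : (T.filter (fun i => ¬ (i + 1 ∈ T))).card ≤ 1 := by
      rw [Finset.card_le_one]
      intro a ha b hb
      rw [mem_filter] at ha hb
      have aux : ∀ a ∈ T, ∀ b ∈ T, a + 1 ∉ T → ¬ a < b := fun a ha b hb h1 hab =>
        h1 (hT.out ha hb ⟨by omega, by omega⟩)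
      have h1 := aux a ha.1 b hb.1 ha.2
      have h2 := aux b hb.1 a ha.1 hb.2
      omega
    exact_mod_cast this
  refine (norm_add_le _ _).trans ((add_le_add hT'sum hlast).trans ?_)
  have h20 : (C * lam * T.card + 2) * (5 / s) = 5 * C * (T.card * s) + 10 * (1 / s) := by
    rw [← hss]; field_simp; ring
  rw [h20]
  have h21 : 2 ≤ 1 / s := by rw [le_div_iff₀ hspos]; linarith
  have hT0 : (0:ℝ) ≤ T.card * s := by positivity
  nlinarith [mul_nonneg (sub_nonneg.2 hC) hT0, mul_nonneg (sub_nonneg.2 hC) (by positivity : 0 ≤ 1 / s)]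

/-- First difference of a real power. -/
noncomputable def dd (β a x : ℝ) : ℝ := (x + a) ^ β - x ^ β

/-- Second difference of a real power. -/
noncomputable def ddd (β a b x : ℝ) : ℝ := dd β a (x + b) - dd β a x

/-- Third difference of a real power. -/
noncomputable def dddd (β a b c x : ℝ) : ℝ := ddd β a b (x + c) - ddd β a b x

lemma hasDerivAt_rpow_add (β a x : ℝ) (hx : 0 < x) (ha : 0 ≤ a) :
    HasDerivAt (fun y : ℝ => (y + a) ^ β) (β * (x + a) ^ (β - 1)) x := by
  have h := (((hasDerivAt_id x).add_const a).rpow_const (p := β) (Or.inl (by simp; linarith)))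
  simpa using h

lemma hasDerivAt_dd (β a x : ℝ) (hx : 0 < x) (ha : 0 ≤ a) :
    HasDerivAt (dd β a) (β * dd (β - 1) a x) x := by
  have h := (hasDerivAt_rpow_add β a x hx ha).sub (hasDerivAt_rpow_add β 0 x hx le_rfl)
  simp only [add_zero] at h
  rw [dd, mul_sub]
  exact h

lemma hasDerivAt_ddd (β a b x : ℝ) (hx : 0 < x) (ha : 0 ≤ a) (hb : 0 ≤ b) :
    HasDerivAt (ddd β a b) (β * ddd (β - 1) a b x) x := by
  have h := ((hasDerivAt_dd β a (x + b) (by linarith) ha).comp_add_const x b).sub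
    (hasDerivAt_dd β a x hx ha)
  rw [ddd, mul_sub]
  exact h

lemma exists_sub_eq_mul (f f' : ℝ → ℝ) (x a : ℝ) (hx : 0 < x) (ha : 0 ≤ a)
    (h : ∀ y, 0 < y → HasDerivAt f (f' y) y) :
    ∃ t, x ≤ t ∧ t ≤ x + a ∧ f (x + a) - f x = a * f' t := by
  rcases ha.eq_or_lt with rfl | ha
  · exact ⟨x, le_rfl, by simp, by simp⟩
  · obtain ⟨t, ht, h1⟩ := exists_hasDerivAt_eq_slope f f' (by linarith : x < x + a)
      (fun y hy => (h y (by linarith [hy.1])).continuousAt.continuousWithinAt)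
      (fun y hy => h y (by linarith [hy.1]))
    refine ⟨t, ht.1.le, ht.2.le, ?_⟩
    rw [h1, add_sub_cancel_left]; field_simp

lemma exists_dd_eq (β a x : ℝ) (hx : 0 < x) (ha : 0 ≤ a) :
    ∃ t, x ≤ t ∧ t ≤ x + a ∧ dd β a x = a * β * t ^ (β - 1) := by
  obtain ⟨t, h1, h2, h3⟩ := exists_sub_eq_mul (fun y => y ^ β) (fun y => β * y ^ (β - 1)) x a hx ha
    (fun y hy => Real.hasDerivAt_rpow_const (Or.inl hy.ne'))
  exact ⟨t, h1, h2, by rw [dd, h3]; ring⟩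

lemma exists_ddd_eq (β a b x : ℝ) (hx : 0 < x) (ha : 0 ≤ a) (hb : 0 ≤ b) :
    ∃ t, x ≤ t ∧ t ≤ x + a + b ∧ ddd β a b x = a * b * (β * (β - 1)) * t ^ (β - 2) := by
  obtain ⟨t, h1, h2, h3⟩ := exists_sub_eq_mul (dd β a) (fun y => β * dd (β - 1) a y) x b hx hb
    (fun y hy => hasDerivAt_dd β a y hy ha)
  obtain ⟨u, h4, h5, h6⟩ := exists_dd_eq (β - 1) a t (by linarith) ha
  refine ⟨u, by linarith, by linarith, ?_⟩
  rw [ddd, h3, h6, show β - 2 = β - 1 - 1 by ring]; ring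

lemma exists_dddd_eq (β a b c x : ℝ) (hx : 0 < x) (ha : 0 ≤ a) (hb : 0 ≤ b) (hc : 0 ≤ c) :
    ∃ t, x ≤ t ∧ t ≤ x + a + b + c ∧
      dddd β a b c x = a * b * c * (β * (β - 1) * (β - 2)) * t ^ (β - 3) := by
  obtain ⟨t, h1, h2, h3⟩ := exists_sub_eq_mul (ddd β a b) (fun y => β * ddd (β - 1) a b y) x c hx hc
    (fun y hy => hasDerivAt_ddd β a b y hy ha hb)
  obtain ⟨u, h4, h5, h6⟩ := exists_ddd_eq (β - 1) a b t (by linarith) ha hb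
  refine ⟨u, by linarith, by linarith, ?_⟩
  rw [dddd, h3, h6, show β - 1 - 2 = β - 3 by ring]; ring

lemma norm_sum_e_neg {ι : Type*} (T : Finset ι) (x : ι → ℝ) :
    ‖∑ i ∈ T, e (-x i)‖ = ‖∑ i ∈ T, e (x i)‖ := by
  rw [← RCLike.norm_conj (∑ i ∈ T, e (x i)), map_sum]
  simp only [conj_e]

lemma card_le_of_mem_Icc (T : Finset ℤ) (M : ℝ) (hM : 1 ≤ M) (h : ∀ m ∈ T, 0 ≤ (m : ℝ) ∧ (m : ℝ) ≤ M) :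
    (T.card : ℝ) ≤ 2 * M := by
  have : T ⊆ Icc 0 ⌊M⌋ := by
    intro m hm
    obtain ⟨h1, h2⟩ := h m hm
    rw [mem_Icc]
    exact ⟨by exact_mod_cast h1, Int.le_floor.2 h2⟩
  have h1 := card_le_card this
  rw [Int.card_Icc] at h1
  have h0 : 0 ≤ ⌊M⌋ := Int.floor_nonneg.2 (by linarith)
  have h2 : ((T.card : ℤ) : ℝ) ≤ ⌊M⌋ + 1 := by
    exact_mod_cast (show (T.card : ℤ) ≤ ⌊M⌋ + 1 by omega)
  have h3 := Int.floor_le M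
  push_cast at h2
  linarith

/-- The second derivative test of van der Corput for `A m ^ γ + ξ m`. -/
lemma van_der_corput (γ : ℝ) (hγ0 : 0 < γ) (hγ1 : γ < 1) :
    ∃ C : ℝ, 1 ≤ C ∧ ∀ (A ξ M : ℝ) (T : Finset ℤ), A ≠ 0 → 1 ≤ M → (T : Set ℤ).OrdConnected →
      (∀ m ∈ T, M / 16 ≤ m ∧ (m : ℝ) ≤ M) →
      ‖∑ m ∈ T, e (A * (m : ℝ) ^ γ + ξ * m)‖ ≤
        C * (√(|A| * M ^ γ) + M / √(|A| * M ^ γ)) := by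
  set κ := γ * (1 - γ) with hκ
  have hκ0 : 0 < κ := mul_pos hγ0 (by linarith)
  have hκ1 : κ ≤ 1 := by nlinarith
  set s := √κ with hs
  have hs0 : 0 < s := Real.sqrt_pos.2 hκ0
  have hs1 : s ≤ 1 := Real.sqrt_le_one.2 hκ1
  refine ⟨20 * 256 * 2 / s, ?_, ?_⟩
  · rw [le_div_iff₀ hs0]; linarith
  -- it suffices to treat negative `A`
  have main : ∀ (A ξ M : ℝ) (T : Finset ℤ), 0 < A → 1 ≤ M → (T : Set ℤ).OrdConnected →
      (∀ m ∈ T, M / 16 ≤ m ∧ (m : ℝ) ≤ M) →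
      ‖∑ m ∈ T, e (-A * (m : ℝ) ^ γ + ξ * m)‖ ≤
        20 * 256 * 2 / s * (√(A * M ^ γ) + M / √(A * M ^ γ)) := by
    intro A ξ M T hA hM hT hTM
    have hM0 : 0 < M := by linarith
    set lam := A * κ * M ^ (γ - 2) with hlam
    have hlam0 : 0 < lam := by positivity
    have hsecond : ∀ i : ℤ, i ∈ T → i + 2 ∈ T →
        lam ≤ -A * ddd γ 1 1 i ∧ -A * ddd γ 1 1 i ≤ 256 * lam := by
      intro i hi hi2
      have h1 := (hTM i hi).1
      have h2 := (hTM (i + 2) hi2).2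
      push_cast at h2
      obtain ⟨t, ht1, ht2, ht⟩ := exists_ddd_eq γ 1 1 i (by linarith) zero_le_one zero_le_one
      have h3 : -A * ddd γ 1 1 i = A * κ * t ^ (γ - 2) := by rw [ht, hκ]; ring
      rw [h3, hlam]
      have hlow : M ^ (γ - 2) ≤ t ^ (γ - 2) :=
        Real.rpow_le_rpow_of_nonpos (by linarith) (by linarith) (by linarith)
      have hup : t ^ (γ - 2) ≤ 256 * M ^ (γ - 2) := by
        calc t ^ (γ - 2) ≤ (M / 16) ^ (γ - 2) :=
              Real.rpow_le_rpow_of_nonpos (by linarith) (by linarith) (by linarith)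
          _ = M ^ (γ - 2) * 16 ^ (2 - γ) := by
              rw [Real.div_rpow hM0.le (by norm_num), div_eq_mul_inv, ← Real.rpow_neg (by norm_num)]
              ring_nf
          _ ≤ M ^ (γ - 2) * 16 ^ (2 : ℝ) := by
              gcongr
              · norm_num
              · linarith
          _ = 256 * M ^ (γ - 2) := by norm_num; ring
      have hAκ : 0 < A * κ := by positivity
      constructor
      · exact mul_le_mul_of_nonneg_left hlow hAκ.le
      · nlinarith
    have hid : ∀ i : ℤ, (-A * ((i + 2 : ℤ) : ℝ) ^ γ + ξ * ((i + 2 : ℤ) : ℝ) -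
          (-A * ((i + 1 : ℤ) : ℝ) ^ γ + ξ * ((i + 1 : ℤ) : ℝ))) -
        (-A * ((i + 1 : ℤ) : ℝ) ^ γ + ξ * ((i + 1 : ℤ) : ℝ) - (-A * (i : ℝ) ^ γ + ξ * (i : ℝ))) =
        -A * ddd γ 1 1 i := by
      intro i
      simp only [ddd, dd]; push_cast
      rw [show (i : ℝ) + 1 + 1 = i + 2 by ring]; ring
    have key := second_difference_test T hT (fun m => -A * (m : ℝ) ^ γ + ξ * m) lam 256 hlam0
      (by norm_num) (fun i hi hi1 hi2 => by rw [hid]; exact (hsecond i hi hi2).1)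
      (fun i hi hi1 hi2 => by rw [hid]; exact (hsecond i hi hi2).2)
    have hcard : (T.card : ℝ) ≤ 2 * M := card_le_of_mem_Icc T M hM
      (fun m hm => ⟨by linarith [(hTM m hm).1], (hTM m hm).2⟩)
    have hsq : √lam = s * √(A * M ^ γ) / M := by
      rw [hlam, hs, ← Real.sqrt_mul hκ0.le]
      have : A * κ * M ^ (γ - 2) = κ * (A * M ^ γ) / M ^ 2 := by
        rw [Real.rpow_sub hM0]; norm_num; ring
      rw [this, Real.sqrt_div' _ (by positivity), Real.sqrt_sq hM0.le]
    set F := √(A * M ^ γ) with hF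
    have hF0 : 0 < F := Real.sqrt_pos.2 (by positivity)
    refine key.trans ?_
    rw [hsq]
    calc 20 * 256 * (T.card * (s * F / M) + 1 / (s * F / M))
        ≤ 20 * 256 * (2 * M * (s * F / M) + 1 / (s * F / M)) := by gcongr
      _ = 20 * 256 / s * (2 * s ^ 2 * F + M / F) := by field_simp
      _ ≤ 20 * 256 / s * (2 * F + 2 * (M / F)) := by
          have : s ^ 2 ≤ 1 := by nlinarith
          have h7 : 0 < M / F := by positivity
          gcongr
          · nlinarith
          · linarith
      _ = _ := by ring
  intro A ξ M T hA hM hT hTM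
  rcases lt_or_gt_of_ne hA with h | h
  · have := main (-A) ξ M T (by linarith) hM hT hTM
    rw [abs_of_neg h]; simpa using this
  · have := main A (-ξ) M T h hM hT hTM
    rw [abs_of_pos h]
    rw [← norm_sum_e_neg]
    convert this using 5
    ring

/-- The correlation sum of `e ∘ f` over `S` with shift `r`. -/
noncomputable def corr {G : Type*} [AddCommGroup G] [DecidableEq G] (S : Finset G) (f : G → ℝ)
    (r : G) : ℂ :=
  ∑ y ∈ S.filter (fun y => y + r ∈ S), e (f (y + r) - f y)

lemma corr_neg {G : Type*} [AddCommGroup G] [DecidableEq G] (S : Finset G) (f : G → ℝ) (r : G) :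
    corr S f (-r) = (starRingEnd ℂ) (corr S f r) := by
  rw [corr, corr, map_sum]
  refine sum_bij' (fun y _ => y - r) (fun y _ => y + r) ?_ ?_ ?_ ?_ ?_
  · intro y hy; rw [mem_filter] at hy ⊢; simpa [sub_eq_add_neg, and_comm] using hy
  · intro y hy; rw [mem_filter] at hy ⊢; simpa [and_comm] using hy
  · intro y _; simp
  · intro y _; simp
  · intro y _
    rw [conj_e]; simp [sub_eq_add_neg, add_comm]

/-- The Weyl-van der Corput inequality, in a family. -/
lemma weyl_van_der_corput {ι G : Type*} [AddCommGroup G] [DecidableEq G] (I : Finset ι)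
    (S : ι → Finset G) (f : ι → G → ℝ) (B T : Finset G)
    (hT : ∀ i ∈ I, ∀ y ∈ S i, ∀ b ∈ B, y - b ∈ T) :
    ∑ i ∈ I, ((B.card : ℝ) * ‖∑ y ∈ S i, e (f i y)‖) ^ 2 ≤
      T.card * ∑ b ∈ B, ∑ b' ∈ B, ‖∑ i ∈ I, corr (S i) (f i) (b' - b)‖ := by
  classical
  set z : ι → G → ℂ := fun i y => if y ∈ S i then e (f i y) else 0 with hz
  have hshift : ∀ i ∈ I, ∀ b ∈ B, ∑ x ∈ T, z i (x + b) = ∑ y ∈ S i, e (f i y) := by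
    intro i hi b hb
    simp only [hz]
    rw [← sum_filter]
    refine sum_bij' (fun x _ => x + b) (fun y _ => y - b) ?_ ?_ ?_ ?_ ?_
    · intro x hx; exact (mem_filter.1 hx).2
    · intro y hy; rw [mem_filter]; exact ⟨hT i hi y hy b hb, by simpa using hy⟩
    · intro y _; simp
    · intro y _; simp
    · intro y _; rfl
  have hcorr : ∀ i ∈ I, ∀ b ∈ B, ∀ b' ∈ B,
      ∑ x ∈ T, z i (x + b') * (starRingEnd ℂ) (z i (x + b)) = corr (S i) (f i) (b' - b) := by
    intro i hi b hb b' hb'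
    have : ∀ x ∈ T, z i (x + b') * (starRingEnd ℂ) (z i (x + b)) =
        if (x + b ∈ S i ∧ x + b' ∈ S i) then e (f i (x + b') - f i (x + b)) else 0 := by
      intro x _
      simp only [hz]
      by_cases h1 : x + b ∈ S i <;> by_cases h2 : x + b' ∈ S i <;> simp [h1, h2, e_sub]
    rw [sum_congr rfl this, ← sum_filter, corr]
    refine sum_bij' (fun x _ => x + b) (fun y _ => y - b) ?_ ?_ ?_ ?_ ?_
    · intro x hx
      rw [mem_filter] at hx ⊢
      refine ⟨hx.2.1, ?_⟩
      rw [show x + b + (b' - b) = x + b' by abel]; exact hx.2.2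
    · intro y hy
      rw [mem_filter] at hy ⊢
      refine ⟨hT i hi y hy.1 b hb, by simpa using hy.1, ?_⟩
      rw [show y - b + b' = y + (b' - b) by abel]; exact hy.2
    · intro y _; simp
    · intro y _; simp
    · intro x _
      rw [show x + b + (b' - b) = x + b' by abel]
  have hi1 : ∀ i ∈ I, ((B.card : ℝ) * ‖∑ y ∈ S i, e (f i y)‖) ^ 2 ≤
      T.card * ∑ x ∈ T, ‖∑ b ∈ B, z i (x + b)‖ ^ 2 := by
    intro i hi
    have h1 : (B.card : ℂ) * ∑ y ∈ S i, e (f i y) = ∑ x ∈ T, ∑ b ∈ B, z i (x + b) := by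
      rw [sum_comm, sum_congr rfl (fun b hb => hshift i hi b hb), sum_const, nsmul_eq_mul]
    have h2 : (B.card : ℝ) * ‖∑ y ∈ S i, e (f i y)‖ = ‖∑ x ∈ T, ∑ b ∈ B, z i (x + b)‖ := by
      rw [← h1, norm_mul]; simp
    rw [h2]
    have h3 : ‖∑ x ∈ T, ∑ b ∈ B, z i (x + b)‖ ≤ ∑ x ∈ T, ‖∑ b ∈ B, z i (x + b)‖ := norm_sum_le _ _
    calc _ ≤ (∑ x ∈ T, ‖∑ b ∈ B, z i (x + b)‖) ^ 2 := by gcongr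
      _ ≤ _ := sq_sum_le_card_mul_sum_sq
  have hi2 : ∀ i ∈ I, ((∑ x ∈ T, ‖∑ b ∈ B, z i (x + b)‖ ^ 2 : ℝ) : ℂ) =
      ∑ b ∈ B, ∑ b' ∈ B, corr (S i) (f i) (b' - b) := by
    intro i hi
    push_cast
    have : ∀ x ∈ T, ((‖∑ b ∈ B, z i (x + b)‖ : ℂ)) ^ 2 =
        ∑ b ∈ B, ∑ b' ∈ B, z i (x + b') * (starRingEnd ℂ) (z i (x + b)) := by
      intro x _
      rw [← Complex.mul_conj', map_sum, sum_mul_sum, sum_comm]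
    rw [sum_congr rfl this, sum_comm]
    refine sum_congr rfl fun b hb => ?_
    rw [sum_comm]
    exact sum_congr rfl fun b' hb' => hcorr i hi b hb b' hb'
  calc _ ≤ ∑ i ∈ I, T.card * ∑ x ∈ T, ‖∑ b ∈ B, z i (x + b)‖ ^ 2 := sum_le_sum hi1
    _ = T.card * ∑ i ∈ I, ∑ x ∈ T, ‖∑ b ∈ B, z i (x + b)‖ ^ 2 := by rw [mul_sum]
    _ ≤ _ := by
      gcongr
      have h5 : ((∑ i ∈ I, ∑ x ∈ T, ‖∑ b ∈ B, z i (x + b)‖ ^ 2 : ℝ) : ℂ) =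
          ∑ b ∈ B, ∑ b' ∈ B, ∑ i ∈ I, corr (S i) (f i) (b' - b) := by
        rw [Complex.ofReal_sum, sum_congr rfl hi2, sum_comm]
        exact sum_congr rfl fun b _ => sum_comm
      have h6 : ∑ i ∈ I, ∑ x ∈ T, ‖∑ b ∈ B, z i (x + b)‖ ^ 2 =
          ‖((∑ i ∈ I, ∑ x ∈ T, ‖∑ b ∈ B, z i (x + b)‖ ^ 2 : ℝ) : ℂ)‖ := by
        rw [Complex.norm_real, Real.norm_of_nonneg (by positivity)]
      rw [h6, h5]
      exact norm_sum_le_of_le _ fun b _ => norm_sum_le _ _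

lemma sum_sum_sub_le {G : Type*} [AddCommGroup G] (B D : Finset G) (g : G → ℝ)
    (hg : ∀ r ∈ D, 0 ≤ g r) (hD : ∀ b ∈ B, ∀ b' ∈ B, b' - b ∈ D) :
    ∑ b ∈ B, ∑ b' ∈ B, g (b' - b) ≤ B.card * ∑ r ∈ D, g r := by
  classical
  have : ∀ b ∈ B, ∑ b' ∈ B, g (b' - b) ≤ ∑ r ∈ D, g r := by
    intro b hb
    rw [← sum_image (f := g) (g := fun b' => b' - b) (fun x _ y _ h => by simpa using h)]
    refine sum_le_sum_of_subset_of_nonneg ?_ (fun r hr _ => hg r hr)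
    intro r hr
    obtain ⟨b', hb', rfl⟩ := mem_image.1 hr
    exact hD b hb b' hb'
  calc _ ≤ ∑ b ∈ B, ∑ r ∈ D, g r := sum_le_sum this
    _ = _ := by rw [sum_const, nsmul_eq_mul]

lemma card_le_of_spaced {ι : Type*} (S : Finset ι) (φ : ι → ℝ) (c l s : ℝ) (hs : 0 < s)
    (h1 : ∀ i ∈ S, |φ i - c| ≤ l) (h2 : ∀ i ∈ S, ∀ j ∈ S, i ≠ j → s ≤ |φ i - φ j|) :
    S.card ≤ ⌊2 * l / s⌋₊ + 1 := by
  have hmap : ∀ i ∈ S, ⌊(φ i - (c - l)) / s⌋₊ ∈ range (⌊2 * l / s⌋₊ + 1) := by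
    intro i hi
    rw [mem_range, Nat.lt_succ_iff]
    apply Nat.floor_le_floor
    have := abs_le.1 (h1 i hi)
    gcongr; linarith
  have := card_le_card_of_injOn _ hmap (by
    intro i hi j hj hij
    by_contra hne
    have h3 := h2 i hi j hj hne
    have hi' := abs_le.1 (h1 i hi)
    have hj' := abs_le.1 (h1 j hj)
    have e1 := Nat.floor_le (a := (φ i - (c - l)) / s) (div_nonneg (by linarith) hs.le)
    have e2 := Nat.lt_floor_add_one ((φ i - (c - l)) / s)
    have e3 := Nat.floor_le (a := (φ j - (c - l)) / s) (div_nonneg (by linarith) hs.le)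
    have e4 := Nat.lt_floor_add_one ((φ j - (c - l)) / s)
    simp only at hij
    rw [hij] at e1 e2
    have h4 : |(φ i - (c - l)) / s - (φ j - (c - l)) / s| < 1 := by
      rw [abs_lt]; constructor <;> linarith
    have h5 : (φ i - (c - l)) / s - (φ j - (c - l)) / s = (φ i - φ j) / s := by ring
    rw [h5, abs_div, abs_of_pos hs, div_lt_one hs] at h4
    linarith)
  simpa using this

lemma eq_of_mul_eq_of_gcd_eq {d h k h' k' : ℕ} (hh : 0 < h) (hg : Nat.gcd h k = d)
    (hg' : Nat.gcd h' k' = d) (hk : h * k' = h' * k) : h = h' ∧ k = k' := by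
  have hd : 0 < d := hg ▸ Nat.gcd_pos_of_pos_left _ hh
  obtain ⟨a, b, hab, ha, hb⟩ := Nat.exists_coprime h k
  obtain ⟨a', b', hab', ha', hb'⟩ := Nat.exists_coprime h' k'
  rw [hg] at ha hb; rw [hg'] at ha' hb'
  subst ha hb ha' hb'
  have h1 : a * b' = a' * b := by
    have : (a * b') * (d * d) = (a' * b) * (d * d) := by linear_combination hk
    exact Nat.eq_of_mul_eq_mul_right (by positivity) this
  have h2 : a ∣ a' := hab.dvd_of_dvd_mul_right ⟨b', h1.symm⟩
  have h3 : a' ∣ a := hab'.dvd_of_dvd_mul_right ⟨b, h1⟩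
  have h4 : a = a' := Nat.dvd_antisymm h2 h3
  subst h4
  have ha0 : 0 < a := Nat.pos_of_ne_zero (by rintro rfl; simp at hh)
  have := Nat.eq_of_mul_eq_mul_left ha0 h1
  exact ⟨rfl, by rw [this]⟩

lemma frac_spacing {d N h k h' k' : ℕ} (hh : 0 < h) (hk0 : 0 < k) (hk0' : 0 < k')
    (hk : k ≤ 2 * N) (hk' : k' ≤ 2 * N) (hg : Nat.gcd h k = d) (hg' : Nat.gcd h' k' = d)
    (hne : ¬ (h = h' ∧ k = k')) :
    (d : ℝ) ^ 2 / (4 * N ^ 2) ≤ |(h : ℝ) / k - h' / k'| := by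
  have hkr : (0 : ℝ) < k := by exact_mod_cast hk0
  have hkr' : (0 : ℝ) < k' := by exact_mod_cast hk0'
  rw [div_sub_div _ _ hkr.ne' hkr'.ne', abs_div, abs_of_pos (mul_pos hkr hkr')]
  have hdvd : ((d : ℤ)) ^ 2 ∣ (h : ℤ) * k' - k * h' := by
    have h1 : (d : ℤ) ∣ h := by exact_mod_cast hg ▸ Nat.gcd_dvd_left h k
    have h2 : (d : ℤ) ∣ k := by exact_mod_cast hg ▸ Nat.gcd_dvd_right h k
    have h3 : (d : ℤ) ∣ h' := by exact_mod_cast hg' ▸ Nat.gcd_dvd_left h' k'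
    have h4 : (d : ℤ) ∣ k' := by exact_mod_cast hg' ▸ Nat.gcd_dvd_right h' k'
    rw [sq]
    exact dvd_sub (mul_dvd_mul h1 h4) (mul_dvd_mul h2 h3)
  have hne0 : (h : ℤ) * k' - k * h' ≠ 0 := by
    intro h0
    apply hne
    apply eq_of_mul_eq_of_gcd_eq hh hg hg'
    have : (h : ℤ) * k' = h' * k := by linarith
    exact_mod_cast this
  have hle : ((d : ℤ)) ^ 2 ≤ |(h : ℤ) * k' - k * h'| :=
    Int.le_of_dvd (abs_pos.2 hne0) ((dvd_abs _ _).2 hdvd)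
  have hle' : (d : ℝ) ^ 2 ≤ |(h : ℝ) * k' - k * h'| := by exact_mod_cast hle
  have h5 : (k : ℝ) * k' ≤ 4 * N ^ 2 := by
    have : k * k' ≤ (2 * N) * (2 * N) := Nat.mul_le_mul hk hk'
    have : (k : ℝ) * k' ≤ (2 * N) * (2 * N) := by exact_mod_cast this
    linarith
  exact div_le_div₀ (abs_nonneg _) hle' (mul_pos hkr hkr') h5

lemma card_multiples_Ico_le (N d : ℕ) :
    (((Ico N (2 * N)).filter (fun x => d ∣ x ∧ 0 < x)).card : ℝ) ≤ 2 * N / d := by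
  have h1 : (Ico N (2 * N)).filter (fun x => d ∣ x ∧ 0 < x) ⊆ (Ioc 0 (2 * N)).filter (fun x => d ∣ x) := by
    intro x hx
    simp only [mem_filter, mem_Ico, mem_Ioc] at hx ⊢
    omega
  have h2 := card_le_card h1
  rw [Nat.Ioc_filter_dvd_card_eq_div] at h2
  calc _ ≤ ((2 * N / d : ℕ) : ℝ) := by exact_mod_cast h2
    _ ≤ ((2 * N : ℕ) : ℝ) / d := Nat.cast_div_le
    _ = _ := by push_cast; ring

lemma rpow_spacing {γ r r' : ℝ} (hγ0 : 0 < γ) (hγ1 : γ < 1) (h1 : 0 < r) (h2 : r ≤ 2)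
    (h1' : 0 < r') (h2' : r' ≤ 2) : γ / 2 * |r - r'| ≤ |r ^ γ - r' ^ γ| := by
  wlog hle : r' ≤ r generalizing r r'
  · have := this h1' h2' h1 h2 (le_of_not_ge hle)
    rwa [abs_sub_comm r, abs_sub_comm (r ^ γ)]
  obtain ⟨t, ht1, ht2, ht⟩ := exists_dd_eq γ (r - r') r' h1' (by linarith)
  rw [dd, add_sub_cancel] at ht
  rw [add_sub_cancel] at ht2
  have : (1 : ℝ) / 2 ≤ t ^ (γ - 1) := by
    calc (1 : ℝ) / 2 = 2 ^ (-1 : ℝ) := by rw [Real.rpow_neg_one]; norm_num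
      _ ≤ 2 ^ (γ - 1) := Real.rpow_le_rpow_of_exponent_le (by norm_num) (by linarith)
      _ ≤ t ^ (γ - 1) := Real.rpow_le_rpow_of_nonpos (by linarith) (by linarith) (by linarith)
  rw [ht, abs_of_nonneg (sub_nonneg.2 hle)]
  have h0 : 0 ≤ (r - r') * γ := mul_nonneg (by linarith) hγ0.le
  rw [abs_of_nonneg (mul_nonneg h0 (by linarith))]
  nlinarith

/-- The pairs of points `(h, n)` in a dyadic box whose values of `h n ^ γ` are close. -/
noncomputable def closePairs (γ : ℝ) (H N : ℕ) (Δ : ℝ) : Finset ((ℕ × ℕ) × (ℕ × ℕ)) :=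
  ((Ico H (2 * H) ×ˢ Ico N (2 * N)) ×ˢ (Ico H (2 * H) ×ˢ Ico N (2 * N))).filter
    (fun p => |(p.1.1 : ℝ) * (p.1.2 : ℝ) ^ γ - (p.2.1 : ℝ) * (p.2.2 : ℝ) ^ γ| ≤ Δ * (H * (N : ℝ) ^ γ))

lemma ratio_close {γ : ℝ} (hγ0 : 0 < γ) {H N : ℕ} (hH : 0 < H) (hN : 0 < N) {Δ : ℝ} (hΔ : 0 ≤ Δ)
    {h n h' n' : ℕ} (hn : N ≤ n) (hn' : N ≤ n') (hh' : H ≤ h')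
    (hp : |(h : ℝ) * (n : ℝ) ^ γ - (h' : ℝ) * (n' : ℝ) ^ γ| ≤ Δ * (H * (N : ℝ) ^ γ)) :
    |(h : ℝ) / h' - ((n' : ℝ) / n) ^ γ| ≤ Δ := by
  have hn0 : (0 : ℝ) < n := by exact_mod_cast (by omega : 0 < n)
  have hn0' : (0 : ℝ) < n' := by exact_mod_cast (by omega : 0 < n')
  have hh0' : (0 : ℝ) < h' := by exact_mod_cast (by omega : 0 < h')
  have hN0 : (0 : ℝ) < N := by exact_mod_cast hN
  have hH0 : (0 : ℝ) < H := by exact_mod_cast hH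
  have hnγ : (0:ℝ) < (n:ℝ) ^ γ := by positivity
  rw [Real.div_rpow hn0'.le hn0.le, div_sub_div _ _ hh0'.ne' hnγ.ne', abs_div,
    abs_of_pos (mul_pos hh0' hnγ), div_le_iff₀ (by positivity)]
  refine hp.trans (mul_le_mul_of_nonneg_left ?_ hΔ)
  have h1 : (H : ℝ) ≤ h' := by exact_mod_cast hh'
  have h2 : (N : ℝ) ^ γ ≤ (n : ℝ) ^ γ :=
    Real.rpow_le_rpow hN0.le (by exact_mod_cast hn) hγ0.le
  gcongr

lemma sq_min_add_le {a b t : ℝ} (ha : 0 ≤ a) (hb : 0 ≤ b) {x : ℝ} (h1 : x ≤ t + a ^ 2)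
    (h2 : x ≤ t + b ^ 2) : x ≤ t + a * b := by
  rcases le_total a b with h | h <;> nlinarith

lemma card_closePairs_fiber_le {γ : ℝ} (hγ0 : 0 < γ) (hγ1 : γ < 1) {H N : ℕ} (hH : 0 < H)
    (hN : 0 < N) {Δ : ℝ} (hΔ : 0 ≤ Δ) {d k : ℕ} (hd : 0 < d) (hk : 0 < k) :
    (((closePairs γ H N Δ).filter
      (fun p => (Nat.gcd p.1.1 p.2.1, Nat.gcd p.1.2 p.2.2) = (d, k))).card : ℝ) ≤
      64 / γ * (H * N + Δ * H ^ 2 * N ^ 2) * (1 / d * (1 / k)) := by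
  set A := (closePairs γ H N Δ).filter
      (fun p => (Nat.gcd p.1.1 p.2.1, Nat.gcd p.1.2 p.2.2) = (d, k)) with hA
  have hmem : ∀ p ∈ A, (H ≤ p.1.1 ∧ p.1.1 < 2 * H) ∧ (N ≤ p.1.2 ∧ p.1.2 < 2 * N) ∧
      (H ≤ p.2.1 ∧ p.2.1 < 2 * H) ∧ (N ≤ p.2.2 ∧ p.2.2 < 2 * N) ∧ Nat.gcd p.1.1 p.2.1 = d ∧
      Nat.gcd p.1.2 p.2.2 = k ∧ |(p.1.1 : ℝ) / p.2.1 - ((p.2.2 : ℝ) / p.1.2) ^ γ| ≤ Δ := by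
    intro p hp
    simp only [hA, closePairs, mem_filter, mem_product, mem_Ico, Prod.mk.injEq] at hp
    obtain ⟨⟨⟨⟨a1, a2⟩, a3, a4⟩, a5⟩, a6⟩ := hp
    exact ⟨a1, a2, a3, a4, a6.1, a6.2, ratio_close hγ0 hH hN hΔ a2.1 a4.1 a3.1 a5⟩
  have hH0 : (0 : ℝ) < H := by exact_mod_cast hH
  have hN0 : (0 : ℝ) < N := by exact_mod_cast hN
  have hd0 : (1 : ℝ) ≤ d := by exact_mod_cast hd
  have hk0 : (1 : ℝ) ≤ k := by exact_mod_cast hk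
  -- counting with the second coordinates fixed
  have c1 : (A.card : ℝ) ≤ (2 * Δ / ((d : ℝ) ^ 2 / (4 * H ^ 2)) + 1) * (2 * N / k) ^ 2 := by
    set B := (Ico N (2 * N)).filter (fun x => k ∣ x ∧ 0 < x) with hB
    have hmaps : ∀ p ∈ A, (p.1.2, p.2.2) ∈ B ×ˢ B := by
      intro p hp
      obtain ⟨a1, a2, a3, a4, a5, a6, a7⟩ := hmem p hp
      simp only [hB, mem_product, mem_filter, mem_Ico]
      exact ⟨⟨a2, a6 ▸ Nat.gcd_dvd_left _ _, by omega⟩, ⟨a4, a6 ▸ Nat.gcd_dvd_right _ _, by omega⟩⟩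
    have := card_le_mul_card_image_of_maps_to hmaps
      (⌊2 * Δ / ((d : ℝ) ^ 2 / (4 * H ^ 2))⌋₊ + 1) (by
      rintro ⟨n, n'⟩ _
      refine card_le_of_spaced _ (fun p => (p.1.1 : ℝ) / p.2.1) (((n' : ℝ) / n) ^ γ) Δ _
        (by positivity) ?_ ?_
      · intro p hp
        rw [mem_filter, Prod.mk.injEq] at hp
        rw [← hp.2.1, ← hp.2.2]
        exact (hmem p hp.1).2.2.2.2.2.2
      · intro p hp q hq hpq
        rw [mem_filter, Prod.mk.injEq] at hp hq
        obtain ⟨a1, a2, a3, a4, a5, a6, a7⟩ := hmem p hp.1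
        obtain ⟨b1, b2, b3, b4, b5, b6, b7⟩ := hmem q hq.1
        refine frac_spacing (by omega) (by omega) (by omega) a3.2.le b3.2.le a5 b5 ?_
        rintro ⟨e1, e2⟩
        exact hpq (Prod.ext (Prod.ext e1 (hp.2.1.trans hq.2.1.symm))
          (Prod.ext e2 (hp.2.2.trans hq.2.2.symm))))
    have h1 : (A.card : ℝ) ≤ ((⌊2 * Δ / ((d : ℝ) ^ 2 / (4 * H ^ 2))⌋₊ + 1 : ℕ) : ℝ) *
        ((B.card : ℝ) * B.card) := by
      rw [card_product] at this; exact_mod_cast this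
    have h2 : (B.card : ℝ) ≤ 2 * N / k := card_multiples_Ico_le N k
    refine h1.trans ?_
    push_cast
    have h3 := Nat.floor_le (show 0 ≤ 2 * Δ / ((d : ℝ) ^ 2 / (4 * H ^ 2)) by positivity)
    rw [sq (2 * (N:ℝ) / k)]
    gcongr
  have c2 : (A.card : ℝ) ≤ (2 * Δ / (γ / 2 * ((k : ℝ) ^ 2 / (4 * N ^ 2))) + 1) * (2 * H / d) ^ 2 := by
    set B := (Ico H (2 * H)).filter (fun x => d ∣ x ∧ 0 < x) with hB
    have hmaps : ∀ p ∈ A, (p.1.1, p.2.1) ∈ B ×ˢ B := by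
      intro p hp
      obtain ⟨a1, a2, a3, a4, a5, a6, a7⟩ := hmem p hp
      simp only [hB, mem_product, mem_filter, mem_Ico]
      exact ⟨⟨a1, a5 ▸ Nat.gcd_dvd_left _ _, by omega⟩, ⟨a3, a5 ▸ Nat.gcd_dvd_right _ _, by omega⟩⟩
    have := card_le_mul_card_image_of_maps_to hmaps
      (⌊2 * Δ / (γ / 2 * ((k : ℝ) ^ 2 / (4 * N ^ 2)))⌋₊ + 1) (by
      rintro ⟨h, h'⟩ _
      refine card_le_of_spaced _ (fun p => ((p.2.2 : ℝ) / p.1.2) ^ γ) ((h : ℝ) / h') Δ _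
        (by positivity) ?_ ?_
      · intro p hp
        rw [mem_filter, Prod.mk.injEq] at hp
        rw [← hp.2.1, ← hp.2.2, abs_sub_comm]
        exact (hmem p hp.1).2.2.2.2.2.2
      · intro p hp q hq hpq
        rw [mem_filter, Prod.mk.injEq] at hp hq
        obtain ⟨a1, a2, a3, a4, a5, a6, a7⟩ := hmem p hp.1
        obtain ⟨b1, b2, b3, b4, b5, b6, b7⟩ := hmem q hq.1
        have hle : ∀ x y : ℕ, N ≤ x → x < 2 * N → N ≤ y → y < 2 * N →
            0 < (x : ℝ) / y ∧ (x : ℝ) / y ≤ 2 := by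
          intro x y h1 h2 h3 h4
          have hy : (0:ℝ) < y := by exact_mod_cast (by omega : 0 < y)
          have hx : (0:ℝ) < x := by exact_mod_cast (by omega : 0 < x)
          refine ⟨by positivity, ?_⟩
          rw [div_le_iff₀ hy]
          exact_mod_cast (by omega : x ≤ 2 * y)
        have hp2 := hle p.2.2 p.1.2 a4.1 a4.2 a2.1 a2.2
        have hq2 := hle q.2.2 q.1.2 b4.1 b4.2 b2.1 b2.2
        refine le_trans ?_ (rpow_spacing hγ0 hγ1 hp2.1 hp2.2 hq2.1 hq2.2)
        refine mul_le_mul_of_nonneg_left ?_ (by positivity)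
        refine frac_spacing (by omega) (by omega) (by omega) a2.2.le b2.2.le
          (by rw [Nat.gcd_comm]; exact a6) (by rw [Nat.gcd_comm]; exact b6) ?_
        rintro ⟨e1, e2⟩
        exact hpq (Prod.ext (Prod.ext (hp.2.1.trans hq.2.1.symm) e2)
          (Prod.ext (hp.2.2.trans hq.2.2.symm) e1)))
    have h1 : (A.card : ℝ) ≤ ((⌊2 * Δ / (γ / 2 * ((k : ℝ) ^ 2 / (4 * N ^ 2)))⌋₊ + 1 : ℕ) : ℝ) *
        ((B.card : ℝ) * B.card) := by
      rw [card_product] at this; exact_mod_cast this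
    have h2 : (B.card : ℝ) ≤ 2 * H / d := card_multiples_Ico_le H d
    refine h1.trans ?_
    push_cast
    have h3 := Nat.floor_le (show 0 ≤ 2 * Δ / (γ / 2 * ((k : ℝ) ^ 2 / (4 * N ^ 2))) by positivity)
    rw [sq (2 * (H:ℝ) / d)]
    gcongr
  set t := 64 / γ * (Δ * H ^ 2 * N ^ 2) * (1 / d * (1 / k)) with ht
  have hdk : (1 : ℝ) / d ^ 2 * (1 / k ^ 2) ≤ 1 / d * (1 / k) := by
    gcongr
    · nlinarith
    · nlinarith
  have hγ' : (64 : ℝ) ≤ 64 / γ := by rw [le_div_iff₀ hγ0]; linarith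
  have hDHN : 0 ≤ Δ * H ^ 2 * N ^ 2 := by positivity
  have e1 : (A.card : ℝ) ≤ t + (2 * N / k) ^ 2 := by
    refine c1.trans ?_
    have : (2 * Δ / ((d : ℝ) ^ 2 / (4 * H ^ 2)) + 1) * (2 * N / k) ^ 2 =
      32 * (Δ * H ^ 2 * N ^ 2) * (1 / d ^ 2 * (1 / k ^ 2)) + (2 * N / k) ^ 2 := by
      field_simp; ring
    rw [this, ht]
    gcongr
    linarith
  have e2 : (A.card : ℝ) ≤ t + (2 * H / d) ^ 2 := by
    refine c2.trans ?_
    have : (2 * Δ / (γ / 2 * ((k : ℝ) ^ 2 / (4 * N ^ 2))) + 1) * (2 * H / d) ^ 2 =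
      64 / γ * (Δ * H ^ 2 * N ^ 2) * (1 / d ^ 2 * (1 / k ^ 2)) + (2 * H / d) ^ 2 := by
      field_simp; ring
    rw [this, ht]
    gcongr
  have e3 := sq_min_add_le (by positivity) (by positivity) e1 e2
  refine e3.trans ?_
  have e4 : 64 / γ * (H * N + Δ * H ^ 2 * N ^ 2) * (1 / d * (1 / k)) =
    t + 64 / γ * (H * N) * (1 / d * (1 / k)) := by rw [ht]; ring
  have e5 : (2 * (N:ℝ) / k) * (2 * H / d) = 4 * (H * N) * (1 / d * (1 / k)) := by ring
  rw [e4, e5]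
  gcongr
  linarith

lemma sum_inv_le_log (N : ℕ) : ∑ d ∈ Icc 1 N, (1 : ℝ) / d ≤ 1 + Real.log N := by
  have := harmonic_le_one_add_log N
  rw [harmonic_eq_sum_Icc] at this
  push_cast at this
  simpa using this

lemma card_closePairs_le {γ : ℝ} (hγ0 : 0 < γ) (hγ1 : γ < 1) {H N : ℕ} (hH : 0 < H)
    (hN : 0 < N) {Δ : ℝ} (hΔ : 0 ≤ Δ) :
    ((closePairs γ H N Δ).card : ℝ) ≤ 64 / γ * (H * N + Δ * H ^ 2 * N ^ 2) *
      ((1 + Real.log (2 * H)) * (1 + Real.log (2 * N))) := by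
  have hmaps : ∀ p ∈ closePairs γ H N Δ, (Nat.gcd p.1.1 p.2.1, Nat.gcd p.1.2 p.2.2) ∈
      Icc 1 (2 * H) ×ˢ Icc 1 (2 * N) := by
    intro p hp
    simp only [closePairs, mem_filter, mem_product, mem_Ico] at hp
    obtain ⟨⟨⟨⟨a1, a2⟩, a3, a4⟩, a5⟩⟩ := hp
    simp only [mem_product, mem_Icc]
    refine ⟨⟨Nat.gcd_pos_of_pos_left _ (by omega), (Nat.gcd_le_left _ (by omega)).trans (by omega)⟩,
      ⟨Nat.gcd_pos_of_pos_left _ (by omega), (Nat.gcd_le_left _ (by omega)).trans (by omega)⟩⟩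
  rw [card_eq_sum_card_fiberwise hmaps]
  push_cast
  calc _ ≤ ∑ q ∈ Icc 1 (2 * H) ×ˢ Icc 1 (2 * N),
        64 / γ * (H * N + Δ * H ^ 2 * N ^ 2) * ((1 : ℝ) / q.1 * (1 / q.2)) := by
        refine sum_le_sum ?_
        rintro ⟨d, k⟩ hq
        simp only [mem_product, mem_Icc] at hq
        exact card_closePairs_fiber_le hγ0 hγ1 hH hN hΔ (by omega) (by omega)
    _ = 64 / γ * (H * N + Δ * H ^ 2 * N ^ 2) *
        ((∑ d ∈ Icc 1 (2 * H), (1 : ℝ) / d) * ∑ k ∈ Icc 1 (2 * N), (1 : ℝ) / k) := by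
        rw [← mul_sum, sum_product, sum_mul_sum]
    _ ≤ _ := by
        have h1 := sum_inv_le_log (2 * H)
        have h2 := sum_inv_le_log (2 * N)
        push_cast at h1 h2
        have h3 : (0:ℝ) ≤ ∑ k ∈ Icc 1 (2 * N), (1 : ℝ) / k := by positivity
        have h4 : (0:ℝ) ≤ ∑ k ∈ Icc 1 (2 * H), (1 : ℝ) / k := by positivity
        have h5 : (0:ℝ) ≤ 1 + Real.log (2 * H) := h4.trans h1
        gcongr

/-- The Cauchy inequality for a bilinear sum whose inner variable is divided into buckets. -/
lemma bilinear_cauchy {ι μ : Type*} (P : Finset ι) (Ms : Finset μ) (R : ℕ) (κ : ι → ℕ)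
    (hκ : ∀ p ∈ P, κ p ∈ range R) (Y : ℝ) (b : μ → ℂ) (hb : ∀ m ∈ Ms, ‖b m‖ ≤ Y)
    (u : ι → ℂ) (hu : ∀ p ∈ P, ‖u p‖ ≤ Y) (x : ι → μ → ℝ) (dom : ι → μ → Prop)
    [∀ p m, Decidable (dom p m)] :
    ‖∑ m ∈ Ms, b m * ∑ p ∈ P, (if dom p m then u p * e (x p m) else 0)‖ ^ 2 ≤
      Y ^ 4 * Ms.card * R * ∑ q ∈ (P ×ˢ P).filter (fun q => κ q.1 = κ q.2),
        ‖∑ m ∈ Ms.filter (fun m => dom q.1 m ∧ dom q.2 m), e (x q.1 m - x q.2 m)‖ := by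
  set z : ι → μ → ℂ := fun p m => if dom p m then u p * e (x p m) else 0 with hz
  have hY2 : 0 ≤ Y ^ 2 := sq_nonneg _
  have h1 : ‖∑ m ∈ Ms, b m * ∑ p ∈ P, z p m‖ ^ 2 ≤
      Y ^ 2 * Ms.card * ∑ m ∈ Ms, ‖∑ p ∈ P, z p m‖ ^ 2 := by
    have h2 : ‖∑ m ∈ Ms, b m * ∑ p ∈ P, z p m‖ ≤ ∑ m ∈ Ms, ‖b m * ∑ p ∈ P, z p m‖ := norm_sum_le _ _
    calc _ ≤ (∑ m ∈ Ms, ‖b m * ∑ p ∈ P, z p m‖) ^ 2 := by gcongr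
      _ ≤ Ms.card * ∑ m ∈ Ms, ‖b m * ∑ p ∈ P, z p m‖ ^ 2 := sq_sum_le_card_mul_sum_sq
      _ ≤ Ms.card * ∑ m ∈ Ms, Y ^ 2 * ‖∑ p ∈ P, z p m‖ ^ 2 := by
          gcongr with m hm
          rw [norm_mul, mul_pow]
          gcongr
          exact hb m hm
      _ = _ := by rw [← mul_sum]; ring
  have h3 : ∀ m, ‖∑ p ∈ P, z p m‖ ^ 2 ≤ R * ∑ k ∈ range R, ‖∑ p ∈ P with κ p = k, z p m‖ ^ 2 := by
    intro m
    rw [← sum_fiberwise_of_maps_to hκ]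
    have h2 : ‖∑ k ∈ range R, ∑ p ∈ P with κ p = k, z p m‖ ≤
      ∑ k ∈ range R, ‖∑ p ∈ P with κ p = k, z p m‖ := norm_sum_le _ _
    calc _ ≤ (∑ k ∈ range R, ‖∑ p ∈ P with κ p = k, z p m‖) ^ 2 := by gcongr
      _ ≤ _ := by
        have := sq_sum_le_card_mul_sum_sq (s := range R) (f := fun k => ‖∑ p ∈ P with κ p = k, z p m‖)
        rwa [card_range] at this
  have h4 : ((∑ m ∈ Ms, ∑ k ∈ range R, ‖∑ p ∈ P with κ p = k, z p m‖ ^ 2 : ℝ) : ℂ) =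
      ∑ q ∈ (P ×ˢ P).filter (fun q => κ q.1 = κ q.2),
        ∑ m ∈ Ms, z q.1 m * (starRingEnd ℂ) (z q.2 m) := by
    rw [sum_comm (s := (P ×ˢ P).filter _)]
    push_cast
    refine sum_congr rfl fun m _ => ?_
    have : ∀ k ∈ range R, ((‖∑ p ∈ P with κ p = k, z p m‖ : ℂ)) ^ 2 =
        ∑ p ∈ P with κ p = k, ∑ p' ∈ P with κ p = κ p', z p m * (starRingEnd ℂ) (z p' m) := by
      intro k _
      rw [← Complex.mul_conj', map_sum, sum_mul_sum]
      refine sum_congr rfl fun p hp => ?_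
      rw [mem_filter] at hp
      rw [hp.2]
      refine sum_congr ?_ fun _ _ => rfl
      ext p'; simp [eq_comm]
    rw [sum_congr rfl this, sum_fiberwise_of_maps_to hκ
      (f := fun p => ∑ p' ∈ P with κ p = κ p', z p m * (starRingEnd ℂ) (z p' m)), sum_filter,
      sum_product]
    exact sum_congr rfl fun p _ => by rw [sum_filter]
  have h5 : ∑ m ∈ Ms, ∑ k ∈ range R, ‖∑ p ∈ P with κ p = k, z p m‖ ^ 2 ≤
      Y ^ 2 * ∑ q ∈ (P ×ˢ P).filter (fun q => κ q.1 = κ q.2),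
        ‖∑ m ∈ Ms.filter (fun m => dom q.1 m ∧ dom q.2 m), e (x q.1 m - x q.2 m)‖ := by
    have h6 : ∑ m ∈ Ms, ∑ k ∈ range R, ‖∑ p ∈ P with κ p = k, z p m‖ ^ 2 =
        ‖((∑ m ∈ Ms, ∑ k ∈ range R, ‖∑ p ∈ P with κ p = k, z p m‖ ^ 2 : ℝ) : ℂ)‖ := by
      rw [Complex.norm_real, Real.norm_of_nonneg (by positivity)]
    rw [h6, h4, mul_sum]
    refine norm_sum_le_of_le _ fun q hq => ?_
    have hq' := mem_product.1 (mem_filter.1 hq).1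
    have h7 : ∑ m ∈ Ms, z q.1 m * (starRingEnd ℂ) (z q.2 m) =
        (u q.1 * (starRingEnd ℂ) (u q.2)) *
          ∑ m ∈ Ms.filter (fun m => dom q.1 m ∧ dom q.2 m), e (x q.1 m - x q.2 m) := by
      rw [mul_sum, sum_filter]
      refine sum_congr rfl fun m _ => ?_
      simp only [hz]
      by_cases h1 : dom q.1 m <;> by_cases h2 : dom q.2 m <;> simp [h1, h2, e_sub]
      ring
    rw [h7, norm_mul, norm_mul, RCLike.norm_conj, sq]
    gcongr
    · exact (norm_nonneg _).trans (hu _ hq'.1)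
    · exact hu _ hq'.1
    · exact hu _ hq'.2
  calc _ ≤ Y ^ 2 * Ms.card * ∑ m ∈ Ms, ‖∑ p ∈ P, z p m‖ ^ 2 := h1
    _ ≤ Y ^ 2 * Ms.card * ∑ m ∈ Ms, R * ∑ k ∈ range R, ‖∑ p ∈ P with κ p = k, z p m‖ ^ 2 := by
        gcongr with m _; exact h3 m
    _ = Y ^ 2 * Ms.card * R * ∑ m ∈ Ms, ∑ k ∈ range R, ‖∑ p ∈ P with κ p = k, z p m‖ ^ 2 := by
        rw [← mul_sum]; ring
    _ ≤ Y ^ 2 * Ms.card * R * (Y ^ 2 * ∑ q ∈ (P ×ˢ P).filter (fun q => κ q.1 = κ q.2),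
        ‖∑ m ∈ Ms.filter (fun m => dom q.1 m ∧ dom q.2 m), e (x q.1 m - x q.2 m)‖) := by
        gcongr
    _ = _ := by ring

lemma ordConnected_map_cast (T : Finset ℕ) (hT : (T : Set ℕ).OrdConnected) :
    ((T.map Nat.castEmbedding : Finset ℤ) : Set ℤ).OrdConnected := by
  constructor
  intro a ha b hb z hz
  simp only [coe_map, Set.mem_image, mem_coe, Nat.castEmbedding_apply] at ha hb ⊢
  obtain ⟨a, ha, rfl⟩ := ha
  obtain ⟨b, hb, rfl⟩ := hb
  have h1 := hz.1
  have h2 := hz.2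
  exact ⟨z.toNat, hT.out ha hb ⟨by omega, by omega⟩, by omega⟩

lemma van_der_corput_nat (γ : ℝ) (hγ0 : 0 < γ) (hγ1 : γ < 1) :
    ∃ C : ℝ, 1 ≤ C ∧ ∀ (A ξ M : ℝ) (T : Finset ℕ), A ≠ 0 → 1 ≤ M → (T : Set ℕ).OrdConnected →
      (∀ m ∈ T, M / 16 ≤ m ∧ (m : ℝ) ≤ M) →
      ‖∑ m ∈ T, e (A * (m : ℝ) ^ γ + ξ * m)‖ ≤
        C * (√(|A| * M ^ γ) + M / √(|A| * M ^ γ)) := by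
  obtain ⟨C, hC, h⟩ := van_der_corput γ hγ0 hγ1
  refine ⟨C, hC, fun A ξ M T hA hM hT hTM => ?_⟩
  have := h A ξ M (T.map Nat.castEmbedding) hA hM (ordConnected_map_cast T hT) (by
    intro m hm
    obtain ⟨k, hk, rfl⟩ := mem_map.1 hm
    simpa using hTM k hk)
  rw [sum_map] at this
  simpa using this

lemma exists_two_pow_between (r : ℝ) (hr : 1 ≤ r) :
    ∃ J : ℕ, r ≤ 2 ^ J ∧ (2 : ℝ) ^ J ≤ 2 * r ∧ (J : ℝ) ≤ 1 + 3 / 2 * Real.log r := by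
  have h0 : ⌊r⌋₊ ≠ 0 := (Nat.floor_pos.2 hr).ne'
  have h1 := Nat.pow_log_le_self 2 h0
  have h2 := Nat.lt_pow_succ_log_self (b := 2) (by norm_num) ⌊r⌋₊
  have h3 := Nat.floor_le (show 0 ≤ r by linarith)
  have h4 := Nat.lt_floor_add_one r
  have h5 : (2 : ℝ) ^ Nat.log 2 ⌊r⌋₊ ≤ r := by
    refine le_trans ?_ h3
    exact_mod_cast h1
  refine ⟨Nat.log 2 ⌊r⌋₊ + 1, ?_, ?_, ?_⟩
  · have : ((⌊r⌋₊ : ℝ) + 1) ≤ 2 ^ (Nat.log 2 ⌊r⌋₊ + 1) := by exact_mod_cast h2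
    linarith
  · rw [pow_succ]; linarith
  · have h6 := Real.log_le_log (by positivity) h5
    rw [Real.log_pow] at h6
    have h7 : 2 / 3 ≤ Real.log 2 := by linarith [Real.log_two_gt_d9]
    have h8 : (0:ℝ) ≤ (Nat.log 2 ⌊r⌋₊ : ℝ) := by positivity
    push_cast
    nlinarith

set_option maxHeartbeats 1000000 in
lemma sum_closePairs_le {γ : ℝ} (hγ0 : 0 < γ) (hγ1 : γ < 1) {H N K : ℕ} (hH : 0 < H)
    (hN : 0 < N) (hK : 0 < K) (hKN : K ≤ N) {M Lg C : ℝ} (hM : 1 ≤ M) (hC : 1 ≤ C)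
    (hL1 : 1 + Real.log (2 * H) ≤ Lg) (hL2 : 1 + Real.log (2 * N) ≤ Lg)
    (g : (ℕ × ℕ) × (ℕ × ℕ) → ℝ) (hg1 : ∀ q, g q ≤ 2 * M)
    (hg2 : ∀ q ∈ closePairs γ H N (1 / K),
      (q.1.1 : ℝ) * (q.1.2 : ℝ) ^ γ - (q.2.1 : ℝ) * (q.2.2 : ℝ) ^ γ ≠ 0 → g q ≤
      C * (√(|(q.1.1 : ℝ) * (q.1.2 : ℝ) ^ γ - (q.2.1 : ℝ) * (q.2.2 : ℝ) ^ γ| * M ^ γ) +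
        M / √(|(q.1.1 : ℝ) * (q.1.2 : ℝ) ^ γ - (q.2.1 : ℝ) * (q.2.2 : ℝ) ^ γ| * M ^ γ))) :
    ∑ q ∈ closePairs γ H N (1 / K), g q ≤ 2000 / γ * C * Lg ^ 3 *
      (H * N * M + (H : ℝ) ^ 2 * N ^ 2 / K * √(H * (M * N) ^ γ / K) +
        M * (H : ℝ) ^ 2 * N ^ 2 / √(H * (M * N) ^ γ * K)) := by
  have hH0 : (0 : ℝ) < H := by exact_mod_cast hH
  have hN0 : (0 : ℝ) < N := by exact_mod_cast hN
  have hK0 : (0 : ℝ) < K := by exact_mod_cast hK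
  have hH1 : (1 : ℝ) ≤ H := by exact_mod_cast hH
  have hN1 : (1 : ℝ) ≤ N := by exact_mod_cast hN
  have hM0 : 0 < M := by linarith
  have hKN' : (K : ℝ) ≤ H * N := by
    have : (K : ℝ) ≤ N := by exact_mod_cast hKN
    nlinarith
  set F := H * (M * N) ^ γ with hF
  have hF0 : 0 < F := by positivity
  have hNγ : (0 : ℝ) < (N : ℝ) ^ γ := by positivity
  have hlogH : 0 ≤ Real.log (2 * H) := Real.log_nonneg (by linarith)
  have hlogN : 0 ≤ Real.log (2 * N) := Real.log_nonneg (by linarith)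
  have hLg : 1 ≤ Lg := by linarith
  have hr : 1 ≤ (H : ℝ) * N / K := by rw [le_div_iff₀ hK0]; linarith
  obtain ⟨J, hJ1, hJ2, hJ3⟩ := exists_two_pow_between _ hr
  have hJL : (J : ℝ) ≤ 3 * Lg := by
    have h1 : (H : ℝ) * N / K ≤ (2 * H) * (2 * N) := by
      rw [div_le_iff₀ hK0]
      have : (1 : ℝ) ≤ K := by exact_mod_cast hK
      nlinarith [mul_pos hH0 hN0]
    have h2 := Real.log_le_log (by positivity) h1
    rw [Real.log_mul (by positivity) (by positivity)] at h2
    nlinarith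
  -- the quantity deciding the level of a pair
  set A : (ℕ × ℕ) × (ℕ × ℕ) → ℝ := fun q =>
    |(q.1.1 : ℝ) * (q.1.2 : ℝ) ^ γ - (q.2.1 : ℝ) * (q.2.2 : ℝ) ^ γ| with hA
  have hmem : ∀ (Δ : ℝ) q, q ∈ closePairs γ H N (1 / K) →
      (q ∈ closePairs γ H N Δ ↔ A q ≤ Δ * (H * (N : ℝ) ^ γ)) := by
    intro Δ q hq
    simp only [closePairs, mem_filter] at hq ⊢
    simp only [hA, hq.1, true_and]
  have hAM : ∀ q Δ, 0 < Δ → Δ * (H * (N : ℝ) ^ γ) < A q → Δ * F ≤ A q * M ^ γ := by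
    intro q Δ hΔ hq
    have : Δ * F = Δ * (H * (N : ℝ) ^ γ) * M ^ γ := by
      rw [hF, Real.mul_rpow hM0.le hN0.le]; ring
    rw [this]
    gcongr
  set Bd : ℕ → ℝ := fun j => C * (M * √(H * N) / √(2 ^ j * F)) with hBd
  have hBd0 : ∀ j, 0 ≤ Bd j := fun j => by simp only [hBd]; positivity
  have hpt : ∀ q ∈ closePairs γ H N (1 / K), ∀ j : ℕ, A q ≤ 2 ^ j / (H * N) * (H * (N : ℝ) ^ γ) →
      g q ≤ C * √(F / K) + (if q ∈ closePairs γ H N (1 / (H * N)) then 2 * M else 0) +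
        ∑ i ∈ range j, if q ∈ closePairs γ H N (2 ^ (i + 1) / (H * N)) then Bd i else 0 := by
    intro q hq j
    induction j with
    | zero =>
      intro h
      rw [pow_zero, ← hmem _ q hq] at h
      rw [if_pos h, range_zero, sum_empty]
      have := hg1 q
      have h2 : 0 ≤ C * √(F / K) := by positivity
      linarith
    | succ j ih =>
      intro h
      rcases le_or_gt (A q) (2 ^ j / (H * N) * (H * (N : ℝ) ^ γ)) with h1 | h1
      · refine (ih h1).trans ?_
        rw [sum_range_succ]
        have : 0 ≤ (if q ∈ closePairs γ H N (2 ^ (j + 1) / (H * N)) then Bd j else 0) := by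
          split_ifs
          · exact hBd0 j
          · exact le_rfl
        linarith
      · rw [← hmem _ q hq] at h
        rw [sum_range_succ, if_pos h]
        have h2 := hAM q _ (by positivity) h1
        have hApos : 0 < A q := lt_of_le_of_lt (by positivity) h1
        have h3 := hg2 q hq (abs_pos.1 hApos)
        have h4 : A q * M ^ γ ≤ F / K := by
          have h5 := (hmem (1 / K) q hq).1 hq
          calc A q * M ^ γ ≤ 1 / K * (H * (N : ℝ) ^ γ) * M ^ γ := by gcongr
            _ = F / K := by rw [hF, Real.mul_rpow hM0.le hN0.le]; ring
        have h6 : M / √(A q * M ^ γ) ≤ M * √(H * N) / √(2 ^ j * F) := by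
          have : M * √(H * N) / √(2 ^ j * F) = M / √(2 ^ j / (H * N) * F) := by
            rw [div_mul_eq_mul_div, Real.sqrt_div (by positivity)]
            field_simp
          rw [this]
          gcongr
        have h7 : g q ≤ C * √(F / K) + Bd j := by
          refine h3.trans ?_
          simp only [hBd]
          rw [mul_add]
          gcongr
        have h8 : 0 ≤ (if q ∈ closePairs γ H N (1 / (H * N)) then 2 * M else 0) := by
          split_ifs
          · linarith
          · exact le_rfl
        have h9 : 0 ≤ ∑ i ∈ range j, if q ∈ closePairs γ H N (2 ^ (i + 1) / (H * N)) then Bd i else 0 := by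
          refine sum_nonneg fun i _ => ?_
          split_ifs
          · exact hBd0 i
          · exact le_rfl
        linarith
  have hpt' : ∀ q ∈ closePairs γ H N (1 / K),
      g q ≤ C * √(F / K) + (if q ∈ closePairs γ H N (1 / (H * N)) then 2 * M else 0) +
        ∑ i ∈ range J, if q ∈ closePairs γ H N (2 ^ (i + 1) / (H * N)) then Bd i else 0 := by
    intro q hq
    refine hpt q hq J (((hmem _ q hq).1 hq).trans ?_)
    refine mul_le_mul_of_nonneg_right ?_ (by positivity)
    rw [div_le_div_iff₀ hK0 (by positivity), one_mul]
    rwa [div_le_iff₀ hK0] at hJ1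
  have hcount : ∀ Δ : ℝ, 0 ≤ Δ → ((closePairs γ H N Δ).card : ℝ) ≤
      64 / γ * Lg ^ 2 * (H * N + Δ * H ^ 2 * N ^ 2) := by
    intro Δ hΔ
    refine (card_closePairs_le hγ0 hγ1 hH hN hΔ).trans ?_
    rw [mul_right_comm, sq Lg]
    gcongr
  have hind : ∀ (Δ B : ℝ), 0 ≤ B → 0 ≤ Δ → ∑ q ∈ closePairs γ H N (1 / K),
      (if q ∈ closePairs γ H N Δ then B else 0) ≤ 64 / γ * Lg ^ 2 * (H * N + Δ * H ^ 2 * N ^ 2) * B := by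
    intro Δ B hB hΔ
    rw [← sum_filter, sum_const, nsmul_eq_mul]
    refine mul_le_mul_of_nonneg_right (le_trans ?_ (hcount Δ hΔ)) hB
    exact_mod_cast card_le_card fun q hq => (mem_filter.1 hq).2
  set D := 64 / γ * Lg ^ 2 with hD
  have hD0 : 0 ≤ D := by positivity
  have hfirst : ((closePairs γ H N (1 / K)).card : ℝ) * (C * √(F / K)) ≤
      D * (2 * C) * ((H : ℝ) ^ 2 * N ^ 2 / K * √(F / K)) := by
    have h1 := hcount (1 / K) (by positivity)
    have h2 : (H : ℝ) * N ≤ (H : ℝ) ^ 2 * N ^ 2 / K := by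
      rw [le_div_iff₀ hK0]; nlinarith [mul_pos hH0 hN0]
    have h3 : ((closePairs γ H N (1 / K)).card : ℝ) ≤ D * (2 * ((H : ℝ) ^ 2 * N ^ 2 / K)) := by
      refine h1.trans ?_
      gcongr
      have : (1 : ℝ) / K * H ^ 2 * N ^ 2 = (H : ℝ) ^ 2 * N ^ 2 / K := by ring
      linarith
    calc _ ≤ D * (2 * ((H : ℝ) ^ 2 * N ^ 2 / K)) * (C * √(F / K)) := by gcongr
      _ = _ := by ring
  have hsecond := hind (1 / (H * N)) (2 * M) (by linarith) (by positivity)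
  have hthird : ∀ i ∈ range J, ∑ q ∈ closePairs γ H N (1 / K),
      (if q ∈ closePairs γ H N (2 ^ (i + 1) / (H * N)) then Bd i else 0) ≤
        D * (8 * C) * (M * (H : ℝ) ^ 2 * N ^ 2 / √(F * K)) := by
    intro i hi
    refine (hind _ _ (hBd0 i) (by positivity)).trans ?_
    have h1 : (H : ℝ) * N + 2 ^ (i + 1) / (H * N) * H ^ 2 * N ^ 2 ≤ 4 * 2 ^ i * (H * N) := by
      have : (2 : ℝ) ^ (i + 1) / (H * N) * H ^ 2 * N ^ 2 = 2 * 2 ^ i * (H * N) := by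
        rw [pow_succ]; field_simp
      rw [this]
      have : (1 : ℝ) ≤ 2 ^ i := one_le_pow₀ (by norm_num)
      nlinarith [mul_pos hH0 hN0]
    have h2 : (2 : ℝ) ^ i ≤ H * N / K := by
      have h3 : (2 : ℝ) ^ (i + 1) ≤ 2 ^ J :=
        pow_le_pow_right₀ (by norm_num) (by have := mem_range.1 hi; omega)
      rw [pow_succ] at h3
      linarith
    have h3 : √(2 ^ i) ≤ √(H * N) / √K := by
      rw [← Real.sqrt_div (by positivity)]
      exact Real.sqrt_le_sqrt h2
    calc D * (H * N + 2 ^ (i + 1) / (H * N) * H ^ 2 * N ^ 2) * Bd i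
        ≤ D * (4 * 2 ^ i * (H * N)) * Bd i := by
          have := hBd0 i
          gcongr
      _ = D * (4 * C) * (M * (H * N) * √(H * N) / √F) * √(2 ^ i) := by
          simp only [hBd]
          rw [Real.sqrt_mul (show (0:ℝ) ≤ 2 ^ i by positivity) F]
          have h4 : (2 : ℝ) ^ i = √(2 ^ i) ^ 2 := (Real.sq_sqrt (by positivity)).symm
          have h5 : 0 < √((2 : ℝ) ^ i) := Real.sqrt_pos.2 (by positivity)
          have h6 : 0 < √F := Real.sqrt_pos.2 hF0
          generalize √((H : ℝ) * N) = t
          generalize √((2 : ℝ) ^ i) = s at *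
          rw [h4]
          field_simp
      _ ≤ D * (4 * C) * (M * (H * N) * √(H * N) / √F) * (√(H * N) / √K) := by gcongr
      _ = D * (4 * C) * (M * (H : ℝ) ^ 2 * N ^ 2 / √(F * K)) := by
          rw [Real.sqrt_mul hF0.le (K : ℝ)]
          have h4 : √((H : ℝ) * N) ^ 2 = H * N := Real.sq_sqrt (by positivity)
          have h5 : 0 < √F := Real.sqrt_pos.2 hF0
          have h6 : 0 < √(K : ℝ) := Real.sqrt_pos.2 hK0
          generalize √((H : ℝ) * N) = t at *
          field_simp
          rw [h4]; ring
      _ ≤ _ := by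
        have : 0 ≤ M * (H : ℝ) ^ 2 * N ^ 2 / √(F * K) := by positivity
        gcongr
        norm_num
  calc _ ≤ ∑ q ∈ closePairs γ H N (1 / K), (C * √(F / K) +
        (if q ∈ closePairs γ H N (1 / (H * N)) then 2 * M else 0) +
        ∑ i ∈ range J, if q ∈ closePairs γ H N (2 ^ (i + 1) / (H * N)) then Bd i else 0) :=
        sum_le_sum hpt'
    _ = ((closePairs γ H N (1 / K)).card : ℝ) * (C * √(F / K)) +
        ∑ q ∈ closePairs γ H N (1 / K), (if q ∈ closePairs γ H N (1 / (H * N)) then 2 * M else 0) +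
        ∑ i ∈ range J, ∑ q ∈ closePairs γ H N (1 / K),
          (if q ∈ closePairs γ H N (2 ^ (i + 1) / (H * N)) then Bd i else 0) := by
        rw [sum_add_distrib, sum_add_distrib, sum_const, nsmul_eq_mul,
          sum_comm (s := closePairs γ H N (1 / K))]
    _ ≤ D * (2 * C) * ((H : ℝ) ^ 2 * N ^ 2 / K * √(F / K)) +
        D * (H * N + 1 / (H * N) * H ^ 2 * N ^ 2) * (2 * M) +
        ∑ i ∈ range J, D * (8 * C) * (M * (H : ℝ) ^ 2 * N ^ 2 / √(F * K)) :=
        add_le_add (add_le_add hfirst hsecond) (sum_le_sum hthird)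
    _ = D * (2 * C) * ((H : ℝ) ^ 2 * N ^ 2 / K * √(F / K)) + D * 4 * (H * N * M) +
        J * (D * (8 * C) * (M * (H : ℝ) ^ 2 * N ^ 2 / √(F * K))) := by
        rw [sum_const, nsmul_eq_mul, card_range]
        congr 2
        field_simp; ring
    _ ≤ D * (24 * C * Lg) * ((H : ℝ) ^ 2 * N ^ 2 / K * √(F / K)) + D * (24 * C * Lg) * (H * N * M) +
        (3 * Lg) * (D * (8 * C) * (M * (H : ℝ) ^ 2 * N ^ 2 / √(F * K))) := by
        have hCL : 1 ≤ C * Lg := one_le_mul_of_one_le_of_one_le hC hLg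
        have h1 : 2 * C ≤ 24 * C * Lg := by nlinarith
        have h2 : 4 ≤ 24 * C * Lg := by nlinarith
        gcongr
    _ = 64 * 24 / γ * C * Lg ^ 3 * (H * N * M + (H : ℝ) ^ 2 * N ^ 2 / K * √(F / K) +
        M * (H : ℝ) ^ 2 * N ^ 2 / √(F * K)) := by rw [hD]; ring
    _ ≤ _ := by
        gcongr
        norm_num

/-- The exponential weight `k ↦ ∑ c h e(h k ^ γ + ξ k)`, `h` running over `[H, 2H)`. -/
noncomputable def powerWeight (γ ξ : ℝ) (H : ℕ) (c : ℕ → ℂ) (k : ℕ) : ℂ :=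
  ∑ h ∈ Ico H (2 * H), c h * e (h * (k : ℝ) ^ γ + ξ * k)

lemma ordConnected_filter_window (n n' X s : ℕ) :
    (((Icc 1 s).filter (fun m => (X < 8 * (m * n) ∧ m * n ≤ X) ∧ X < 8 * (m * n') ∧ m * n' ≤ X) :
      Finset ℕ) : Set ℕ).OrdConnected := by
  constructor
  intro a ha b hb z hz
  simp only [coe_filter, mem_Icc, Set.mem_ofPred_eq] at ha hb ⊢
  obtain ⟨h1, h2⟩ := hz
  have e1 := Nat.mul_le_mul_right n h1
  have e2 := Nat.mul_le_mul_right n h2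
  have e3 := Nat.mul_le_mul_right n' h1
  have e4 := Nat.mul_le_mul_right n' h2
  omega

lemma typeII_dyadic {γ : ℝ} (hγ0 : 0 < γ) (hγ1 : γ < 1) :
    ∃ C : ℝ, 1 ≤ C ∧ ∀ (X N H K : ℕ) (ξ Y Lg : ℝ) (a b c : ℕ → ℂ), 0 < N → N ≤ X → 0 < H → 0 < K →
      K ≤ N → (∀ n, ‖a n‖ ≤ Y) → (∀ n, ‖b n‖ ≤ Y) → (∀ n, ‖c n‖ ≤ 1) →
      1 + Real.log (2 * H) ≤ Lg → 1 + Real.log (2 * N) ≤ Lg →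
      ‖∑ m ∈ Icc 1 (X / N), b m * ∑ n ∈ Ico N (2 * N),
        (if X < 8 * (m * n) ∧ m * n ≤ X then a n * powerWeight γ ξ H c (m * n) else 0)‖ ^ 2 ≤
      C * Y ^ 4 * Lg ^ 3 * ((X / N : ℝ) * K) * (H * X + (H : ℝ) ^ 2 * N ^ 2 / K * √(H * (X : ℝ) ^ γ / K) +
        X * (H : ℝ) ^ 2 * N / √(H * (X : ℝ) ^ γ * K)) := by
  obtain ⟨C, hC, hvdc⟩ := van_der_corput_nat γ hγ0 hγ1
  have hCγ : 1 ≤ C / γ := by rw [le_div_iff₀ hγ0]; linarith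
  refine ⟨8000 * (C / γ), by linarith, ?_⟩
  intro X N H K ξ Y Lg a b c hN hNX hH hK hKN ha hb hc hL1 hL2
  have hH0 : (0 : ℝ) < H := by exact_mod_cast hH
  have hN0 : (0 : ℝ) < N := by exact_mod_cast hN
  have hK0 : (0 : ℝ) < K := by exact_mod_cast hK
  have hX0 : (0 : ℝ) < X := by exact_mod_cast hN.trans_le hNX
  have hY : 0 ≤ Y := (norm_nonneg _).trans (ha 0)
  set M : ℝ := X / N with hM
  have hM1 : 1 ≤ M := by
    rw [hM, le_div_iff₀ hN0, one_mul]; exact_mod_cast hNX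
  have hM0 : 0 < M := by linarith
  have hMN : M * N = X := by rw [hM]; field_simp
  have hNγ : (0 : ℝ) < (N : ℝ) ^ γ := by positivity
  set P := Ico H (2 * H) ×ˢ Ico N (2 * N) with hP
  set κ : ℕ × ℕ → ℕ := fun p => ⌊K * ((p.1 : ℝ) * (p.2 : ℝ) ^ γ) / (H * (N : ℝ) ^ γ)⌋₊ with hκ
  have hκR : ∀ p ∈ P, κ p ∈ range (4 * K) := by
    intro p hp
    simp only [hP, mem_product, mem_Ico] at hp
    have h1 : (p.1 : ℝ) < 2 * H := by exact_mod_cast hp.1.2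
    have h2 : (p.2 : ℝ) < 2 * N := by exact_mod_cast hp.2.2
    have h3 : (p.2 : ℝ) ^ γ ≤ 2 * (N : ℝ) ^ γ := by
      calc (p.2 : ℝ) ^ γ ≤ (2 * N : ℝ) ^ γ := Real.rpow_le_rpow (by positivity) h2.le hγ0.le
        _ = 2 ^ γ * (N : ℝ) ^ γ := Real.mul_rpow (by norm_num) hN0.le
        _ ≤ 2 ^ (1 : ℝ) * (N : ℝ) ^ γ := by
          gcongr
          norm_num
        _ = _ := by norm_num
    rw [mem_range, hκ, Nat.floor_lt (by positivity), div_lt_iff₀ (by positivity)]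
    push_cast
    have h4 : (p.1 : ℝ) * (p.2 : ℝ) ^ γ < 2 * H * (2 * (N : ℝ) ^ γ) :=
      mul_lt_mul' h1.le (lt_of_le_of_ne h3 ?_) (by positivity) (by positivity) |>.trans_le le_rfl
    · nlinarith
    · intro h5
      have : (p.2 : ℝ) ^ γ < (2 * N : ℝ) ^ γ := Real.rpow_lt_rpow (by positivity) h2 hγ0
      rw [Real.mul_rpow (by norm_num) hN0.le] at this
      have h6 : (2 : ℝ) ^ γ ≤ 2 ^ (1 : ℝ) := Real.rpow_le_rpow_of_exponent_le (by norm_num) hγ1.le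
      rw [Real.rpow_one] at h6
      nlinarith
  set x : ℕ × ℕ → ℕ → ℝ := fun p m => p.1 * ((m * p.2 : ℕ) : ℝ) ^ γ + ξ * ((m * p.2 : ℕ) : ℝ) with hx
  have hrew : ∑ m ∈ Icc 1 (X / N), b m * ∑ n ∈ Ico N (2 * N),
        (if X < 8 * (m * n) ∧ m * n ≤ X then a n * powerWeight γ ξ H c (m * n) else 0) =
      ∑ m ∈ Icc 1 (X / N), b m * ∑ p ∈ P, (if X < 8 * (m * p.2) ∧ m * p.2 ≤ X then
        (c p.1 * a p.2) * e (x p m) else 0) := by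
    refine sum_congr rfl fun m _ => ?_
    congr 1
    rw [hP, sum_product_right]
    refine sum_congr rfl fun n _ => ?_
    split_ifs
    · rw [powerWeight, mul_sum]
      refine sum_congr rfl fun h _ => ?_
      simp only [hx]
      ring
    · simp
  have hu : ∀ p ∈ P, ‖c p.1 * a p.2‖ ≤ Y := by
    intro p _
    rw [norm_mul]
    calc _ ≤ 1 * Y := mul_le_mul (hc _) (ha _) (norm_nonneg _) (by norm_num)
      _ = Y := one_mul _
  have hmain := bilinear_cauchy P (Icc 1 (X / N)) (4 * K) κ hκR Y b (fun m _ => hb m)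
    (fun p => c p.1 * a p.2) hu x (fun p m => X < 8 * (m * p.2) ∧ m * p.2 ≤ X)
  rw [hrew]
  refine hmain.trans ?_
  set g : (ℕ × ℕ) × (ℕ × ℕ) → ℝ := fun q => ‖∑ m ∈ (Icc 1 (X / N)).filter (fun m =>
    (X < 8 * (m * q.1.2) ∧ m * q.1.2 ≤ X) ∧ X < 8 * (m * q.2.2) ∧ m * q.2.2 ≤ X),
      e (x q.1 m - x q.2 m)‖ with hg
  have hcardM : ((Icc 1 (X / N)).card : ℝ) ≤ M := by
    rw [Nat.card_Icc, Nat.add_sub_cancel, hM]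
    exact Nat.cast_div_le
  have hg1 : ∀ q, g q ≤ 2 * M := by
    intro q
    refine (norm_sum_le _ _).trans ?_
    simp only [norm_e, sum_const, nsmul_eq_mul, mul_one]
    have : ((((Icc 1 (X / N)).filter (fun m =>
      (X < 8 * (m * q.1.2) ∧ m * q.1.2 ≤ X) ∧ X < 8 * (m * q.2.2) ∧ m * q.2.2 ≤ X)).card : ℕ) : ℝ) ≤
      ((Icc 1 (X / N)).card : ℝ) := by exact_mod_cast card_filter_le _ _
    linarith
  have hg2 : ∀ q ∈ closePairs γ H N (1 / K),
      (q.1.1 : ℝ) * (q.1.2 : ℝ) ^ γ - (q.2.1 : ℝ) * (q.2.2 : ℝ) ^ γ ≠ 0 → g q ≤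
      C * (√(|(q.1.1 : ℝ) * (q.1.2 : ℝ) ^ γ - (q.2.1 : ℝ) * (q.2.2 : ℝ) ^ γ| * M ^ γ) +
        M / √(|(q.1.1 : ℝ) * (q.1.2 : ℝ) ^ γ - (q.2.1 : ℝ) * (q.2.2 : ℝ) ^ γ| * M ^ γ)) := by
    intro q hq hA
    simp only [closePairs, mem_filter, mem_product, mem_Ico] at hq
    have h1 := hvdc _ (ξ * ((q.1.2 : ℝ) - q.2.2)) M _ hA hM1
      (ordConnected_filter_window q.1.2 q.2.2 X (X / N)) (by
        intro m hm
        simp only [mem_filter, mem_Icc] at hm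
        constructor
        · rw [hM, div_div, div_le_iff₀ (by positivity)]
          have h2 : X ≤ m * (N * 16) := by
            have h3 := Nat.mul_le_mul_left m hq.1.1.2.2.le
            have h4 := hm.2.1.1
            calc X ≤ 8 * (m * q.1.2) := h4.le
              _ ≤ 8 * (m * (2 * N)) := by omega
              _ = _ := by ring
          exact_mod_cast h2
        · refine le_trans ?_ (Nat.cast_div_le (α := ℝ) (m := X) (n := N))
          exact_mod_cast hm.1.2)
    refine le_trans (le_of_eq ?_) h1
    simp only [hg]
    congr 1
    refine sum_congr rfl fun m _ => ?_
    congr 1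
    simp only [hx]
    push_cast
    rw [Real.mul_rpow (by positivity) (by positivity), Real.mul_rpow (by positivity) (by positivity)]
    ring
  have hsub : (P ×ˢ P).filter (fun q => κ q.1 = κ q.2) ⊆ closePairs γ H N (1 / K) := by
    intro q hq
    rw [mem_filter] at hq
    rw [closePairs, mem_filter]
    refine ⟨hq.1, ?_⟩
    have h1 := hq.2
    simp only [hκ] at h1
    have h2 := Nat.floor_le (show 0 ≤ K * ((q.1.1 : ℝ) * (q.1.2 : ℝ) ^ γ) / (H * (N : ℝ) ^ γ) by positivity)
    have h3 := Nat.floor_le (show 0 ≤ K * ((q.2.1 : ℝ) * (q.2.2 : ℝ) ^ γ) / (H * (N : ℝ) ^ γ) by positivity)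
    have h4 := Nat.lt_floor_add_one (K * ((q.1.1 : ℝ) * (q.1.2 : ℝ) ^ γ) / (H * (N : ℝ) ^ γ))
    have h5 := Nat.lt_floor_add_one (K * ((q.2.1 : ℝ) * (q.2.2 : ℝ) ^ γ) / (H * (N : ℝ) ^ γ))
    rw [h1] at h2 h4
    have h6 : |K * ((q.1.1 : ℝ) * (q.1.2 : ℝ) ^ γ) / (H * (N : ℝ) ^ γ) -
        K * ((q.2.1 : ℝ) * (q.2.2 : ℝ) ^ γ) / (H * (N : ℝ) ^ γ)| ≤ 1 := by
      rw [abs_le]; constructor <;> linarith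
    have h7 : (q.1.1 : ℝ) * (q.1.2 : ℝ) ^ γ - (q.2.1 : ℝ) * (q.2.2 : ℝ) ^ γ =
        (K * ((q.1.1 : ℝ) * (q.1.2 : ℝ) ^ γ) / (H * (N : ℝ) ^ γ) -
        K * ((q.2.1 : ℝ) * (q.2.2 : ℝ) ^ γ) / (H * (N : ℝ) ^ γ)) * (1 / K * (H * (N : ℝ) ^ γ)) := by
      field_simp
    rw [h7, abs_mul, abs_of_pos (show 0 < 1 / (K : ℝ) * (H * (N : ℝ) ^ γ) by positivity)]
    calc _ ≤ 1 * (1 / (K : ℝ) * (H * (N : ℝ) ^ γ)) := by gcongr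
      _ = _ := one_mul _
  have hsum := sum_closePairs_le hγ0 hγ1 hH hN hK hKN hM1 hC hL1 hL2 g hg1 hg2
  have hsum' : ∑ q ∈ (P ×ˢ P).filter (fun q => κ q.1 = κ q.2), g q ≤
      ∑ q ∈ closePairs γ H N (1 / K), g q :=
    sum_le_sum_of_subset_of_nonneg hsub fun q _ _ => norm_nonneg _
  rw [hMN] at hsum
  calc _ ≤ Y ^ 4 * M * ((4 * K : ℕ) : ℝ) * (2000 / γ * C * Lg ^ 3 * (H * N * M +
        (H : ℝ) ^ 2 * N ^ 2 / K * √(H * (X : ℝ) ^ γ / K) +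
        M * (H : ℝ) ^ 2 * N ^ 2 / √(H * (X : ℝ) ^ γ * K))) := by
        have h8 : 0 ≤ ∑ q ∈ (P ×ˢ P).filter (fun q => κ q.1 = κ q.2), g q :=
          sum_nonneg fun q _ => norm_nonneg _
        have h9 := hsum'.trans hsum
        gcongr
    _ = _ := by
        rw [← hMN]
        push_cast
        ring

open Filter

lemma mul_le_rpow {X A B a b s : ℝ} (hX : 1 ≤ X) (hB0 : 0 ≤ B) (hA : A ≤ X ^ a)
    (hB : B ≤ X ^ b) (h : a + b ≤ s) : A * B ≤ X ^ s :=
  calc A * B ≤ X ^ a * X ^ b := mul_le_mul hA hB hB0 (by positivity)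
    _ = X ^ (a + b) := (Real.rpow_add (by linarith) _ _).symm
    _ ≤ X ^ s := Real.rpow_le_rpow_of_exponent_le hX h

lemma sqrt_le_rpow {X A a s : ℝ} (hX : 1 ≤ X) (hA : A ≤ X ^ a) (h : a ≤ 2 * s) : √A ≤ X ^ s := by
  have h1 : (X ^ s) ^ 2 = X ^ (2 * s) := by
    rw [← Real.rpow_natCast, ← Real.rpow_mul (by linarith)]; congr 1; push_cast; ring
  rw [Real.sqrt_le_left (by positivity), h1]
  exact hA.trans (Real.rpow_le_rpow_of_exponent_le hX h)

lemma pow_le_rpow {X A a s : ℝ} (k : ℕ) (hX : 1 ≤ X) (hA0 : 0 ≤ A) (hA : A ≤ X ^ a) (h : k * a ≤ s) :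
    A ^ k ≤ X ^ s :=
  calc A ^ k ≤ (X ^ a) ^ k := pow_le_pow_left₀ hA0 hA k
    _ = X ^ (k * a) := by
      rw [← Real.rpow_natCast, ← Real.rpow_mul (by linarith)]; congr 1; ring
    _ ≤ _ := Real.rpow_le_rpow_of_exponent_le hX h

lemma le_rpow_of_sq_le {X A s t : ℝ} (hX : 1 ≤ X) (hA : A ^ 2 ≤ X ^ t) (h : t ≤ 2 * s) : A ≤ X ^ s :=
  (Real.le_sqrt_of_sq_le hA).trans (sqrt_le_rpow hX le_rfl h)

lemma div_le_rpow {X A B a b s : ℝ} (hX : 1 ≤ X) (hA : A ≤ X ^ a) (hB : X ^ b ≤ B)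
    (h : a - b ≤ s) : A / B ≤ X ^ s := by
  have hX0 : 0 < X := by linarith
  have hb : 0 < X ^ b := Real.rpow_pos_of_pos hX0 _
  calc A / B ≤ X ^ a / X ^ b := by
        have : 0 ≤ X ^ a := by positivity
        gcongr
    _ = X ^ (a - b) := (Real.rpow_sub hX0 _ _).symm
    _ ≤ X ^ s := Real.rpow_le_rpow_of_exponent_le hX h

lemma eventually_log_pow_le (C : ℝ) (k : ℕ) {ε : ℝ} (hε : 0 < ε) :
    ∀ᶠ X : ℕ in atTop, C * (1 + Real.log X) ^ k ≤ (X : ℝ) ^ ε := by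
  have hδ : 0 < ε / (2 * (k + 1)) := by positivity
  have h1 := (isLittleO_log_rpow_atTop hδ).bound (show (0 : ℝ) < 1 by norm_num)
  have h2 := (tendsto_rpow_atTop (show 0 < ε / 2 by linarith)).eventually_ge_atTop (|C| * 2 ^ k)
  have h3 := (tendsto_rpow_atTop hδ).eventually_ge_atTop 1
  have h4 := eventually_ge_atTop (1 : ℝ)
  have key : ∀ᶠ x : ℝ in atTop, C * (1 + Real.log x) ^ k ≤ x ^ ε := by
    filter_upwards [h1, h2, h3, h4] with x g1 g2 g3 g4
    have hlog : 0 ≤ Real.log x := Real.log_nonneg g4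
    rw [Real.norm_of_nonneg hlog, Real.norm_of_nonneg (by positivity), one_mul] at g1
    have g5 : (1 + Real.log x) ^ k ≤ 2 ^ k * x ^ (ε / 2) := by
      calc (1 + Real.log x) ^ k ≤ (2 * x ^ (ε / (2 * (k + 1)))) ^ k := by gcongr; linarith
        _ = 2 ^ k * (x ^ (ε / (2 * (k + 1)))) ^ k := mul_pow _ _ _
        _ ≤ 2 ^ k * x ^ (ε / 2) := by
          gcongr
          refine pow_le_rpow k g4 (by positivity) le_rfl ?_
          rw [← mul_div_assoc, div_le_div_iff₀ (by positivity) (by norm_num)]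
          nlinarith
    calc C * (1 + Real.log x) ^ k ≤ |C| * (2 ^ k * x ^ (ε / 2)) := by
          gcongr
          exact le_abs_self C
      _ = (|C| * 2 ^ k) * x ^ (ε / 2) := by ring
      _ ≤ x ^ (ε / 2) * x ^ (ε / 2) := by gcongr
      _ = x ^ ε := by rw [← Real.rpow_add (by linarith)]; congr 1; ring
  exact tendsto_natCast_atTop_atTop.eventually key

lemma eventually_const_le (C : ℝ) {ε : ℝ} (hε : 0 < ε) :
    ∀ᶠ X : ℕ in atTop, C ≤ (X : ℝ) ^ ε := by
  simpa using eventually_log_pow_le C 0 hε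

lemma sum_Ico_two_pow {M : Type*} [AddCommMonoid M] (F : ℕ → M) (I : ℕ) :
    ∑ n ∈ Ico 1 (2 ^ I), F n = ∑ i ∈ range I, ∑ n ∈ Ico (2 ^ i) (2 * 2 ^ i), F n := by
  induction I with
  | zero => simp
  | succ I ih =>
    rw [sum_range_succ, ← ih, ← pow_succ']
    exact (sum_Ico_consecutive F Nat.one_le_two_pow (Nat.pow_le_pow_right (by norm_num) (by omega))).symm

/-- Dyadic decomposition of a sum whose terms vanish beyond `X`. -/
lemma norm_sum_le_dyadic (F : ℕ → ℂ) {X : ℕ} {B : ℝ} (hF : ∀ n, X < n → F n = 0) (hB : 0 ≤ B)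
    (h : ∀ N, 0 < N → N ≤ X → ‖∑ n ∈ Ico N (2 * N), F n‖ ≤ B) :
    ‖∑ n ∈ Icc 1 X, F n‖ ≤ 2 * (1 + Real.log X) * B := by
  have h1 : ∑ n ∈ Icc 1 X, F n = ∑ n ∈ Ico 1 (2 ^ (Nat.log 2 X + 1)), F n := by
    refine sum_subset ?_ ?_
    · intro n hn
      rw [mem_Icc] at hn
      rw [mem_Ico]
      exact ⟨hn.1, hn.2.trans_lt (Nat.lt_pow_succ_log_self (by norm_num) X)⟩
    · intro n hn hn'
      rw [mem_Ico] at hn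
      rw [mem_Icc] at hn'
      exact hF n (by omega)
  rcases Nat.eq_zero_or_pos X with rfl | hX
  · simp; positivity
  have h2 : ((Nat.log 2 X + 1 : ℕ) : ℝ) ≤ 2 * (1 + Real.log X) := by
    have h3 := Nat.pow_log_le_self 2 hX.ne'
    have h4 : ((2 : ℝ) ^ Nat.log 2 X) ≤ X := by exact_mod_cast h3
    have h5 := Real.log_le_log (by positivity) h4
    rw [Real.log_pow] at h5
    have h6 : 1 / 2 ≤ Real.log 2 := by linarith [Real.log_two_gt_d9]
    have h7 : (0:ℝ) ≤ (Nat.log 2 X : ℝ) := by positivity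
    push_cast
    nlinarith
  rw [h1, sum_Ico_two_pow]
  calc _ ≤ ∑ i ∈ range (Nat.log 2 X + 1), ‖∑ n ∈ Ico (2 ^ i) (2 * 2 ^ i), F n‖ := norm_sum_le _ _
    _ ≤ ∑ i ∈ range (Nat.log 2 X + 1), B := by
      refine sum_le_sum fun i hi => h _ (by positivity) ?_
      have : i ≤ Nat.log 2 X := by have := mem_range.1 hi; omega
      exact (Nat.pow_le_pow_right (by norm_num) this).trans (Nat.pow_log_le_self 2 hX.ne')
    _ = ((Nat.log 2 X + 1 : ℕ) : ℝ) * B := by rw [sum_const, card_range, nsmul_eq_mul]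
    _ ≤ _ := by gcongr

/-- The sum of `a n b m w (m n)` over `X / 8 < m n ≤ X`. -/
noncomputable def bilin (X : ℕ) (w : ℕ → ℂ) (a b : ℕ → ℂ) : ℂ :=
  ∑ n ∈ Icc 1 X, ∑ m ∈ Icc 1 X, if X < 8 * (m * n) ∧ m * n ≤ X then a n * b m * w (m * n) else 0

lemma norm_bilin_le_dyadic (X : ℕ) (w a b : ℕ → ℂ) {B : ℝ} (hB : 0 ≤ B)
    (h : ∀ N, 0 < N → N ≤ X → ‖∑ m ∈ Icc 1 (X / N), b m * ∑ n ∈ Ico N (2 * N),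
        (if X < 8 * (m * n) ∧ m * n ≤ X then a n * w (m * n) else 0)‖ ≤ B) :
    ‖bilin X w a b‖ ≤ 2 * (1 + Real.log X) * B := by
  refine norm_sum_le_dyadic _ ?_ hB ?_
  · intro n hn
    refine sum_eq_zero fun m hm => if_neg ?_
    rintro ⟨-, h2⟩
    have := Nat.mul_le_mul_right n (mem_Icc.1 hm).1
    omega
  · intro N hN hNX
    refine le_trans (le_of_eq ?_) (h N hN hNX)
    congr 1
    rw [sum_comm]
    have hsub : Icc 1 (X / N) ⊆ Icc 1 X := Icc_subset_Icc_right (Nat.div_le_self _ _)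
    rw [← sum_subset hsub]
    · refine sum_congr rfl fun m _ => ?_
      rw [mul_sum]
      refine sum_congr rfl fun n _ => ?_
      split_ifs
      · ring
      · simp
    · intro m hm hm'
      refine sum_eq_zero fun n hn => if_neg ?_
      rintro ⟨-, h2⟩
      refine hm' (mem_Icc.2 ⟨(mem_Icc.1 hm).1, ?_⟩)
      rw [Nat.le_div_iff_mul_le hN]
      exact (Nat.mul_le_mul_left m (mem_Ico.1 hn).1).trans h2

lemma typeII_bound {γ η θ ε u v : ℝ} (hη0 : 0 < η) (hη1 : η < 1 / 2) (hγ : γ = 1 - η) (hθ : 0 < θ)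
    (hε : 0 < ε) (hε1 : η + ε ≤ 1) (hu : η + 2 * θ + 40 * ε ≤ u) (hv : v ≤ 1 - 5 * η - 6 * θ - 100 * ε) :
    ∀ᶠ X : ℕ in atTop, ∀ (U V H : ℕ) (ξ : ℝ) (a b c : ℕ → ℂ), (X : ℝ) ^ u ≤ U → (V : ℝ) ≤ (X : ℝ) ^ v →
      0 < H → (H : ℝ) ≤ (X : ℝ) ^ (η + ε) → (∀ n, ‖a n‖ ≤ (X : ℝ) ^ ε) → (∀ n, ‖b n‖ ≤ (X : ℝ) ^ ε) →
      (∀ n, ‖c n‖ ≤ 1) → (∀ n, a n ≠ 0 → U < n ∧ n ≤ V) →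
      ‖bilin X (powerWeight γ ξ H c) a b‖ ≤ (X : ℝ) ^ (1 - θ - 8 * ε) := by
  obtain ⟨C, hC, hdy⟩ := typeII_dyadic (γ := γ) (by linarith) (by linarith)
  set w := η + 2 * θ + 31 * ε with hw
  filter_upwards [eventually_ge_atTop 1, eventually_log_pow_le 2 1 hε, eventually_const_le C hε,
    eventually_const_le 3 hε, eventually_const_le 2 hε] with X hX1 hlog hCX h3X h2X
  intro U V H ξ a b c hU hV hH hHX ha hb hc hsupp
  have hX : (1 : ℝ) ≤ X := by exact_mod_cast hX1
  have hX0 : (0 : ℝ) < X := by linarith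
  have hH0 : (0 : ℝ) < H := by exact_mod_cast hH
  rw [pow_one] at hlog
  have hmain : ‖bilin X (powerWeight γ ξ H c) a b‖ ≤
      2 * (1 + Real.log X) * (X : ℝ) ^ (1 - θ - 10 * ε) := by
    refine norm_bilin_le_dyadic _ _ _ _ (by positivity) ?_
    intro N hN hNX
    by_cases hcase : U < 2 * N ∧ N ≤ V
    swap
    · have : ∑ m ∈ Icc 1 (X / N), b m * ∑ n ∈ Ico N (2 * N),
        (if X < 8 * (m * n) ∧ m * n ≤ X then a n * powerWeight γ ξ H c (m * n) else 0) = 0 := by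
        refine sum_eq_zero fun m _ => ?_
        rw [sum_eq_zero, mul_zero]
        intro n hn
        have : a n = 0 := by
          by_contra h0
          have h1 := hsupp n h0
          rw [mem_Ico] at hn
          omega
        simp [this]
      rw [this, norm_zero]
      positivity
    obtain ⟨hc1, hc2⟩ := hcase
    have hN0 : (0 : ℝ) < N := by exact_mod_cast hN
    have hUN : (X : ℝ) ^ u ≤ 2 * N := hU.trans (by exact_mod_cast hc1.le)
    have hNV : (N : ℝ) ≤ (X : ℝ) ^ v := le_trans (by exact_mod_cast hc2) hV
    have hXw : 0 < (X : ℝ) ^ w := Real.rpow_pos_of_pos hX0 _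
    have hNw : 1 ≤ N / (X : ℝ) ^ w := by
      rw [le_div_iff₀ hXw, one_mul]
      have h1 : (X : ℝ) ^ w * 2 ≤ (X : ℝ) ^ u := mul_le_rpow hX (by norm_num) le_rfl h2X (by linarith)
      linarith
    set K := ⌊N / (X : ℝ) ^ w⌋₊ with hK
    have hK0 : 0 < K := Nat.floor_pos.2 hNw
    have hKle : (K : ℝ) ≤ N / (X : ℝ) ^ w := Nat.floor_le (by positivity)
    have hKge : N / (X : ℝ) ^ w ≤ 2 * K := by
      have := Nat.lt_floor_add_one (N / (X : ℝ) ^ w)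
      have h1 : (1 : ℝ) ≤ K := by exact_mod_cast hK0
      rw [← hK] at this
      linarith
    have hK0' : (0 : ℝ) < K := by exact_mod_cast hK0
    have hKN : K ≤ N := by
      have h1 : (1 : ℝ) ≤ (X : ℝ) ^ w := Real.one_le_rpow hX (by positivity)
      have : (K : ℝ) ≤ N := hKle.trans (div_le_self hN0.le h1)
      exact_mod_cast this
    have hLg : ∀ t : ℕ, 0 < t → (t : ℝ) ≤ X → 1 + Real.log (2 * t) ≤ (X : ℝ) ^ ε := by
      intro t ht htX
      refine le_trans ?_ hlog
      have ht0 : (0 : ℝ) < t := by exact_mod_cast ht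
      rw [Real.log_mul (by norm_num) ht0.ne']
      have h1 := Real.log_le_log ht0 htX
      have h2 := Real.log_two_lt_d9
      have h3 := Real.log_nonneg hX
      linarith
    have hHX' : (H : ℝ) ≤ X := hHX.trans (by
      calc (X : ℝ) ^ (η + ε) ≤ (X : ℝ) ^ (1 : ℝ) := Real.rpow_le_rpow_of_exponent_le hX hε1
        _ = X := Real.rpow_one _)
    have hNX' : (N : ℝ) ≤ X := by exact_mod_cast hNX
    have hS := hdy X N H K ξ _ _ a b c hN hNX hH hK0 hKN ha hb hc (hLg H hH hHX') (hLg N hN hNX')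
    refine le_rpow_of_sq_le (t := 2 - 2 * θ - 20 * ε) hX (hS.trans ?_) (by linarith)
    have hKN' : (K : ℝ) / N ≤ (X : ℝ) ^ (-w) := by
      rw [Real.rpow_neg hX0.le, div_le_iff₀ hN0]
      calc (K : ℝ) ≤ N / (X : ℝ) ^ w := hKle
        _ = _ := by ring
    have hX1' : (X : ℝ) ≤ (X : ℝ) ^ (1 : ℝ) := (Real.rpow_one _).ge
    have hpre : C * ((X : ℝ) ^ ε) ^ 4 * ((X : ℝ) ^ ε) ^ 3 ≤ (X : ℝ) ^ (8 * ε) :=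
      mul_le_rpow hX (by positivity) (mul_le_rpow hX (by positivity) hCX
        (pow_le_rpow 4 hX (by positivity) le_rfl le_rfl) le_rfl)
        (pow_le_rpow 3 hX (by positivity) le_rfl le_rfl) (by push_cast; linarith)
    have hR1 : (X / N * K : ℝ) * (H * X) ≤ (X : ℝ) ^ (2 - 2 * θ - 30 * ε) := by
      have : (X / N * K : ℝ) * (H * X) = X * (K / N) * (H * X) := by ring
      rw [this]
      exact mul_le_rpow hX (by positivity) (mul_le_rpow hX (by positivity) hX1' hKN' le_rfl)
        (mul_le_rpow hX (by positivity) hHX hX1' le_rfl) (by linarith)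
    have hR2 : (X / N * K : ℝ) * ((H : ℝ) ^ 2 * N ^ 2 / K * √(H * (X : ℝ) ^ γ / K)) ≤
        (X : ℝ) ^ (2 - 2 * θ - 30 * ε) := by
      have h1 : (X / N * K : ℝ) * ((H : ℝ) ^ 2 * N ^ 2 / K * √(H * (X : ℝ) ^ γ / K)) =
          X * (H : ℝ) ^ 2 * √(N ^ 2 * (H * (X : ℝ) ^ γ / K)) := by
        rw [Real.sqrt_mul (by positivity), Real.sqrt_sq hN0.le]
        field_simp
      have h2 : (N : ℝ) ^ 2 * (H * (X : ℝ) ^ γ / K) ≤ 2 * (N * ((X : ℝ) ^ w * (H * (X : ℝ) ^ γ))) := by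
        have h3 : (N : ℝ) / K ≤ 2 * (X : ℝ) ^ w := by
          rw [div_le_iff₀ hXw] at hKge
          rw [div_le_iff₀ hK0']
          linarith
        calc (N : ℝ) ^ 2 * (H * (X : ℝ) ^ γ / K) = N * (H * (X : ℝ) ^ γ) * (N / K) := by ring
          _ ≤ N * (H * (X : ℝ) ^ γ) * (2 * (X : ℝ) ^ w) := by gcongr
          _ = _ := by ring
      rw [h1]
      refine mul_le_rpow (b := (ε + (v + (w + (η + ε + γ)))) / 2) hX (by positivity)
        (mul_le_rpow hX (by positivity) hX1'
        (pow_le_rpow 2 hX (by positivity) hHX le_rfl) le_rfl) (sqrt_le_rpow (a := ε + (v + (w + (η + ε + γ)))) hX (h2.trans ?_) ?_)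
        ?_
      · exact mul_le_rpow hX (by positivity) h2X (mul_le_rpow hX (by positivity) hNV
          (mul_le_rpow hX (by positivity) le_rfl (mul_le_rpow hX (by positivity) hHX le_rfl le_rfl)
          le_rfl) le_rfl) le_rfl
      · linarith
      · push_cast; linarith
    have hR3 : (X / N * K : ℝ) * (X * (H : ℝ) ^ 2 * N / √(H * (X : ℝ) ^ γ * K)) ≤
        (X : ℝ) ^ (2 - 2 * θ - 30 * ε) := by
      have hXγ : 0 < (X : ℝ) ^ γ := Real.rpow_pos_of_pos hX0 _
      have h1 : (X / N * K : ℝ) * (X * (H : ℝ) ^ 2 * N / √(H * (X : ℝ) ^ γ * K)) =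
          X * X * H * √(H * (K / (X : ℝ) ^ γ)) := by
        have h2 : √(H * (K / (X : ℝ) ^ γ)) = H * K / √(H * (X : ℝ) ^ γ * K) := by
          rw [eq_div_iff (Real.sqrt_pos.2 (by positivity)).ne', ← Real.sqrt_mul (by positivity),
            Real.sqrt_eq_iff_mul_self_eq_of_pos (by positivity)]
          field_simp
        rw [h2]
        field_simp
      have h2 : (K : ℝ) / (X : ℝ) ^ γ ≤ (X : ℝ) ^ (v - w - γ) := by
        refine div_le_rpow (a := v - w) hX (hKle.trans ?_) le_rfl le_rfl
        exact div_le_rpow hX hNV le_rfl le_rfl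
      rw [h1]
      refine mul_le_rpow hX (by positivity) (mul_le_rpow hX (by positivity)
        (mul_le_rpow hX (by positivity) hX1' hX1' le_rfl) hHX le_rfl)
        (sqrt_le_rpow (s := ((η + ε) + (v - w - γ)) / 2) hX
          (mul_le_rpow hX (by positivity) hHX h2 le_rfl) (by linarith)) ?_
      linarith
    have hsum : (X / N * K : ℝ) * (H * X + (H : ℝ) ^ 2 * N ^ 2 / K * √(H * (X : ℝ) ^ γ / K) +
        X * (H : ℝ) ^ 2 * N / √(H * (X : ℝ) ^ γ * K)) ≤ 3 * (X : ℝ) ^ (2 - 2 * θ - 30 * ε) := by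
      rw [mul_add, mul_add]; linarith
    rw [mul_assoc _ (X / N * K : ℝ)]
    refine mul_le_rpow hX (by positivity) hpre
      (hsum.trans (mul_le_rpow hX (by positivity) h3X le_rfl le_rfl)) (by linarith)
  calc _ ≤ _ := hmain
    _ ≤ _ := mul_le_rpow hX (by positivity) hlog le_rfl (by linarith)

lemma norm_bilin_powerWeight_le (X T H : ℕ) (γ ξ Y : ℝ) (a c : ℕ → ℂ) (S : Finset ℕ)
    (ha : ∀ n, ‖a n‖ ≤ Y) (hc : ∀ n, ‖c n‖ ≤ 1) (hS : ∀ n ∈ Icc 1 X, a n ≠ 0 → n ∈ S) :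
    ‖bilin X (powerWeight γ ξ H c) a (fun m => if T < m then 1 else 0)‖ ≤
      Y * ∑ h ∈ Ico H (2 * H), ∑ n ∈ S,
        ‖∑ m ∈ (Icc 1 X).filter (fun m => T < m ∧ X < 8 * (m * n) ∧ m * n ≤ X),
          e (h * ((m * n : ℕ) : ℝ) ^ γ + ξ * ((m * n : ℕ) : ℝ))‖ := by
  have hY : 0 ≤ Y := (norm_nonneg _).trans (ha 0)
  set E : ℕ → ℕ → ℂ := fun h n => ∑ m ∈ (Icc 1 X).filter (fun m => T < m ∧ X < 8 * (m * n) ∧ m * n ≤ X),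
          e (h * ((m * n : ℕ) : ℝ) ^ γ + ξ * ((m * n : ℕ) : ℝ)) with hE
  have h1 : bilin X (powerWeight γ ξ H c) a (fun m => if T < m then 1 else 0) =
      ∑ n ∈ Icc 1 X, a n * ∑ h ∈ Ico H (2 * H), c h * E h n := by
    rw [bilin]
    refine sum_congr rfl fun n _ => ?_
    simp only [hE, mul_sum, sum_filter, powerWeight]
    rw [sum_comm]
    refine sum_congr rfl fun m _ => ?_
    by_cases hT : T < m
    · by_cases hX : X < 8 * (m * n) ∧ m * n ≤ X
      · simp [hT, hX]
      · simp [hX]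
    · simp [hT]
  rw [h1]
  calc _ ≤ ∑ n ∈ Icc 1 X, ‖a n * ∑ h ∈ Ico H (2 * H), c h * E h n‖ := norm_sum_le _ _
    _ ≤ ∑ n ∈ Icc 1 X, (if n ∈ S then Y * ∑ h ∈ Ico H (2 * H), ‖E h n‖ else 0) := by
      refine sum_le_sum fun n hn => ?_
      by_cases h0 : a n = 0
      · rw [h0, zero_mul, norm_zero]
        split_ifs
        · positivity
        · exact le_rfl
      · rw [if_pos (hS n hn h0), norm_mul]
        refine mul_le_mul (ha n) ?_ (norm_nonneg _) hY
        refine (norm_sum_le _ _).trans (sum_le_sum fun h _ => ?_)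
        rw [norm_mul]
        exact mul_le_of_le_one_left (norm_nonneg _) (hc h)
    _ ≤ ∑ n ∈ S, Y * ∑ h ∈ Ico H (2 * H), ‖E h n‖ := by
      rw [← sum_filter]
      refine sum_le_sum_of_subset_of_nonneg (fun n hn => (mem_filter.1 hn).2) fun n _ _ => ?_
      positivity
    _ = _ := by
      rw [← mul_sum, sum_comm]

lemma ordConnected_filter_window_gt (n X T : ℕ) :
    (((Icc 1 X).filter (fun m => T < m ∧ X < 8 * (m * n) ∧ m * n ≤ X) : Finset ℕ) : Set ℕ).OrdConnected := by
  constructor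
  intro a ha b hb z hz
  simp only [coe_filter, mem_Icc, Set.mem_ofPred_eq] at ha hb ⊢
  obtain ⟨h1, h2⟩ := hz
  have e1 := Nat.mul_le_mul_right n h1
  have e2 := Nat.mul_le_mul_right n h2
  omega

lemma typeI_small_bound {γ η θ ε u : ℝ} (hη0 : 0 < η) (hγ : γ = 1 - η) (hθ : 0 < θ)
    (hε : 0 < ε) (hu0 : η ≤ u) (hu : 1 / 2 + η + u ≤ 1 - θ - 30 * ε) :
    ∀ᶠ X : ℕ in atTop, ∀ (U T H : ℕ) (ξ : ℝ) (a c : ℕ → ℂ), (U : ℝ) ≤ (X : ℝ) ^ u →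
      0 < H → (H : ℝ) ≤ (X : ℝ) ^ (η + ε) → (∀ n, ‖a n‖ ≤ (X : ℝ) ^ ε) →
      (∀ n, ‖c n‖ ≤ 1) → (∀ n, a n ≠ 0 → n ≤ U) →
      ‖bilin X (powerWeight γ ξ H c) a (fun m => if T < m then 1 else 0)‖ ≤
        (X : ℝ) ^ (1 - θ - 8 * ε) := by
  obtain ⟨C, hC, hvdc⟩ := van_der_corput_nat γ (by linarith) (by linarith)
  filter_upwards [eventually_ge_atTop 1, eventually_log_pow_le 1 1 hε, eventually_const_le C hε,
    eventually_const_le 2 hε] with X hX1 hlog hCX h2X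
  intro U T H ξ a c hU hH hHX ha hc hsupp
  have hX : (1 : ℝ) ≤ X := by exact_mod_cast hX1
  have hX0 : (0 : ℝ) < X := by linarith
  have hH1 : (1 : ℝ) ≤ H := by exact_mod_cast hH
  have hXγ : 0 < (X : ℝ) ^ γ := Real.rpow_pos_of_pos hX0 _
  rw [pow_one, one_mul] at hlog
  have hX1' : (X : ℝ) ≤ (X : ℝ) ^ (1 : ℝ) := (Real.rpow_one _).ge
  refine (norm_bilin_powerWeight_le X T H γ ξ _ a c (Icc 1 U) ha hc
    (fun n hn h0 => mem_Icc.2 ⟨(mem_Icc.1 hn).1, hsupp n h0⟩)).trans ?_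
  have hterm : ∀ h ∈ Ico H (2 * H), ∀ n ∈ Icc 1 U,
      ‖∑ m ∈ (Icc 1 X).filter (fun m => T < m ∧ X < 8 * (m * n) ∧ m * n ≤ X),
          e (h * ((m * n : ℕ) : ℝ) ^ γ + ξ * ((m * n : ℕ) : ℝ))‖ ≤
      C * (√(2 * H * (X : ℝ) ^ γ) + X / √(X : ℝ) ^ γ * (1 / n)) := by
    intro h hh n hn
    rw [mem_Ico] at hh
    rw [mem_Icc] at hn
    have hn0 : (0 : ℝ) < n := by exact_mod_cast hn.1
    have hh1 : (H : ℝ) ≤ h := by exact_mod_cast hh.1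
    have hh2 : (h : ℝ) ≤ 2 * H := by exact_mod_cast hh.2.le
    have hh0 : (0 : ℝ) < h := by linarith
    rcases lt_or_ge X n with hXn | hXn
    · have : (Icc 1 X).filter (fun m => T < m ∧ X < 8 * (m * n) ∧ m * n ≤ X) = ∅ := by
        refine filter_eq_empty_iff.2 fun m hm h3 => ?_
        have := Nat.mul_le_mul_right n (mem_Icc.1 hm).1
        omega
      rw [this, sum_empty, norm_zero]
      positivity
    have hM : (1 : ℝ) ≤ X / n := by
      rw [le_div_iff₀ hn0, one_mul]; exact_mod_cast hXn
    have h1 := hvdc (h * (n : ℝ) ^ γ) (ξ * n) (X / n) _ (by positivity) hM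
      (ordConnected_filter_window_gt n X T) (by
        intro m hm
        simp only [mem_filter, mem_Icc] at hm
        constructor
        · rw [div_div, div_le_iff₀ (by positivity)]
          have : X ≤ m * (n * 16) := by
            calc X ≤ 8 * (m * n) := hm.2.2.1.le
              _ ≤ m * (n * 16) := by nlinarith [Nat.zero_le (m * n)]
          exact_mod_cast this
        · rw [le_div_iff₀ hn0]; exact_mod_cast hm.2.2.2)
    have h2 : |(h : ℝ) * (n : ℝ) ^ γ| * (X / n : ℝ) ^ γ = h * (X : ℝ) ^ γ := by
      rw [abs_of_pos (by positivity), Real.div_rpow hX0.le hn0.le]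
      field_simp
    rw [h2] at h1
    refine le_trans (le_of_eq ?_) (h1.trans ?_)
    · congr 1
      refine sum_congr rfl fun m _ => ?_
      congr 1
      push_cast
      rw [Real.mul_rpow (by positivity) (by positivity)]
      ring
    · have h3 : √(X : ℝ) ^ γ ≤ √(h * (X : ℝ) ^ γ) := by
        rw [Real.sqrt_eq_rpow, ← Real.rpow_mul hX0.le, mul_comm, Real.rpow_mul hX0.le,
          ← Real.sqrt_eq_rpow]
        refine Real.sqrt_le_sqrt ?_
        nlinarith
      have h4 : 0 < √(X : ℝ) ^ γ := by positivity
      have h5 : (X / n : ℝ) / √(h * (X : ℝ) ^ γ) ≤ X / √(X : ℝ) ^ γ * (1 / n) := by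
        rw [div_mul_div_comm, mul_one, div_div, mul_comm (n : ℝ)]
        gcongr
      gcongr
  have hsum : ∑ h ∈ Ico H (2 * H), ∑ n ∈ Icc 1 U,
      ‖∑ m ∈ (Icc 1 X).filter (fun m => T < m ∧ X < 8 * (m * n) ∧ m * n ≤ X),
          e (h * ((m * n : ℕ) : ℝ) ^ γ + ξ * ((m * n : ℕ) : ℝ))‖ ≤
      C * (H * (U * √(2 * H * (X : ℝ) ^ γ)) + H * (X / √(X : ℝ) ^ γ * (1 + Real.log U))) := by
    calc _ ≤ ∑ h ∈ Ico H (2 * H), ∑ n ∈ Icc 1 U,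
          C * (√(2 * H * (X : ℝ) ^ γ) + X / √(X : ℝ) ^ γ * (1 / n)) :=
          sum_le_sum fun h hh => sum_le_sum fun n hn => hterm h hh n hn
      _ = C * (H * (U * √(2 * H * (X : ℝ) ^ γ)) +
          H * (X / √(X : ℝ) ^ γ * ∑ n ∈ Icc 1 U, 1 / (n : ℝ))) := by
          rw [sum_const, Nat.card_Ico, nsmul_eq_mul, ← mul_sum, sum_add_distrib, sum_const,
            Nat.card_Icc, ← mul_sum, nsmul_eq_mul]
          have : 2 * H - H = H := by omega
          rw [this]
          push_cast
          ring
      _ ≤ _ := by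
          gcongr
          exact sum_inv_le_log U
  have hlogU : 1 + Real.log U ≤ (X : ℝ) ^ ε := by
    refine le_trans ?_ hlog
    rcases Nat.eq_zero_or_pos U with rfl | hU0
    · simp only [Nat.cast_zero, Real.log_zero]
      have := Real.log_nonneg hX
      linarith
    · have h1 : (U : ℝ) ≤ X := hU.trans (by
        calc (X : ℝ) ^ u ≤ (X : ℝ) ^ (1 : ℝ) := Real.rpow_le_rpow_of_exponent_le hX (by linarith)
          _ = X := Real.rpow_one _)
      have := Real.log_le_log (by exact_mod_cast hU0) h1
      linarith
  have hlogU0 : 0 ≤ 1 + Real.log U := by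
    rcases Nat.eq_zero_or_pos U with rfl | hU0
    · simp
    · have : 0 ≤ Real.log U := Real.log_nonneg (by exact_mod_cast hU0)
      linarith
  have hsq : √(X : ℝ) ^ γ = (X : ℝ) ^ (γ / 2) := by
    rw [Real.sqrt_eq_rpow, ← Real.rpow_mul hX0.le]; congr 1; ring
  have hA : (H : ℝ) * (U * √(2 * H * (X : ℝ) ^ γ)) ≤ (X : ℝ) ^ (1 - θ - 20 * ε) := by
    refine mul_le_rpow hX (by positivity) hHX (mul_le_rpow hX (by positivity) hU
      (sqrt_le_rpow (s := (ε + (η + ε) + γ) / 2) hX (mul_le_rpow hX (by positivity)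
        (mul_le_rpow hX (by positivity) h2X hHX le_rfl) le_rfl le_rfl) ?_) le_rfl) ?_ <;> linarith
  have hB : (H : ℝ) * (X / √(X : ℝ) ^ γ * (1 + Real.log U)) ≤ (X : ℝ) ^ (1 - θ - 20 * ε) := by
    refine mul_le_rpow hX (by positivity) hHX (mul_le_rpow hX hlogU0
      (div_le_rpow hX hX1' hsq.ge le_rfl) hlogU le_rfl) ?_
    linarith
  have hC' : (H * (U * √(2 * H * (X : ℝ) ^ γ)) + H * (X / √(X : ℝ) ^ γ * (1 + Real.log U))) ≤
      (X : ℝ) ^ (1 - θ - 19 * ε) := by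
    have : 2 * (X : ℝ) ^ (1 - θ - 20 * ε) ≤ (X : ℝ) ^ (1 - θ - 19 * ε) :=
      mul_le_rpow hX (by positivity) h2X le_rfl (by linarith)
    linarith
  refine mul_le_rpow hX (by positivity) le_rfl (hsum.trans (mul_le_rpow hX (by positivity) hCX hC' le_rfl)) ?_
  linarith

lemma dd_bounds {β A B a x : ℝ} (hβ0 : 0 < β) (hβ1 : β < 1) (hA : 0 < A) (hAx : A ≤ x) (ha : 0 ≤ a)
    (hxB : x + a ≤ B) : a * β * B ^ (β - 1) ≤ dd β a x ∧ dd β a x ≤ a * β * A ^ (β - 1) := by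
  obtain ⟨t, h1, h2, h3⟩ := exists_dd_eq β a x (by linarith) ha
  rw [h3]
  have h4 : B ^ (β - 1) ≤ t ^ (β - 1) :=
    Real.rpow_le_rpow_of_nonpos (by linarith) (by linarith) (by linarith)
  have h5 : t ^ (β - 1) ≤ A ^ (β - 1) :=
    Real.rpow_le_rpow_of_nonpos hA (by linarith) (by linarith)
  constructor <;> gcongr

lemma ddd_bounds {β A B a b x : ℝ} (hβ0 : 0 < β) (hβ1 : β < 1) (hA : 0 < A) (hAx : A ≤ x) (ha : 0 ≤ a)
    (hb : 0 ≤ b) (hxB : x + a + b ≤ B) :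
    a * b * (β * (1 - β)) * B ^ (β - 2) ≤ -ddd β a b x ∧
      -ddd β a b x ≤ a * b * (β * (1 - β)) * A ^ (β - 2) := by
  obtain ⟨t, h1, h2, h3⟩ := exists_ddd_eq β a b x (by linarith) ha hb
  have h6 : -ddd β a b x = a * b * (β * (1 - β)) * t ^ (β - 2) := by rw [h3]; ring
  rw [h6]
  have h7 : 0 ≤ 1 - β := by linarith
  have h4 : B ^ (β - 2) ≤ t ^ (β - 2) :=
    Real.rpow_le_rpow_of_nonpos (by linarith) (by linarith) (by linarith)
  have h5 : t ^ (β - 2) ≤ A ^ (β - 2) :=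
    Real.rpow_le_rpow_of_nonpos hA (by linarith) (by linarith)
  constructor <;> gcongr

lemma dddd_bounds {β A B a b c x : ℝ} (hβ0 : 0 < β) (hβ1 : β < 1) (hA : 0 < A) (hAx : A ≤ x) (ha : 0 ≤ a)
    (hb : 0 ≤ b) (hc : 0 ≤ c) (hxB : x + a + b + c ≤ B) :
    a * b * c * (β * (1 - β) * (2 - β)) * B ^ (β - 3) ≤ dddd β a b c x ∧
      dddd β a b c x ≤ a * b * c * (β * (1 - β) * (2 - β)) * A ^ (β - 3) := by
  obtain ⟨t, h1, h2, h3⟩ := exists_dddd_eq β a b c x (by linarith) ha hb hc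
  have h6 : dddd β a b c x = a * b * c * (β * (1 - β) * (2 - β)) * t ^ (β - 3) := by rw [h3]; ring
  rw [h6]
  have h7 : 0 ≤ 1 - β := by linarith
  have h8 : 0 ≤ 2 - β := by linarith
  have h4 : B ^ (β - 3) ≤ t ^ (β - 3) :=
    Real.rpow_le_rpow_of_nonpos (by linarith) (by linarith) (by linarith)
  have h5 : t ^ (β - 3) ≤ A ^ (β - 3) :=
    Real.rpow_le_rpow_of_nonpos hA (by linarith) (by linarith)
  constructor <;> gcongr

lemma dddd_anti {β a b c d x : ℝ} (hβ0 : 0 < β) (hβ1 : β < 1) (hx : 0 < x) (ha : 0 ≤ a)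
    (hb : 0 ≤ b) (hc : 0 ≤ c) (hd : 0 ≤ d) : dddd β a b c (x + d) ≤ dddd β a b c x := by
  obtain ⟨t, h1, -, h3⟩ := exists_sub_eq_mul (dddd β a b c) (fun y => β * dddd (β - 1) a b c y) x d hx hd
    (fun y hy => by
      have h := ((hasDerivAt_ddd β a b (y + c) (by linarith) ha hb).comp_add_const y c).sub
        (hasDerivAt_ddd β a b y hy ha hb)
      rw [dddd, mul_sub]
      exact h)
  obtain ⟨u, h4, -, h5⟩ := exists_dddd_eq (β - 1) a b c t (by linarith) ha hb hc
  have h6 : dddd (β - 1) a b c t ≤ 0 := by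
    rw [h5]
    have h7 : 0 ≤ u ^ (β - 1 - 3) := by
      have : 0 < u := by linarith
      positivity
    have h8 : (β - 1) * (β - 1 - 1) * (β - 1 - 2) ≤ 0 := by
      have : 0 ≤ (1 - β) * (2 - β) * (3 - β) :=
        mul_nonneg (mul_nonneg (by linarith) (by linarith)) (by linarith)
      linarith
    have h9 : 0 ≤ a * b * c := by positivity
    exact mul_nonpos_of_nonpos_of_nonneg (mul_nonpos_of_nonneg_of_nonpos h9 h8) h7
  have h7 : d * (β * dddd (β - 1) a b c t) ≤ 0 :=
    mul_nonpos_of_nonneg_of_nonpos hd (mul_nonpos_of_nonneg_of_nonpos hβ0.le h6)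
  linarith

lemma rpow_two_mul_ge {M p : ℝ} (hM : 0 < M) (k : ℕ) (hp : -k ≤ p) :
    M ^ p / 2 ^ k ≤ (2 * M) ^ p := by
  rw [Real.mul_rpow (by norm_num) hM.le, div_eq_inv_mul]
  gcongr
  rw [← Real.rpow_natCast, ← Real.rpow_neg (by norm_num)]
  exact Real.rpow_le_rpow_of_exponent_le (by norm_num) hp

lemma rpow_div_le {N p B : ℝ} (hN : 0 < N) (hB : 1 ≤ B) (k : ℕ) (hp : -k ≤ p) :
    (N / B) ^ p ≤ B ^ k * N ^ p := by
  rw [Real.div_rpow hN.le (by linarith), div_eq_inv_mul, ← Real.rpow_neg (by linarith)]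
  gcongr
  rw [← Real.rpow_natCast]
  exact Real.rpow_le_rpow_of_exponent_le hB (by linarith)

lemma norm_sum_first_variable_le {γ : ℝ} (hγ0 : 0 < γ) (hγ1 : γ < 1) (T : Finset ℤ)
    (hT : (T : Set ℤ).OrdConnected) {M r d₁ d₂ h : ℝ} (c₀ : ℝ) (hM : 1 ≤ M) (hr : 1 ≤ r)
    (hTM : ∀ m ∈ T, M ≤ m ∧ m + r ≤ 2 * M) (hd₁ : 0 < d₁) (hh : 0 < h)
    (hd : d₂ - d₁ ≤ d₁ * (r * (1 - γ) / (8 * M)))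
    (hhalf : h * (d₁ * r * M ^ (γ - 2) + M ^ (γ - 1) * |d₁ - d₂|) ≤ 1 / 2) :
    ‖∑ m ∈ T, e (h * (((m : ℝ) + r) ^ γ * d₂ - (m : ℝ) ^ γ * d₁) + c₀)‖ ≤
      2 + 8 / (h * d₁ * r * (γ * (1 - γ)) * M ^ (γ - 2)) := by
  have hM0 : 0 < M := by linarith
  have h1γ : 0 < 1 - γ := by linarith
  have hMp : ∀ p : ℝ, 0 < M ^ p := fun p => Real.rpow_pos_of_pos hM0 p
  have hMM1 : M ^ (γ - 1) = M ^ (γ - 2) * M := by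
    rw [← Real.rpow_add_one hM0.ne']; congr 1; ring
  have hMM2 : M ^ (γ - 2) = M ^ (γ - 3) * M := by
    rw [← Real.rpow_add_one hM0.ne']; congr 1; ring
  set δ := h * d₁ * r * (γ * (1 - γ)) * M ^ (γ - 2) / 8 with hδ
  have hδ0 : 0 < δ := by have := hMp (γ - 2); positivity
  have h2 : 2 + 8 / (h * d₁ * r * (γ * (1 - γ)) * M ^ (γ - 2)) = 2 + 1 / δ := by
    rw [hδ, one_div_div]
  rw [h2]
  set x : ℤ → ℝ := fun m => h * (((m : ℝ) + r) ^ γ * d₂ - (m : ℝ) ^ γ * d₁) + c₀ with hx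
  have hdiff : ∀ m : ℤ, x (m + 1) - x m = -(h * (dd γ 1 m * d₁ - dd γ 1 (m + r) * d₂)) := by
    intro m
    simp only [hx, dd]
    push_cast
    rw [add_right_comm (m : ℝ) 1 r]
    ring
  have hdiff2 : ∀ m : ℤ, (x (m + 2) - x (m + 1)) - (x (m + 1) - x m) =
      h * (-ddd γ 1 1 m * d₁ - -ddd γ 1 1 (m + r) * d₂) := by
    intro m
    have h3 : m + 2 = (m + 1) + 1 := by ring
    rw [h3, hdiff, hdiff]
    simp only [ddd]
    push_cast
    rw [add_right_comm (m : ℝ) 1 r]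
    ring
  refine kusmin_landau_half T hT x δ hδ0 (Or.inr ?_) (Or.inl ?_)
  · intro m hm hm1
    obtain ⟨a1, a2⟩ := hTM m hm
    obtain ⟨a3, a4⟩ := hTM _ hm1
    push_cast at a3 a4
    rw [hdiff, neg_neg]
    have hP := dd_bounds hγ0 hγ1 hM0 (show M ≤ (m : ℝ) + r by linarith) zero_le_one (B := 2 * M) (by linarith)
    have hPd := ddd_bounds hγ0 hγ1 hM0 a1 zero_le_one (show 0 ≤ r by linarith) (B := 2 * M) (by linarith)
    have hPd' : -ddd γ 1 r m = dd γ 1 m - dd γ 1 (m + r) := by rw [ddd]; ring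
    rw [hPd', one_mul] at hPd
    rw [one_mul] at hP
    have hP0 : 0 ≤ dd γ 1 (m + r) := le_trans (by positivity) hP.1
    have hB := rpow_two_mul_ge (p := γ - 2) hM0 2 (by push_cast; linarith)
    have hlow : r * (γ * (1 - γ)) * (M ^ (γ - 2) / 2 ^ 2) ≤ dd γ 1 m - dd γ 1 (m + r) := by
      refine le_trans ?_ hPd.1
      gcongr
    have hsplit : dd γ 1 m * d₁ - dd γ 1 (m + r) * d₂ =
        d₁ * (dd γ 1 m - dd γ 1 (m + r)) + dd γ 1 (m + r) * (d₁ - d₂) := by ring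
    rw [hsplit]
    constructor
    · have h3 : dd γ 1 (m + r) * (d₂ - d₁) ≤ γ * M ^ (γ - 1) * (d₁ * (r * (1 - γ) / (8 * M))) := by
        calc _ ≤ dd γ 1 (m + r) * (d₁ * (r * (1 - γ) / (8 * M))) := by gcongr
          _ ≤ _ := by
            have := hP.2
            gcongr
      have h4 : γ * M ^ (γ - 1) * (d₁ * (r * (1 - γ) / (8 * M))) =
          d₁ * r * (γ * (1 - γ)) * M ^ (γ - 2) / 8 := by
        rw [hMM1]; field_simp
      have h5 : d₁ * (r * (γ * (1 - γ)) * (M ^ (γ - 2) / 2 ^ 2)) ≤ d₁ * (dd γ 1 m - dd γ 1 (m + r)) := by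
        gcongr
      have h6 : δ = h * (d₁ * r * (γ * (1 - γ)) * M ^ (γ - 2) / 8) := by rw [hδ]; ring
      rw [h6]
      refine mul_le_mul_of_nonneg_left ?_ hh.le
      rw [h4] at h3
      linarith
    · refine le_trans (mul_le_mul_of_nonneg_left ?_ hh.le) hhalf
      have h3 : dd γ 1 m - dd γ 1 (m + r) ≤ r * M ^ (γ - 2) := by
        refine hPd.2.trans ?_
        have : γ * (1 - γ) ≤ 1 := by nlinarith
        have h7 := hMp (γ - 2)
        calc r * (γ * (1 - γ)) * M ^ (γ - 2) ≤ r * 1 * M ^ (γ - 2) := by gcongr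
          _ = _ := by ring
      have h4 : dd γ 1 (m + r) ≤ M ^ (γ - 1) := by
        refine hP.2.trans ?_
        have := hMp (γ - 1)
        nlinarith
      have h5 : dd γ 1 (m + r) * (d₁ - d₂) ≤ M ^ (γ - 1) * |d₁ - d₂| := by
        calc _ ≤ dd γ 1 (m + r) * |d₁ - d₂| := by gcongr; exact le_abs_self _
          _ ≤ _ := by gcongr
      calc _ ≤ d₁ * (r * M ^ (γ - 2)) + M ^ (γ - 1) * |d₁ - d₂| := by gcongr
        _ = _ := by ring
  · intro m hm hm1 hm2
    obtain ⟨a1, a2⟩ := hTM m hm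
    obtain ⟨a3, a4⟩ := hTM _ hm2
    push_cast at a3 a4
    have hP := ddd_bounds hγ0 hγ1 hM0 (show M ≤ (m : ℝ) + r by linarith) zero_le_one zero_le_one
      (B := 2 * M) (by linarith)
    have hPd := dddd_bounds hγ0 hγ1 hM0 a1 zero_le_one zero_le_one (show 0 ≤ r by linarith)
      (B := 2 * M) (by linarith)
    rw [dddd] at hPd
    simp only [one_mul] at hP hPd
    have hB := rpow_two_mul_ge (p := γ - 3) hM0 3 (by push_cast; linarith)
    have h2γ : 0 < 2 - γ := by linarith
    have hlow : r * (γ * (1 - γ) * (2 - γ)) * (M ^ (γ - 3) / 2 ^ 3) ≤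
        ddd γ 1 1 (m + r) - ddd γ 1 1 m := by
      refine le_trans ?_ hPd.1
      gcongr
    have h0 := hMp (γ - 3)
    have hP0 : 0 ≤ -ddd γ 1 1 (m + r) := le_trans (by positivity) hP.1
    have hkey : 0 ≤ -ddd γ 1 1 m * d₁ - -ddd γ 1 1 (m + r) * d₂ := by
      have h3 : -ddd γ 1 1 (m + r) * (d₂ - d₁) ≤
          γ * (1 - γ) * M ^ (γ - 2) * (d₁ * (r * (1 - γ) / (8 * M))) := by
        calc _ ≤ -ddd γ 1 1 (m + r) * (d₁ * (r * (1 - γ) / (8 * M))) := by gcongr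
          _ ≤ _ := by
            have := hP.2
            gcongr
      have h4 : γ * (1 - γ) * M ^ (γ - 2) * (d₁ * (r * (1 - γ) / (8 * M))) =
          d₁ * (r * (γ * (1 - γ) * (1 - γ)) * (M ^ (γ - 3) / 2 ^ 3)) := by
        rw [hMM2]; field_simp; norm_num
      have h5 : d₁ * (r * (γ * (1 - γ) * (1 - γ)) * (M ^ (γ - 3) / 2 ^ 3)) ≤
          d₁ * (ddd γ 1 1 (m + r) - ddd γ 1 1 m) := by
        gcongr
        refine le_trans ?_ hlow
        gcongr
        linarith
      linarith
    have h6 : 0 ≤ h * (-ddd γ 1 1 m * d₁ - -ddd γ 1 1 (m + r) * d₂) := mul_nonneg hh.le hkey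
    rw [← hdiff2] at h6
    linarith

lemma norm_sum_second_variable_le {γ : ℝ} (hγ0 : 0 < γ) (hγ1 : γ < 1) (T : Finset ℤ)
    (hT : (T : Set ℤ).OrdConnected) {N q s u₁ u₂ h : ℝ} (c₀ : ℝ) (hN : 1 ≤ N) (hq : 1 ≤ q) (hs : 1 ≤ s)
    (hTN : ∀ n ∈ T, N / 16 ≤ n - s ∧ n + q ≤ N) (hu₁ : 0 < u₁) (hu₂ : u₁ ≤ u₂) (hh : 0 < h)
    (hhalf : h * q * (4096 * u₁ * s * N ^ (γ - 3) + 256 * (u₂ - u₁) * N ^ (γ - 2)) ≤ 1 / 2) :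
    ‖∑ n ∈ T, e (h * (u₂ * dd γ q ((n : ℝ) - s) - u₁ * dd γ q n) + c₀)‖ ≤
      2 + 1 / (h * u₁ * q * s * (γ * (1 - γ)) * N ^ (γ - 3)) := by
  have hN0 : 0 < N := by linarith
  have h1γ : 0 < 1 - γ := by linarith
  have hNp : ∀ p : ℝ, 0 < N ^ p := fun p => Real.rpow_pos_of_pos hN0 p
  have hN16 : 0 < N / 16 := by positivity
  set δ := h * u₁ * q * s * (γ * (1 - γ)) * N ^ (γ - 3) with hδ
  have hδ0 : 0 < δ := by have := hNp (γ - 3); positivity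
  set x : ℤ → ℝ := fun n => h * (u₂ * dd γ q ((n : ℝ) - s) - u₁ * dd γ q n) + c₀ with hx
  have hdiff : ∀ n : ℤ, x (n + 1) - x n =
      -(h * (u₁ * dddd γ q 1 s (n - s) + (u₂ - u₁) * -ddd γ q 1 (n - s))) := by
    intro n
    simp only [hx, dddd, ddd]
    push_cast
    rw [add_sub_right_comm (n : ℝ) 1 s, sub_add_cancel (n : ℝ) s]
    ring
  have hdiff2 : ∀ n : ℤ, (x (n + 2) - x (n + 1)) - (x (n + 1) - x n) =
      h * (u₂ * dddd γ q 1 1 (n - s) - u₁ * dddd γ q 1 1 n) := by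
    intro n
    simp only [hx, dddd, ddd]
    push_cast
    have e1 : (n : ℝ) + 2 - s = n - s + 1 + 1 := by ring
    have e2 : (n : ℝ) + 1 - s = n - s + 1 := by ring
    have e3 : (n : ℝ) + 2 = n + 1 + 1 := by ring
    rw [e1, e2, e3]
    ring
  refine kusmin_landau_half T hT x δ hδ0 (Or.inr ?_) (Or.inl ?_)
  · intro n hn hn1
    obtain ⟨a1, a2⟩ := hTN n hn
    obtain ⟨a3, a4⟩ := hTN _ hn1
    push_cast at a3 a4
    rw [hdiff, neg_neg]
    have hP := ddd_bounds hγ0 hγ1 hN16 a1 (show 0 ≤ q by linarith) zero_le_one (B := N) (by linarith)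
    have hPd := dddd_bounds hγ0 hγ1 hN16 a1 (show 0 ≤ q by linarith) zero_le_one
      (show 0 ≤ s by linarith) (B := N) (by linarith)
    have hB2 := rpow_div_le (p := γ - 2) hN0 (show (1 : ℝ) ≤ 16 by norm_num) 2 (by push_cast; linarith)
    have hB3 := rpow_div_le (p := γ - 3) hN0 (show (1 : ℝ) ≤ 16 by norm_num) 3 (by push_cast; linarith)
    have hN2 := hNp (γ - 2)
    have hN3 := hNp (γ - 3)
    have hg1 : γ * (1 - γ) ≤ 1 := by nlinarith
    have hg2 : γ * (1 - γ) * (2 - γ) ≤ 1 := by nlinarith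
    have hE0 : 0 ≤ -ddd γ q 1 (n - s) := le_trans (by positivity) hP.1
    have hu : 0 ≤ u₂ - u₁ := by linarith
    constructor
    · have h1 : q * 1 * s * (γ * (1 - γ)) * N ^ (γ - 3) ≤ dddd γ q 1 s (n - s) := by
        refine le_trans ?_ hPd.1
        have h2 : γ * (1 - γ) ≤ γ * (1 - γ) * (2 - γ) :=
          le_mul_of_one_le_right (by positivity) (by linarith)
        exact mul_le_mul_of_nonneg_right (mul_le_mul_of_nonneg_left h2 (by positivity)) (by positivity)
      calc δ = h * (u₁ * (q * 1 * s * (γ * (1 - γ)) * N ^ (γ - 3)) + 0) := by rw [hδ]; ring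
        _ ≤ _ := by gcongr; positivity
    · have h1 : dddd γ q 1 s (n - s) ≤ q * (4096 * s * N ^ (γ - 3)) := by
        refine hPd.2.trans ?_
        calc q * 1 * s * (γ * (1 - γ) * (2 - γ)) * (N / 16) ^ (γ - 3)
            ≤ q * 1 * s * 1 * (16 ^ 3 * N ^ (γ - 3)) := by gcongr
          _ = _ := by ring
      have h2 : -ddd γ q 1 (n - s) ≤ q * (256 * N ^ (γ - 2)) := by
        refine hP.2.trans ?_
        calc q * 1 * (γ * (1 - γ)) * (N / 16) ^ (γ - 2)
            ≤ q * 1 * 1 * (16 ^ 2 * N ^ (γ - 2)) := by gcongr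
          _ = _ := by ring
      refine le_trans ?_ hhalf
      calc _ ≤ h * (u₁ * (q * (4096 * s * N ^ (γ - 3))) + (u₂ - u₁) * (q * (256 * N ^ (γ - 2)))) := by
            gcongr
        _ = _ := by ring
  · intro n hn hn1 hn2
    obtain ⟨a1, a2⟩ := hTN n hn
    have h1 := dddd_anti hγ0 hγ1 (show 0 < (n : ℝ) - s by linarith) (show 0 ≤ q by linarith) zero_le_one
      zero_le_one (show 0 ≤ s by linarith)
    rw [sub_add_cancel] at h1
    have h2 := dddd_bounds hγ0 hγ1 hN16 a1 (show 0 ≤ q by linarith) zero_le_one zero_le_one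
      (B := n - s + q + 1 + 1) (by linarith)
    have h3 : 0 ≤ dddd γ q 1 1 (n - s) := by
      refine le_trans ?_ h2.1
      have : 0 < 2 - γ := by linarith
      have : 0 < (n : ℝ) - s + q + 1 + 1 := by linarith
      positivity
    have h4 : 0 ≤ u₂ * dddd γ q 1 1 (n - s) - u₁ * dddd γ q 1 1 n := by
      have : u₁ * dddd γ q 1 1 n ≤ u₂ * dddd γ q 1 1 (n - s) := by
        calc _ ≤ u₁ * dddd γ q 1 1 (n - s) := by gcongr
          _ ≤ _ := by gcongr
      linarith
    have h5 := mul_nonneg hh.le h4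
    rw [← hdiff2] at h5
    linarith

lemma norm_sum_le_of_fibers_snd (S : Finset (ℤ × ℤ)) (g : ℤ × ℤ → ℂ) {K B : ℝ} (hB : 0 ≤ B)
    (hK : ((S.image Prod.snd).card : ℝ) ≤ K)
    (h : ∀ n ∈ S.image Prod.snd, ‖∑ m ∈ (S.filter (fun y => y.2 = n)).image Prod.fst, g (m, n)‖ ≤ B) :
    ‖∑ y ∈ S, g y‖ ≤ K * B := by
  rw [← sum_fiberwise_of_maps_to (g := Prod.snd) (t := S.image Prod.snd)
    (fun y hy => mem_image_of_mem _ hy)]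
  calc _ ≤ ∑ n ∈ S.image Prod.snd, ‖∑ y ∈ S.filter (fun y => y.2 = n), g y‖ := norm_sum_le _ _
    _ ≤ ∑ n ∈ S.image Prod.snd, B := by
      refine sum_le_sum fun n hn => ?_
      refine le_trans (le_of_eq ?_) (h n hn)
      rw [sum_image]
      · congr 1
        refine sum_congr rfl fun y hy => ?_
        rw [← (mem_filter.1 hy).2]
      · intro x hx y hy hxy
        exact Prod.ext hxy (((mem_filter.1 hx).2).trans ((mem_filter.1 hy).2).symm)
    _ ≤ K * B := by rw [sum_const, nsmul_eq_mul]; gcongr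

lemma norm_sum_le_of_fibers_fst (S : Finset (ℤ × ℤ)) (g : ℤ × ℤ → ℂ) {K B : ℝ} (hB : 0 ≤ B)
    (hK : ((S.image Prod.fst).card : ℝ) ≤ K)
    (h : ∀ m ∈ S.image Prod.fst, ‖∑ n ∈ (S.filter (fun y => y.1 = m)).image Prod.snd, g (m, n)‖ ≤ B) :
    ‖∑ y ∈ S, g y‖ ≤ K * B := by
  rw [← sum_fiberwise_of_maps_to (g := Prod.fst) (t := S.image Prod.fst)
    (fun y hy => mem_image_of_mem _ hy)]
  calc _ ≤ ∑ n ∈ S.image Prod.fst, ‖∑ y ∈ S.filter (fun y => y.1 = n), g y‖ := norm_sum_le _ _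
    _ ≤ ∑ n ∈ S.image Prod.fst, B := by
      refine sum_le_sum fun n hn => ?_
      refine le_trans (le_of_eq ?_) (h n hn)
      rw [sum_image]
      · congr 1
        refine sum_congr rfl fun y hy => ?_
        rw [← (mem_filter.1 hy).2]
      · intro x hx y hy hxy
        exact Prod.ext (((mem_filter.1 hx).2).trans ((mem_filter.1 hy).2).symm) hxy
    _ ≤ K * B := by rw [sum_const, nsmul_eq_mul]; gcongr

/-- Every horizontal and every vertical section of `S` is an interval. -/
def SectionsOrdConnected (S : Finset (ℤ × ℤ)) : Prop :=
  (∀ n, {m | (m, n) ∈ S}.OrdConnected) ∧ ∀ m, {n | (m, n) ∈ S}.OrdConnected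

lemma SectionsOrdConnected.filter_shift {S : Finset (ℤ × ℤ)} (hS : SectionsOrdConnected S)
    (r : ℤ × ℤ) : SectionsOrdConnected (S.filter (fun y => y + r ∈ S)) := by
  refine ⟨fun n => ⟨fun a ha b hb z hz => ?_⟩, fun m => ⟨fun a ha b hb z hz => ?_⟩⟩
  · simp only [Set.mem_ofPred_eq, mem_filter] at ha hb ⊢
    obtain ⟨r₁, r₂⟩ := r
    simp only [Prod.mk_add_mk] at ha hb ⊢
    exact ⟨(hS.1 n).out ha.1 hb.1 hz, (hS.1 (n + r₂)).out ha.2 hb.2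
      ⟨by linarith [hz.1], by linarith [hz.2]⟩⟩
  · simp only [Set.mem_ofPred_eq, mem_filter] at ha hb ⊢
    obtain ⟨r₁, r₂⟩ := r
    simp only [Prod.mk_add_mk] at ha hb ⊢
    exact ⟨(hS.2 m).out ha.1 hb.1 hz, (hS.2 (m + r₁)).out ha.2 hb.2
      ⟨by linarith [hz.1], by linarith [hz.2]⟩⟩

lemma SectionsOrdConnected.fst {S : Finset (ℤ × ℤ)} (hS : SectionsOrdConnected S) (n : ℤ) :
    (((S.filter (fun y => y.2 = n)).image Prod.fst : Finset ℤ) : Set ℤ).OrdConnected := by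
  convert hS.1 n using 1
  ext m
  simp

lemma SectionsOrdConnected.snd {S : Finset (ℤ × ℤ)} (hS : SectionsOrdConnected S) (m : ℤ) :
    (((S.filter (fun y => y.1 = m)).image Prod.snd : Finset ℤ) : Set ℤ).OrdConnected := by
  convert hS.2 m using 1
  ext n
  simp

lemma rpow_cancel_aux {h q r N M γ g : ℝ} (hh : 0 < h) (hq : 0 < q) (hr : 0 < r) (hN : 0 < N) (hM : 0 < M)
    (hγ : 0 < γ) (hg : 0 < g) :
    8 / (h * (q * γ * N ^ (γ - 1)) * r * (γ * g) * M ^ (γ - 2)) =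
      8 / (γ ^ 2 * g) * (M * (M * N) ^ (1 - γ) / (h * q)) / r := by
  have h1 : (M * N) ^ (1 - γ) = M ^ (1 - γ) * N ^ (1 - γ) := Real.mul_rpow hM.le hN.le
  have h2 : N ^ (γ - 1) = (N ^ (1 - γ))⁻¹ := by rw [← Real.rpow_neg hN.le]; congr 1; ring
  have h3 : M ^ (γ - 2) = (M * M ^ (1 - γ))⁻¹ := by
    rw [mul_comm, ← Real.rpow_add_one hM.ne', ← Real.rpow_neg hM.le]
    congr 1; ring
  have := Real.rpow_pos_of_pos hN (1 - γ)
  have := Real.rpow_pos_of_pos hM (1 - γ)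
  rw [h1, h2, h3]
  field_simp

lemma norm_corr_le_first {γ : ℝ} (hγ0 : 0 < γ) (hγ1 : γ < 1) (S : Finset (ℤ × ℤ))
    (hS : SectionsOrdConnected S) {M N q h : ℝ} (c : ℝ) (hM : 1 ≤ M) (hN : 1 ≤ N) (hq : 1 ≤ q)
    (hh : 0 < h) (hSM : ∀ y ∈ S, M ≤ y.1 ∧ (y.1 : ℝ) ≤ 2 * M)
    (hSN : ∀ y ∈ S, N / 16 ≤ y.2 ∧ y.2 + q ≤ N) (r₁ r₂ : ℤ) (hr₁ : 1 ≤ r₁)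
    (hr : -r₂ * (2048 * M) ≤ r₁ * N)
    (hA : h * q * (M * N) ^ (γ - 1) * (16 * r₁ / M + 256 * |(r₂ : ℝ)| / N) ≤ 1 / 2) :
    ‖corr S (fun y => h * (y.1 : ℝ) ^ γ * dd γ q y.2 + c * y.1) (r₁, r₂)‖ ≤
      2 * N * (2 + 8 / (γ ^ 2 * (1 - γ)) * (M * (M * N) ^ (1 - γ) / (h * q)) / r₁) := by
  have hM0 : 0 < M := by linarith
  have hN0 : 0 < N := by linarith
  have hq0 : 0 < q := by linarith
  have h1γ : 0 < 1 - γ := by linarith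
  have hr₁' : (1 : ℝ) ≤ r₁ := by exact_mod_cast hr₁
  have hMN : 0 < (M * N) ^ (1 - γ) := by positivity
  have hSr := hS.filter_shift (r₁, r₂)
  have hmem : ∀ m n : ℤ, (m, n) ∈ S.filter (fun y => y + (r₁, r₂) ∈ S) →
      (M ≤ m ∧ (m : ℝ) + r₁ ≤ 2 * M) ∧ (N / 16 ≤ n ∧ (n : ℝ) + q ≤ N) ∧
      (N / 16 ≤ (n : ℝ) + r₂ ∧ (n : ℝ) + r₂ + q ≤ N) := by
    intro m n hmn
    obtain ⟨h1, h2⟩ := mem_filter.1 hmn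
    have h3 := hSM _ h1
    have h4 := hSM _ h2
    have h5 := hSN _ h1
    have h6 := hSN _ h2
    simp only [Prod.mk_add_mk, Int.cast_add] at h3 h4 h5 h6
    exact ⟨⟨h3.1, h4.2⟩, h5, h6⟩
  rw [corr]
  refine norm_sum_le_of_fibers_snd _ _ (by positivity) ?_ ?_
  · refine card_le_of_mem_Icc _ N hN fun n hn => ?_
    obtain ⟨⟨m, n⟩, hy, rfl⟩ := mem_image.1 hn
    have := (hmem m n hy).2.1
    constructor <;> linarith
  · intro n hn
    obtain ⟨⟨m₀, n⟩, hy, rfl⟩ := mem_image.1 hn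
    obtain ⟨-, ⟨hn1, hn2⟩, hn3, hn4⟩ := hmem m₀ n hy
    have hn0 : (0 : ℝ) < n := by linarith
    have hN16 : 0 < N / 16 := by positivity
    obtain ⟨hd1, hd1'⟩ := dd_bounds hγ0 hγ1 hN16 hn1 hq0.le hn2
    obtain ⟨hd2, hd2'⟩ := dd_bounds hγ0 hγ1 hN16 hn3 hq0.le hn4
    have hNp : ∀ p : ℝ, 0 < N ^ p := fun p => Real.rpow_pos_of_pos hN0 p
    have hMp : ∀ p : ℝ, 0 < M ^ p := fun p => Real.rpow_pos_of_pos hM0 p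
    have hN1 := hNp (γ - 1)
    have hN2 := hNp (γ - 2)
    have hM2 := hMp (γ - 2)
    have hM1 := hMp (γ - 1)
    have hD0 : 0 < q * γ * N ^ (γ - 1) := by positivity
    have hd₁ : 0 < dd γ q n := lt_of_lt_of_le hD0 hd1
    have hB1 := rpow_div_le (p := γ - 1) hN0 (show (1 : ℝ) ≤ 16 by norm_num) 1 (by push_cast; linarith)
    have hB2 := rpow_div_le (p := γ - 2) hN0 (show (1 : ℝ) ≤ 16 by norm_num) 2 (by push_cast; linarith)
    have hNN : N ^ (γ - 1) = N ^ (γ - 2) * N := by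
      rw [← Real.rpow_add_one hN0.ne']; congr 1; ring
    have hMM : M ^ (γ - 1) = M ^ (γ - 2) * M := by
      rw [← Real.rpow_add_one hM0.ne']; congr 1; ring
    have hgg : γ * (1 - γ) ≤ 1 := by nlinarith
    have habs : |dd γ q n - dd γ q (n + r₂)| ≤ 256 * q * (γ * (1 - γ)) * |(r₂ : ℝ)| * N ^ (γ - 2) := by
      rcases le_total 0 (r₂ : ℝ) with h0 | h0
      · have h1 := ddd_bounds hγ0 hγ1 hN16 hn1 hq0.le h0 (B := n + q + r₂) le_rfl
        have h2 : dd γ q n - dd γ q (n + r₂) = -ddd γ q r₂ n := by rw [ddd]; ring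
        have h3 : 0 ≤ -ddd γ q r₂ n := le_trans (by
          have : 0 < (n : ℝ) + q + r₂ := by linarith
          positivity) h1.1
        rw [h2, abs_of_nonneg h3, abs_of_nonneg h0]
        calc _ ≤ q * r₂ * (γ * (1 - γ)) * (16 ^ 2 * N ^ (γ - 2)) :=
            h1.2.trans (by gcongr)
          _ = _ := by ring
      · have h1 := ddd_bounds hγ0 hγ1 hN16 hn3 hq0.le (neg_nonneg.2 h0) (B := N) (by linarith)
        have h2 : dd γ q n - dd γ q (n + r₂) = -(-ddd γ q (-r₂) (n + r₂)) := by
          rw [ddd, add_neg_cancel_right]; ring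
        have h3 : 0 ≤ -ddd γ q (-r₂) (n + r₂) := le_trans (by
          have := neg_nonneg.2 h0
          positivity) h1.1
        rw [h2, abs_neg, abs_of_nonneg h3, abs_of_nonpos h0]
        calc _ ≤ q * -r₂ * (γ * (1 - γ)) * (16 ^ 2 * N ^ (γ - 2)) :=
            h1.2.trans (by have := neg_nonneg.2 h0; gcongr)
          _ = _ := by ring
    have hkey := norm_sum_first_variable_le hγ0 hγ1 _ (hSr.fst n) (M := M) (r := r₁)
      (d₁ := dd γ q n) (d₂ := dd γ q (n + r₂)) (h := h) (c * r₁) hM hr₁' (by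
        intro m hm
        obtain ⟨y, hy, rfl⟩ := mem_image.1 hm
        obtain ⟨hy1, hy2⟩ := mem_filter.1 hy
        exact (hmem y.1 y.2 hy1).1) hd₁ hh (by
        rcases le_total 0 (r₂ : ℝ) with h0 | h0
        · have h1 := ddd_bounds hγ0 hγ1 hN16 hn1 hq0.le h0 (B := n + q + r₂) le_rfl
          have h3 : 0 ≤ -ddd γ q r₂ n := le_trans (by
            have : 0 < (n : ℝ) + q + r₂ := by linarith
            positivity) h1.1
          rw [ddd] at h3
          have h4 : dd γ q (n + r₂) - dd γ q n ≤ 0 := by linarith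
          refine h4.trans (by positivity)
        · have h1 : dd γ q (n + r₂) - dd γ q n ≤
              256 * q * (γ * (1 - γ)) * |(r₂ : ℝ)| * N ^ (γ - 2) := by
            refine le_trans (le_abs_self _) ?_
            rw [abs_sub_comm]; exact habs
          rw [abs_of_nonpos h0] at h1
          have h2 : -(r₂ : ℝ) ≤ r₁ * N / (2048 * M) := by
            rw [le_div_iff₀ (by positivity)]; exact hr
          calc _ ≤ 256 * q * (γ * (1 - γ)) * (r₁ * N / (2048 * M)) * N ^ (γ - 2) := by
                refine h1.trans ?_
                gcongr
            _ = q * γ * N ^ (γ - 1) * (r₁ * (1 - γ) / (8 * M)) := by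
                rw [hNN]; field_simp; norm_num
            _ ≤ _ := by gcongr) (by
        refine le_trans ?_ hA
        rw [Real.mul_rpow hM0.le hN0.le]
        have e1 : dd γ q n ≤ 16 * q * N ^ (γ - 1) := by
          calc _ ≤ q * 1 * (16 ^ 1 * N ^ (γ - 1)) := hd1'.trans (by gcongr)
            _ = _ := by ring
        have e2 : |dd γ q n - dd γ q (n + r₂)| ≤ 256 * q * |(r₂ : ℝ)| * N ^ (γ - 2) := by
          calc _ ≤ 256 * q * 1 * |(r₂ : ℝ)| * N ^ (γ - 2) := habs.trans (by gcongr)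
            _ = _ := by ring
        calc _ ≤ h * (16 * q * N ^ (γ - 1) * r₁ * M ^ (γ - 2) +
              M ^ (γ - 1) * (256 * q * |(r₂ : ℝ)| * N ^ (γ - 2))) := by gcongr
          _ = _ := by rw [hNN, hMM]; field_simp)
    refine le_trans (le_of_eq ?_) (hkey.trans ?_)
    · congr 1
      refine sum_congr rfl fun m _ => ?_
      congr 1
      simp only [Prod.mk_add_mk, Int.cast_add]
      ring
    · rw [← rpow_cancel_aux hh hq0 (by linarith) hN0 hM0 hγ0 h1γ]
      gcongr

lemma norm_corr_le_second {γ : ℝ} (hγ0 : 0 < γ) (hγ1 : γ < 1) (S : Finset (ℤ × ℤ))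
    (hS : SectionsOrdConnected S) {M N q h : ℝ} (c : ℝ) (hM : 1 ≤ M) (hN : 1 ≤ N) (hq : 1 ≤ q)
    (hh : 0 < h) (hSM : ∀ y ∈ S, M ≤ y.1 ∧ (y.1 : ℝ) ≤ 2 * M)
    (hSN : ∀ y ∈ S, N / 16 ≤ y.2 ∧ y.2 + q ≤ N) (r₁ s : ℤ) (hr₁ : 0 ≤ r₁) (hs : 1 ≤ s)
    (hr : r₁ * N ≤ s * (2048 * M))
    (hB : h * q * (M * N) ^ γ * (2 ^ 21 * s) ≤ N ^ 3) :
    ‖corr S (fun y => h * (y.1 : ℝ) ^ γ * dd γ q y.2 + c * y.1) (r₁, -s)‖ ≤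
      4 * M * (2 + 8 / (γ ^ 2 * (1 - γ)) * (N ^ 3 / (h * q * (M * N) ^ γ)) / s) := by
  have hM0 : 0 < M := by linarith
  have hN0 : 0 < N := by linarith
  have hq0 : 0 < q := by linarith
  have h1γ : 0 < 1 - γ := by linarith
  have hr₁' : (0 : ℝ) ≤ r₁ := by exact_mod_cast hr₁
  have hs' : (1 : ℝ) ≤ s := by exact_mod_cast hs
  have hMNγ : (M * N) ^ γ = M ^ γ * N ^ γ := Real.mul_rpow hM0.le hN0.le
  have hMγ : 0 < M ^ γ := by positivity
  have hNγ : 0 < N ^ γ := by positivity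
  have hSr := hS.filter_shift (r₁, -s)
  have hmem : ∀ m n : ℤ, (m, n) ∈ S.filter (fun y => y + (r₁, -s) ∈ S) →
      (M ≤ m ∧ (m : ℝ) + r₁ ≤ 2 * M) ∧ (N / 16 ≤ (n : ℝ) - s ∧ (n : ℝ) + q ≤ N) := by
    intro m n hmn
    obtain ⟨h1, h2⟩ := mem_filter.1 hmn
    have h3 := hSM _ h1
    have h4 := hSM _ h2
    have h5 := hSN _ h1
    have h6 := hSN _ h2
    simp only [Prod.mk_add_mk, ← sub_eq_add_neg, Int.cast_add, Int.cast_sub] at h3 h4 h5 h6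
    exact ⟨⟨h3.1, h4.2⟩, h6.1, h5.2⟩
  rw [corr]
  refine norm_sum_le_of_fibers_fst _ _ (by positivity) ?_ ?_
  · rw [show 4 * M = 2 * (2 * M) by ring]
    refine card_le_of_mem_Icc _ (2 * M) (by linarith) fun n hn => ?_
    obtain ⟨⟨m, n⟩, hy, rfl⟩ := mem_image.1 hn
    have := (hmem m n hy).1
    constructor <;> linarith
  · intro m hm
    obtain ⟨⟨m, n₀⟩, hy, rfl⟩ := mem_image.1 hm
    obtain ⟨⟨hm1, hm2⟩, -⟩ := hmem m n₀ hy
    have hm0 : (0 : ℝ) < m := by linarith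
    have hu : dd γ r₁ m ≤ r₁ * M ^ (γ - 1) := by
      calc _ ≤ r₁ * 1 * M ^ (γ - 1) :=
          (dd_bounds hγ0 hγ1 hM0 hm1 hr₁' le_rfl).2.trans (by gcongr)
        _ = _ := by ring
    have hu1 : (m : ℝ) ^ γ ≤ 2 * M ^ γ := by
      calc (m : ℝ) ^ γ ≤ (2 * M) ^ γ := by gcongr; linarith
        _ = 2 ^ γ * M ^ γ := Real.mul_rpow (by norm_num) hM0.le
        _ ≤ 2 ^ (1 : ℝ) * M ^ γ := by gcongr; norm_num
        _ = _ := by rw [Real.rpow_one]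
    have hMM : M ^ γ = M ^ (γ - 1) * M := by
      rw [← Real.rpow_add_one hM0.ne']; congr 1; ring
    have hN3 : N ^ (γ - 3) = N ^ γ / N ^ 3 := by
      rw [Real.rpow_sub hN0]; norm_cast
    have hN2 : N ^ (γ - 2) = N ^ γ / N ^ 2 := by
      rw [Real.rpow_sub hN0]; norm_cast
    have hM1 : 0 < M ^ (γ - 1) := Real.rpow_pos_of_pos hM0 _
    have hkey := norm_sum_second_variable_le hγ0 hγ1 _ (hSr.snd m) (N := N) (q := q) (s := s)
      (u₁ := (m : ℝ) ^ γ) (u₂ := ((m : ℝ) + r₁) ^ γ) (h := h) (c * r₁) hN hq hs' (by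
        intro n hn
        obtain ⟨y, hy, rfl⟩ := mem_image.1 hn
        obtain ⟨hy1, hy2⟩ := mem_filter.1 hy
        exact (hmem y.1 y.2 hy1).2) (by positivity)
        (Real.rpow_le_rpow hm0.le (by linarith) hγ0.le) hh (by
        have e0 : 0 ≤ ((m : ℝ) + r₁) ^ γ - (m : ℝ) ^ γ :=
          sub_nonneg.2 (Real.rpow_le_rpow hm0.le (by linarith) hγ0.le)
        have e1 : ((m : ℝ) + r₁) ^ γ - (m : ℝ) ^ γ ≤ s * 2048 / N * M ^ γ := by
          calc _ ≤ (r₁ : ℝ) * M ^ (γ - 1) := hu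
            _ ≤ s * (2048 * M) / N * M ^ (γ - 1) := by
                gcongr
                rw [le_div_iff₀ hN0]; exact hr
            _ = _ := by rw [hMM]; ring
        calc _ ≤ h * q * (4096 * (2 * M ^ γ) * s * (N ^ γ / N ^ 3) +
              256 * (s * 2048 / N * M ^ γ) * (N ^ γ / N ^ 2)) := by
                rw [hN2, hN3]; gcongr
          _ = (h * q * (M * N) ^ γ * ((8192 + 524288) * s)) / N ^ 3 := by
                rw [hMNγ]; field_simp; ring
          _ ≤ (h * q * (M * N) ^ γ * (2 ^ 21 * s) / 2) / N ^ 3 := by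
                refine div_le_div_of_nonneg_right ?_ (by positivity)
                have e2 : 0 ≤ h * q * (M * N) ^ γ * s := by positivity
                linarith
          _ ≤ (N ^ 3 / 2) / N ^ 3 := by gcongr
          _ = 1 / 2 := by field_simp)
    refine le_trans (le_of_eq ?_) (hkey.trans ?_)
    · congr 1
      refine sum_congr rfl fun n _ => ?_
      congr 1
      simp only [Prod.mk_add_mk, ← sub_eq_add_neg, Int.cast_add, Int.cast_sub]
      ring
    · rw [hN3]
      have e1 : 8 / (γ ^ 2 * (1 - γ)) * (N ^ 3 / (h * q * (M * N) ^ γ)) / s =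
          1 / (h * M ^ γ * q * s * (γ * (γ * (1 - γ) / 8)) * (N ^ γ / N ^ 3)) := by
        rw [hMNγ]; field_simp
      rw [e1]
      gcongr
      nlinarith

lemma sum_Ioo_le_sum_Icc (R : ℕ) (g : ℤ → ℝ) (hg : ∀ i, 0 ≤ g i) (hz : ∀ i < 1, g i = 0) :
    ∑ i ∈ Ioo (-(R : ℤ)) R, g i ≤ ∑ d ∈ Icc 1 R, g d := by
  rw [← sum_filter_of_ne (p := fun i : ℤ => 1 ≤ i) (fun i _ h => by
    by_contra h1; exact h (hz i (by omega)))]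
  have : ∑ d ∈ Icc 1 R, g d = ∑ i ∈ (Icc 1 R).map Nat.castEmbedding, g i := by rw [sum_map]; rfl
  rw [this]
  refine sum_le_sum_of_subset_of_nonneg (fun i hi => ?_) fun i _ _ => hg i
  rw [mem_filter, mem_Ioo] at hi
  rw [Finset.mem_map]
  exact ⟨i.toNat, mem_Icc.2 (by omega), by simp; omega⟩

lemma card_Ioo_neg_le (R : ℕ) : ((Ioo (-(R : ℤ)) R).card : ℝ) ≤ 2 * R := by
  rw [Int.card_Ioo]
  have : ((R : ℤ) - -(R : ℤ) - 1).toNat ≤ 2 * R := by omega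
  exact_mod_cast this

lemma card_filter_mul_le {R : ℕ} {N t : ℝ} (hN : 0 < N) (ht : 0 ≤ t) :
    (((Ioo (-(R : ℤ)) R).filter (fun r : ℤ => 0 ≤ r ∧ (r : ℝ) * N ≤ t)).card : ℝ) ≤ min (R : ℝ) (1 + t / N) := by
  refine le_min ?_ ?_
  · have h1 : (Ioo (-(R : ℤ)) R).filter (fun r : ℤ => 0 ≤ r ∧ (r : ℝ) * N ≤ t) ⊆ Ico 0 (R : ℤ) := by
      intro r hr
      rw [mem_filter, mem_Ioo] at hr
      rw [mem_Ico]; omega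
    have := card_le_card h1
    rw [Int.card_Ico] at this
    have h2 : ((Ioo (-(R : ℤ)) R).filter (fun r : ℤ => 0 ≤ r ∧ (r : ℝ) * N ≤ t)).card ≤ R := by omega
    exact_mod_cast h2
  · have h1 : (Ioo (-(R : ℤ)) R).filter (fun r : ℤ => 0 ≤ r ∧ (r : ℝ) * N ≤ t) ⊆ Icc 0 ⌊t / N⌋ := by
      intro r hr
      rw [mem_filter] at hr
      rw [mem_Icc]
      exact ⟨hr.2.1, Int.le_floor.2 ((le_div_iff₀ hN).2 hr.2.2)⟩
    have h2 := card_le_card h1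
    rw [Int.card_Icc] at h2
    have h3 : 0 ≤ ⌊t / N⌋ := Int.floor_nonneg.2 (by positivity)
    have h4 : (((Ioo (-(R : ℤ)) R).filter (fun r : ℤ => 0 ≤ r ∧ (r : ℝ) * N ≤ t)).card : ℤ) ≤ ⌊t / N⌋ + 1 := by omega
    have h5 : (((Ioo (-(R : ℤ)) R).filter (fun r : ℤ => 0 ≤ r ∧ (r : ℝ) * N ≤ t)).card : ℝ) ≤ (⌊t / N⌋ + 1 : ℤ) := by
      exact_mod_cast h4
    refine h5.trans ?_
    push_cast
    linarith [Int.floor_le (t / N)]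

lemma sum_box_le (κ : ℤ × ℤ → ℝ) (hsymm : ∀ r, κ (-r) = κ r) (R₁ R₂ : ℕ)
    {A a B b M N L Z : ℝ} (hA : 0 ≤ A) (ha : 0 ≤ a) (hB : 0 ≤ B) (hb : 0 ≤ b) (hM : 0 < M) (hN : 0 < N)
    (hZ : κ 0 ≤ Z) (hZ0 : 0 ≤ Z) (hL₁ : ∑ d ∈ Icc 1 R₁, 1 / (d : ℝ) ≤ L)
    (hL₂ : ∑ d ∈ Icc 1 R₂, 1 / (d : ℝ) ≤ L)
    (h1 : ∀ r₁ r₂ : ℤ, 1 ≤ r₁ → r₁ < R₁ → |r₂| < R₂ → -(r₂ : ℝ) * (2048 * M) ≤ r₁ * N →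
      κ (r₁, r₂) ≤ A * (2 + a / r₁))
    (h2 : ∀ r₁ s : ℤ, 0 ≤ r₁ → r₁ < R₁ → 1 ≤ s → s < R₂ → (r₁ : ℝ) * N ≤ s * (2048 * M) →
      κ (r₁, -s) ≤ B * (2 + b / s)) :
    ∑ r ∈ Ioo (-(R₁ : ℤ)) R₁ ×ˢ Ioo (-(R₂ : ℤ)) R₂, κ r ≤
      Z + 2 * (2 * R₂ * A * (2 * R₁ + a * L) + B * (2 * R₁ * R₂ + b * (L + 2048 * M / N * R₂))) := by
  set D := Ioo (-(R₁ : ℤ)) R₁ ×ˢ Ioo (-(R₂ : ℤ)) R₂ with hD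
  set F₁ : ℤ → ℝ := fun r => if 1 ≤ r then A * (2 + a / r) else 0 with hF₁
  set F₂ : ℤ → ℤ → ℝ := fun s r => if 0 ≤ r ∧ (r : ℝ) * N ≤ s * (2048 * M) then B * (2 + b / s) else 0
    with hF₂
  set F₃ : ℤ → ℤ → ℝ := fun s r => if 1 ≤ s then F₂ s r else 0 with hF₃
  have hF₁0 : ∀ r, 0 ≤ F₁ r := by
    intro r; simp only [hF₁]; split_ifs with h
    · have : (0 : ℝ) < r := by exact_mod_cast h
      positivity
    · exact le_rfl
  have hF₃0 : ∀ s r, 0 ≤ F₃ s r := by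
    intro s r; simp only [hF₃, hF₂]; split_ifs with h h'
    · have : (0 : ℝ) < s := by exact_mod_cast h
      positivity
    · exact le_rfl
    · exact le_rfl
  set G : ℤ × ℤ → ℝ := fun r => F₁ r.1 + F₃ (-r.2) r.1 with hG
  have hG0 : ∀ r, 0 ≤ G r := fun r => add_nonneg (hF₁0 _) (hF₃0 _ _)
  have hhalf : ∀ r ∈ D, (1 ≤ r.1 ∨ (r.1 = 0 ∧ r.2 < 0)) → κ r ≤ G r := by
    rintro ⟨r₁, r₂⟩ hr hr'
    simp only [hD, mem_product, mem_Ioo] at hr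
    by_cases hc : 1 ≤ r₁ ∧ -(r₂ : ℝ) * (2048 * M) ≤ r₁ * N
    · have := h1 r₁ r₂ hc.1 hr.1.2 (abs_lt.2 hr.2) hc.2
      have h3 := hF₃0 (-r₂) r₁
      simp only [hG, hF₁, if_pos hc.1]
      linarith
    · have hs : 1 ≤ -r₂ := by
        by_contra h0
        have hr2 : (0 : ℝ) ≤ r₂ := by exact_mod_cast (by omega : 0 ≤ r₂)
        rcases hr' with h | h
        · refine hc ⟨h, ?_⟩
          have : (1 : ℝ) ≤ r₁ := by exact_mod_cast h
          calc -(r₂ : ℝ) * (2048 * M) ≤ 0 := by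
                rw [neg_mul]; exact neg_nonpos.2 (by positivity)
            _ ≤ _ := by positivity
        · simp only at h; omega
      have h0 : 0 ≤ r₁ := by rcases hr' with h | h <;> simp only at h <;> omega
      have hle : (r₁ : ℝ) * N ≤ (-r₂ : ℤ) * (2048 * M) := by
        push_cast
        rcases hr' with h | h
        · by_contra h4
          exact hc ⟨h, by linarith⟩
        · simp only at h
          rw [h.1]
          have : (1 : ℝ) ≤ -r₂ := by exact_mod_cast hs
          simp only [Int.cast_zero, zero_mul]
          positivity
      have := h2 r₁ (-r₂) h0 hr.1.2 hs (by omega) hle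
      rw [neg_neg] at this
      have h3 := hF₁0 r₁
      simp only [hG, hF₃, hF₂, if_pos hs, if_pos (And.intro h0 hle)]
      linarith
  have hneg : ∀ r, r ∈ D → -r ∈ D := by
    rintro ⟨r₁, r₂⟩ hr
    simp only [hD, mem_product, mem_Ioo, Prod.neg_mk] at hr ⊢
    omega
  have hall : ∀ r ∈ D, κ r ≤ (if r = 0 then Z else 0) + (G r + G (-r)) := by
    rintro ⟨r₁, r₂⟩ hr
    have g1 := hG0 (r₁, r₂)
    have g2 := hG0 (-(r₁, r₂))
    by_cases h0 : ((r₁, r₂) : ℤ × ℤ) = 0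
    · rw [if_pos h0]; rw [h0] at g1 g2 ⊢; linarith
    · rw [if_neg h0]
      by_cases hp : 1 ≤ r₁ ∨ (r₁ = 0 ∧ r₂ < 0)
      · have := hhalf _ hr hp; linarith
      · have := hhalf _ (hneg _ hr) (by
          simp only [Prod.neg_mk]
          rw [Prod.mk_eq_zero] at h0
          omega)
        rw [hsymm] at this; linarith
  have hsumneg : ∑ r ∈ D, G (-r) = ∑ r ∈ D, G r :=
    sum_bij' (fun r _ => -r) (fun r _ => -r) hneg hneg (fun r _ => neg_neg r) (fun r _ => neg_neg r)
      (fun r _ => rfl)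
  have hsum0 : ∑ r ∈ D, (if r = 0 then Z else 0) ≤ Z := by
    rw [sum_ite_eq']; split_ifs <;> linarith
  have hsum1 : ∑ r ∈ D, F₁ r.1 ≤ 2 * R₂ * A * (2 * R₁ + a * L) := by
    rw [hD, sum_product]
    simp only [sum_const, nsmul_eq_mul]
    rw [← mul_sum]
    have e1 : ∑ i ∈ Ioo (-(R₁ : ℤ)) R₁, F₁ i ≤ A * (2 * R₁ + a * L) := by
      refine (sum_Ioo_le_sum_Icc R₁ F₁ hF₁0 fun i hi => by simp only [hF₁]; rw [if_neg (by omega)]).trans ?_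
      have : ∀ d ∈ Icc 1 R₁, F₁ d = A * 2 + A * a * (1 / (d : ℝ)) := by
        intro d hd
        simp only [hF₁]
        rw [if_pos (by exact_mod_cast (mem_Icc.1 hd).1)]
        push_cast; ring
      rw [sum_congr rfl this, sum_add_distrib, ← mul_sum (Icc 1 R₁) _ (A * a), sum_const, Nat.card_Icc, nsmul_eq_mul]
      have := mul_le_mul_of_nonneg_left hL₁ (mul_nonneg hA ha)
      push_cast
      linarith
    calc _ ≤ 2 * R₂ * (A * (2 * R₁ + a * L)) := by
          gcongr
          · exact sum_nonneg fun i _ => hF₁0 i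
          · exact card_Ioo_neg_le R₂
      _ = _ := by ring
  have hsum2 : ∑ r ∈ D, F₃ (-r.2) r.1 ≤ B * (2 * R₁ * R₂ + b * (L + 2048 * M / N * R₂)) := by
    rw [hD, sum_product_right]
    have e0 : ∑ y ∈ Ioo (-(R₂ : ℤ)) R₂, ∑ x ∈ Ioo (-(R₁ : ℤ)) R₁, F₃ (-y) x =
        ∑ y ∈ Ioo (-(R₂ : ℤ)) R₂, ∑ x ∈ Ioo (-(R₁ : ℤ)) R₁, F₃ y x :=
      sum_bij' (fun r _ => -r) (fun r _ => -r) (fun r hr => by rw [mem_Ioo] at hr ⊢; omega)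
        (fun r hr => by rw [mem_Ioo] at hr ⊢; omega) (fun r _ => neg_neg r) (fun r _ => neg_neg r)
        (fun r _ => rfl)
    rw [e0]
    refine (sum_Ioo_le_sum_Icc R₂ (fun s => ∑ x ∈ Ioo (-(R₁ : ℤ)) R₁, F₃ s x)
      (fun s => sum_nonneg fun r _ => hF₃0 s r) fun i hi => by
        refine sum_eq_zero fun r _ => if_neg (by omega)).trans ?_
    have e1 : ∀ d ∈ Icc 1 R₂, ∑ x ∈ Ioo (-(R₁ : ℤ)) R₁, F₃ d x ≤
        B * (2 * R₁) + B * b * (1 / (d : ℝ) + 2048 * M / N) := by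
      intro d hd
      have hd1 := (mem_Icc.1 hd).1
      have hd0 : (0 : ℝ) < d := by exact_mod_cast hd1
      simp only [hF₃, hF₂]
      have hd2 : (1 : ℤ) ≤ d := by exact_mod_cast hd1
      simp only [if_pos hd2]
      rw [← sum_filter, sum_const, nsmul_eq_mul, Int.cast_natCast]
      have := card_filter_mul_le (R := R₁) hN (t := (d : ℝ) * (2048 * M)) (by positivity)
      set k : ℝ := (((Ioo (-(R₁ : ℤ)) R₁).filter
        (fun r : ℤ => 0 ≤ r ∧ (r : ℝ) * N ≤ (d : ℝ) * (2048 * M))).card : ℝ) with hk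
      have hk1 : k ≤ R₁ := this.trans (min_le_left _ _)
      have hk2 : k ≤ 1 + (d : ℝ) * (2048 * M) / N := this.trans (min_le_right _ _)
      calc k * (B * (2 + b / d)) = B * (2 * k) + B * b / d * k := by ring
        _ ≤ B * (2 * R₁) + B * b / d * (1 + (d : ℝ) * (2048 * M) / N) := by gcongr
        _ = B * (2 * R₁) + B * b * (1 / (d : ℝ) + 2048 * M / N) := by field_simp
    refine (sum_le_sum e1).trans ?_
    rw [sum_add_distrib, ← mul_sum (Icc 1 R₂) _ (B * b), sum_add_distrib]
    simp only [sum_const, Nat.card_Icc, nsmul_eq_mul, add_tsub_cancel_right]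
    have := mul_le_mul_of_nonneg_left hL₂ (mul_nonneg hB hb)
    linarith
  calc ∑ r ∈ D, κ r ≤ ∑ r ∈ D, ((if r = 0 then Z else 0) + (G r + G (-r))) := sum_le_sum hall
    _ = ∑ r ∈ D, (if r = 0 then Z else 0) + 2 * (∑ r ∈ D, F₁ r.1 + ∑ r ∈ D, F₃ (-r.2) r.1) := by
      rw [sum_add_distrib, sum_add_distrib, hsumneg, ← sum_add_distrib (f := fun r : ℤ × ℤ => F₁ r.1)]
      ring
    _ ≤ _ := by linarith

lemma norm_sq_sum_shift_le {γ : ℝ} (hγ0 : 0 < γ) (hγ1 : γ < 1) (S : Finset (ℤ × ℤ))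
    (hS : SectionsOrdConnected S) {M N q h L : ℝ} (c : ℝ) (hM : 1 ≤ M) (hN : 1 ≤ N) (hq : 1 ≤ q)
    (hh : 0 < h) (hSM : ∀ y ∈ S, M ≤ y.1 ∧ (y.1 : ℝ) ≤ 2 * M)
    (hSN : ∀ y ∈ S, N / 16 ≤ y.2 ∧ y.2 + q ≤ N) (R₁ R₂ : ℕ) (hR₁ : 1 ≤ R₁) (hR₂ : 1 ≤ R₂)
    (hR₁M : (R₁ : ℝ) ≤ M) (hR₂N : (R₂ : ℝ) ≤ N)
    (hL₁ : ∑ d ∈ Icc 1 R₁, 1 / (d : ℝ) ≤ L) (hL₂ : ∑ d ∈ Icc 1 R₂, 1 / (d : ℝ) ≤ L)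
    (hA : h * q * (M * N) ^ (γ - 1) * (16 * R₁ / M + 256 * R₂ / N) ≤ 1 / 2)
    (hB : h * q * (M * N) ^ γ * (2 ^ 21 * R₂) ≤ N ^ 3) :
    R₁ * R₂ * ‖∑ y ∈ S, e (h * (y.1 : ℝ) ^ γ * dd γ q y.2 + c * y.1)‖ ^ 2 ≤
      12 * (M * N) * (12 * (M * N) + 2 * (2 * R₂ * (2 * N) *
        (2 * R₁ + 8 / (γ ^ 2 * (1 - γ)) * (M * (M * N) ^ (1 - γ) / (h * q)) * L) + 4 * M * (2 * R₁ * R₂ +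
        8 / (γ ^ 2 * (1 - γ)) * (N ^ 3 / (h * q * (M * N) ^ γ)) * (L + 2048 * M / N * R₂)))) := by
  have hM0 : 0 < M := by linarith
  have hN0 : 0 < N := by linarith
  have hq0 : 0 < q := by linarith
  have h1γ : 0 < 1 - γ := by linarith
  have hMN0 : 0 < (M * N) ^ (γ - 1) := by positivity
  have hMN1 : 0 < (M * N) ^ γ := by positivity
  have hR₁' : (1 : ℝ) ≤ R₁ := by exact_mod_cast hR₁
  have hR₂' : (1 : ℝ) ≤ R₂ := by exact_mod_cast hR₂
  set f : ℤ × ℤ → ℝ := fun y => h * (y.1 : ℝ) ^ γ * dd γ q y.2 + c * y.1 with hf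
  set B : Finset (ℤ × ℤ) := Ico 0 (R₁ : ℤ) ×ˢ Ico 0 (R₂ : ℤ) with hBdef
  set D := Ioo (-(R₁ : ℤ)) R₁ ×ˢ Ioo (-(R₂ : ℤ)) R₂ with hD
  set T : Finset (ℤ × ℤ) := Icc (⌊M⌋ - R₁) ⌊2 * M⌋ ×ˢ Icc (-(R₂ : ℤ)) ⌊N⌋ with hT
  have hBcard : (B.card : ℝ) = R₁ * R₂ := by
    rw [hBdef, card_product, Int.card_Ico, Int.card_Ico]; simp
  have hST : ∀ y ∈ S, ∀ b ∈ B, y - b ∈ T := by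
    rintro ⟨m, n⟩ hy ⟨b₁, b₂⟩ hb
    obtain ⟨h1, h2⟩ := hSM _ hy
    obtain ⟨h3, h4⟩ := hSN _ hy
    simp only [hBdef, mem_product, mem_Ico] at hb
    simp only [hT, Prod.mk_sub_mk, mem_product, mem_Icc]
    have e1 : ⌊M⌋ ≤ m := by
      rw [← Int.floor_intCast (R := ℝ) m]; exact Int.floor_le_floor h1
    have e2 : m ≤ ⌊2 * M⌋ := Int.le_floor.2 h2
    have e3 : 0 ≤ n := by
      have : (0 : ℝ) ≤ n := le_trans (by positivity) h3
      exact_mod_cast this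
    have e4 : n ≤ ⌊N⌋ := Int.le_floor.2 (by linarith)
    omega
  have hTcard : (T.card : ℝ) ≤ 12 * (M * N) := by
    rw [hT, card_product, Int.card_Icc, Int.card_Icc]
    have h1 : ((⌊2 * M⌋ + 1 - (⌊M⌋ - R₁)).toNat : ℝ) ≤ 4 * M := by
      have e1 : ⌊M⌋ ≤ ⌊2 * M⌋ := Int.floor_le_floor (by linarith)
      have e2 : (((⌊2 * M⌋ + 1 - (⌊M⌋ - R₁)).toNat : ℤ) : ℝ) = ((⌊2 * M⌋ + 1 - (⌊M⌋ - R₁) : ℤ) : ℝ) := by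
        congr 1; omega
      rw [Int.cast_natCast] at e2
      rw [e2]
      push_cast
      linarith [Int.floor_le (2 * M), Int.sub_one_lt_floor M]
    have h2 : ((⌊N⌋ + 1 - -(R₂ : ℤ)).toNat : ℝ) ≤ 3 * N := by
      have e1 : 0 ≤ ⌊N⌋ := Int.floor_nonneg.2 hN0.le
      have e2 : (((⌊N⌋ + 1 - -(R₂ : ℤ)).toNat : ℤ) : ℝ) = ((⌊N⌋ + 1 - -(R₂ : ℤ) : ℤ) : ℝ) := by
        congr 1; omega
      rw [Int.cast_natCast] at e2
      rw [e2]
      push_cast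
      linarith [Int.floor_le N]
    push_cast
    calc _ ≤ 4 * M * (3 * N) := by gcongr
      _ = _ := by ring
  have hw := weyl_van_der_corput {()} (fun _ => S) (fun _ => f) B T (fun _ _ => hST)
  simp only [sum_singleton] at hw
  have hbox : ∑ r ∈ D, ‖corr S f r‖ ≤ _ :=
    sum_box_le (fun r => ‖corr S f r‖) (fun r => by rw [corr_neg]; exact RCLike.norm_conj _)
      R₁ R₂ (A := 2 * N) (a := 8 / (γ ^ 2 * (1 - γ)) * (M * (M * N) ^ (1 - γ) / (h * q))) (B := 4 * M)
      (b := 8 / (γ ^ 2 * (1 - γ)) * (N ^ 3 / (h * q * (M * N) ^ γ))) (M := M) (N := N) (L := L)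
      (Z := 12 * (M * N)) (by positivity) (by positivity) (by positivity) (by positivity) hM0 hN0
      (by
        refine (norm_sum_e_le_card _ _).trans (le_trans ?_ hTcard)
        have : S ⊆ T := by
          intro y hy
          have := hST y hy 0 (by rw [hBdef, mem_product, mem_Ico, mem_Ico]; simp; omega)
          rwa [sub_zero] at this
        exact_mod_cast card_le_card ((filter_subset _ _).trans this))
      (by positivity) hL₁ hL₂
      (fun r₁ r₂ hr1 hr2 hr3 hr4 => norm_corr_le_first hγ0 hγ1 S hS c hM hN hq hh hSM hSN r₁ r₂ hr1 hr4 (by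
        refine le_trans ?_ hA
        have e1 : (r₁ : ℝ) ≤ R₁ := by exact_mod_cast hr2.le
        have e2 : |(r₂ : ℝ)| ≤ R₂ := by exact_mod_cast hr3.le
        gcongr))
      (fun r₁ s hr1 hr2 hs1 hs2 hr => norm_corr_le_second hγ0 hγ1 S hS c hM hN hq hh hSM hSN r₁ s hr1 hs1 hr (by
        refine le_trans ?_ hB
        have e1 : (s : ℝ) ≤ R₂ := by exact_mod_cast hs2.le
        gcongr))
  have hss := sum_sum_sub_le B D (fun r => ‖corr S f r‖) (fun r _ => norm_nonneg _) (by
    rintro ⟨b₁, b₂⟩ hb ⟨b₁', b₂'⟩ hb'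
    simp only [hBdef, mem_product, mem_Ico] at hb hb'
    simp only [hD, Prod.mk_sub_mk, mem_product, mem_Ioo]
    omega)
  rw [hBcard] at hw hss
  have hRR : 0 < (R₁ : ℝ) * R₂ := by positivity
  refine le_of_mul_le_mul_left ?_ hRR
  calc (R₁ : ℝ) * R₂ * (R₁ * R₂ * ‖∑ y ∈ S, e (f y)‖ ^ 2) = (R₁ * R₂ * ‖∑ y ∈ S, e (f y)‖) ^ 2 := by ring
    _ ≤ _ := hw
    _ ≤ 12 * (M * N) * (R₁ * R₂ * ∑ r ∈ D, ‖corr S f r‖) := by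
        gcongr
    _ = R₁ * R₂ * (12 * (M * N) * ∑ r ∈ D, ‖corr S f r‖) := by ring
    _ ≤ _ := by gcongr

lemma sum_inv_le_one_add_log {R : ℕ} {X : ℝ} (hX : 1 ≤ X) (hR : (R : ℝ) ≤ X) :
    ∑ d ∈ Icc 1 R, 1 / (d : ℝ) ≤ 1 + Real.log X := by
  rcases Nat.eq_zero_or_pos R with rfl | h0
  · have := Real.log_nonneg hX
    simp; linarith
  · have := Real.log_le_log (by exact_mod_cast h0) hR
    linarith [sum_inv_le_log R]

set_option maxHeartbeats 1000000 in
lemma norm_sq_sum_shift_le_rpow {γ η ε σ v : ℝ} (hη0 : 0 < η) (hγ : γ = 1 - η)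
    (hε : 0 < ε) (hσ : η ≤ 2 * σ) (h8 : 8 * σ + 30 * ε ≤ 1) (h4 : 4 * σ + 30 * ε ≤ v)
    (hv : 1 + η ≤ 2 * v + 2 * σ) :
    ∀ᶠ X : ℕ in atTop, ∀ (S : Finset (ℤ × ℤ)) (M N h c : ℝ) (q Q : ℕ), SectionsOrdConnected S →
      M * N = X → (X : ℝ) ^ v ≤ M → (X : ℝ) ^ v ≤ N → 1 ≤ h → h ≤ (X : ℝ) ^ (η + 2 * ε) →
      1 ≤ q → q ≤ Q → (X : ℝ) ^ (2 * σ) ≤ Q → (Q : ℝ) ≤ (X : ℝ) ^ (2 * σ + ε) →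
      (∀ y ∈ S, M ≤ y.1 ∧ (y.1 : ℝ) ≤ 2 * M) → (∀ y ∈ S, N / 16 ≤ y.2 ∧ (y.2 : ℝ) + q ≤ N) →
      ‖∑ y ∈ S, e (h * (y.1 : ℝ) ^ γ * dd γ q y.2 + c * y.1)‖ ^ 2 ≤
        (X : ℝ) ^ (2 + 4 * ε - 4 * σ) + (X : ℝ) ^ (2 + 4 * ε - 2 * σ) / q := by
  have hγ0 : 0 < γ := by linarith
  have hγ1 : γ < 1 := by linarith
  set C := 8 / (γ ^ 2 * (1 - γ)) with hC
  have h1γ : 0 < 1 - γ := by linarith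
  have hC0 : 0 < C := by positivity
  filter_upwards [eventually_ge_atTop 1, eventually_log_pow_le 1 1 hε, eventually_const_le (2 ^ 30) hε,
    eventually_const_le (12 * (12 + 32)) hε, eventually_const_le (12 * (8 * 128 * C * 2049 + 8 * C)) hε]
    with X hX1 hlog hc1 hc2 hc3
  intro S M N h c q Q hS hMN hXM hXN hh1 hhX hq1 hqQ hQ1 hQ2 hSM hSN
  have hX : (1 : ℝ) ≤ X := by exact_mod_cast hX1
  have hX0 : (0 : ℝ) < X := by linarith
  rw [pow_one, one_mul] at hlog
  have hXp : ∀ p : ℝ, 0 < (X : ℝ) ^ p := fun p => Real.rpow_pos_of_pos hX0 p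
  have hX1' : (X : ℝ) ≤ (X : ℝ) ^ (1 : ℝ) := (Real.rpow_one _).ge
  have hX1'' : (X : ℝ) ^ (1 : ℝ) ≤ X := (Real.rpow_one _).le
  have hσ0 : 0 < σ := by linarith
  have hM0 : 0 < M := (hXp _).trans_le hXM
  have hN0 : 0 < N := (hXp _).trans_le hXN
  have hq' : (1 : ℝ) ≤ q := by exact_mod_cast hq1
  have hqQ' : (q : ℝ) ≤ Q := by exact_mod_cast hqQ
  have hh0 : 0 < h := by linarith
  have hQ0 : (0 : ℝ) < Q := by linarith
  have hone : ∀ p : ℝ, 0 ≤ p → (1 : ℝ) ≤ (X : ℝ) ^ p := fun p hp => Real.one_le_rpow hX hp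
  have hM1 : 1 ≤ M := (hone v (by linarith)).trans hXM
  have hN1 : 1 ≤ N := (hone v (by linarith)).trans hXN
  have hNX : N ≤ (X : ℝ) ^ (1 - v) := by
    have : N = X / M := by rw [← hMN]; field_simp
    rw [this]; exact div_le_rpow hX hX1' hXM le_rfl
  have hMX : M ≤ (X : ℝ) ^ (1 - v) := by
    have : M = X / N := by rw [← hMN]; field_simp
    rw [this]; exact div_le_rpow hX hX1' hXN le_rfl
  have hXη : 1 ≤ (X : ℝ) ^ η := hone η hη0.le
  set R : ℝ := M * (X : ℝ) ^ η / (64 * h * Q) with hR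
  have hR0 : 0 < R := by positivity
  have hR2 : 2 ≤ R := by
    rw [hR, le_div_iff₀ (by positivity)]
    calc 2 * (64 * h * Q) = 128 * (h * Q) := by ring
      _ ≤ (X : ℝ) ^ (ε + (η + 2 * ε + (2 * σ + ε))) := by
          refine mul_le_rpow hX (by positivity) (by linarith) (mul_le_rpow hX hQ0.le hhX hQ2 le_rfl) le_rfl
      _ ≤ (X : ℝ) ^ v * (X : ℝ) ^ η := by
          rw [← Real.rpow_add hX0]; exact Real.rpow_le_rpow_of_exponent_le hX (by linarith)
      _ ≤ _ := by gcongr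
  set R₁ : ℕ := ⌊R⌋₊ with hR₁
  have hR₁le : (R₁ : ℝ) ≤ R := Nat.floor_le hR0.le
  have hR₁ge : R / 2 ≤ R₁ := by linarith [Nat.lt_floor_add_one R]
  have hR₁0 : (0 : ℝ) < R₁ := by linarith
  set R₂ : ℕ := ⌈(Q : ℝ) ^ 2 / R₁⌉₊ with hR₂
  have hR₂ge : (Q : ℝ) ^ 2 / R₁ ≤ R₂ := Nat.le_ceil _
  have hR₂0 : (0 : ℝ) < R₂ := lt_of_lt_of_le (by positivity) hR₂ge
  have hRR : (Q : ℝ) ^ 2 ≤ R₁ * R₂ := by rw [div_le_iff₀ hR₁0] at hR₂ge; linarith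
  set G : ℝ := 128 * h * Q ^ 3 / (M * (X : ℝ) ^ η) with hG
  have hG0 : 0 < G := by positivity
  have hR₂le : (R₂ : ℝ) ≤ G + 1 := by
    have h1 : (R₂ : ℝ) < (Q : ℝ) ^ 2 / R₁ + 1 := Nat.ceil_lt_add_one (by positivity)
    have h2 : (Q : ℝ) ^ 2 / R₁ ≤ Q ^ 2 / (R / 2) := by gcongr
    have h3 : (Q : ℝ) ^ 2 / (R / 2) = G := by rw [hG, hR]; field_simp; norm_num
    linarith
  have hRinv : 1 / (R₁ : ℝ) ≤ 128 * h * Q / (M * (X : ℝ) ^ η) := by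
    have h3 : 1 / (R / 2) = 128 * h * Q / (M * (X : ℝ) ^ η) := by rw [hR]; field_simp; norm_num
    rw [← h3]; gcongr
  have hhQ : h * Q ≤ (X : ℝ) ^ (η + 2 * σ + 3 * ε) := mul_le_rpow hX hQ0.le hhX hQ2 (by linarith)
  have hGX : G ≤ (X : ℝ) ^ (6 * σ + 6 * ε - v) := by
    have h1 : h * Q * Q ^ 2 ≤ (X : ℝ) ^ (η + 6 * σ + 5 * ε) :=
      mul_le_rpow hX (by positivity) hhQ (pow_le_rpow 2 hX hQ0.le hQ2 (s := 4 * σ + 2 * ε) (by push_cast; linarith))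
        (by linarith)
    have h2 : 128 * (h * Q * Q ^ 2) ≤ (X : ℝ) ^ (η + 6 * σ + 6 * ε) :=
      mul_le_rpow hX (by positivity) (show (128 : ℝ) ≤ (X : ℝ) ^ ε by linarith) h1 (by linarith)
    rw [hG, show 128 * h * (Q : ℝ) ^ 3 = 128 * (h * Q * Q ^ 2) by ring]
    refine div_le_rpow hX h2 (b := v + η) ?_ (by linarith)
    rw [Real.rpow_add hX0]; gcongr
  have hsmall : ∀ p : ℝ, p ≤ -ε → (X : ℝ) ^ p ≤ 1 / 2 ^ 30 := by
    intro p hp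
    calc (X : ℝ) ^ p ≤ (X : ℝ) ^ (-ε) := Real.rpow_le_rpow_of_exponent_le hX hp
      _ = 1 / (X : ℝ) ^ ε := by rw [Real.rpow_neg hX0.le, one_div]
      _ ≤ _ := by gcongr
  have hXε2 : (2 : ℝ) ^ 30 ≤ (X : ℝ) ^ v := hc1.trans (Real.rpow_le_rpow_of_exponent_le hX (by linarith))
  have hR₁M : (R₁ : ℝ) ≤ M := by
    refine hR₁le.trans ?_
    rw [hR, div_le_iff₀ (by positivity)]
    have h1 : (X : ℝ) ^ η ≤ Q := (Real.rpow_le_rpow_of_exponent_le hX hσ).trans hQ1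
    have h2 : (Q : ℝ) ≤ 64 * h * Q := le_mul_of_one_le_left hQ0.le (by linarith)
    exact mul_le_mul_of_nonneg_left (h1.trans h2) hM0.le
  have hR₂N : (R₂ : ℝ) ≤ N := by
    have h1 : G / N ≤ 1 / 2 ^ 30 :=
      (div_le_rpow hX hGX hXN le_rfl).trans (hsmall _ (by linarith))
    rw [div_le_iff₀ hN0] at h1
    linarith
  have hRX : ∀ R' : ℕ, ((R' : ℝ) ≤ M ∨ (R' : ℝ) ≤ N) → (R' : ℝ) ≤ X := by
    rintro R' (h' | h')
    · exact h'.trans (by rw [← hMN]; exact le_mul_of_one_le_right hM0.le hN1)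
    · exact h'.trans (by rw [← hMN]; exact le_mul_of_one_le_left hN0.le hM1)
  have hA : h * q * (M * N) ^ (γ - 1) * (16 * R₁ / M + 256 * R₂ / N) ≤ 1 / 2 := by
    rw [hMN, show γ - 1 = -η by linarith, Real.rpow_neg hX0.le]
    have h1 : h * Q * ((X : ℝ) ^ η)⁻¹ * (16 * R₁ / M) ≤ 1 / 4 := by
      calc _ ≤ h * Q * ((X : ℝ) ^ η)⁻¹ * (16 * R / M) := by gcongr
        _ = 1 / 4 := by rw [hR]; field_simp; norm_num
    have h2 : h * Q * ((X : ℝ) ^ η)⁻¹ * (256 * R₂ / N) ≤ 1 / 4 := by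
      have e1 : h * Q / (X : ℝ) ^ η ≤ (X : ℝ) ^ (2 * σ + 3 * ε) := div_le_rpow hX hhQ le_rfl (by linarith)
      have e2 : G / N ≤ (X : ℝ) ^ (6 * σ + 6 * ε - 2 * v) := div_le_rpow hX hGX hXN (by linarith)
      have e3 : 1 / N ≤ (X : ℝ) ^ (-v) := div_le_rpow hX (Real.rpow_zero (X : ℝ)).ge hXN (by linarith)
      have e4 : h * Q / (X : ℝ) ^ η * (G / N) ≤ 1 / 2 ^ 30 :=
        (mul_le_rpow hX (by positivity) e1 e2 le_rfl).trans (hsmall _ (by linarith))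
      have e5 : h * Q / (X : ℝ) ^ η * (1 / N) ≤ 1 / 2 ^ 30 :=
        (mul_le_rpow hX (by positivity) e1 e3 le_rfl).trans (hsmall _ (by linarith))
      calc _ ≤ h * Q * ((X : ℝ) ^ η)⁻¹ * (256 * (G + 1) / N) := by gcongr
        _ = 256 * (h * Q / (X : ℝ) ^ η * (G / N) + h * Q / (X : ℝ) ^ η * (1 / N)) := by
            field_simp
        _ ≤ 256 * (1 / 2 ^ 30 + 1 / 2 ^ 30) := by gcongr
        _ ≤ _ := by norm_num
    calc _ ≤ h * Q * ((X : ℝ) ^ η)⁻¹ * (16 * R₁ / M + 256 * R₂ / N) := by gcongr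
      _ = h * Q * ((X : ℝ) ^ η)⁻¹ * (16 * R₁ / M) + h * Q * ((X : ℝ) ^ η)⁻¹ * (256 * R₂ / N) := by ring
      _ ≤ _ := by linarith
  have hB : h * q * (M * N) ^ γ * (2 ^ 21 * R₂) ≤ N ^ 3 := by
    rw [hMN]
    have e0 : h * Q * (X : ℝ) ^ γ ≤ (X : ℝ) ^ (1 + 2 * σ + 3 * ε) :=
      mul_le_rpow hX (hXp _).le hhQ le_rfl (by linarith)
    have e1 : h * Q * (X : ℝ) ^ γ * G ≤ (X : ℝ) ^ (1 + 8 * σ + 9 * ε - v) :=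
      mul_le_rpow hX hG0.le e0 hGX (by linarith)
    have eN : ∀ k : ℕ, (X : ℝ) ^ (k * v) ≤ N ^ k := by
      intro k
      calc (X : ℝ) ^ (k * v) = ((X : ℝ) ^ v) ^ k := by
            rw [← Real.rpow_natCast, ← Real.rpow_mul hX0.le]; congr 1; ring
        _ ≤ N ^ k := by gcongr
    have eN3 := eN 3
    have e2 : h * Q * (X : ℝ) ^ γ / N ^ 3 ≤ 1 / 2 ^ 30 :=
      (div_le_rpow hX e0 eN3 le_rfl).trans (hsmall _ (by push_cast; linarith))
    have e3 : h * Q * (X : ℝ) ^ γ * G / N ^ 3 ≤ 1 / 2 ^ 30 := by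
      have f1 : h * Q * (X : ℝ) ^ γ * G / N ^ 3 =
          h * Q * h * Q ^ 3 * 128 * (X : ℝ) ^ γ / ((M * N) * (X : ℝ) ^ η) / N ^ 2 := by
        rw [hG]; field_simp
      have f2 : h * Q * h * Q ^ 3 * 128 * (X : ℝ) ^ γ / ((M * N) * (X : ℝ) ^ η) =
          128 * ((h * Q) ^ 2 * Q ^ 2) * (X : ℝ) ^ γ / (X : ℝ) ^ (1 + η) := by
        rw [hMN, Real.rpow_add hX0, Real.rpow_one]; ring
      rw [f1, f2]
      refine (div_le_rpow hX (a := 8 * σ + 9 * ε) (div_le_rpow hX (mul_le_rpow hX (hXp _).le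
        (mul_le_rpow hX (by positivity) (show (128 : ℝ) ≤ (X : ℝ) ^ ε by linarith)
          (mul_le_rpow hX (by positivity) (pow_le_rpow 2 hX (by positivity) hhQ le_rfl)
            (pow_le_rpow 2 hX (by positivity) hQ2 le_rfl) le_rfl) le_rfl) le_rfl le_rfl) le_rfl ?_) (eN 2)
            le_rfl).trans (hsmall _ ?_) <;> push_cast <;> linarith
    have hN3 : 0 < N ^ 3 := by positivity
    rw [div_le_iff₀ hN3] at e2 e3
    calc _ ≤ h * Q * (X : ℝ) ^ γ * (2 ^ 21 * (G + 1)) := by gcongr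
      _ = 2 ^ 21 * (h * Q * (X : ℝ) ^ γ * G + h * Q * (X : ℝ) ^ γ) := by ring
      _ ≤ N ^ 3 := by linarith
  have hL₁ := sum_inv_le_one_add_log hX (hRX R₁ (Or.inl hR₁M))
  have hL₂ := sum_inv_le_one_add_log hX (hRX R₂ (Or.inr hR₂N))
  have hmain := norm_sq_sum_shift_le hγ0 hγ1 S hS c hM1 hN1 hq' hh0 hSM hSN R₁ R₂
    (by exact_mod_cast hR₁0) (by exact_mod_cast hR₂0) hR₁M hR₂N hL₁ hL₂ hA hB
  rw [hMN, ← hC] at hmain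
  set L := 1 + Real.log X with hL
  have hL1 : 1 ≤ L := by linarith [Real.log_nonneg hX]
  set W := ‖∑ y ∈ S, e (h * (y.1 : ℝ) ^ γ * dd γ q y.2 + c * y.1)‖ ^ 2 with hW
  have hXγη : (X : ℝ) = (X : ℝ) ^ γ * (X : ℝ) ^ (1 - γ) := by
    rw [← Real.rpow_add hX0, add_sub_cancel, Real.rpow_one]
  have hηγ : (1 - γ) = η := by linarith
  have hW1 : W ≤ 12 * X * (12 * (X / Q ^ 2) + 16 * (N + M) + 8 * 128 * C * 2049 * L * (N * Q / q) +
      8 * C * L * (M * N ^ 3 / ((X : ℝ) ^ γ * Q ^ 2) / q)) := by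
    have hdiv : W ≤ 12 * X * (12 * X * (1 / (R₁ * R₂)) + 16 * N + 8 * N * (C * (M * (X : ℝ) ^ (1 - γ) / (h * q))) *
        L * (1 / R₁) + 16 * M + 8 * M * (C * (N ^ 3 / (h * q * (X : ℝ) ^ γ))) * L * (1 / (R₁ * R₂)) +
        8 * 2048 * M ^ 2 / N * (C * (N ^ 3 / (h * q * (X : ℝ) ^ γ))) * (1 / R₁)) := by
      refine le_of_mul_le_mul_left (hmain.trans (le_of_eq ?_)) (mul_pos hR₁0 hR₂0)
      field_simp
      ring
    refine hdiv.trans (mul_le_mul_of_nonneg_left ?_ (by positivity))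
    have hXη1 : 0 < (X : ℝ) ^ (1 - γ) := hXp _
    have hXγ1 : 0 < (X : ℝ) ^ γ := hXp _
    rw [← hηγ] at hRinv
    have hRRinv : 1 / ((R₁ : ℝ) * R₂) ≤ 1 / (Q : ℝ) ^ 2 := by gcongr
    have j1 : 12 * (X : ℝ) * (1 / (R₁ * R₂)) ≤ 12 * (X / Q ^ 2) := by
      calc _ ≤ 12 * (X : ℝ) * (1 / Q ^ 2) := by gcongr
        _ = _ := by ring
    have j3 : 8 * N * (C * (M * (X : ℝ) ^ (1 - γ) / (h * q))) * L * (1 / R₁) ≤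
        8 * 128 * C * L * (N * Q / q) := by
      calc _ ≤ 8 * N * (C * (M * (X : ℝ) ^ (1 - γ) / (h * q))) * L * (128 * h * Q / (M * (X : ℝ) ^ (1 - γ))) := by
            gcongr
        _ = _ := by field_simp
    have j5 : 8 * M * (C * (N ^ 3 / (h * q * (X : ℝ) ^ γ))) * L * (1 / (R₁ * R₂)) ≤
        8 * C * L * (M * N ^ 3 / ((X : ℝ) ^ γ * Q ^ 2) / q) := by
      calc _ ≤ 8 * M * (C * (N ^ 3 / (1 * q * (X : ℝ) ^ γ))) * L * (1 / Q ^ 2) := by gcongr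
        _ = _ := by field_simp
    have j6 : 8 * 2048 * M ^ 2 / N * (C * (N ^ 3 / (h * q * (X : ℝ) ^ γ))) * (1 / R₁) ≤
        8 * 128 * C * 2048 * L * (N * Q / q) := by
      calc _ ≤ 8 * 2048 * M ^ 2 / N * (C * (N ^ 3 / (h * q * (X : ℝ) ^ γ))) *
            (128 * h * Q / (M * (X : ℝ) ^ (1 - γ))) := by gcongr
        _ = 8 * 128 * C * 2048 * 1 * (M * N * N * Q / (q * ((X : ℝ) ^ γ * (X : ℝ) ^ (1 - γ)))) := by
            field_simp
        _ = 8 * 128 * C * 2048 * 1 * (N * Q / q) := by rw [← hXγη, hMN]; field_simp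
        _ ≤ _ := by gcongr
    linarith
  have hq0 : (0 : ℝ) < q := by linarith
  have k1 : (X : ℝ) / Q ^ 2 ≤ (X : ℝ) ^ (1 - 4 * σ) := by
    refine div_le_rpow hX hX1' (b := 4 * σ) ?_ le_rfl
    calc (X : ℝ) ^ (4 * σ) = ((X : ℝ) ^ (2 * σ)) ^ 2 := by
          rw [← Real.rpow_natCast, ← Real.rpow_mul hX0.le]; congr 1; push_cast; ring
      _ ≤ _ := by gcongr
  have k2 : N + M ≤ 2 * (X : ℝ) ^ (1 - 4 * σ) := by
    have := Real.rpow_le_rpow_of_exponent_le hX (show 1 - v ≤ 1 - 4 * σ by linarith)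
    linarith
  have k3 : N * Q ≤ (X : ℝ) ^ (1 - 2 * σ) := mul_le_rpow hX hQ0.le hNX hQ2 (by linarith)
  have k4 : M * N ^ 3 / ((X : ℝ) ^ γ * Q ^ 2) ≤ (X : ℝ) ^ (1 - 2 * σ) := by
    rw [show M * N ^ 3 = M * N * N ^ 2 by ring, hMN]
    refine div_le_rpow hX (mul_le_rpow hX (by positivity) hX1' (pow_le_rpow 2 hX hN0.le hNX le_rfl) le_rfl)
      (b := γ + 4 * σ) ?_ (by push_cast; linarith)
    calc (X : ℝ) ^ (γ + 4 * σ) = (X : ℝ) ^ γ * ((X : ℝ) ^ (2 * σ)) ^ 2 := by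
          rw [Real.rpow_add hX0]
          congr 1
          rw [← Real.rpow_natCast, ← Real.rpow_mul hX0.le]; congr 1; push_cast; ring
      _ ≤ _ := by gcongr
  have hW2 : W ≤ 12 * (12 + 32) * (X * (X : ℝ) ^ (1 - 4 * σ)) +
      12 * (8 * 128 * C * 2049 + 8 * C) * (L * (X * (X : ℝ) ^ (1 - 2 * σ))) / q := by
    calc W ≤ 12 * X * (12 * (X : ℝ) ^ (1 - 4 * σ) + 16 * (2 * (X : ℝ) ^ (1 - 4 * σ)) +
          8 * 128 * C * 2049 * L * ((X : ℝ) ^ (1 - 2 * σ) / q) +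
          8 * C * L * ((X : ℝ) ^ (1 - 2 * σ) / q)) := hW1.trans (by gcongr)
      _ = _ := by ring
  refine hW2.trans (add_le_add ?_ ?_)
  · exact mul_le_rpow hX (by positivity) hc2 (mul_le_rpow hX (hXp _).le hX1' le_rfl le_rfl) (by linarith)
  · gcongr
    exact mul_le_rpow hX (by positivity) hc3 (mul_le_rpow hX (by positivity) hlog
      (mul_le_rpow hX (hXp _).le hX1' le_rfl le_rfl) le_rfl) (by linarith)

lemma sum_corr_sections {S : Finset (ℤ × ℤ)} (f : ℤ × ℤ → ℝ) (I : Finset ℤ) (hI : ∀ y ∈ S, y.1 ∈ I)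
    (r : ℤ) :
    ∑ i ∈ I, corr ((S.filter (fun y => y.1 = i)).image Prod.snd) (fun n => f (i, n)) r =
      corr S f (0, r) := by
  rw [corr, ← sum_fiberwise_of_maps_to (g := Prod.fst) (t := I)
    (fun y hy => hI y (mem_filter.1 hy).1)]
  refine sum_congr rfl fun i _ => ?_
  rw [corr]
  refine sum_bij' (fun n _ => (i, n)) (fun y _ => y.2) ?_ ?_ ?_ ?_ ?_
  · intro n hn
    simpa using hn
  · rintro ⟨m, n⟩ hy
    simp only [mem_filter, Prod.mk_add_mk, add_zero] at hy
    obtain ⟨⟨h1, h2⟩, rfl⟩ := hy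
    simpa using ⟨h1, h2⟩
  · intro n _; rfl
  · rintro ⟨m, n⟩ hy
    simp only [mem_filter] at hy
    simp [hy.2]
  · intro n _; simp

lemma sum_Ioo_neg_norm_corr {S : Finset (ℤ × ℤ)} (f : ℤ × ℤ → ℝ) (Q : ℕ) :
    ∑ r ∈ Ioo (-(Q : ℤ)) Q, ‖corr S f (0, r)‖ ≤
      S.card + 2 * ∑ q ∈ Ico 1 Q, ‖corr S f (0, (q : ℤ))‖ := by
  have hsplit : Ioo (-(Q : ℤ)) Q ⊆ {0} ∪ ((Ico 1 Q).image (fun q : ℕ => (q : ℤ)) ∪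
      (Ico 1 Q).image (fun q : ℕ => -(q : ℤ))) := by
    intro r hr
    rw [mem_Ioo] at hr
    simp only [mem_union, mem_singleton, mem_image, mem_Ico]
    rcases lt_trichotomy r 0 with h | h | h
    · exact Or.inr (Or.inr ⟨r.natAbs, by omega, by omega⟩)
    · exact Or.inl h
    · exact Or.inr (Or.inl ⟨r.natAbs, by omega, by omega⟩)
  have hneg : ∀ q : ℕ, ‖corr S f (0, -(q : ℤ))‖ = ‖corr S f (0, (q : ℤ))‖ := by
    intro q
    have := corr_neg S f (0, (q : ℤ))
    rw [Prod.neg_mk, neg_zero] at this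
    rw [this, RCLike.norm_conj]
  have h0 : ‖corr S f (0, 0)‖ ≤ S.card := by
    rw [corr]
    refine (norm_sum_e_le_card _ _).trans ?_
    exact_mod_cast card_filter_le _ _
  have nn : ∀ s : Finset ℤ, 0 ≤ ∑ r ∈ s, ‖corr S f (0, r)‖ := fun s => sum_nonneg fun _ _ => norm_nonneg _
  have hun : ∀ s t : Finset ℤ, ∑ r ∈ s ∪ t, ‖corr S f (0, r)‖ ≤
      ∑ r ∈ s, ‖corr S f (0, r)‖ + ∑ r ∈ t, ‖corr S f (0, r)‖ := by
    intro s t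
    rw [← sum_union_inter]
    linarith [nn (s ∩ t)]
  have hp : ∑ r ∈ (Ico 1 Q).image (fun q : ℕ => (q : ℤ)), ‖corr S f (0, r)‖ =
      ∑ q ∈ Ico 1 Q, ‖corr S f (0, (q : ℤ))‖ :=
    sum_image (fun x _ y _ h => by simpa using h)
  have hm : ∑ r ∈ (Ico 1 Q).image (fun q : ℕ => -(q : ℤ)), ‖corr S f (0, r)‖ =
      ∑ q ∈ Ico 1 Q, ‖corr S f (0, (q : ℤ))‖ := by
    rw [sum_image (fun x _ y _ h => by simpa using h)]
    exact sum_congr rfl fun q _ => hneg q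
  have h1 := sum_le_sum_of_subset_of_nonneg hsplit
    (f := fun r => ‖corr S f (0, r)‖) (fun _ _ _ => norm_nonneg _)
  have h2 := hun {0} ((Ico 1 Q).image (fun q : ℕ => (q : ℤ)) ∪ (Ico 1 Q).image (fun q : ℕ => -(q : ℤ)))
  have h3 := hun ((Ico 1 Q).image (fun q : ℕ => (q : ℤ))) ((Ico 1 Q).image (fun q : ℕ => -(q : ℤ)))
  rw [sum_singleton] at h2
  linarith

lemma sq_sum_norm_sections_le (S : Finset (ℤ × ℤ)) (I : Finset ℤ) (hI : ∀ y ∈ S, y.1 ∈ I) (f : ℤ × ℤ → ℝ)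
    {M N : ℝ} (hM : 1 ≤ M) (hN : 1 ≤ N) (Q : ℕ) (hQ : 1 ≤ Q) (hQN : (Q : ℝ) ≤ N)
    (hIM : ∀ i ∈ I, M ≤ i ∧ (i : ℝ) ≤ 2 * M) (hSN : ∀ y ∈ S, 0 ≤ y.2 ∧ (y.2 : ℝ) ≤ N) :
    Q * (∑ i ∈ I, ‖∑ n ∈ (S.filter (fun y => y.1 = i)).image Prod.snd, e (f (i, n))‖) ^ 2 ≤
      12 * (M * N) * (8 * (M * N) + 2 * ∑ q ∈ Ico 1 Q, ‖corr S f (0, (q : ℤ))‖) := by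
  set A : ℤ → Finset ℤ := fun i => (S.filter (fun y => y.1 = i)).image Prod.snd with hA
  have hQ0 : (0 : ℝ) < Q := by exact_mod_cast hQ
  have hIcard : (I.card : ℝ) ≤ 4 * M := by
    have := card_le_of_mem_Icc I (2 * M) (by linarith)
      (fun m hm => ⟨by have := (hIM m hm).1; exact_mod_cast (by linarith : (0 : ℝ) ≤ m), (hIM m hm).2⟩)
    linarith
  have hScard : (S.card : ℝ) ≤ 8 * (M * N) := by
    have h1 : S ⊆ I ×ˢ S.image Prod.snd := fun y hy =>
      mem_product.2 ⟨hI y hy, mem_image_of_mem _ hy⟩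
    have h2 : ((S.image Prod.snd).card : ℝ) ≤ 2 * N := by
      refine card_le_of_mem_Icc _ N hN fun n hn => ?_
      obtain ⟨y, hy, rfl⟩ := mem_image.1 hn
      exact ⟨by exact_mod_cast (hSN y hy).1, (hSN y hy).2⟩
    calc (S.card : ℝ) ≤ (I ×ˢ S.image Prod.snd).card := by exact_mod_cast card_le_card h1
      _ = I.card * (S.image Prod.snd).card := by rw [card_product]; push_cast; ring
      _ ≤ 4 * M * (2 * N) := by gcongr
      _ = _ := by ring
  set T : Finset ℤ := Icc (-(Q : ℤ)) ⌊N⌋ with hT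
  have hTcard : (T.card : ℝ) ≤ 3 * N := by
    rw [hT, Int.card_Icc]
    have h0 : 0 ≤ ⌊N⌋ := Int.floor_nonneg.2 (by linarith)
    have h1 : (((⌊N⌋ + 1 - -(Q : ℤ)).toNat : ℕ) : ℤ) = ⌊N⌋ + 1 + Q := by omega
    have h2 : (((⌊N⌋ + 1 - -(Q : ℤ)).toNat : ℕ) : ℝ) = ⌊N⌋ + 1 + Q := by exact_mod_cast h1
    rw [h2]
    linarith [Int.floor_le N]
  have hw := weyl_van_der_corput I A (fun i n => f (i, n)) (Ico 0 (Q : ℤ)) T (by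
    intro i _ n hn b hb
    obtain ⟨y, hy, rfl⟩ := mem_image.1 hn
    have hy' := hSN y (mem_filter.1 hy).1
    have h2 : y.2 ≤ ⌊N⌋ := Int.le_floor.2 hy'.2
    rw [mem_Ico] at hb
    rw [hT, mem_Icc]
    omega)
  have hcardB : ((Ico 0 (Q : ℤ)).card : ℝ) = Q := by simp
  simp only [hA, sum_corr_sections f I hI, hcardB] at hw
  have hd := sum_sum_sub_le (Ico 0 (Q : ℤ)) (Ioo (-(Q : ℤ)) Q) (fun r => ‖corr S f (0, r)‖)
    (fun _ _ => norm_nonneg _) (by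
      intro b hb b' hb'
      rw [mem_Ico] at hb hb'
      rw [mem_Ioo]
      omega)
  rw [hcardB] at hd
  have hs := sum_Ioo_neg_norm_corr (S := S) f Q
  have hcs := sq_sum_le_card_mul_sum_sq (s := I) (f := fun i => Q * ‖∑ n ∈ A i, e (f (i, n))‖)
  rw [← mul_sum] at hcs
  set Z := ∑ q ∈ Ico 1 Q, ‖corr S f (0, (q : ℤ))‖ with hZ
  have hZ0 : 0 ≤ Z := sum_nonneg fun _ _ => norm_nonneg _
  refine le_of_mul_le_mul_left ?_ hQ0
  calc Q * (Q * (∑ i ∈ I, ‖∑ n ∈ A i, e (f (i, n))‖) ^ 2)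
      = (Q * ∑ i ∈ I, ‖∑ n ∈ A i, e (f (i, n))‖) ^ 2 := by ring
    _ ≤ I.card * ∑ i ∈ I, (Q * ‖∑ n ∈ A i, e (f (i, n))‖) ^ 2 := hcs
    _ ≤ 4 * M * (3 * N * (Q * (8 * (M * N) + 2 * Z))) := by
        refine mul_le_mul hIcard (hw.trans ?_) (sum_nonneg fun _ _ => sq_nonneg _) (by positivity)
        refine mul_le_mul hTcard (hd.trans ?_)
          (sum_nonneg fun _ _ => sum_nonneg fun _ _ => norm_nonneg _) (by positivity)
        refine mul_le_mul_of_nonneg_left (hs.trans ?_) hQ0.le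
        linarith
    _ = _ := by ring

lemma sum_norm_sections_le_rpow {γ η ε σ v : ℝ} (hη0 : 0 < η) (hγ : γ = 1 - η)
    (hε : 0 < ε) (hσ : η ≤ 2 * σ) (h8 : 8 * σ + 30 * ε ≤ 1) (h4 : 4 * σ + 30 * ε ≤ v)
    (hv : 1 + η ≤ 2 * v + 2 * σ) :
    ∀ᶠ X : ℕ in atTop, ∀ (S : Finset (ℤ × ℤ)) (I : Finset ℤ) (M N h ξ : ℝ), SectionsOrdConnected S →
      (∀ y ∈ S, y.1 ∈ I) → M * N = X → (X : ℝ) ^ v ≤ M → (X : ℝ) ^ v ≤ N → 1 ≤ h →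
      h ≤ (X : ℝ) ^ (η + 2 * ε) →
      (∀ i ∈ I, M ≤ i ∧ (i : ℝ) ≤ 2 * M) → (∀ y ∈ S, N / 16 ≤ y.2 ∧ (y.2 : ℝ) ≤ N) →
      ∑ i ∈ I, ‖∑ n ∈ (S.filter (fun y => y.1 = i)).image Prod.snd,
        e (h * ((i : ℝ) * n) ^ γ + ξ * (i * n))‖ ≤ (X : ℝ) ^ (1 - σ + 4 * ε) := by
  filter_upwards [eventually_ge_atTop 1, eventually_log_pow_le 1 1 hε, eventually_const_le 120 hε,
    norm_sq_sum_shift_le_rpow hη0 hγ hε hσ h8 h4 hv] with X hX1 hlog hc2 hW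
  intro S I M N h ξ hS hI hMN hXM hXN hh1 hhX hIM hSN
  have hX : (1 : ℝ) ≤ X := by exact_mod_cast hX1
  have hX0 : (0 : ℝ) < X := by linarith
  rw [pow_one, one_mul] at hlog
  have hXp : ∀ p : ℝ, 0 < (X : ℝ) ^ p := fun p => Real.rpow_pos_of_pos hX0 p
  have hX1' : (X : ℝ) ≤ (X : ℝ) ^ (1 : ℝ) := (Real.rpow_one _).ge
  have hσ0 : 0 < σ := by linarith
  have hM1 : 1 ≤ M := (Real.one_le_rpow hX (by linarith)).trans hXM
  have hN1 : 1 ≤ N := (Real.one_le_rpow hX (by linarith)).trans hXN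
  have hγ0 : 0 < γ := by linarith
  set Q : ℕ := ⌈(X : ℝ) ^ (2 * σ)⌉₊ with hQdef
  have hQ1 : (X : ℝ) ^ (2 * σ) ≤ Q := Nat.le_ceil _
  have hone : (1 : ℝ) ≤ (X : ℝ) ^ (2 * σ) := Real.one_le_rpow hX (by linarith)
  have hQ2 : (Q : ℝ) ≤ (X : ℝ) ^ (2 * σ + ε) := by
    have h1 : (Q : ℝ) < (X : ℝ) ^ (2 * σ) + 1 := Nat.ceil_lt_add_one (hXp _).le
    calc (Q : ℝ) ≤ 2 * (X : ℝ) ^ (2 * σ) := by linarith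
      _ ≤ _ := mul_le_rpow hX (hXp _).le (show (2 : ℝ) ≤ (X : ℝ) ^ ε by linarith) le_rfl (by linarith)
  have hQ0 : (0 : ℝ) < Q := by linarith
  have hQ1' : 1 ≤ Q := by exact_mod_cast hone.trans hQ1
  have hQN : (Q : ℝ) ≤ N := hQ2.trans ((Real.rpow_le_rpow_of_exponent_le hX (by linarith)).trans hXN)
  have hQX : (Q : ℝ) ≤ X := by
    refine hQN.trans ?_
    rw [← hMN]; exact le_mul_of_one_le_left (by linarith) hM1
  have hS0 : ∀ y ∈ S, 0 ≤ y.2 := by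
    intro y hy
    have := (hSN y hy).1
    exact_mod_cast (show (0 : ℝ) ≤ y.2 by linarith)
  set f : ℤ × ℤ → ℝ := fun y => h * ((y.1 : ℝ) * y.2) ^ γ + ξ * (y.1 * y.2) with hf
  have hmain := sq_sum_norm_sections_le S I hI f hM1 hN1 Q hQ1' hQN hIM
    (fun y hy => ⟨hS0 y hy, (hSN y hy).2⟩)
  set Z := ∑ q ∈ Ico 1 Q, ‖corr S f (0, (q : ℤ))‖ with hZ
  have hZ0 : 0 ≤ Z := sum_nonneg fun _ _ => norm_nonneg _
  have hcorr : ∀ q ∈ Ico 1 Q, ‖corr S f (0, (q : ℤ))‖ ^ 2 ≤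
      (X : ℝ) ^ (2 + 4 * ε - 4 * σ) + (X : ℝ) ^ (2 + 4 * ε - 2 * σ) / q := by
    intro q hq
    rw [mem_Ico] at hq
    refine le_trans (le_of_eq ?_) (hW (S.filter (fun y => y + (0, (q : ℤ)) ∈ S)) M N h (ξ * q) q Q
      (hS.filter_shift _) hMN hXM hXN hh1 hhX hq.1 hq.2.le hQ1 hQ2
      (fun y hy => hIM _ (hI y (mem_filter.1 hy).1)) ?_)
    · rw [corr]
      congr 2
      refine sum_congr rfl fun y hy => ?_
      have hyS := (mem_filter.1 hy).1
      have h1 : (0 : ℝ) ≤ y.1 := by linarith [(hIM _ (hI y hyS)).1]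
      have h2 : (0 : ℝ) ≤ y.2 := by exact_mod_cast hS0 y hyS
      congr 1
      simp only [hf, Prod.fst_add, Prod.snd_add, add_zero, dd]
      push_cast
      rw [Real.mul_rpow h1 (by positivity), Real.mul_rpow h1 h2]
      ring
    · intro y hy
      have h1 := (hSN y (mem_filter.1 hy).1).1
      have h2 := (hSN _ (mem_filter.1 hy).2).2
      simp only [Prod.snd_add] at h2
      push_cast at h2
      exact ⟨h1, h2⟩
  have hlogQ : ∑ q ∈ Ico 1 Q, 1 / (q : ℝ) ≤ (X : ℝ) ^ ε := by
    refine le_trans (sum_le_sum_of_subset_of_nonneg Ico_subset_Icc_self fun _ _ _ => by positivity)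
      ((sum_inv_le_one_add_log hX hQX).trans hlog)
  have hZsq : Z ^ 2 ≤ (X : ℝ) ^ (2 + 7 * ε) := by
    have hcard : ((Ico 1 Q).card : ℝ) ≤ Q := by rw [Nat.card_Ico]; exact_mod_cast Nat.sub_le _ _
    have h1 : Q * (Q * (X : ℝ) ^ (2 + 4 * ε - 4 * σ)) ≤ (X : ℝ) ^ (2 + 6 * ε) :=
      mul_le_rpow hX (by positivity) hQ2 (mul_le_rpow hX (hXp _).le hQ2 le_rfl le_rfl) (by linarith)
    have h2 : Q * ((X : ℝ) ^ (2 + 4 * ε - 2 * σ) * (X : ℝ) ^ ε) ≤ (X : ℝ) ^ (2 + 6 * ε) :=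
      mul_le_rpow hX (by positivity) hQ2 (mul_le_rpow hX (hXp _).le le_rfl le_rfl le_rfl) (by linarith)
    have h3 : 2 * (X : ℝ) ^ (2 + 6 * ε) ≤ (X : ℝ) ^ (2 + 7 * ε) :=
      mul_le_rpow hX (hXp _).le (show (2 : ℝ) ≤ (X : ℝ) ^ ε by linarith) le_rfl (by linarith)
    calc Z ^ 2 ≤ (Ico 1 Q).card * ∑ q ∈ Ico 1 Q, ‖corr S f (0, (q : ℤ))‖ ^ 2 := sq_sum_le_card_mul_sum_sq
      _ ≤ Q * ∑ q ∈ Ico 1 Q, ((X : ℝ) ^ (2 + 4 * ε - 4 * σ) + (X : ℝ) ^ (2 + 4 * ε - 2 * σ) / q) := by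
          refine mul_le_mul hcard (sum_le_sum hcorr) (sum_nonneg fun _ _ => sq_nonneg _) hQ0.le
      _ = Q * ((Ico 1 Q).card * (X : ℝ) ^ (2 + 4 * ε - 4 * σ) +
          (X : ℝ) ^ (2 + 4 * ε - 2 * σ) * ∑ q ∈ Ico 1 Q, 1 / (q : ℝ)) := by
          rw [sum_add_distrib, sum_const, nsmul_eq_mul, mul_sum]
          simp only [mul_one_div]
      _ ≤ Q * (Q * (X : ℝ) ^ (2 + 4 * ε - 4 * σ) + (X : ℝ) ^ (2 + 4 * ε - 2 * σ) * (X : ℝ) ^ ε) := by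
          gcongr
      _ ≤ _ := by linarith
  have hZ1 : Z ≤ (X : ℝ) ^ (1 + 4 * ε) := le_rpow_of_sq_le hX hZsq (by linarith)
  refine le_rpow_of_sq_le hX (t := 2 - 2 * σ + 5 * ε) ?_ (by linarith)
  set W := (∑ i ∈ I, ‖∑ n ∈ (S.filter (fun y => y.1 = i)).image Prod.snd, e (f (i, n))‖) ^ 2 with hWdef
  have hfin : Q * W ≤ (X : ℝ) ^ (2 + 5 * ε) := by
    rw [hMN] at hmain
    have hXX : (X : ℝ) ≤ (X : ℝ) ^ (1 + 4 * ε) :=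
      hX1'.trans (Real.rpow_le_rpow_of_exponent_le hX (by linarith))
    calc Q * W ≤ 12 * X * (8 * (X : ℝ) ^ (1 + 4 * ε) + 2 * (X : ℝ) ^ (1 + 4 * ε)) := by
          refine hmain.trans ?_; gcongr
      _ = 120 * (X * (X : ℝ) ^ (1 + 4 * ε)) := by ring
      _ ≤ _ := mul_le_rpow hX (by positivity) hc2 (mul_le_rpow hX (hXp _).le hX1' le_rfl le_rfl) (by linarith)
  calc W = Q * W / Q := by field_simp
    _ ≤ _ := div_le_rpow hX hfin hQ1 (by linarith)

lemma sectionsOrdConnected_hyperbola (a b X T : ℕ) :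
    SectionsOrdConnected ((Ico (a : ℤ) b ×ˢ Icc 1 (X : ℤ)).filter
      (fun y => (T : ℤ) < y.2 ∧ (X : ℤ) < 8 * (y.2 * y.1) ∧ y.2 * y.1 ≤ X)) := by
  constructor
  · intro n
    refine ⟨fun x hx y hy z hz => ?_⟩
    simp only [Set.mem_ofPred_eq, mem_filter, mem_product, mem_Ico, mem_Icc] at hx hy ⊢
    obtain ⟨⟨⟨h1, h2⟩, h3, h4⟩, h5, h6, h7⟩ := hx
    obtain ⟨⟨⟨k1, k2⟩, k3, k4⟩, k5, k6, k7⟩ := hy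
    have e1 := mul_le_mul_of_nonneg_left hz.1 (show (0 : ℤ) ≤ n by omega)
    have e2 := mul_le_mul_of_nonneg_left hz.2 (show (0 : ℤ) ≤ n by omega)
    have := hz.1
    have := hz.2
    omega
  · intro m
    refine ⟨fun x hx y hy z hz => ?_⟩
    simp only [Set.mem_ofPred_eq, mem_filter, mem_product, mem_Ico, mem_Icc] at hx hy ⊢
    obtain ⟨⟨⟨h1, h2⟩, h3, h4⟩, h5, h6, h7⟩ := hx
    obtain ⟨⟨⟨k1, k2⟩, k3, k4⟩, k5, k6, k7⟩ := hy
    have e1 := mul_le_mul_of_nonneg_right hz.1 (show (0 : ℤ) ≤ m by omega)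
    have e2 := mul_le_mul_of_nonneg_right hz.2 (show (0 : ℤ) ≤ m by omega)
    have := hz.1
    have := hz.2
    omega

lemma sum_Ico_natCast {M : Type*} [AddCommMonoid M] (a b : ℕ) (g : ℤ → M) :
    ∑ n ∈ Ico a b, g (n : ℤ) = ∑ i ∈ Ico (a : ℤ) b, g i := by
  refine sum_bij' (fun n _ => (n : ℤ)) (fun i _ => i.toNat) ?_ ?_ ?_ ?_ ?_
  · intro n hn; simpa using hn
  · intro i hi; rw [mem_Ico] at hi ⊢; omega
  · intro n _; simp
  · intro i hi; rw [mem_Ico] at hi; omega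
  · intro n _; rfl

set_option maxHeartbeats 400000 in
lemma sum_norm_block_le_rpow {γ η ε σ v : ℝ} (hη0 : 0 < η) (hγ : γ = 1 - η)
    (hε : 0 < ε) (hσ : η ≤ 2 * σ) (h8 : 8 * σ + 30 * ε ≤ 1) (h4 : 4 * σ + 30 * ε ≤ v)
    (hv : 1 + η ≤ 2 * v + 2 * σ) :
    ∀ᶠ X : ℕ in atTop, ∀ (N T : ℕ) (h ξ : ℝ), (X : ℝ) ^ v ≤ N → N * (X : ℝ) ^ v ≤ X → 1 ≤ h →
      h ≤ (X : ℝ) ^ (η + 2 * ε) →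
      ∑ n ∈ Ico N (2 * N), ‖∑ m ∈ (Icc 1 X).filter (fun m => T < m ∧ X < 8 * (m * n) ∧ m * n ≤ X),
          e (h * ((m * n : ℕ) : ℝ) ^ γ + ξ * ((m * n : ℕ) : ℝ))‖ ≤ (X : ℝ) ^ (1 - σ + 4 * ε) := by
  filter_upwards [eventually_ge_atTop 1, sum_norm_sections_le_rpow hη0 hγ hε hσ h8 h4 hv] with X hX1 hmain
  intro N T h ξ hN1 hN2 hh1 hhX
  have hX : (1 : ℝ) ≤ X := by exact_mod_cast hX1
  have hX0 : (0 : ℝ) < X := by linarith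
  have hXv : 1 ≤ (X : ℝ) ^ v := Real.one_le_rpow hX (by linarith)
  have hN0 : (0 : ℝ) < N := by linarith
  set S : Finset (ℤ × ℤ) := (Ico (N : ℤ) ((2 * N : ℕ) : ℤ) ×ˢ Icc 1 (X : ℤ)).filter
      (fun y => (T : ℤ) < y.2 ∧ (X : ℤ) < 8 * (y.2 * y.1) ∧ y.2 * y.1 ≤ X) with hS
  have hbd : ∀ i ∈ Ico (N : ℤ) ((2 * N : ℕ) : ℤ), (N : ℝ) ≤ i ∧ (i : ℝ) ≤ 2 * N := by
    intro i hi
    rw [mem_Ico] at hi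
    have h2 := hi.2.le
    push_cast at h2
    exact ⟨by exact_mod_cast hi.1, by exact_mod_cast h2⟩
  have hfst : ∀ y ∈ S, y.1 ∈ Ico (N : ℤ) ((2 * N : ℕ) : ℤ) := fun y hy =>
    (mem_product.1 (mem_filter.1 hy).1).1
  have := hmain S (Ico (N : ℤ) ((2 * N : ℕ) : ℤ)) N (X / N) h ξ (sectionsOrdConnected_hyperbola _ _ _ _)
    hfst (by field_simp) hN1 (by rw [le_div_iff₀ hN0]; linarith) hh1 hhX hbd (by
      intro y hy
      have h1 := hbd _ (hfst y hy)
      rw [hS] at hy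
      simp only [mem_filter, mem_product, mem_Icc] at hy
      obtain ⟨⟨-, h2, -⟩, -, h3, h4⟩ := hy
      have h2' : (1 : ℝ) ≤ y.2 := by exact_mod_cast h2
      have h3' : (X : ℝ) < 8 * (y.2 * y.1) := by exact_mod_cast h3
      have h4' : (y.2 * y.1 : ℝ) ≤ X := by exact_mod_cast h4
      constructor
      · rw [div_div, div_le_iff₀ (by positivity)]
        nlinarith
      · rw [le_div_iff₀ hN0]
        nlinarith)
  refine le_trans (le_of_eq ?_) this
  rw [← sum_Ico_natCast N (2 * N) (fun i => ‖∑ n ∈ (S.filter (fun y => y.1 = i)).image Prod.snd,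
        e (h * ((i : ℝ) * n) ^ γ + ξ * (i * n))‖)]
  refine sum_congr rfl fun n hn => ?_
  congr 1
  refine sum_bij' (fun m _ => (m : ℤ)) (fun m _ => m.toNat) ?_ ?_ ?_ ?_ ?_
  · intro m hm
    rw [mem_filter, mem_Icc] at hm
    rw [mem_Ico] at hn
    rw [mem_image]
    refine ⟨((n : ℤ), (m : ℤ)), ?_, rfl⟩
    simp only [hS, mem_filter, mem_product, mem_Icc, mem_Ico]
    norm_cast
    refine ⟨⟨⟨⟨hn.1, hn.2⟩, hm.1⟩, hm.2⟩, trivial⟩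
  · intro z hz
    obtain ⟨⟨i, m⟩, hy, rfl⟩ := mem_image.1 hz
    simp only [hS, mem_filter, mem_product, mem_Icc, mem_Ico] at hy
    obtain ⟨⟨⟨-, h2⟩, h3⟩, rfl⟩ := hy
    lift m to ℕ using by omega
    simp only [Int.toNat_natCast, mem_filter, mem_Icc]
    exact_mod_cast And.intro h2 h3
  · intro m _; simp
  · intro z hz
    obtain ⟨⟨i, m⟩, hy, rfl⟩ := mem_image.1 hz
    simp only [hS, mem_filter, mem_product, mem_Icc, mem_Ico] at hy
    simp only
    omega
  · intro m _
    push_cast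
    rw [mul_comm (n : ℝ)]

lemma typeI_large_bound {γ η θ ε σ v : ℝ} (hη0 : 0 < η) (hγ : γ = 1 - η)
    (hε : 0 < ε) (hσ : η ≤ 2 * σ) (h8 : 8 * σ + 30 * ε ≤ 1) (h4 : 4 * σ + 31 * ε ≤ v)
    (hv : 1 + η + 2 * ε ≤ 2 * v + 2 * σ) (hσθ : η + θ + 20 * ε ≤ σ) :
    ∀ᶠ X : ℕ in atTop, ∀ (T H : ℕ) (ξ : ℝ) (a c : ℕ → ℂ),
      0 < H → (H : ℝ) ≤ (X : ℝ) ^ (η + ε) → (∀ n, ‖a n‖ ≤ (X : ℝ) ^ ε) →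
      (∀ n, ‖c n‖ ≤ 1) → (∀ n, a n ≠ 0 → (X : ℝ) ^ v ≤ n ∧ n * (X : ℝ) ^ v ≤ X) →
      ‖bilin X (powerWeight γ ξ H c) a (fun m => if T < m then 1 else 0)‖ ≤
        (X : ℝ) ^ (1 - θ - 8 * ε) := by
  filter_upwards [eventually_ge_atTop 1, eventually_log_pow_le 2 1 hε, eventually_const_le 2 hε,
    sum_norm_block_le_rpow (v := v - ε) hη0 hγ hε hσ h8 (by linarith) (by linarith)] with X hX1 hlog h2X hblock
  intro T H ξ a c hH hHX ha hc hsupp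
  have hX : (1 : ℝ) ≤ X := by exact_mod_cast hX1
  have hX0 : (0 : ℝ) < X := by linarith
  have hXp : ∀ p : ℝ, 0 < (X : ℝ) ^ p := fun p => Real.rpow_pos_of_pos hX0 p
  rw [pow_one] at hlog
  set E : ℕ → ℕ → ℂ := fun h n => ∑ m ∈ (Icc 1 X).filter (fun m => T < m ∧ X < 8 * (m * n) ∧ m * n ≤ X),
          e (h * ((m * n : ℕ) : ℝ) ^ γ + ξ * ((m * n : ℕ) : ℝ)) with hE
  refine (norm_bilin_powerWeight_le X T H γ ξ _ a c ((Icc 1 X).filter (fun n => a n ≠ 0)) ha hc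
    (fun n hn h0 => mem_filter.2 ⟨hn, h0⟩)).trans ?_
  have hterm : ∀ h ∈ Ico H (2 * H), ∑ n ∈ (Icc 1 X).filter (fun n => a n ≠ 0), ‖E h n‖ ≤
      (X : ℝ) ^ ε * (X : ℝ) ^ (1 - σ + 4 * ε) := by
    intro h hh
    rw [mem_Ico] at hh
    have hh1 : (1 : ℝ) ≤ h := by exact_mod_cast hH.trans_le hh.1
    have hh2 : (h : ℝ) ≤ (X : ℝ) ^ (η + 2 * ε) := by
      have : (h : ℝ) ≤ 2 * H := by exact_mod_cast hh.2.le
      exact this.trans (mul_le_rpow hX (by positivity) h2X hHX (by linarith))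
    have h1 := norm_sum_le_dyadic (fun n => ((if n ≤ X ∧ a n ≠ 0 then ‖E h n‖ else 0 : ℝ) : ℂ)) (X := X)
      (B := (X : ℝ) ^ (1 - σ + 4 * ε)) (fun n hn => by simp [hn.not_ge]) (hXp _).le (by
        intro N hN hNX
        rw [← Complex.ofReal_sum, Complex.norm_real, Real.norm_of_nonneg
          (sum_nonneg fun n _ => by split_ifs <;> positivity)]
        by_cases hex : ∃ n ∈ Ico N (2 * N), a n ≠ 0
        · obtain ⟨n, hn, h0⟩ := hex
          rw [mem_Ico] at hn
          obtain ⟨s1, s2⟩ := hsupp n h0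
          have hn1 : (N : ℝ) ≤ n := by exact_mod_cast hn.1
          have hn2 : (n : ℝ) ≤ 2 * N := by exact_mod_cast hn.2.le
          have hvv : (X : ℝ) ^ (v - ε) * 2 ≤ (X : ℝ) ^ v :=
            mul_le_rpow hX (by norm_num) le_rfl h2X (by linarith)
          refine le_trans (sum_le_sum fun n _ => ?_) (hblock N T h ξ (by linarith) ?_ hh1 hh2)
          · split_ifs
            · exact le_rfl
            · exact norm_nonneg _
          · refine le_trans ?_ s2
            have : (X : ℝ) ^ (v - ε) ≤ (X : ℝ) ^ v := Real.rpow_le_rpow_of_exponent_le hX (by linarith)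
            exact mul_le_mul hn1 this (hXp _).le (by positivity)
        · push Not at hex
          rw [sum_eq_zero fun n hn => by rw [if_neg (fun h => h.2 (hex n hn))]]
          exact (hXp _).le)
    rw [← Complex.ofReal_sum, Complex.norm_real, Real.norm_of_nonneg
          (sum_nonneg fun n _ => by split_ifs <;> positivity)] at h1
    refine le_trans (le_of_eq ?_) (h1.trans (mul_le_mul_of_nonneg_right hlog (hXp _).le))
    rw [sum_filter]
    refine sum_congr rfl fun n hn => ?_
    simp [(mem_Icc.1 hn).2]
  have hsum : ∑ h ∈ Ico H (2 * H), ∑ n ∈ (Icc 1 X).filter (fun n => a n ≠ 0), ‖E h n‖ ≤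
      H * ((X : ℝ) ^ ε * (X : ℝ) ^ (1 - σ + 4 * ε)) := by
    refine (sum_le_sum hterm).trans (le_of_eq ?_)
    rw [sum_const, Nat.card_Ico, nsmul_eq_mul, show 2 * H - H = H by omega]
  refine mul_le_rpow hX (by positivity) le_rfl (hsum.trans (mul_le_rpow hX
    (mul_pos (hXp _) (hXp _)).le hHX (mul_le_rpow hX (hXp _).le le_rfl le_rfl le_rfl) le_rfl)) ?_
  linarith

open ArithmeticFunction in
lemma exists_card_divisors_le {ε : ℝ} (hε : 0 < ε) :
    ∃ C : ℝ, ∀ n : ℕ, n ≠ 0 → (n.divisors.card : ℝ) ≤ C * (n : ℝ) ^ ε := by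
  set K : ℝ := 1 + 1 / (ε * Real.log 2) with hK
  have hlog2 : 0 < Real.log 2 := Real.log_pos (by norm_num)
  have hK1 : 1 ≤ K := by rw [hK]; linarith [show 0 < 1 / (ε * Real.log 2) by positivity]
  set P : ℕ := ⌈(2 : ℝ) ^ (1 / ε)⌉₊ with hP
  refine ⟨K ^ P, fun n hn => ?_⟩
  have hterm : ∀ p ∈ n.primeFactors, ((n.factorization p + 1 : ℕ) : ℝ) ≤
      (if p < P then K else 1) * ((p : ℝ) ^ n.factorization p) ^ ε := by
    intro p hp
    set a := n.factorization p with ha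
    have hp2 : (2 : ℝ) ≤ p := by exact_mod_cast (Nat.prime_of_mem_primeFactors hp).two_le
    have hpow : ((p : ℝ) ^ a) ^ ε = ((p : ℝ) ^ ε) ^ a := by
      rw [← Real.rpow_natCast, ← Real.rpow_natCast, ← Real.rpow_mul (by positivity),
        ← Real.rpow_mul (by positivity), mul_comm]
    rw [hpow]
    split_ifs with hpP
    · have h1 : 1 + ε * Real.log 2 ≤ (p : ℝ) ^ ε := by
        calc 1 + ε * Real.log 2 ≤ Real.exp (ε * Real.log 2) := by
              linarith [Real.add_one_le_exp (ε * Real.log 2)]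
          _ = (2 : ℝ) ^ ε := by rw [Real.rpow_def_of_pos (by norm_num), mul_comm]
          _ ≤ _ := Real.rpow_le_rpow (by norm_num) hp2 hε.le
      have h2 : 1 + a * (ε * Real.log 2) ≤ ((p : ℝ) ^ ε) ^ a :=
        (one_add_mul_le_pow (by nlinarith [mul_pos hε hlog2]) a).trans (pow_le_pow_left₀ (by positivity) h1 a)
      calc ((a + 1 : ℕ) : ℝ) ≤ K * (1 + a * (ε * Real.log 2)) := by
            have : K * (1 + a * (ε * Real.log 2)) =
                a + 1 + (1 / (ε * Real.log 2) + a * (ε * Real.log 2)) := by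
              rw [hK]; field_simp; ring
            rw [this]
            push_cast
            linarith [show 0 ≤ 1 / (ε * Real.log 2) + a * (ε * Real.log 2) by positivity]
        _ ≤ _ := mul_le_mul_of_nonneg_left h2 (by linarith)
    · have h1 : (2 : ℝ) ≤ (p : ℝ) ^ ε := by
        have h3 : (2 : ℝ) ^ (1 / ε) ≤ p := (Nat.le_ceil _).trans (by exact_mod_cast not_lt.1 hpP)
        calc (2 : ℝ) = ((2 : ℝ) ^ (1 / ε)) ^ ε := by
              rw [← Real.rpow_mul (by norm_num), one_div, inv_mul_cancel₀ hε.ne', Real.rpow_one]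
          _ ≤ _ := Real.rpow_le_rpow (by positivity) h3 hε.le
      rw [one_mul]
      calc ((a + 1 : ℕ) : ℝ) ≤ (2 : ℝ) ^ a := by exact_mod_cast Nat.lt_two_pow_self
        _ ≤ _ := pow_le_pow_left₀ (by norm_num) h1 a
  calc (n.divisors.card : ℝ) = ∏ p ∈ n.primeFactors, ((n.factorization p + 1 : ℕ) : ℝ) := by
        rw [Nat.card_divisors hn]; push_cast; rfl
    _ ≤ ∏ p ∈ n.primeFactors, (if p < P then K else 1) * ((p : ℝ) ^ n.factorization p) ^ ε :=
        prod_le_prod (fun _ _ => by positivity) hterm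
    _ = (∏ p ∈ n.primeFactors, if p < P then K else 1) * (n : ℝ) ^ ε := by
        rw [prod_mul_distrib, Real.finsetProd_rpow _ _ (fun _ _ => by positivity)]
        congr 2
        have h := Nat.prod_factorization_pow_eq_self hn
        rw [Finsupp.prod, Nat.support_factorization] at h
        exact_mod_cast h
    _ ≤ K ^ P * (n : ℝ) ^ ε := by
        gcongr
        rw [← prod_filter, prod_const]
        refine pow_le_pow_right₀ hK1 ?_
        calc _ ≤ (range P).card := card_le_card fun p hp => mem_range.2 (mem_filter.1 hp).2
          _ = P := card_range P

lemma eventually_card_divisors_le {ε : ℝ} (hε : 0 < ε) :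
    ∀ᶠ X : ℕ in atTop, ∀ n ∈ Icc 1 X, (n.divisors.card : ℝ) ≤ (X : ℝ) ^ ε := by
  obtain ⟨C, hC⟩ := exists_card_divisors_le (half_pos hε)
  filter_upwards [eventually_ge_atTop 1, eventually_const_le C (half_pos hε)] with X hX1 hCX n hn
  rw [mem_Icc] at hn
  have hX : (1 : ℝ) ≤ X := by exact_mod_cast hX1
  refine (hC n (by omega)).trans (mul_le_rpow hX (by positivity) hCX (b := ε / 2) ?_ (by linarith))
  exact Real.rpow_le_rpow (by positivity) (by exact_mod_cast hn.2) (by positivity)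

namespace ArithmeticFunction

/-- The restriction of `f` to `n ≤ P`. -/
noncomputable def cutLe (P : ℕ) (f : ArithmeticFunction ℝ) : ArithmeticFunction ℝ :=
  ⟨fun n => if n ≤ P then f n else 0, by simp⟩

/-- The restriction of `f` to `n > P`. -/
noncomputable def cutGt (P : ℕ) (f : ArithmeticFunction ℝ) : ArithmeticFunction ℝ :=
  ⟨fun n => if P < n then f n else 0, by simp⟩

lemma cutLe_apply (P : ℕ) (f : ArithmeticFunction ℝ) (n : ℕ) : cutLe P f n = if n ≤ P then f n else 0 := rfl

lemma cutGt_apply (P : ℕ) (f : ArithmeticFunction ℝ) (n : ℕ) : cutGt P f n = if P < n then f n else 0 := rfl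

lemma cutLe_add_cutGt (P : ℕ) (f : ArithmeticFunction ℝ) : cutLe P f + cutGt P f = f := by
  ext n
  rw [add_apply, cutLe_apply, cutGt_apply]
  by_cases h : n ≤ P
  · rw [if_pos h, if_neg (by omega), add_zero]
  · rw [if_neg h, if_pos (by omega), zero_add]

lemma cutLe_ne_zero {P : ℕ} {f : ArithmeticFunction ℝ} {n : ℕ} (h : cutLe P f n ≠ 0) : n ≤ P ∧ f n ≠ 0 := by
  rw [cutLe_apply] at h
  split_ifs at h with h1
  · exact ⟨h1, h⟩
  · exact absurd rfl h

lemma cutGt_ne_zero {P : ℕ} {f : ArithmeticFunction ℝ} {n : ℕ} (h : cutGt P f n ≠ 0) : P < n ∧ f n ≠ 0 := by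
  rw [cutGt_apply] at h
  split_ifs at h with h1
  · exact ⟨h1, h⟩
  · exact absurd rfl h

lemma exists_of_mul_ne_zero {f g : ArithmeticFunction ℝ} {n : ℕ} (h : (f * g) n ≠ 0) :
    ∃ a b, f a ≠ 0 ∧ g b ≠ 0 ∧ n = a * b := by
  rw [mul_apply] at h
  obtain ⟨x, hx, h1⟩ := exists_ne_zero_of_sum_ne_zero h
  exact ⟨x.1, x.2, left_ne_zero_of_mul h1, right_ne_zero_of_mul h1, ((Nat.mem_divisorsAntidiagonal.1 hx).1).symm⟩

lemma abs_cutLe_le (P : ℕ) (f : ArithmeticFunction ℝ) (n : ℕ) : |cutLe P f n| ≤ |f n| := by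
  rw [cutLe_apply]; split_ifs <;> simp

lemma abs_cutGt_le (P : ℕ) (f : ArithmeticFunction ℝ) (n : ℕ) : |cutGt P f n| ≤ |f n| := by
  rw [cutGt_apply]; split_ifs <;> simp

/-- `f` is bounded by `D ^ k` on `[1, X]`. -/
def BoundedBy (X : ℕ) (D : ℝ) (k : ℕ) (f : ArithmeticFunction ℝ) : Prop :=
  ∀ n ∈ Icc 1 X, |f n| ≤ D ^ k

variable {X : ℕ} {D : ℝ} {j k : ℕ} {f g : ArithmeticFunction ℝ}

lemma BoundedBy.mono (hD : 1 ≤ D) (hf : BoundedBy X D j f) (h : j ≤ k) : BoundedBy X D k f :=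
  fun n hn => (hf n hn).trans (pow_le_pow_right₀ hD h)

lemma BoundedBy.cutLe (hf : BoundedBy X D k f) (P : ℕ) : BoundedBy X D k (cutLe P f) :=
  fun n hn => (abs_cutLe_le P f n).trans (hf n hn)

lemma BoundedBy.cutGt (hf : BoundedBy X D k f) (P : ℕ) : BoundedBy X D k (cutGt P f) :=
  fun n hn => (abs_cutGt_le P f n).trans (hf n hn)

lemma BoundedBy.mul (hD : 1 ≤ D) (hd : ∀ n ∈ Icc 1 X, (n.divisors.card : ℝ) ≤ D)
    (hf : BoundedBy X D j f) (hg : BoundedBy X D k g) : BoundedBy X D (j + k + 1) (f * g) := by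
  intro n hn
  rw [mem_Icc] at hn
  rw [mul_apply]
  calc _ ≤ ∑ x ∈ n.divisorsAntidiagonal, |f x.1 * g x.2| := abs_sum_le_sum_abs _ _
    _ ≤ ∑ x ∈ n.divisorsAntidiagonal, D ^ j * D ^ k := by
        refine sum_le_sum fun x hx => ?_
        obtain ⟨h1, h2⟩ := Nat.mem_divisorsAntidiagonal.1 hx
        have ha : 0 < x.1 := Nat.pos_of_ne_zero fun h => h2 (by rw [← h1, h, zero_mul])
        have hb : 0 < x.2 := Nat.pos_of_ne_zero fun h => h2 (by rw [← h1, h, mul_zero])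
        rw [abs_mul]
        refine mul_le_mul (hf _ (mem_Icc.2 ⟨ha, ?_⟩)) (hg _ (mem_Icc.2 ⟨hb, ?_⟩)) (abs_nonneg _) (by positivity)
        · exact (Nat.le_mul_of_pos_right _ hb).trans (h1.le.trans hn.2)
        · exact (Nat.le_mul_of_pos_left _ ha).trans (h1.le.trans hn.2)
    _ = n.divisors.card * (D ^ j * D ^ k) := by
        rw [sum_const, nsmul_eq_mul, ← Nat.map_div_right_divisors, card_map]
    _ ≤ D * (D ^ j * D ^ k) := mul_le_mul_of_nonneg_right (hd n (mem_Icc.2 hn)) (by positivity)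
    _ = _ := by ring

/-- The sum of `f n * w n` over `X / 8 < n ≤ X`. -/
noncomputable def windowSum (X : ℕ) (w : ℕ → ℂ) (f : ArithmeticFunction ℝ) : ℂ :=
  ∑ n ∈ (Icc 1 X).filter (fun n => X < 8 * n), (f n : ℂ) * w n

lemma windowSum_add (w : ℕ → ℂ) : windowSum X w (f + g) = windowSum X w f + windowSum X w g := by
  simp [windowSum, add_mul, sum_add_distrib]

lemma windowSum_sub (w : ℕ → ℂ) : windowSum X w (f - g) = windowSum X w f - windowSum X w g := by
  simp [windowSum, sub_eq_add_neg, add_mul, sum_add_distrib]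

lemma windowSum_eq_zero (w : ℕ → ℂ) (h : ∀ n, f n ≠ 0 → 8 * n ≤ X ∨ X < n) : windowSum X w f = 0 := by
  refine sum_eq_zero fun n hn => ?_
  rw [mem_filter, mem_Icc] at hn
  have : f n = 0 := by
    by_contra h0
    have := h n h0
    omega
  rw [this, Complex.ofReal_zero, zero_mul]

lemma windowSum_mul (w : ℕ → ℂ) :
    windowSum X w (f * g) = bilin X w (fun n => (f n : ℂ)) (fun n => (g n : ℂ)) := by
  rw [windowSum, bilin, ← sum_product' (Icc 1 X) (Icc 1 X) (fun n m =>
    if X < 8 * (m * n) ∧ m * n ≤ X then (f n : ℂ) * g m * w (m * n) else 0), ← sum_filter]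
  simp only [mul_apply, Complex.ofReal_sum, sum_mul]
  rw [sum_sigma']
  refine sum_bij' (fun x _ => x.2) (fun y _ => ⟨y.1 * y.2, y⟩) ?_ ?_ ?_ ?_ ?_
  · rintro ⟨n, a, b⟩ hx
    simp only [mem_sigma, mem_filter, mem_Icc, Nat.mem_divisorsAntidiagonal, mem_product] at hx ⊢
    obtain ⟨⟨⟨h1, h2⟩, h3⟩, rfl, h5⟩ := hx
    have ha : 0 < a := Nat.pos_of_ne_zero fun h => h5 (by rw [h, zero_mul])
    have hb : 0 < b := Nat.pos_of_ne_zero fun h => h5 (by rw [h, mul_zero])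
    rw [mul_comm b a]
    exact ⟨⟨⟨ha, (Nat.le_mul_of_pos_right _ hb).trans h2⟩, ⟨hb, (Nat.le_mul_of_pos_left _ ha).trans h2⟩⟩, h3, h2⟩
  · rintro ⟨a, b⟩ hx
    simp only [mem_sigma, mem_filter, mem_Icc, Nat.mem_divisorsAntidiagonal, mem_product] at hx ⊢
    obtain ⟨⟨⟨h1, h2⟩, h3, h4⟩, h5, h6⟩ := hx
    rw [mul_comm b a] at h5 h6
    have := Nat.mul_pos h1 h3
    exact ⟨⟨⟨this, h6⟩, h5⟩, trivial, this.ne'⟩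
  · rintro ⟨n, a, b⟩ hx
    simp only [mem_sigma, Nat.mem_divisorsAntidiagonal] at hx
    obtain ⟨-, rfl, -⟩ := hx
    rfl
  · rintro ⟨a, b⟩ _; rfl
  · rintro ⟨n, a, b⟩ hx
    simp only [mem_sigma, Nat.mem_divisorsAntidiagonal] at hx
    obtain ⟨-, rfl, -⟩ := hx
    simp only
    push_cast
    rw [mul_comm b a]

end ArithmeticFunction

namespace ArithmeticFunction

variable {X U V : ℕ} {D E : ℝ} {w : ℕ → ℂ}

/-- Bounds for the bilinear sums that enter the decomposition of the von Mangoldt function. -/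
structure BilinearBounds (X U V : ℕ) (w : ℕ → ℂ) (Y E : ℝ) : Prop where
  typeII : ∀ a b : ℕ → ℂ, (∀ n ∈ Icc 1 X, ‖a n‖ ≤ Y) → (∀ n ∈ Icc 1 X, ‖b n‖ ≤ Y) →
    (∀ n, a n ≠ 0 → U < n ∧ n ≤ V) → ‖bilin X w a b‖ ≤ E
  typeI : ∀ T ≥ V, ∀ a : ℕ → ℂ, (∀ n ∈ Icc 1 X, ‖a n‖ ≤ Y) →
    ((∀ n, a n ≠ 0 → n ≤ U) ∨ ∀ n, a n ≠ 0 → V < n ∧ n ≤ X / V) →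
    ‖bilin X w a (fun m => if T < m then 1 else 0)‖ ≤ E

lemma norm_windowSum_typeII (hb : BilinearBounds X U V w (D ^ 4) E) (hD : 1 ≤ D)
    {f g : ArithmeticFunction ℝ} {j k : ℕ} (hf : BoundedBy X D j f) (hg : BoundedBy X D k g) (hj : j ≤ 4)
    (hk : k ≤ 4) (hsupp : ∀ n, f n ≠ 0 → U < n ∧ n ≤ V) : ‖windowSum X w (f * g)‖ ≤ E := by
  rw [windowSum_mul]
  refine hb.typeII _ _ ?_ ?_ ?_
  · intro n hn; rw [Complex.norm_real]; exact hf.mono hD hj n hn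
  · intro n hn; rw [Complex.norm_real]; exact hg.mono hD hk n hn
  · intro n hn; exact hsupp n (by simpa using hn)

lemma norm_windowSum_zeta (hb : BilinearBounds X U V w (D ^ 4) E) (hD : 1 ≤ D)
    {f : ArithmeticFunction ℝ} {j : ℕ} (hf : BoundedBy X D j f) (hj : j ≤ 4)
    (hsupp : (∀ n, f n ≠ 0 → n ≤ U) ∨ ∀ n, f n ≠ 0 → V < n ∧ n ≤ X / V) :
    ‖windowSum X w (f * cutGt V zeta)‖ ≤ E := by
  rw [windowSum_mul]
  refine le_trans (le_of_eq ?_) (hb.typeI V le_rfl (fun n => (f n : ℂ)) ?_ ?_)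
  · congr 2
    ext m
    rw [cutGt_apply]
    split_ifs with h
    · rw [natCoe_apply, zeta_apply, if_neg (by omega)]; simp
    · simp
  · intro n hn; rw [Complex.norm_real]; exact hf.mono hD hj n hn
  · simpa using hsupp

lemma cutGt_log_eq_sum {V m : ℕ} (hm : m ≤ X) :
    cutGt V log m = Real.log (V + 1 : ℕ) * (if V < m then 1 else 0) +
      ∑ T ∈ Ico (V + 1) X, (Real.log (T + 1 : ℕ) - Real.log T) * (if T < m then 1 else 0) := by
  rw [cutGt_apply]
  have key : ∀ m, V + 1 ≤ m → m ≤ X → ∑ T ∈ Ico (V + 1) X,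
      (Real.log (T + 1 : ℕ) - Real.log T) * (if T < m then 1 else 0) = Real.log m - Real.log (V + 1 : ℕ) := by
    intro m hm1 hm2
    rw [← sum_Ico_consecutive _ hm1 hm2, ← sum_Ico_sub (fun k : ℕ => Real.log k) hm1]
    rw [sum_congr rfl (g := fun T : ℕ => Real.log (T + 1 : ℕ) - Real.log T) (fun T hT => by
      rw [if_pos (mem_Ico.1 hT).2, mul_one]), add_eq_left]
    exact sum_eq_zero fun T hT => by rw [if_neg (by have := (mem_Ico.1 hT).1; omega), mul_zero]
  split_ifs with h
  · rw [key m h hm, log_apply]; ring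
  · rw [mul_zero, zero_add, eq_comm]
    exact sum_eq_zero fun T hT => by rw [if_neg (by have := (mem_Ico.1 hT).1; omega), mul_zero]

lemma bilin_add_right (X : ℕ) (w a b b' : ℕ → ℂ) :
    bilin X w a (fun m => b m + b' m) = bilin X w a b + bilin X w a b' := by
  simp only [bilin, ← sum_add_distrib]
  refine sum_congr rfl fun n _ => sum_congr rfl fun m _ => ?_
  split_ifs <;> ring

lemma bilin_const_mul_right (X : ℕ) (w a b : ℕ → ℂ) (c : ℂ) :
    bilin X w a (fun m => c * b m) = c * bilin X w a b := by
  simp only [bilin, mul_sum]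
  refine sum_congr rfl fun n _ => sum_congr rfl fun m _ => ?_
  split_ifs <;> ring

lemma bilin_sum_right {ι : Type*} (X : ℕ) (w a : ℕ → ℂ) (s : Finset ι) (b : ι → ℕ → ℂ) :
    bilin X w a (fun m => ∑ i ∈ s, b i m) = ∑ i ∈ s, bilin X w a (b i) := by
  simp only [bilin]
  rw [sum_comm (s := s)]
  refine sum_congr rfl fun n _ => ?_
  rw [sum_comm (s := s)]
  refine sum_congr rfl fun m _ => ?_
  split_ifs
  · rw [mul_sum, sum_mul]
  · simp

lemma bilin_congr {X : ℕ} {w a a' b b' : ℕ → ℂ} (ha : ∀ n ∈ Icc 1 X, a n = a' n)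
    (hb : ∀ n ∈ Icc 1 X, b n = b' n) : bilin X w a b = bilin X w a' b' :=
  sum_congr rfl fun n hn => sum_congr rfl fun m hm => by rw [ha n hn, hb m hm]

lemma norm_windowSum_log (hb : BilinearBounds X U V w (D ^ 4) E) (hD : 1 ≤ D) (hVX : V < X)
    {f : ArithmeticFunction ℝ} {j : ℕ} (hf : BoundedBy X D j f) (hj : j ≤ 4)
    (hsupp : (∀ n, f n ≠ 0 → n ≤ U) ∨ ∀ n, f n ≠ 0 → V < n ∧ n ≤ X / V) :
    ‖windowSum X w (f * cutGt V log)‖ ≤ Real.log X * E := by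
  have hI : ∀ T ≥ V, ‖bilin X w (fun n => (f n : ℂ)) (fun m => if T < m then 1 else 0)‖ ≤ E := by
    intro T hT
    refine hb.typeI T hT _ ?_ (by simpa using hsupp)
    intro n hn; rw [Complex.norm_real]; exact hf.mono hD hj n hn
  have hmono : ∀ T ∈ Ico (V + 1) X, 0 ≤ Real.log (T + 1 : ℕ) - Real.log T := by
    intro T hT
    have := Real.log_le_log (x := T) (y := (T + 1 : ℕ))
      (by exact_mod_cast (by have := (mem_Ico.1 hT).1; omega : 0 < T)) (by push_cast; linarith)
    linarith
  have h1 : windowSum X w (f * cutGt V log) =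
      (Real.log (V + 1 : ℕ) : ℂ) * bilin X w (fun n => (f n : ℂ)) (fun m => if V < m then 1 else 0) +
      ∑ T ∈ Ico (V + 1) X, ((Real.log (T + 1 : ℕ) - Real.log T : ℝ) : ℂ) *
        bilin X w (fun n => (f n : ℂ)) (fun m => if T < m then 1 else 0) := by
    rw [windowSum_mul]
    simp only [← bilin_const_mul_right]
    rw [← bilin_sum_right, ← bilin_add_right]
    refine bilin_congr (fun _ _ => rfl) fun m hm => ?_
    rw [cutGt_log_eq_sum (mem_Icc.1 hm).2]
    simp only [Complex.ofReal_add, Complex.ofReal_sum, Complex.ofReal_mul, apply_ite Complex.ofReal,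
      Complex.ofReal_one, Complex.ofReal_zero]
  rw [h1]
  calc _ ≤ Real.log (V + 1 : ℕ) * E + ∑ T ∈ Ico (V + 1) X, (Real.log (T + 1 : ℕ) - Real.log T) * E := by
        refine (norm_add_le _ _).trans (add_le_add ?_ ((norm_sum_le _ _).trans (sum_le_sum fun T hT => ?_)))
        · rw [norm_mul, Complex.norm_real, Real.norm_of_nonneg (Real.log_natCast_nonneg _)]
          exact mul_le_mul_of_nonneg_left (hI V le_rfl) (Real.log_natCast_nonneg _)
        · rw [norm_mul, Complex.norm_real, Real.norm_of_nonneg (hmono T hT)]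
          exact mul_le_mul_of_nonneg_left (hI T (by have := (mem_Ico.1 hT).1; omega)) (hmono T hT)
    _ = _ := by
        rw [← sum_mul, sum_Ico_sub (fun k : ℕ => Real.log k) (show V + 1 ≤ X by omega)]
        ring

lemma cut_three {U V : ℕ} (h : U ≤ V) (f : ArithmeticFunction ℝ) :
    cutLe U f + cutGt U (cutLe V f) + cutGt V f = f := by
  ext n
  simp only [add_apply, cutLe_apply, cutGt_apply]
  split_ifs <;> first | omega | simp

lemma decomposition_identity {R : Type*} [CommRing R] {m z L₁ L₂ L₃ A₂ A₃ A₄ z₁ z₂ z₃ l₁ l₂ l₃ B₁ B₂ P₁ P₂ R₁ R₂ : R}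
    (hl : l₁ + l₂ + l₃ = (L₁ + L₂ + L₃) * z) (hz : z₁ + z₂ + z₃ = z) (hA : A₂ + A₃ + A₄ = 1 - m * z)
    (hB : B₁ + B₂ = m * L₁) (hP : P₁ + P₂ = A₃ * m) (hR : R₁ + R₂ = A₃ * B₁) :
    L₁ + L₂ + L₃ = (m * (l₁ + l₂) + L₁ - B₁ * (z₁ + z₂) + A₄ * L₃ + A₃ * m * l₁ + P₂ * l₃ - A₃ * B₁ * z₁ -
      R₂ * z₃ + A₃ * (A₂ + A₃ + A₄) * L₃) + ((m * l₃ + P₁ * l₃) - (B₁ * z₃ + R₁ * z₃)) +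
      (L₂ * (A₂ + A₃ + A₄) + A₂ * L₃ + l₂ * (A₃ * m) + L₂ * (A₃ * (A₂ + A₃ + A₄)) -
        (B₂ * z + L₂ * A₃ + B₂ * (A₃ * z) + z₂ * (A₃ * B₁))) := by
  obtain rfl : l₃ = (L₁ + L₂ + L₃) * z - l₁ - l₂ := by linear_combination hl
  obtain rfl : z₃ = z - z₁ - z₂ := by linear_combination hz
  obtain rfl : A₄ = 1 - m * z - A₂ - A₃ := by linear_combination hA
  obtain rfl : B₂ = m * L₁ - B₁ := by linear_combination hB
  obtain rfl : P₂ = A₃ * m - P₁ := by linear_combination hP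
  obtain rfl : R₂ = A₃ * B₁ - R₁ := by linear_combination hR
  ring

lemma norm_windowSum_vonMangoldt_le (hb : BilinearBounds X U V w (D ^ 4) E) (hD : 1 ≤ D)
    (hd : ∀ n ∈ Icc 1 X, (n.divisors.card : ℝ) ≤ D) (hlog : Real.log X ≤ D) (hV0 : 0 < V) (hVX : V < X)
    (hUV : 8 * (U * U) ≤ V) (hUVX : 8 * (U * V) ≤ X) (hXU : X ≤ V * V * U) (hVV : V * V ≤ X) :
    ‖windowSum X w vonMangoldt‖ ≤ 10 * (1 + Real.log X) * E := by
  set W := X / V with hW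
  have hWV : W * V ≤ X := Nat.div_mul_le_self X V
  have hWX : X < (W + 1) * V := by rw [mul_comm]; exact Nat.lt_mul_div_succ X hV0
  have hUV' : U ≤ V := by nlinarith
  have hVW : V ≤ W := by rw [hW, Nat.le_div_iff_mul_le hV0]; exact hVV
  set m : ArithmeticFunction ℝ := cutLe U (moebius : ArithmeticFunction ℝ) with hm
  set z : ArithmeticFunction ℝ := (zeta : ArithmeticFunction ℝ) with hz
  set L₁ := cutLe U vonMangoldt with hL₁
  set L₂ := cutGt U (cutLe V vonMangoldt) with hL₂
  set L₃ := cutGt V vonMangoldt with hL₃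
  set A : ArithmeticFunction ℝ := cutGt U (moebius : ArithmeticFunction ℝ) * z with hA
  set A₂ := cutLe V A with hA₂
  set A₃ := cutGt V (cutLe W A) with hA₃
  set A₄ := cutGt W A with hA₄
  set z₁ := cutLe U z with hz₁
  set z₂ := cutGt U (cutLe V z) with hz₂
  set z₃ := cutGt V z with hz₃
  set l₁ := cutLe U log with hl₁
  set l₂ := cutGt U (cutLe V log) with hl₂
  set l₃ := cutGt V log with hl₃
  set B₁ := cutLe U (m * L₁) with hB₁
  set B₂ := cutGt U (m * L₁) with hB₂
  set P₁ := cutLe W (A₃ * m) with hP₁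
  set P₂ := cutGt W (A₃ * m) with hP₂
  set R₁ := cutLe W (A₃ * B₁) with hR₁
  set R₂ := cutGt W (A₃ * B₁) with hR₂
  have eL : L₁ + L₂ + L₃ = vonMangoldt := cut_three hUV' _
  have eA : A₂ + A₃ + A₄ = A := cut_three hVW _
  have eA' : A₂ + A₃ + A₄ = 1 - m * z := by
    rw [eA, hA, hm, eq_sub_iff_add_eq, ← add_mul, add_comm, cutLe_add_cutGt, coe_moebius_mul_coe_zeta]
  have hid := decomposition_identity (m := m) (z := z) (L₁ := L₁) (L₂ := L₂) (L₃ := L₃) (A₂ := A₂) (A₃ := A₃)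
    (A₄ := A₄) (z₁ := z₁) (z₂ := z₂) (z₃ := z₃) (l₁ := l₁) (l₂ := l₂) (l₃ := l₃)
    (B₁ := B₁) (B₂ := B₂) (P₁ := P₁) (P₂ := P₂) (R₁ := R₁) (R₂ := R₂)
    (by rw [eL, vonMangoldt_mul_zeta]; exact cut_three hUV' _) (cut_three hUV' _) eA'
    (cutLe_add_cutGt U (m * L₁)) (cutLe_add_cutGt W (A₃ * m)) (cutLe_add_cutGt W (A₃ * B₁))
  rw [eL, eA] at hid
  -- supports
  have hne0 : ∀ {f : ArithmeticFunction ℝ} {n : ℕ}, f n ≠ 0 → 0 < n := fun {f n} h =>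
    Nat.pos_of_ne_zero fun h0 => h (by rw [h0]; exact f.map_zero)
  have sm : ∀ {n}, m n ≠ 0 → n ≤ U := fun h => (cutLe_ne_zero h).1
  have sA : ∀ {n}, A n ≠ 0 → U < n := by
    intro n h
    obtain ⟨a, b, ha, hb', rfl⟩ := exists_of_mul_ne_zero h
    exact (cutGt_ne_zero ha).1.trans_le (Nat.le_mul_of_pos_right _ (hne0 hb'))
  have sA₃ : ∀ {n}, A₃ n ≠ 0 → V < n ∧ n ≤ W := fun h =>
    ⟨(cutGt_ne_zero h).1, (cutLe_ne_zero (cutGt_ne_zero h).2).1⟩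
  have sB₁ : ∀ {n}, B₁ n ≠ 0 → n ≤ U := fun h => (cutLe_ne_zero h).1
  have sB₂ : ∀ n, B₂ n ≠ 0 → U < n ∧ n ≤ V := by
    intro n h
    refine ⟨(cutGt_ne_zero h).1, ?_⟩
    obtain ⟨a, b, ha, hb', rfl⟩ := exists_of_mul_ne_zero (cutGt_ne_zero h).2
    have := Nat.mul_le_mul (sm ha) (cutLe_ne_zero hb').1
    omega
  have smid : ∀ f : ArithmeticFunction ℝ, ∀ n, cutGt U (cutLe V f) n ≠ 0 → U < n ∧ n ≤ V := fun f n h =>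
    ⟨(cutGt_ne_zero h).1, (cutLe_ne_zero (cutGt_ne_zero h).2).1⟩
  have sA₂ : ∀ n, A₂ n ≠ 0 → U < n ∧ n ≤ V := fun n h =>
    ⟨sA (cutLe_ne_zero h).2, (cutLe_ne_zero h).1⟩
  have sA₃mul : ∀ {f : ArithmeticFunction ℝ} {n : ℕ}, (A₃ * f) n ≠ 0 → V < n := by
    intro f n h
    obtain ⟨a, b, ha, hb', rfl⟩ := exists_of_mul_ne_zero h
    exact (sA₃ ha).1.trans_le (Nat.le_mul_of_pos_right _ (hne0 hb'))
  have sTI : ∀ f : ArithmeticFunction ℝ, ∀ n, cutLe W (A₃ * f) n ≠ 0 → V < n ∧ n ≤ X / V := fun f n h =>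
    ⟨sA₃mul (cutLe_ne_zero h).2, (cutLe_ne_zero h).1⟩
  -- terms that vanish on the window
  have zlow : ∀ {f g : ArithmeticFunction ℝ}, (∀ {n}, f n ≠ 0 → n ≤ U) → (∀ {n}, g n ≠ 0 → n ≤ V) →
      windowSum X w (f * g) = 0 := by
    intro f g hf hg
    refine windowSum_eq_zero w fun n h => Or.inl ?_
    obtain ⟨a, b, ha, hb', rfl⟩ := exists_of_mul_ne_zero h
    have := Nat.mul_le_mul (hf ha) (hg hb')
    omega
  have zhigh : ∀ {f g : ArithmeticFunction ℝ}, (∀ {n}, f n ≠ 0 → W < n) →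
      windowSum X w (f * cutGt V g) = 0 := by
    intro f g hf
    refine windowSum_eq_zero w fun n h => Or.inr ?_
    obtain ⟨a, b, ha, hb', rfl⟩ := exists_of_mul_ne_zero h
    exact hWX.trans_le (Nat.mul_le_mul (hf ha) (cutGt_ne_zero hb').1.le)
  have zmid : ∀ {f g : ArithmeticFunction ℝ}, (∀ {n}, f n ≠ 0 → n ≤ U) →
      windowSum X w (A₃ * f * cutLe U g) = 0 := by
    intro f g hf
    refine windowSum_eq_zero w fun n h => Or.inl ?_
    obtain ⟨x, b, hx, hb', rfl⟩ := exists_of_mul_ne_zero h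
    obtain ⟨a, c, ha, hc', rfl⟩ := exists_of_mul_ne_zero hx
    have h1 := Nat.mul_le_mul (hf hc') (cutLe_ne_zero hb').1
    calc 8 * (a * c * b) = a * (8 * (c * b)) := by ring
      _ ≤ W * V := Nat.mul_le_mul (sA₃ ha).2 (by omega)
      _ ≤ X := hWV
  have ztop : windowSum X w (A₃ * A * L₃) = 0 := by
    refine windowSum_eq_zero w fun n h => Or.inr ?_
    obtain ⟨x, b, hx, hb', rfl⟩ := exists_of_mul_ne_zero h
    obtain ⟨a, c, ha, hc', rfl⟩ := exists_of_mul_ne_zero hx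
    have h1 := Nat.mul_le_mul (Nat.mul_le_mul (sA₃ ha).1 (sA hc')) (cutGt_ne_zero hb').1
    calc X ≤ V * V * U := hXU
      _ < (V + 1) * (U + 1) * (V + 1) := by nlinarith
      _ ≤ a * c * b := h1
  have zL₁ : windowSum X w L₁ = 0 := by
    refine windowSum_eq_zero w fun n h => Or.inl ?_
    have := (cutLe_ne_zero h).1
    nlinarith
  have slow : ∀ f : ArithmeticFunction ℝ, ∀ {n}, (cutLe U f + cutGt U (cutLe V f)) n ≠ 0 → n ≤ V := by
    intro f n h
    by_contra! hn
    refine h ?_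
    rw [add_apply, cutLe_apply, cutGt_apply, cutLe_apply]
    simp [show ¬ n ≤ U by omega, show ¬ n ≤ V by omega]
  -- coefficient bounds
  have hlogn : ∀ n ∈ Icc 1 X, Real.log n ≤ D := fun n hn =>
    (Real.log_le_log (by exact_mod_cast (mem_Icc.1 hn).1) (by exact_mod_cast (mem_Icc.1 hn).2)).trans hlog
  have bμ : BoundedBy X D 0 (moebius : ArithmeticFunction ℝ) := by
    intro n _
    rw [intCoe_apply, pow_zero]
    exact_mod_cast abs_moebius_le_one
  have bz : BoundedBy X D 0 z := by
    intro n _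
    rw [hz, natCoe_apply, zeta_apply, pow_zero]
    split_ifs <;> simp
  have bΛ : BoundedBy X D 1 vonMangoldt := by
    intro n hn
    rw [pow_one, abs_of_nonneg vonMangoldt_nonneg]
    exact vonMangoldt_le_log.trans (hlogn n hn)
  have bl : BoundedBy X D 1 log := by
    intro n hn
    rw [pow_one, log_apply, abs_of_nonneg (Real.log_natCast_nonneg _)]
    exact hlogn n hn
  have bm : BoundedBy X D 0 m := bμ.cutLe U
  have bL₂ : BoundedBy X D 1 L₂ := (bΛ.cutLe V).cutGt U
  have bA : BoundedBy X D 1 A := (bμ.cutGt U).mul hD hd bz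
  have bA₃ : BoundedBy X D 1 A₃ := (bA.cutLe W).cutGt V
  have bB : BoundedBy X D 2 (m * L₁) := bm.mul hD hd (bΛ.cutLe U)
  have bA₃m : BoundedBy X D 2 (A₃ * m) := bA₃.mul hD hd bm
  have bA₃B : BoundedBy X D 4 (A₃ * B₁) := bA₃.mul hD hd (bB.cutLe U)
  -- the remaining terms
  have II₁ := norm_windowSum_typeII hb hD bL₂ bA (by norm_num) (by norm_num) (smid _)
  have II₂ : ‖windowSum X w (A₂ * L₃)‖ ≤ E :=
    norm_windowSum_typeII hb hD (bA.cutLe V) (bΛ.cutGt V) (by norm_num) (by norm_num) sA₂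
  have II₃ : ‖windowSum X w (l₂ * (A₃ * m))‖ ≤ E :=
    norm_windowSum_typeII hb hD ((bl.cutLe V).cutGt U) bA₃m (by norm_num) (by norm_num) (smid _)
  have II₄ := norm_windowSum_typeII hb hD bL₂ (bA₃.mul hD hd bA) (by norm_num) (by norm_num) (smid _)
  have II₅ : ‖windowSum X w (B₂ * z)‖ ≤ E :=
    norm_windowSum_typeII hb hD (bB.cutGt U) bz (by norm_num) (by norm_num) sB₂
  have II₆ := norm_windowSum_typeII hb hD bL₂ bA₃ (by norm_num) (by norm_num) (smid _)
  have II₇ : ‖windowSum X w (B₂ * (A₃ * z))‖ ≤ E :=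
    norm_windowSum_typeII hb hD (bB.cutGt U) (bA₃.mul hD hd bz) (by norm_num) (by norm_num) sB₂
  have II₈ : ‖windowSum X w (z₂ * (A₃ * B₁))‖ ≤ E :=
    norm_windowSum_typeII hb hD ((bz.cutLe V).cutGt U) bA₃B (by norm_num) (by norm_num) (smid _)
  have I₁ : ‖windowSum X w (m * l₃)‖ ≤ Real.log X * E :=
    norm_windowSum_log hb hD hVX bm (by norm_num) (Or.inl fun _ => sm)
  have I₂ : ‖windowSum X w (P₁ * l₃)‖ ≤ Real.log X * E :=
    norm_windowSum_log hb hD hVX (bA₃m.cutLe W) (by norm_num) (Or.inr (sTI _))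
  have I₃ : ‖windowSum X w (B₁ * z₃)‖ ≤ E :=
    norm_windowSum_zeta hb hD (bB.cutLe U) (by norm_num) (Or.inl fun _ => sB₁)
  have I₄ : ‖windowSum X w (R₁ * z₃)‖ ≤ E :=
    norm_windowSum_zeta hb hD (bA₃B.cutLe W) (by norm_num) (Or.inr (sTI _))
  have hE : 0 ≤ E := (norm_nonneg _).trans I₃
  rw [hid]
  have Z₁ : windowSum X w (m * (l₁ + l₂)) = 0 := zlow sm (slow log)
  have Z₂ : windowSum X w (B₁ * (z₁ + z₂)) = 0 := zlow sB₁ (slow z)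
  have Z₃ : windowSum X w (A₄ * L₃) = 0 := zhigh fun h => (cutGt_ne_zero h).1
  have Z₄ : windowSum X w (A₃ * m * l₁) = 0 := zmid sm
  have Z₅ : windowSum X w (P₂ * l₃) = 0 := zhigh fun h => (cutGt_ne_zero h).1
  have Z₆ : windowSum X w (A₃ * B₁ * z₁) = 0 := zmid sB₁
  have Z₇ : windowSum X w (R₂ * z₃) = 0 := zhigh fun h => (cutGt_ne_zero h).1
  simp only [windowSum_add, windowSum_sub, Z₁, Z₂, Z₃, Z₄, Z₅, Z₆, Z₇, zL₁, ztop, add_zero, sub_zero, zero_add]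
  have hE' : 0 ≤ Real.log X * E := mul_nonneg (Real.log_natCast_nonneg X) hE
  have key : ∀ a₁ a₂ a₃ a₄ b₁ b₂ b₃ b₄ b₅ b₆ b₇ b₈ : ℂ,
      ‖a₁ + a₂ - (a₃ + a₄) + (b₁ + b₂ + b₃ + b₄ - (b₅ + b₆ + b₇ + b₈))‖ ≤
        (‖a₁‖ + ‖a₂‖) + (‖a₃‖ + ‖a₄‖) + ((‖b₁‖ + ‖b₂‖ + ‖b₃‖ + ‖b₄‖) + (‖b₅‖ + ‖b₆‖ + ‖b₇‖ + ‖b₈‖)) := by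
    intros
    refine (norm_add_le _ _).trans (add_le_add ((norm_sub_le _ _).trans (add_le_add (norm_add_le _ _)
      (norm_add_le _ _))) ((norm_sub_le _ _).trans (add_le_add norm_add₄_le norm_add₄_le)))
  refine (key _ _ _ _ _ _ _ _ _ _ _ _).trans ?_
  linarith

end ArithmeticFunction

lemma nint_neg (x : ℝ) : nint (-x) = nint x := by
  have key : ∀ y : ℝ, nint (-y) ≤ nint y := by
    intro y
    have := round_le (-y) (-round y)
    unfold nint
    refine this.trans (le_of_eq ?_)
    push_cast
    rw [← abs_neg]
    congr 1
    ring
  refine le_antisymm (key x) ?_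
  simpa using key (-x)

lemma nint_nonneg (x : ℝ) : 0 ≤ nint x := abs_nonneg _

lemma nint_le_abs_sub (x : ℝ) (k : ℤ) : nint x ≤ |x - k| := round_le x k

lemma norm_sum_e_mul_le {T : Finset ℕ} (hT : (T : Set ℕ).OrdConnected) {y : ℝ} (hy : 0 < nint y) :
    ‖∑ m ∈ T, e (y * m)‖ ≤ 2 / nint y := by
  have h1 := nint_le_abs_sub y ⌊y⌋
  have h2 := nint_le_abs_sub y (⌊y⌋ + 1)
  rw [abs_of_nonneg (by linarith [Int.floor_le y])] at h1
  rw [abs_of_nonpos (by push_cast; linarith [Int.lt_floor_add_one y])] at h2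
  push_cast at h2
  have := kusmin_landau (T.map Nat.castEmbedding) (ordConnected_map_cast T hT) (fun i => y * i) (nint y) hy ⌊y⌋
    (fun i _ _ => by push_cast; linarith) (fun i _ _ => by push_cast; linarith)
    (Or.inl fun i _ _ _ => by push_cast; linarith)
  rw [sum_map] at this
  refine (le_of_eq (by simp)).trans (this.trans ?_)
  have h3 : 1 ≤ 1 / nint y := by
    rw [le_div_iff₀ hy]
    linarith
  calc 1 + 1 / nint y ≤ 1 / nint y + 1 / nint y := by linarith
    _ = 2 / nint y := by ring

lemma typeI_linear {X K T : ℕ} {ξ Y Q : ℝ} (hpos : ∀ d ∈ Icc 1 K, 0 < nint (ξ * d))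
    (hQ : ∑ d ∈ Icc 1 K, 1 / nint (ξ * d) ≤ Q) (hY : 0 ≤ Y) {a : ℕ → ℂ} (ha : ∀ n, ‖a n‖ ≤ Y)
    (hsupp : ∀ n, a n ≠ 0 → n ≤ K) :
    ‖bilin X (fun n => e (ξ * n)) a (fun m => if T < m then 1 else 0)‖ ≤ Y * (2 * Q) := by
  have h1 : ∀ n ∈ Icc 1 X, ‖∑ m ∈ Icc 1 X, (if X < 8 * (m * n) ∧ m * n ≤ X then
      a n * (if T < m then 1 else 0) * e (ξ * (m * n : ℕ)) else 0)‖ ≤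
      if n ∈ Icc 1 K then Y * (2 / nint (ξ * n)) else 0 := by
    intro n hn
    by_cases h0 : a n = 0
    · simp only [h0, zero_mul, ite_self, sum_const_zero, norm_zero]
      split_ifs
      · exact mul_nonneg hY (div_nonneg zero_le_two (nint_nonneg _))
      · exact le_rfl
    have hnK : n ∈ Icc 1 K := mem_Icc.2 ⟨(mem_Icc.1 hn).1, hsupp n h0⟩
    rw [if_pos hnK]
    have : ∑ m ∈ Icc 1 X, (if X < 8 * (m * n) ∧ m * n ≤ X then
      a n * (if T < m then 1 else 0) * e (ξ * (m * n : ℕ)) else 0) =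
      a n * ∑ m ∈ (Icc 1 X).filter (fun m => T < m ∧ X < 8 * (m * n) ∧ m * n ≤ X), e (ξ * n * m) := by
      rw [mul_sum, sum_filter]
      refine sum_congr rfl fun m _ => ?_
      have : ξ * (m * n : ℕ) = ξ * n * m := by push_cast; ring
      rw [this]
      split_ifs <;> first | tauto | simp
    rw [this, norm_mul]
    exact mul_le_mul (ha n) (norm_sum_e_mul_le (ordConnected_filter_window_gt n X T) (hpos n hnK))
      (norm_nonneg _) hY
  refine (norm_sum_le _ _).trans ((sum_le_sum h1).trans ?_)
  rw [← sum_filter]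
  calc _ ≤ ∑ n ∈ Icc 1 K, Y * (2 / nint (ξ * n)) := by
        refine sum_le_sum_of_subset_of_nonneg (fun n hn => (mem_filter.1 hn).2) fun n hn _ => ?_
        exact mul_nonneg hY (div_nonneg zero_le_two (nint_nonneg _))
    _ = Y * (2 * ∑ d ∈ Icc 1 K, 1 / nint (ξ * d)) := by
        rw [mul_sum, mul_sum]
        exact sum_congr rfl fun n _ => by ring
    _ ≤ _ := by gcongr

lemma sum_Ioo_neg_inv_nint_le {K N : ℕ} {ξ Q : ℝ} (hNK : N ≤ K + 1)
    (hQ : ∑ d ∈ Icc 1 K, 1 / nint (ξ * d) ≤ Q) :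
    ∑ r ∈ (Ioo (-(N : ℤ)) N).erase 0, 2 / nint (ξ * r) ≤ 4 * Q := by
  have hnn : ∀ r : ℤ, 0 ≤ 2 / nint (ξ * r) := fun r => div_nonneg zero_le_two (nint_nonneg _)
  have hsub : (Ioo (-(N : ℤ)) N).erase 0 ⊆
      ((Icc 1 K).image fun d : ℕ => (d : ℤ)) ∪ ((Icc 1 K).image fun d : ℕ => -(d : ℤ)) := by
    intro r hr
    simp only [mem_erase, mem_Ioo, mem_union, mem_image, mem_Icc] at hr ⊢
    rcases le_total 0 r with h | h
    · exact Or.inl ⟨r.toNat, by omega, by omega⟩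
    · exact Or.inr ⟨(-r).toNat, by omega, by omega⟩
  calc _ ≤ ∑ r ∈ ((Icc 1 K).image fun d : ℕ => (d : ℤ)) ∪ ((Icc 1 K).image fun d : ℕ => -(d : ℤ)),
        2 / nint (ξ * r) := sum_le_sum_of_subset_of_nonneg hsub fun r _ _ => hnn r
    _ ≤ ∑ r ∈ ((Icc 1 K).image fun d : ℕ => (d : ℤ)), 2 / nint (ξ * r) +
        ∑ r ∈ ((Icc 1 K).image fun d : ℕ => -(d : ℤ)), 2 / nint (ξ * r) := by
        rw [← sum_union_inter]
        exact le_add_of_nonneg_right (sum_nonneg fun r _ => hnn r)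
    _ = 4 * ∑ d ∈ Icc 1 K, 1 / nint (ξ * d) := by
        rw [sum_image (fun x _ y _ h => by simpa using h), sum_image (fun x _ y _ h => by simpa using h),
          ← sum_add_distrib, mul_sum]
        refine sum_congr rfl fun d _ => ?_
        push_cast
        rw [mul_neg, nint_neg]
        ring
    _ ≤ _ := by gcongr

lemma typeII_linear_dyadic {X K N : ℕ} {ξ Y Q : ℝ} (hpos : ∀ d ∈ Icc 1 K, 0 < nint (ξ * d))
    (hQ : ∑ d ∈ Icc 1 K, 1 / nint (ξ * d) ≤ Q) (hN : 0 < N) (hNK : N ≤ K + 1) {a b : ℕ → ℂ}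
    (ha : ∀ n, ‖a n‖ ≤ Y) (hb : ∀ n, ‖b n‖ ≤ Y) :
    ‖∑ m ∈ Icc 1 (X / N), b m * ∑ n ∈ Ico N (2 * N),
        (if X < 8 * (m * n) ∧ m * n ≤ X then a n * e (ξ * (m * n : ℕ)) else 0)‖ ^ 2 ≤
      Y ^ 4 * (X * (X / N + 4 * Q)) := by
  have hN0 : (0 : ℝ) < N := by exact_mod_cast hN
  have hQ0 : 0 ≤ Q := le_trans (sum_nonneg fun d _ => div_nonneg zero_le_one (nint_nonneg _)) hQ
  have hcard : ((Icc 1 (X / N)).card : ℝ) ≤ X / N := by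
    rw [Nat.card_Icc, Nat.add_sub_cancel]
    exact Nat.cast_div_le
  set g : ℤ → ℝ := fun r => if r = 0 then (X / N : ℝ) else 2 / nint (ξ * r) with hg
  have hg0 : ∀ r, 0 ≤ g r := by
    intro r
    simp only [hg]
    split_ifs
    · positivity
    · exact div_nonneg zero_le_two (nint_nonneg _)
  have hc := bilinear_cauchy (Ico N (2 * N)) (Icc 1 (X / N)) 1 (fun _ => 0) (by simp) Y b (fun m _ => hb m) a
    (fun n _ => ha n) (fun n m => ξ * (m * n : ℕ)) (fun n m => X < 8 * (m * n) ∧ m * n ≤ X)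
  refine hc.trans ?_
  have hpair : ∀ q ∈ Ico N (2 * N) ×ˢ Ico N (2 * N),
      ‖∑ m ∈ (Icc 1 (X / N)).filter (fun m => (X < 8 * (m * q.1) ∧ m * q.1 ≤ X) ∧ X < 8 * (m * q.2) ∧
        m * q.2 ≤ X), e (ξ * (m * q.1 : ℕ) - ξ * (m * q.2 : ℕ))‖ ≤ g ((q.2 : ℤ) - q.1) := by
    intro q hq
    rw [mem_product, mem_Ico, mem_Ico] at hq
    simp only [hg]
    split_ifs with h
    · refine (norm_sum_e_le_card _ _).trans (le_trans ?_ hcard)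
      exact_mod_cast card_filter_le _ _
    · have hne : 0 < nint (ξ * ((q.2 : ℤ) - q.1 : ℤ)) := by
        rcases lt_or_gt_of_ne h with h' | h'
        · have := hpos (q.1 - q.2) (mem_Icc.2 (by omega))
          rw [← nint_neg]
          convert this using 2
          push_cast [show q.2 ≤ q.1 by omega]
          ring
        · have := hpos (q.2 - q.1) (mem_Icc.2 (by omega))
          convert this using 2
          push_cast [show q.1 ≤ q.2 by omega]
          ring
      have h1 : ∀ m : ℕ, ξ * (m * q.1 : ℕ) - ξ * (m * q.2 : ℕ) = -(ξ * ((q.2 : ℤ) - q.1 : ℤ)) * m := by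
        intro m; push_cast; ring
      simp only [h1]
      rw [← nint_neg] at hne ⊢
      exact norm_sum_e_mul_le (ordConnected_filter_window q.1 q.2 X (X / N)) hne
  have hsum : ∑ q ∈ Ico N (2 * N) ×ˢ Ico N (2 * N), g ((q.2 : ℤ) - q.1) ≤ N * (X / N + 4 * Q) := by
    rw [sum_product]
    have h := sum_sum_sub_le ((Ico N (2 * N)).map Nat.castEmbedding : Finset ℤ) (Ioo (-(N : ℤ)) N) g
      (fun r _ => hg0 r) (by
        intro b hb b' hb'
        simp only [Finset.mem_map, mem_Ico, Nat.castEmbedding_apply] at hb hb'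
        obtain ⟨b, hb, rfl⟩ := hb
        obtain ⟨b', hb', rfl⟩ := hb'
        rw [mem_Ioo]
        omega)
    simp only [sum_map, card_map, Nat.castEmbedding_apply, Nat.card_Ico] at h
    refine h.trans ?_
    rw [show 2 * N - N = N by omega]
    gcongr
    rw [← add_sum_erase _ _ (show (0 : ℤ) ∈ Ioo (-(N : ℤ)) N by rw [mem_Ioo]; omega)]
    refine add_le_add (by simp [hg]) ?_
    refine le_trans (sum_le_sum fun r hr => ?_) (sum_Ioo_neg_inv_nint_le hNK hQ)
    simp only [hg]
    rw [if_neg (mem_erase.1 hr).1]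
  have hsum2 := (sum_le_sum hpair).trans hsum
  simp only [filter_true, Nat.cast_one, mul_one]
  calc _ ≤ Y ^ 4 * (X / N) * (N * (X / N + 4 * Q)) := by
        have : 0 ≤ Y := (norm_nonneg _).trans (ha 0)
        gcongr
    _ = _ := by field_simp

lemma sum_inv_nint_le {α : ℝ} {a : ℤ} {q K : ℕ} (hq : 0 < q) (hcop : IsCoprime a (q : ℤ))
    (hα : |α - a / q| ≤ 1 / (q : ℝ) ^ 2) (hK : 2 * K ≤ q) :
    (∀ d ∈ Icc 1 K, 0 < nint (α * d)) ∧ ∑ d ∈ Icc 1 K, 1 / nint (α * d) ≤ 4 * q * (1 + Real.log q) := by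
  have hq0 : (0 : ℝ) < q := by exact_mod_cast hq
  set s : ℕ → ℕ := fun d => ((d * a) % (q : ℤ)).toNat with hs
  have hsz : ∀ d, (s d : ℤ) = (d * a) % (q : ℤ) := fun d => Int.toNat_of_nonneg (Int.emod_nonneg _ (by omega))
  have hslt : ∀ d, s d < q := fun d => by
    have := Int.emod_lt_of_pos (d * a : ℤ) (show (0 : ℤ) < q by omega)
    have := hsz d
    omega
  have hinj : ∀ d ≤ K, ∀ d' ≤ K, s d = s d' → d = d' := by
    intro d hd d' hd' h
    have h1 : (d * a : ℤ) % q = (d' * a) % q := by rw [← hsz, ← hsz, h]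
    have h2 : (q : ℤ) ∣ (d' - d) * a := by
      rw [sub_mul]
      exact Int.ModEq.dvd h1
    have h3 : (q : ℤ) ∣ d' - d := (hcop.symm).dvd_of_dvd_mul_right h2
    have h4 := Int.eq_zero_of_abs_lt_dvd h3 (by rw [abs_lt]; omega)
    omega
  have hspos : ∀ d ∈ Icc 1 K, 0 < s d := by
    intro d hd
    rw [mem_Icc] at hd
    by_contra h0
    have : s d = s 0 := by
      have : s 0 = 0 := by simp [hs]
      omega
    have := hinj d hd.2 0 (by omega) this
    omega
  have hlow : ∀ d ∈ Icc 1 K, (min (s d) (q - s d) : ℝ) / (2 * q) ≤ nint (α * d) := by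
    intro d hd
    have hd1 := mem_Icc.1 hd
    have h1 : (1 : ℝ) ≤ s d := by exact_mod_cast hspos d hd
    have h2 : (s d : ℝ) + 1 ≤ q := by exact_mod_cast hslt d
    have hmin1 : 1 ≤ (min (s d) (q - s d) : ℝ) := le_min h1 (by linarith)
    set k := round (α * d) with hk
    have hdiv : (d * a : ℝ) = s d + q * ((d * a / q : ℤ) : ℝ) := by
      have := Int.emod_add_mul_ediv (d * a : ℤ) q
      rw [← hsz] at this
      exact_mod_cast this.symm
    set j : ℤ := d * a / q with hj
    have herr : |α * d - d * a / q| ≤ 1 / (2 * q) := by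
      have : α * d - d * a / q = d * (α - a / q) := by ring
      rw [this, abs_mul, Nat.abs_cast]
      calc (d : ℝ) * |α - a / q| ≤ (q / 2) * (1 / (q : ℝ) ^ 2) := by
            refine mul_le_mul ?_ hα (abs_nonneg _) (by positivity)
            have : 2 * (d : ℝ) ≤ q := by exact_mod_cast (by omega)
            linarith
        _ = _ := by field_simp
    have hmain : (min (s d) (q - s d) : ℝ) / q ≤ |(d * a / q : ℝ) - k| := by
      have : (d * a / q : ℝ) - k = (s d + q * ((j - k : ℤ) : ℝ)) / q := by
        rw [hdiv]; push_cast; field_simp; ring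
      rw [this, abs_div, abs_of_pos hq0]
      gcongr
      rcases lt_or_ge (j - k) 0 with h | h
      · have : ((j - k : ℤ) : ℝ) ≤ -1 := by exact_mod_cast (by omega)
        refine (min_le_right _ _).trans (le_trans ?_ (neg_le_abs _))
        nlinarith
      · have : (0 : ℝ) ≤ ((j - k : ℤ) : ℝ) := by exact_mod_cast h
        refine (min_le_left _ _).trans (le_trans ?_ (le_abs_self _))
        nlinarith
    have htri : |(d * a / q : ℝ) - k| ≤ |α * d - d * a / q| + nint (α * d) := by
      have : (d * a / q : ℝ) - k = -(α * d - d * a / q) + (α * d - k) := by ring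
      rw [this, ← abs_neg (α * d - d * a / q)]
      exact abs_add_le _ _
    have h5 : 1 / (2 * q : ℝ) ≤ (min (s d) (q - s d) : ℝ) / (2 * q) := by gcongr
    have h6 : (min (s d) (q - s d) : ℝ) / q = (min (s d) (q - s d) : ℝ) / (2 * q) +
      (min (s d) (q - s d) : ℝ) / (2 * q) := by field_simp; ring
    linarith
  have hminpos : ∀ d ∈ Icc 1 K, 0 < (min (s d) (q - s d) : ℝ) := by
    intro d hd
    have h1 : (0 : ℝ) < s d := by exact_mod_cast hspos d hd
    have h2 : (s d : ℝ) < q := by exact_mod_cast hslt d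
    exact lt_min h1 (by linarith)
  refine ⟨fun d hd => lt_of_lt_of_le (div_pos (hminpos d hd) (by positivity)) (hlow d hd), ?_⟩
  have hterm : ∀ d ∈ Icc 1 K, 1 / nint (α * d) ≤ 2 * q * (1 / (s d : ℝ) + 1 / ((q - s d : ℕ) : ℝ)) := by
    intro d hd
    have h1 : (0 : ℝ) < s d := by exact_mod_cast hspos d hd
    have h2 : (s d : ℝ) < q := by exact_mod_cast hslt d
    rw [Nat.cast_sub (hslt d).le]
    have h3 : (0 : ℝ) < q - s d := by linarith
    calc 1 / nint (α * d) ≤ 1 / ((min (s d) (q - s d) : ℝ) / (2 * q)) :=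
          one_div_le_one_div_of_le (div_pos (hminpos d hd) (by positivity)) (hlow d hd)
      _ = 2 * q * (1 / (min (s d) (q - s d) : ℝ)) := by field_simp
      _ ≤ _ := by
          gcongr
          rcases min_choice (s d : ℝ) (q - s d) with h | h <;> rw [h]
          · exact le_add_of_nonneg_right (by positivity)
          · exact le_add_of_nonneg_left (by positivity)
  have hS : ∀ t : ℕ → ℕ, (∀ d ∈ Icc 1 K, t d ∈ Icc 1 q) → (∀ d ∈ Icc 1 K, ∀ d' ∈ Icc 1 K, t d = t d' → d = d') →
      ∑ d ∈ Icc 1 K, 1 / (t d : ℝ) ≤ 1 + Real.log q := by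
    intro t ht hti
    rw [← sum_image (f := fun r : ℕ => 1 / (r : ℝ)) (g := t) (fun x hx y hy h => hti x hx y hy h)]
    refine le_trans (sum_le_sum_of_subset_of_nonneg (t := Icc 1 q) ?_ fun _ _ _ => by positivity) (sum_inv_le_log q)
    intro r hr
    obtain ⟨d, hd, rfl⟩ := mem_image.1 hr
    exact ht d hd
  calc _ ≤ ∑ d ∈ Icc 1 K, 2 * q * (1 / (s d : ℝ) + 1 / ((q - s d : ℕ) : ℝ)) := sum_le_sum hterm
    _ = 2 * q * (∑ d ∈ Icc 1 K, 1 / (s d : ℝ) + ∑ d ∈ Icc 1 K, 1 / ((q - s d : ℕ) : ℝ)) := by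
        rw [← mul_sum, sum_add_distrib]
    _ ≤ 2 * q * ((1 + Real.log q) + (1 + Real.log q)) := by
        gcongr
        · refine hS s (fun d hd => ?_) fun d hd d' hd' h => hinj d (mem_Icc.1 hd).2 d' (mem_Icc.1 hd').2 h
          have := hspos d hd; have := hslt d; rw [mem_Icc]; omega
        · refine hS (fun d => q - s d) (fun d hd => ?_) fun d hd d' hd' h =>
            hinj d (mem_Icc.1 hd).2 d' (mem_Icc.1 hd').2 ?_
          · have := hspos d hd; have := hslt d; rw [mem_Icc]; omega
          · have := hslt d; have := hslt d'
            omega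
    _ = _ := by ring

lemma sum_inv_nint_mul_le {α : ℝ} {a : ℤ} {q K l L : ℕ} (hq : 0 < q) (hcop : IsCoprime a (q : ℤ))
    (hα : |α - a / q| ≤ 1 / (q : ℝ) ^ 2) (hl : 0 < l) (hlL : l ≤ L) (hK : 2 * (L * K) ≤ q) :
    (∀ d ∈ Icc 1 K, 0 < nint (l * α * d)) ∧
      ∑ d ∈ Icc 1 K, 1 / nint (l * α * d) ≤ 4 * q * (1 + Real.log q) := by
  obtain ⟨h1, h2⟩ := sum_inv_nint_le hq hcop hα hK
  have hmem : ∀ d ∈ Icc 1 K, l * d ∈ Icc 1 (L * K) := by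
    intro d hd
    rw [mem_Icc] at hd ⊢
    exact ⟨Nat.mul_pos hl hd.1, Nat.mul_le_mul hlL hd.2⟩
  have hcast : ∀ d : ℕ, l * α * d = α * (l * d : ℕ) := fun d => by push_cast; ring
  refine ⟨fun d hd => by rw [hcast]; exact h1 _ (hmem d hd), le_trans ?_ h2⟩
  simp only [hcast]
  rw [← sum_image (f := fun k : ℕ => 1 / nint (α * k)) (g := fun d => l * d)
    (fun x _ y _ h => Nat.eq_of_mul_eq_mul_left hl h)]
  refine sum_le_sum_of_subset_of_nonneg ?_ fun k _ _ => div_nonneg zero_le_one (nint_nonneg _)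
  intro k hk
  obtain ⟨d, hd, rfl⟩ := mem_image.1 hk
  exact hmem d hd

lemma exists_cutoffs {v ε : ℝ} (hε : 0 < ε) (hv1 : 2 + 6 * ε ≤ 5 * v) (hv2 : 2 * v + 2 * ε ≤ 1) :
    ∀ᶠ X : ℕ in atTop, ∃ U V : ℕ, (X : ℝ) ^ (1 - 2 * v) ≤ U ∧ (U : ℝ) ≤ (X : ℝ) ^ (1 - 2 * v + ε) ∧
      (X : ℝ) ^ v ≤ V ∧ (V : ℝ) ≤ (X : ℝ) ^ (v + ε) ∧ 0 < V ∧ V < X ∧ 8 * (U * U) ≤ V ∧ 8 * (U * V) ≤ X ∧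
      X ≤ V * V * U ∧ V * V ≤ X := by
  filter_upwards [eventually_ge_atTop 2, eventually_const_le 2 hε, eventually_const_le 8 hε] with X hX2 h2X h8X
  have hX2' : (2 : ℝ) ≤ X := by exact_mod_cast hX2
  have hX : (1 : ℝ) ≤ X := by linarith
  have hX0 : (0 : ℝ) < X := by linarith
  have hup : ∀ t : ℝ, 0 ≤ t → (⌈(X : ℝ) ^ t⌉₊ : ℝ) ≤ (X : ℝ) ^ (t + ε) := by
    intro t ht
    have h1 := Real.one_le_rpow hX ht
    have h2 := (Nat.ceil_lt_add_one (Real.rpow_nonneg hX0.le t)).le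
    calc (⌈(X : ℝ) ^ t⌉₊ : ℝ) ≤ 2 * (X : ℝ) ^ t := by linarith
      _ ≤ _ := mul_le_rpow hX (by positivity) h2X le_rfl (by linarith)
  have hUu := hup (1 - 2 * v) (by linarith)
  have hVu := hup v (by linarith)
  have hUl := Nat.le_ceil ((X : ℝ) ^ (1 - 2 * v))
  have hVl := Nat.le_ceil ((X : ℝ) ^ v)
  set U := ⌈(X : ℝ) ^ (1 - 2 * v)⌉₊
  set V := ⌈(X : ℝ) ^ v⌉₊
  have hX1' : (X : ℝ) ^ (1 : ℝ) = X := Real.rpow_one _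
  have hV0 : 0 < V := Nat.ceil_pos.2 (Real.rpow_pos_of_pos hX0 _)
  have hVV : V * V ≤ X := by
    have : (V : ℝ) * V ≤ (X : ℝ) ^ (1 : ℝ) := mul_le_rpow hX (by positivity) hVu hVu (by linarith)
    rw [hX1'] at this
    exact_mod_cast this
  refine ⟨U, V, hUl, hUu, hVl, hVu, hV0, ?_, ?_, ?_, ?_, hVV⟩
  · by_contra! h
    have := Nat.mul_le_mul h h
    nlinarith
  · have : (8 : ℝ) * (U * U) ≤ (X : ℝ) ^ v := mul_le_rpow hX (by positivity) h8X
      (mul_le_rpow hX (by positivity) hUu hUu le_rfl) (by linarith)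
    exact_mod_cast this.trans hVl
  · have : (8 : ℝ) * (U * V) ≤ (X : ℝ) ^ (1 : ℝ) := mul_le_rpow hX (by positivity) h8X
      (mul_le_rpow hX (by positivity) hUu hVu le_rfl) (by linarith)
    rw [hX1'] at this
    exact_mod_cast this
  · have : (X : ℝ) ≤ V * V * U := by
      calc (X : ℝ) = (X : ℝ) ^ v * (X : ℝ) ^ v * (X : ℝ) ^ (1 - 2 * v) := by
            rw [← Real.rpow_add hX0, ← Real.rpow_add hX0, show v + v + (1 - 2 * v) = 1 by ring, hX1']
        _ ≤ _ := by gcongr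
    exact_mod_cast this

namespace ArithmeticFunction

variable {X U V : ℕ} {w : ℕ → ℂ} {Y E : ℝ}

lemma BilinearBounds.of_forall (hY : 0 ≤ Y)
    (h2 : ∀ a b : ℕ → ℂ, (∀ n, ‖a n‖ ≤ Y) → (∀ n, ‖b n‖ ≤ Y) → (∀ n, a n ≠ 0 → U < n ∧ n ≤ V) →
      ‖bilin X w a b‖ ≤ E)
    (h1 : ∀ (T : ℕ) (a : ℕ → ℂ), (∀ n, ‖a n‖ ≤ Y) →
      ((∀ n, a n ≠ 0 → n ≤ U) ∨ ∀ n, a n ≠ 0 → V < n ∧ n ≤ X / V) →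
      ‖bilin X w a (fun m => if T < m then 1 else 0)‖ ≤ E) : BilinearBounds X U V w Y E := by
  set tr : (ℕ → ℂ) → ℕ → ℂ := fun a n => if n ∈ Icc 1 X then a n else 0 with htr
  have tr1 : ∀ a, ∀ n ∈ Icc 1 X, a n = tr a n := fun a n hn => (if_pos hn).symm
  have tr2 : ∀ a : ℕ → ℂ, (∀ n ∈ Icc 1 X, ‖a n‖ ≤ Y) → ∀ n, ‖tr a n‖ ≤ Y := by
    intro a ha n
    simp only [htr]
    split_ifs with h
    · exact ha n h
    · simpa using hY
  have tr3 : ∀ {a : ℕ → ℂ} {n}, tr a n ≠ 0 → a n ≠ 0 := by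
    intro a n h h0
    simp [htr, h0] at h
  constructor
  · intro a b ha hb hs
    rw [bilin_congr (tr1 a) (tr1 b)]
    exact h2 _ _ (tr2 a ha) (tr2 b hb) fun n h => hs n (tr3 h)
  · intro T _ a ha hs
    rw [bilin_congr (tr1 a) (fun n _ => rfl)]
    exact h1 T _ (tr2 a ha) (hs.imp (fun hs n h => hs n (tr3 h)) fun hs n h => hs n (tr3 h))

lemma bilinearBounds_powerWeight {γ η θ ε u v σ : ℝ} (hη0 : 0 < η) (hη1 : η < 1 / 2) (hγ : γ = 1 - η)
    (hθ : 0 < θ) (hε : 0 < ε) (hu : η + 2 * θ + 40 * ε ≤ u) (hv : v + ε ≤ 1 - 5 * η - 6 * θ - 100 * ε)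
    (hu2 : 1 / 2 + η + (u + ε) ≤ 1 - θ - 30 * ε) (hσ : η ≤ 2 * σ) (h8 : 8 * σ + 30 * ε ≤ 1)
    (h4 : 4 * σ + 31 * ε ≤ v) (hvσ : 1 + η + 2 * ε ≤ 2 * v + 2 * σ) (hσθ : η + θ + 20 * ε ≤ σ) :
    ∀ᶠ X : ℕ in atTop, ∀ (U V H : ℕ) (ξ : ℝ) (c : ℕ → ℂ), (X : ℝ) ^ u ≤ U → (U : ℝ) ≤ (X : ℝ) ^ (u + ε) →
      (X : ℝ) ^ v ≤ V → (V : ℝ) ≤ (X : ℝ) ^ (v + ε) → 0 < H → (H : ℝ) ≤ (X : ℝ) ^ (η + ε) →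
      (∀ n, ‖c n‖ ≤ 1) →
      BilinearBounds X U V (powerWeight γ ξ H c) ((X : ℝ) ^ ε) ((X : ℝ) ^ (1 - θ - 8 * ε)) := by
  filter_upwards [typeII_bound hη0 hη1 hγ hθ hε (by linarith) hu hv,
    typeI_small_bound hη0 hγ hθ hε (u := u + ε) (by linarith) hu2,
    typeI_large_bound hη0 hγ hε hσ h8 h4 hvσ hσθ] with X hII hIs hIl
  intro U V H ξ c hU1 hU2 hV1 hV2 hH hHX hc
  refine BilinearBounds.of_forall (Real.rpow_nonneg (Nat.cast_nonneg X) _) ?_ ?_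
  · intro a b ha hb hs
    exact hII U V H ξ a b c hU1 hV2 hH hHX ha hb hc hs
  · intro T a ha hs
    rcases hs with hs | hs
    · exact hIs U T H ξ a c hU2 hH hHX ha hc hs
    · refine hIl T H ξ a c hH hHX ha hc fun n hn => ?_
      obtain ⟨h1, h2⟩ := hs n hn
      refine ⟨hV1.trans (by exact_mod_cast h1.le), ?_⟩
      calc (n : ℝ) * (X : ℝ) ^ v ≤ n * V := by gcongr
        _ ≤ X := by exact_mod_cast (Nat.mul_le_mul_right V h2).trans (Nat.div_mul_le_self X V)

lemma bilinearBounds_linear {θ ε u v : ℝ} (hθ : 0 < θ) (hε : 0 < ε) (hu : 2 * θ + 40 * ε ≤ u)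
    (hv : 1 / 4 + θ + 2 * ε ≤ v) (hv2 : 2 * v + 2 * ε ≤ 1) (hθ2 : 2 * θ + 40 * ε ≤ 1 / 4) :
    ∀ᶠ X : ℕ in atTop, ∀ (U V l L q : ℕ) (a : ℤ) (α : ℝ), (X : ℝ) ^ u ≤ U → U ≤ V →
      (X : ℝ) ^ v ≤ V → (V : ℝ) ≤ (X : ℝ) ^ (v + ε) → 0 < l → l ≤ L → (L : ℝ) ≤ (X : ℝ) ^ (θ + ε) →
      0 < q → IsCoprime a (q : ℤ) → |α - a / q| ≤ 1 / (q : ℝ) ^ 2 → (X : ℝ) ^ (3 / 4 : ℝ) ≤ q →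
      (q : ℝ) ≤ 2 * (X : ℝ) ^ (3 / 4 : ℝ) →
      BilinearBounds X U V (fun n => e (l * α * n)) ((X : ℝ) ^ ε) ((X : ℝ) ^ (1 - θ - 8 * ε)) := by
  filter_upwards [eventually_ge_atTop 16, eventually_log_pow_le 2 1 hε, eventually_log_pow_le 8 1 hε,
    eventually_const_le 2 hε, eventually_const_le 32 hε, eventually_log_pow_le 1 1 hε] with X hX16 hlog h8log h2X h32X hlog1
  intro U V l L q r α hU hUV hV hV2 hl hlL hL hq hcop hα hq1 hq2
  have hX16' : (16 : ℝ) ≤ X := by exact_mod_cast hX16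
  have hX : (1 : ℝ) ≤ X := by linarith
  have hX0 : (0 : ℝ) < X := by linarith
  have hX1' : (X : ℝ) ^ (1 : ℝ) = X := Real.rpow_one _
  have hV0 : 0 < V := by
    have := (Real.rpow_pos_of_pos hX0 v).trans_le hV
    exact_mod_cast this
  rw [pow_one] at hlog h8log
  set K := X / V with hK
  have hKX : (K : ℝ) ≤ (X : ℝ) ^ (1 - v) := by
    refine Nat.cast_div_le.trans (div_le_rpow hX (a := 1) (by rw [hX1']) hV le_rfl)
  have hLK : 2 * (L * K) ≤ q := by
    have : (2 : ℝ) * (L * K) ≤ (X : ℝ) ^ (3 / 4 : ℝ) := mul_le_rpow hX (by positivity) h2X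
      (mul_le_rpow hX (by positivity) hL hKX le_rfl) (by linarith)
    exact_mod_cast this.trans hq1
  have hVK : V ≤ K := by
    rw [hK, Nat.le_div_iff_mul_le hV0]
    have : (V : ℝ) * V ≤ (X : ℝ) ^ (1 : ℝ) := mul_le_rpow hX (by positivity) hV2 hV2 (by linarith)
    rw [hX1'] at this
    exact_mod_cast this
  obtain ⟨hpos, hS⟩ := sum_inv_nint_mul_le hq hcop hα hl hlL hLK
  have hq0 : (0 : ℝ) < q := by exact_mod_cast hq
  have hqX : (q : ℝ) ≤ X := by
    refine hq2.trans ?_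
    have h1 : (2 : ℝ) ≤ (X : ℝ) ^ (1 / 4 : ℝ) := by
      calc (2 : ℝ) = (16 : ℝ) ^ (1 / 4 : ℝ) := by
            rw [show (16 : ℝ) = 2 ^ (4 : ℝ) by norm_num, ← Real.rpow_mul (by norm_num)]; norm_num
        _ ≤ _ := Real.rpow_le_rpow (by norm_num) hX16' (by norm_num)
    calc 2 * (X : ℝ) ^ (3 / 4 : ℝ) ≤ (X : ℝ) ^ (1 : ℝ) :=
          mul_le_rpow hX (by positivity) h1 le_rfl (by norm_num)
      _ = X := hX1'
  have hQ : 4 * q * (1 + Real.log q) ≤ (X : ℝ) ^ (3 / 4 + ε) := by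
    have h1 : Real.log q ≤ Real.log X := Real.log_le_log hq0 hqX
    calc 4 * q * (1 + Real.log q) ≤ 4 * (2 * (X : ℝ) ^ (3 / 4 : ℝ)) * (1 + Real.log X) := by
          have : 0 ≤ Real.log q := Real.log_natCast_nonneg q
          gcongr
      _ = (8 * (1 + Real.log X)) * (X : ℝ) ^ (3 / 4 : ℝ) := by ring
      _ ≤ _ := mul_le_rpow hX (by positivity) h8log le_rfl (by linarith)
  have hS' := hS.trans hQ
  have hYnn : 0 ≤ (X : ℝ) ^ ε := Real.rpow_nonneg hX0.le _
  refine BilinearBounds.of_forall hYnn ?_ ?_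
  · intro a b ha hb hs
    have hmain : ‖bilin X (fun n => e (l * α * n)) a b‖ ≤
        2 * (1 + Real.log X) * (X : ℝ) ^ (1 - θ - 10 * ε) := by
      refine norm_bilin_le_dyadic _ _ _ _ (by positivity) ?_
      intro N hN hNX
      by_cases hcase : U < 2 * N ∧ N ≤ V
      swap
      · rw [sum_eq_zero, norm_zero]
        · positivity
        refine fun m _ => ?_
        rw [sum_eq_zero, mul_zero]
        intro n hn
        have : a n = 0 := by
          by_contra h0
          have h1 := hs n h0
          rw [mem_Ico] at hn
          omega
        simp [this]
      obtain ⟨hc1, hc2⟩ := hcase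
      have hN0 : (0 : ℝ) < N := by exact_mod_cast hN
      have hUN : (X : ℝ) ^ u ≤ 2 * N := hU.trans (by exact_mod_cast hc1.le)
      have hdy := typeII_linear_dyadic (X := X) hpos hS' hN (by omega) ha hb
      refine le_rpow_of_sq_le (t := 2 - 2 * θ - 20 * ε) hX (hdy.trans ?_) (by linarith)
      refine mul_le_rpow hX (by positivity) (pow_le_rpow 4 hX hYnn le_rfl le_rfl)
        (b := 2 - 2 * θ - 24 * ε) ?_ (by push_cast; linarith)
      refine mul_le_rpow hX (by positivity) hX1'.ge (b := 1 - 2 * θ - 24 * ε) ?_ (by linarith)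
      have hN1 : (X : ℝ) / N ≤ 2 * (X : ℝ) ^ (1 - u) := by
        rw [div_le_iff₀ hN0]
        calc (X : ℝ) = (X : ℝ) ^ (1 - u) * (X : ℝ) ^ u := by
              rw [← Real.rpow_add hX0, sub_add_cancel, hX1']
          _ ≤ (X : ℝ) ^ (1 - u) * (2 * N) := by gcongr
          _ = _ := by ring
      have h3 : (X : ℝ) ^ (1 - u) ≤ (X : ℝ) ^ (1 - 2 * θ - 30 * ε) :=
        Real.rpow_le_rpow_of_exponent_le hX (by linarith)
      have h4 : (X : ℝ) ^ (3 / 4 + ε) ≤ (X : ℝ) ^ (1 - 2 * θ - 30 * ε) :=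
        Real.rpow_le_rpow_of_exponent_le hX (by linarith)
      have h5 : (X : ℝ) / N + 4 * (X : ℝ) ^ (3 / 4 + ε) ≤ 32 * (X : ℝ) ^ (1 - 2 * θ - 30 * ε) := by
        have := Real.rpow_nonneg hX0.le (1 - 2 * θ - 30 * ε)
        linarith
      exact h5.trans (mul_le_rpow hX (by positivity) h32X le_rfl (by linarith))
    exact hmain.trans (mul_le_rpow hX (by positivity) hlog le_rfl (by linarith))
  · intro T a ha hs
    refine (typeI_linear (K := K) hpos hS' hYnn ha fun n hn => ?_).trans ?_
    · rcases hs with hs | hs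
      · exact (hs n hn).trans (hUV.trans hVK)
      · exact (hs n hn).2
    · exact mul_le_rpow hX (by positivity) le_rfl (mul_le_rpow hX (by positivity) h2X le_rfl le_rfl)
        (by linarith)

lemma norm_windowSum_vonMangoldt_rpow_le {η γ θ : ℝ} (hη0 : 0 < η) (hγ : γ = 1 - η) (hθ : 0 < θ)
    (h : 9 * η + 10 * θ < 1) : ∃ ε, 0 < ε ∧ ε < 1 / 100 ∧ ∀ᶠ X : ℕ in atTop,
      (∀ (H : ℕ) (ξ : ℝ) (c : ℕ → ℂ), 0 < H → (H : ℝ) ≤ (X : ℝ) ^ (η + ε) → (∀ n, ‖c n‖ ≤ 1) →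
        ‖windowSum X (powerWeight γ ξ H c) vonMangoldt‖ ≤ (X : ℝ) ^ (1 - θ - 7 * ε)) ∧
      (∀ (l L q : ℕ) (a : ℤ) (α : ℝ), 0 < l → l ≤ L → (L : ℝ) ≤ (X : ℝ) ^ (θ + ε) →
        0 < q → IsCoprime a (q : ℤ) → |α - a / q| ≤ 1 / (q : ℝ) ^ 2 → (X : ℝ) ^ (3 / 4 : ℝ) ≤ q →
        (q : ℝ) ≤ 2 * (X : ℝ) ^ (3 / 4 : ℝ) →
        ‖windowSum X (fun n => e (l * α * n)) vonMangoldt‖ ≤ (X : ℝ) ^ (1 - θ - 7 * ε)) := by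
  obtain ⟨τ, hτ⟩ : ∃ τ, τ = (1 - 9 * η - 10 * θ) / 40 := ⟨_, rfl⟩
  obtain ⟨ε, hε⟩ : ∃ ε, ε = τ / 100 := ⟨_, rfl⟩
  obtain ⟨v, hv⟩ : ∃ v, v = 1 / 2 - η / 2 - θ - τ := ⟨_, rfl⟩
  have hτ0 : 0 < τ := by rw [hτ]; linarith
  have hε0 : 0 < ε := by rw [hε]; linarith
  refine ⟨ε, hε0, by linarith, ?_⟩
  filter_upwards [eventually_ge_atTop 1, exists_cutoffs (v := v) hε0 (by linarith) (by linarith),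
    bilinearBounds_powerWeight (u := 1 - 2 * v) (v := v) (σ := η + θ + 2 * τ) hη0 (by linarith) hγ hθ hε0 (by linarith)
      (by linarith) (by linarith) (by linarith) (by linarith) (by linarith) (by linarith) (by linarith),
    bilinearBounds_linear (u := 1 - 2 * v) (v := v) hθ hε0 (by linarith) (by linarith) (by linarith) (by linarith),
    eventually_card_divisors_le (show 0 < ε / 4 by linarith),
    eventually_log_pow_le 1 1 (show 0 < ε / 4 by linarith), eventually_log_pow_le 10 1 hε0]
    with X hX1 ⟨U, V, hU1, hU2, hV1, hV2, hV0, hVX, hUV, hUVX, hXU, hVV⟩ hpow hlin hdiv hlog hlog10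
  have hX : (1 : ℝ) ≤ X := by exact_mod_cast hX1
  have hX0 : (0 : ℝ) < X := by linarith
  rw [pow_one] at hlog hlog10
  have hD4 : ((X : ℝ) ^ (ε / 4)) ^ 4 = (X : ℝ) ^ ε := by
    rw [← Real.rpow_natCast, ← Real.rpow_mul hX0.le]
    congr 1
    push_cast
    ring
  have hfin : ∀ w, BilinearBounds X U V w ((X : ℝ) ^ ε) ((X : ℝ) ^ (1 - θ - 8 * ε)) →
      ‖windowSum X w vonMangoldt‖ ≤ (X : ℝ) ^ (1 - θ - 7 * ε) := by
    intro w hw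
    rw [← hD4] at hw
    refine (norm_windowSum_vonMangoldt_le hw (Real.one_le_rpow hX (by linarith)) hdiv (by linarith) hV0 hVX hUV
      hUVX hXU hVV).trans ?_
    exact mul_le_rpow hX (by positivity) hlog10 le_rfl (by linarith)
  refine ⟨fun H ξ c hH hHX hc => hfin _ (hpow U V H ξ c hU1 hU2 hV1 hV2 hH hHX hc), ?_⟩
  intro l L q a α hl hlL hL hq hcop hα hq1 hq2
  exact hfin _ (hlin U V l L q a α hU1 (by nlinarith) hV1 hV2 hl hlL hL hq hcop hα hq1 hq2)

end ArithmeticFunction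

lemma abs_sum_mul_shift_le (N : ℕ) (c : ℕ → ℝ) (h : ℤ) :
    |∑ p ∈ (range N ×ˢ range N).filter (fun p => (p.1 : ℤ) - p.2 = h), c p.1 * c p.2| ≤
      ∑ i ∈ range N, c i ^ 2 := by
  set S := (range N ×ˢ range N).filter (fun p => (p.1 : ℤ) - p.2 = h) with hS
  have hmem : ∀ p ∈ S, p.1 ∈ range N ∧ p.2 ∈ range N ∧ (p.1 : ℤ) - p.2 = h := by
    intro p hp
    rw [hS, mem_filter, mem_product] at hp
    exact ⟨hp.1.1, hp.1.2, hp.2⟩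
  have h1 : ∑ p ∈ S, c p.1 ^ 2 ≤ ∑ i ∈ range N, c i ^ 2 := by
    rw [← sum_image (f := fun i => c i ^ 2) (g := fun p : ℕ × ℕ => p.1)]
    · refine sum_le_sum_of_subset_of_nonneg ?_ fun _ _ _ => sq_nonneg _
      intro i hi
      obtain ⟨p, hp, rfl⟩ := mem_image.1 hi
      exact (hmem p hp).1
    · intro p hp q hq hpq
      have e1 := (hmem p hp).2.2
      have e2 := (hmem q hq).2.2
      simp only at hpq
      exact Prod.ext hpq (by omega)
  have h2 : ∑ p ∈ S, c p.2 ^ 2 ≤ ∑ i ∈ range N, c i ^ 2 := by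
    rw [← sum_image (f := fun i => c i ^ 2) (g := fun p : ℕ × ℕ => p.2)]
    · refine sum_le_sum_of_subset_of_nonneg ?_ fun _ _ _ => sq_nonneg _
      intro i hi
      obtain ⟨p, hp, rfl⟩ := mem_image.1 hi
      exact (hmem p hp).2.1
    · intro p hp q hq hpq
      have e1 := (hmem p hp).2.2
      have e2 := (hmem q hq).2.2
      simp only at hpq
      exact Prod.ext (by omega) hpq
  calc _ ≤ ∑ p ∈ S, |c p.1 * c p.2| := abs_sum_le_sum_abs _ _
    _ ≤ ∑ p ∈ S, (c p.1 ^ 2 + c p.2 ^ 2) / 2 := by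
        refine sum_le_sum fun p _ => ?_
        rw [abs_mul, ← sq_abs (c p.1), ← sq_abs (c p.2)]
        nlinarith [sq_nonneg (|c p.1| - |c p.2|)]
    _ = (∑ p ∈ S, c p.1 ^ 2 + ∑ p ∈ S, c p.2 ^ 2) / 2 := by rw [← sum_div, sum_add_distrib]
    _ ≤ _ := by linarith

lemma exists_geom_pow_coeff (k K : ℕ) (hk : 0 < k) (hK : 0 < K) :
    ∃ c : ℕ → ℝ, ∀ x : ℝ, (∑ j ∈ range K, e (x * j)) ^ k = ∑ i ∈ range (k * K), (c i : ℂ) * e (i * x) := by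
  set P : Polynomial ℝ := (∑ j ∈ range K, Polynomial.X ^ j) ^ k with hP
  have hdeg : P.natDegree < k * K := by
    have h1 : (∑ j ∈ range K, (Polynomial.X : Polynomial ℝ) ^ j).natDegree ≤ K - 1 :=
      Polynomial.natDegree_sum_le_of_forall_le _ _ fun j hj => by
        rw [Polynomial.natDegree_X_pow]
        have := mem_range.1 hj
        omega
    calc P.natDegree ≤ k * (K - 1) := Polynomial.natDegree_pow_le_of_le k h1
      _ < k * K := Nat.mul_lt_mul_of_pos_left (by omega) hk
  refine ⟨P.coeff, fun x => ?_⟩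
  have hpow : ∀ i : ℕ, e (i * x) = e x ^ i := fun i => (e_nat_mul i x)
  have h1 : Polynomial.eval₂ (algebraMap ℝ ℂ) (e x) P = (∑ j ∈ range K, e (x * j)) ^ k := by
    rw [hP, Polynomial.eval₂_pow, Polynomial.eval₂_finsetSum]
    congr 1
    refine sum_congr rfl fun j _ => ?_
    rw [Polynomial.eval₂_pow, Polynomial.eval₂_X, mul_comm, hpow]
  rw [← h1, Polynomial.eval₂_eq_sum_range' _ hdeg]
  refine sum_congr rfl fun i _ => ?_
  rw [hpow]
  rfl

lemma exists_fejer_pow (k K : ℕ) (hk : 0 < k) (hK : 0 < K) : ∃ (g : ℤ → ℝ) (G : ℝ → ℝ), g 0 = 1 ∧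
    (∀ h, |g h| ≤ 1) ∧ (∀ x, 0 ≤ G x) ∧
    (∀ x, (G x : ℂ) = ∑ h ∈ Ioo (-(k * K : ℕ) : ℤ) (k * K : ℕ), (g h : ℂ) * e (h * x)) ∧
    ∀ x δ, 0 < δ → δ ≤ nint x → G x ≤ (k * K : ℕ) * (2 / (δ * K)) ^ (2 * k) := by
  obtain ⟨c, hc⟩ := exists_geom_pow_coeff k K hk hK
  set J := k * K with hJ
  have hJ0 : 0 < J := Nat.mul_pos hk hK
  have hJ0' : (0 : ℝ) < J := by exact_mod_cast hJ0
  have hK0 : (0 : ℝ) < K := by exact_mod_cast hK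
  set S := ∑ i ∈ range J, c i ^ 2 with hS
  have hsum : ∑ i ∈ range J, c i = (K : ℝ) ^ k := by
    have := hc 0
    simp only [zero_mul, mul_zero, e_zero, sum_const, card_range, mul_one, nsmul_eq_mul] at this
    exact_mod_cast this.symm
  have hSlow : (K : ℝ) ^ (2 * k) / J ≤ S := by
    rw [div_le_iff₀ hJ0', mul_comm 2 k, pow_mul, ← hsum]
    have := sq_sum_le_card_mul_sum_sq (s := range J) (f := c)
    rw [card_range] at this
    linarith
  have hS0 : 0 < S := lt_of_lt_of_le (by positivity) hSlow
  set B : ℤ → Finset (ℕ × ℕ) := fun h => (range J ×ˢ range J).filter (fun p => (p.1 : ℤ) - p.2 = h) with hB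
  set g : ℤ → ℝ := fun h => (∑ p ∈ B h, c p.1 * c p.2) / S with hg
  refine ⟨g, fun x => ‖∑ j ∈ range K, e (x * j)‖ ^ (2 * k) / S, ?_, ?_, ?_, ?_, ?_⟩
  · have : ∑ p ∈ B 0, c p.1 * c p.2 = S := by
      refine (sum_bij (fun i _ => (i, i)) ?_ ?_ ?_ ?_).symm
      · intro i hi
        simp only [hB, mem_filter, mem_product, sub_self, and_true]
        exact ⟨hi, hi⟩
      · intro i _ j _ h
        exact (Prod.ext_iff.1 h).1
      · intro p hp
        simp only [hB, mem_filter, mem_product] at hp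
        exact ⟨p.1, hp.1.1, Prod.ext rfl (by have := hp.2; simp only; omega)⟩
      · intro i _
        simp only
        ring
    simp only [hg]
    rw [this, div_self hS0.ne']
  · intro h
    simp only [hg]
    rw [abs_div, abs_of_pos hS0, div_le_one hS0]
    exact abs_sum_mul_shift_le J c h
  · intro x
    positivity
  · intro x
    have h1 : ((‖∑ j ∈ range K, e (x * j)‖ ^ (2 * k) : ℝ) : ℂ) =
        ∑ p ∈ range J ×ˢ range J, ((c p.1 * c p.2 : ℝ) : ℂ) * e (((p.1 : ℤ) - p.2 : ℤ) * x) := by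
      rw [mul_comm 2 k, pow_mul, ← norm_pow, hc, Complex.ofReal_pow, ← Complex.mul_conj', map_sum, sum_mul_sum,
        ← sum_product']
      refine sum_congr rfl fun p _ => ?_
      have : (((p.1 : ℤ) - p.2 : ℤ) * x : ℝ) = p.1 * x - p.2 * x := by push_cast; ring
      rw [this, e_sub, map_mul, Complex.conj_ofReal]
      push_cast
      ring
    rw [Complex.ofReal_div, h1, ← sum_fiberwise_of_maps_to (t := Ioo (-(J : ℕ) : ℤ) (J : ℕ))
      (g := fun p : ℕ × ℕ => (p.1 : ℤ) - p.2), sum_div]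
    · refine sum_congr rfl fun h _ => ?_
      simp only [hg, hB]
      rw [Complex.ofReal_div, div_mul_eq_mul_div]
      congr 1
      rw [Complex.ofReal_sum, sum_mul]
      refine sum_congr rfl fun p hp => ?_
      rw [(mem_filter.1 hp).2]
    · intro p hp
      rw [mem_product, mem_range, mem_range] at hp
      rw [mem_Ioo]
      omega
  · intro x δ hδ hx
    have hx0 : 0 < nint x := hδ.trans_le hx
    have hord : ((range K : Finset ℕ) : Set ℕ).OrdConnected := by
      rw [coe_range]
      exact Set.ordConnected_Iio
    have h1 : ‖∑ j ∈ range K, e (x * j)‖ ≤ 2 / δ :=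
      (norm_sum_e_mul_le hord hx0).trans (by gcongr)
    calc ‖∑ j ∈ range K, e (x * j)‖ ^ (2 * k) / S ≤ (2 / δ) ^ (2 * k) / ((K : ℝ) ^ (2 * k) / J) := by gcongr
      _ = _ := by
        rw [← div_div, div_pow (2 / δ)]
        field_simp

lemma sum_Ioo_neg_eq {M : Type*} [AddCommMonoid M] (F : ℤ → M) (j : ℕ) :
    ∑ r ∈ Ioo (-((j + 1 : ℕ) : ℤ)) (j + 1 : ℕ), F r = F 0 + ∑ h ∈ Icc 1 j, (F h + F (-h)) := by
  induction j with
  | zero =>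
    have : Ioo (-((0 + 1 : ℕ) : ℤ)) (0 + 1 : ℕ) = {0} := by decide
    rw [this]
    simp
  | succ j ih =>
    have : Ioo (-((j + 1 + 1 : ℕ) : ℤ)) (j + 1 + 1 : ℕ) =
        insert (((j + 1 : ℕ) : ℤ)) (insert (-((j + 1 : ℕ) : ℤ)) (Ioo (-((j + 1 : ℕ) : ℤ)) (j + 1 : ℕ))) := by
      ext r
      simp only [mem_Ioo, mem_insert]
      omega
    rw [this, sum_insert, sum_insert, ih, ← insert_Icc_right_eq_Icc_add_one (by omega), sum_insert]
    · abel
    · simp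
    · simp
    · simp only [mem_insert, mem_Ioo]
      omega

namespace ArithmeticFunction

lemma windowSum_e_neg (X : ℕ) (x : ℕ → ℝ) (f : ArithmeticFunction ℝ) :
    windowSum X (fun n => e (-x n)) f = starRingEnd ℂ (windowSum X (fun n => e (x n)) f) := by
  rw [windowSum, windowSum, map_sum]
  refine sum_congr rfl fun n _ => ?_
  rw [map_mul, Complex.conj_ofReal, conj_e]

lemma norm_sum_mul_windowSum_le {γ ξ B : ℝ} {X J : ℕ} {f : ArithmeticFunction ℝ} (hB : 0 ≤ B)
    (h : ∀ (H : ℕ) (c : ℕ → ℂ), 0 < H → H ≤ J → (∀ n, ‖c n‖ ≤ 1) →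
      ‖windowSum X (powerWeight γ ξ H c) f‖ ≤ B) {c : ℕ → ℂ} (hc : ∀ n, ‖c n‖ ≤ 1) :
    ‖∑ h ∈ Icc 1 J, c h * windowSum X (fun n => e (h * (n : ℝ) ^ γ + ξ * n)) f‖ ≤
      2 * (1 + Real.log J) * B := by
  set c' : ℕ → ℂ := fun n => if n ≤ J then c n else 0 with hc'
  have hc1 : ∀ n, ‖c' n‖ ≤ 1 := by
    intro n
    simp only [hc']
    split_ifs
    · exact hc n
    · simp
  have := norm_sum_le_dyadic (fun h => c' h * windowSum X (fun n => e (h * (n : ℝ) ^ γ + ξ * n)) f) (X := J)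
    (fun n hn => by simp [hc', hn]) hB (fun H hH hHJ => by
      refine le_trans (le_of_eq ?_) (h H c' hH hHJ hc1)
      congr 1
      simp only [windowSum, powerWeight, mul_sum]
      rw [sum_comm]
      refine sum_congr rfl fun n _ => sum_congr rfl fun k _ => by ring)
  refine le_trans (le_of_eq ?_) this
  congr 1
  refine sum_congr rfl fun n hn => ?_
  simp only [hc']
  rw [if_pos (mem_Icc.1 hn).2]

lemma norm_sum_Ioo_erase_mul_windowSum_le {γ ξ B : ℝ} {X j : ℕ} {f : ArithmeticFunction ℝ} (hB : 0 ≤ B)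
    (h : ∀ (H : ℕ) (ξ : ℝ) (c : ℕ → ℂ), 0 < H → H ≤ j → (∀ n, ‖c n‖ ≤ 1) →
      ‖windowSum X (powerWeight γ ξ H c) f‖ ≤ B) {c : ℤ → ℂ} (hc : ∀ n, ‖c n‖ ≤ 1) :
    ‖∑ h ∈ Ioo (-((j + 1 : ℕ) : ℤ)) (j + 1 : ℕ), c h * windowSum X (fun n => e (h * (n : ℝ) ^ γ + ξ * n)) f -
      c 0 * windowSum X (fun n => e (ξ * n)) f‖ ≤ 4 * (1 + Real.log j) * B := by
  rw [sum_Ioo_neg_eq]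
  simp only [Int.cast_zero, zero_mul, zero_add, add_sub_cancel_left]
  rw [sum_add_distrib]
  have h1 := norm_sum_mul_windowSum_le (ξ := ξ) (c := fun h : ℕ => c h) hB (fun H c => h H ξ c) fun n => hc n
  have h2 := norm_sum_mul_windowSum_le (ξ := -ξ) (c := fun h : ℕ => starRingEnd ℂ (c (-h))) hB
    (fun H c => h H (-ξ) c) fun n => by rw [RCLike.norm_conj]; exact hc _
  rw [← RCLike.norm_conj, map_sum] at h2
  have h3 : ∀ k : ℕ, starRingEnd ℂ (starRingEnd ℂ (c (-k)) *
      windowSum X (fun n => e (k * (n : ℝ) ^ γ + -ξ * n)) f) =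
      c (-k) * windowSum X (fun n => e (((-k : ℤ) : ℝ) * (n : ℝ) ^ γ + ξ * n)) f := by
    intro k
    rw [map_mul, Complex.conj_conj, ← windowSum_e_neg]
    congr 3
    ext n
    congr 1
    push_cast
    ring
  simp only [h3] at h2
  refine (norm_add_le _ _).trans ?_
  simp only [Int.cast_natCast]
  linarith

lemma abs_windowSum_fejer_sub_le {γ α β s B : ℝ} {X i j : ℕ} {f : ArithmeticFunction ℝ}
    (hpow : ∀ (H : ℕ) (ξ : ℝ) (c : ℕ → ℂ), 0 < H → H ≤ i → (∀ n, ‖c n‖ ≤ 1) →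
      ‖windowSum X (powerWeight γ ξ H c) f‖ ≤ B) (hB : 0 ≤ B)
    (hlin : ∀ l : ℕ, 0 < l → l ≤ j → ‖windowSum X (fun n => e (l * α * n)) f‖ ≤ B)
    {g₁ g₂ : ℤ → ℝ} {G₁ G₂ : ℝ → ℝ} (h₁ : g₁ 0 = 1) (h₂ : g₂ 0 = 1) (b₁ : ∀ h, |g₁ h| ≤ 1)
    (b₂ : ∀ h, |g₂ h| ≤ 1)
    (e₁ : ∀ x, (G₁ x : ℂ) = ∑ h ∈ Ioo (-((i + 1 : ℕ) : ℤ)) (i + 1 : ℕ), (g₁ h : ℂ) * e (h * x))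
    (e₂ : ∀ x, (G₂ x : ℂ) = ∑ h ∈ Ioo (-((j + 1 : ℕ) : ℤ)) (j + 1 : ℕ), (g₂ h : ℂ) * e (h * x)) :
    |∑ n ∈ (Icc 1 X).filter (fun n => X < 8 * n), f n * (G₁ ((n : ℝ) ^ γ + s) * G₂ (α * n + β)) -
      ∑ n ∈ (Icc 1 X).filter (fun n => X < 8 * n), f n| ≤ (2 * j + 1) * (5 * (1 + Real.log i) * B) := by
  set W := (Icc 1 X).filter (fun n => X < 8 * n)
  set I := Ioo (-((i + 1 : ℕ) : ℤ)) (i + 1 : ℕ)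
  set T : ℤ → ℂ := fun l => ∑ h ∈ I, ((g₁ h : ℂ) * e (h * s)) *
    windowSum X (fun n => e (h * (n : ℝ) ^ γ + (l * α) * n)) f with hT
  have hlog : 0 ≤ Real.log i := Real.log_natCast_nonneg i
  have hexp : ((∑ n ∈ W, f n * (G₁ ((n : ℝ) ^ γ + s) * G₂ (α * n + β)) : ℝ) : ℂ) =
      ∑ l ∈ Ioo (-((j + 1 : ℕ) : ℤ)) (j + 1 : ℕ), ((g₂ l : ℂ) * e (l * β)) * T l := by
    simp only [hT, windowSum, mul_sum]
    rw [sum_congr rfl fun l _ => sum_comm, sum_comm, Complex.ofReal_sum]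
    refine sum_congr rfl fun n _ => ?_
    rw [Complex.ofReal_mul, Complex.ofReal_mul, mul_comm (G₁ _ : ℂ), e₁, e₂, sum_mul_sum, mul_sum]
    refine sum_congr rfl fun l _ => ?_
    rw [mul_sum]
    refine sum_congr rfl fun h _ => ?_
    rw [show (h : ℝ) * ((n : ℝ) ^ γ + s) = h * (n : ℝ) ^ γ + h * s by ring,
      show (l : ℝ) * (α * n + β) = l * α * n + l * β by ring, e_add, e_add, e_add]
    ring
  have hT1 : ∀ l : ℤ, ‖T l - windowSum X (fun n => e (l * α * n)) f‖ ≤ 4 * (1 + Real.log i) * B := by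
    intro l
    have := norm_sum_Ioo_erase_mul_windowSum_le (ξ := l * α) (c := fun h => (g₁ h : ℂ) * e (h * s)) hB hpow
      fun h => by rw [norm_mul, norm_e, mul_one, Complex.norm_real]; exact b₁ h
    simp only [h₁, Int.cast_zero, zero_mul, e_zero, Complex.ofReal_one, one_mul] at this
    exact this
  have hlin' : ∀ l : ℤ, l ≠ 0 → |l| ≤ j → ‖windowSum X (fun n => e (l * α * n)) f‖ ≤ B := by
    intro l hl0 hlj
    obtain ⟨hl1, hl2⟩ := abs_le.1 hlj
    rcases lt_or_gt_of_ne hl0 with h | h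
    · have := hlin l.natAbs (by omega) (by omega)
      rw [← Complex.norm_conj, ← windowSum_e_neg, Nat.cast_natAbs, abs_of_neg h] at this
      simpa only [Int.cast_neg, neg_mul, neg_neg] using this
    · have := hlin l.natAbs (by omega) (by omega)
      rw [Nat.cast_natAbs, abs_of_pos h] at this
      exact this
  have hT2 : ∀ l : ℤ, l ≠ 0 → |l| ≤ j → ‖T l‖ ≤ 5 * (1 + Real.log i) * B := by
    intro l hl0 hlj
    have h1 := norm_sub_norm_le (T l) (windowSum X (fun n => e (l * α * n)) f)
    have h2 := hT1 l
    have h3 := hlin' l hl0 hlj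
    nlinarith [mul_nonneg hlog hB]
  have hT0 : ‖T 0 - (∑ n ∈ W, f n : ℝ)‖ ≤ 5 * (1 + Real.log i) * B := by
    have := hT1 0
    simp only [Int.cast_zero, zero_mul, e_zero, windowSum, mul_one] at this
    rw [Complex.ofReal_sum]
    refine this.trans ?_
    gcongr
    norm_num
  have hterm : ∀ l : ℤ, ‖(g₂ l : ℂ) * e (l * β)‖ ≤ 1 := by
    intro l
    rw [norm_mul, norm_e, mul_one, Complex.norm_real]
    exact b₂ l
  have hterm' : ∀ l : ℤ, l ≠ 0 → |l| ≤ j → ‖((g₂ l : ℂ) * e (l * β)) * T l‖ ≤ 5 * (1 + Real.log i) * B := by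
    intro l hl0 hlj
    rw [norm_mul]
    exact (mul_le_of_le_one_left (norm_nonneg _) (hterm l)).trans (hT2 l hl0 hlj)
  rw [← Real.norm_eq_abs, ← Complex.norm_real, Complex.ofReal_sub, hexp, sum_Ioo_neg_eq, add_sub_right_comm]
  refine (norm_add_le _ _).trans ?_
  have h0 : ‖((g₂ 0 : ℂ) * e ((0 : ℤ) * β)) * T 0 - (∑ n ∈ W, f n : ℝ)‖ ≤ 5 * (1 + Real.log i) * B := by
    simpa [h₂, e_zero] using hT0
  have h1 : ‖∑ h ∈ Icc 1 j, (((g₂ h : ℂ) * e ((h : ℤ) * β)) * T h + ((g₂ (-h) : ℂ) * e ((-h : ℤ) * β)) * T (-h))‖ ≤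
      j * (2 * (5 * (1 + Real.log i) * B)) := by
    refine (norm_sum_le _ _).trans ((sum_le_card_nsmul _ _ (2 * (5 * (1 + Real.log i) * B)) ?_).trans ?_)
    · intro l hl
      rw [mem_Icc] at hl
      refine (norm_add_le _ _).trans ?_
      have e1 := hterm' l (by omega) (by rw [abs_of_nonneg (by omega)]; omega)
      have e2 := hterm' (-l) (by omega) (by rw [abs_neg, abs_of_nonneg (by omega)]; omega)
      linarith
    · rw [Nat.card_Icc, Nat.add_sub_cancel, nsmul_eq_mul]
  calc _ ≤ 5 * (1 + Real.log i) * B + j * (2 * (5 * (1 + Real.log i) * B)) := add_le_add h0 h1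
    _ = _ := by ring

end ArithmeticFunction

lemma eventually_exists_fejer {κ ε : ℝ} (hε : 0 < ε) (hκ : 0 < κ) :
    ∀ᶠ X : ℕ in atTop, ∃ (j : ℕ) (g : ℤ → ℝ) (G : ℝ → ℝ), ((j + 1 : ℕ) : ℝ) ≤ (X : ℝ) ^ (κ + ε) ∧ g 0 = 1 ∧
      (∀ h, |g h| ≤ 1) ∧ (∀ x, 0 ≤ G x) ∧
      (∀ x, (G x : ℂ) = ∑ h ∈ Ioo (-((j + 1 : ℕ) : ℤ)) (j + 1 : ℕ), (g h : ℂ) * e (h * x)) ∧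
      (∀ x, G x ≤ 2 * (X : ℝ) ^ (κ + ε)) ∧
      ∀ x, (X : ℝ) ^ (-κ) / 8 ≤ nint x → G x ≤ (X : ℝ) ^ (-2 : ℝ) := by
  obtain ⟨k, hk⟩ := exists_nat_ge ((κ + ε + 2) * 2 / ε)
  have hk0 : 0 < k := by
    have : 0 < (κ + ε + 2) * 2 / ε := by positivity
    exact_mod_cast this.trans_le hk
  rw [div_le_iff₀ hε] at hk
  filter_upwards [eventually_ge_atTop 1, eventually_const_le (2 * k) (half_pos hε),
    eventually_const_le 16 (show 0 < ε / 4 by linarith)] with X hX1 h2k h16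
  have hX : (1 : ℝ) ≤ X := by exact_mod_cast hX1
  have hX0 : (0 : ℝ) < X := by linarith
  obtain ⟨K, hK⟩ : ∃ K, K = ⌈(X : ℝ) ^ (κ + ε / 2)⌉₊ := ⟨_, rfl⟩
  have hP1 : 1 ≤ (X : ℝ) ^ (κ + ε / 2) := Real.one_le_rpow hX (by linarith)
  have hKl : (X : ℝ) ^ (κ + ε / 2) ≤ K := by rw [hK]; exact Nat.le_ceil _
  have hKu : (K : ℝ) ≤ 2 * (X : ℝ) ^ (κ + ε / 2) := by
    have := Nat.ceil_lt_add_one (zero_le_one.trans hP1)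
    rw [hK]
    linarith
  have hK0 : 0 < K := by exact_mod_cast (zero_lt_one.trans_le hP1).trans_le hKl
  have hJ : ((k * K : ℕ) : ℝ) ≤ (X : ℝ) ^ (κ + ε) := by
    push_cast
    calc (k : ℝ) * K ≤ (2 * k) * (X : ℝ) ^ (κ + ε / 2) := by nlinarith [Nat.cast_nonneg (α := ℝ) k]
      _ ≤ _ := mul_le_rpow hX (by positivity) h2k le_rfl (by linarith)
  obtain ⟨g, G, hg0, hg1, hG0, hG, hGδ⟩ := exists_fejer_pow k K hk0 hK0
  obtain ⟨j, hj⟩ : ∃ j, k * K = j + 1 := ⟨k * K - 1, (Nat.succ_pred_eq_of_pos (Nat.mul_pos hk0 hK0)).symm⟩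
  rw [hj] at hJ hG hGδ
  refine ⟨j, g, G, hJ, hg0, hg1, hG0, hG, fun x => ?_, fun x hx => ?_⟩
  · have h1 : ‖(G x : ℂ)‖ ≤ ∑ h ∈ Ioo (-((j + 1 : ℕ) : ℤ)) (j + 1 : ℕ), (1 : ℝ) := by
      rw [hG]
      refine (norm_sum_le _ _).trans (sum_le_sum fun h _ => ?_)
      rw [norm_mul, norm_e, mul_one, Complex.norm_real]
      exact hg1 h
    rw [Complex.norm_real, Real.norm_eq_abs, sum_const, Int.card_Ioo, nsmul_eq_mul, mul_one] at h1
    have h2 : ((((j + 1 : ℕ) : ℤ) - -((j + 1 : ℕ) : ℤ) - 1).toNat : ℝ) ≤ 2 * (j + 1 : ℕ) := by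
      norm_cast
      omega
    linarith [le_abs_self (G x)]
  · have hδ : 0 < (X : ℝ) ^ (-κ) / 8 := by positivity
    have h1 : 2 / ((X : ℝ) ^ (-κ) / 8 * K) ≤ (X : ℝ) ^ (-(ε / 4)) := by
      refine (div_le_div_of_nonneg_left (by norm_num) (by positivity)
        (mul_le_mul_of_nonneg_left hKl hδ.le)).trans ?_
      have h2 : 2 / ((X : ℝ) ^ (-κ) / 8 * (X : ℝ) ^ (κ + ε / 2)) = 16 / (X : ℝ) ^ (ε / 2) := by
        rw [div_mul_eq_mul_div, ← Real.rpow_add hX0, show -κ + (κ + ε / 2) = ε / 2 by ring]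
        field_simp
        norm_num
      rw [h2]
      exact div_le_rpow hX h16 le_rfl (by linarith)
    have h3 : (2 / ((X : ℝ) ^ (-κ) / 8 * K)) ^ (2 * k) ≤ (X : ℝ) ^ (-(κ + ε + 2)) := by
      refine pow_le_rpow (2 * k) hX (by positivity) h1 ?_
      push_cast
      linarith
    exact (hGδ x _ hδ hx).trans (mul_le_rpow hX (by positivity) hJ h3 (by linarith))

namespace ArithmeticFunction

lemma eventually_le_sum_window_vonMangoldt :
    ∀ᶠ X : ℕ in atTop, (X : ℝ) / 4 ≤ ∑ n ∈ (Icc 1 X).filter (fun n => X < 8 * n), vonMangoldt n := by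
  filter_upwards [eventually_ge_atTop 8, eventually_log_pow_le 100 1 (show (0 : ℝ) < 1 / 2 by norm_num)] with X hX8 hlog
  rw [pow_one, ← Real.sqrt_eq_rpow] at hlog
  have hX : (8 : ℝ) ≤ X := by exact_mod_cast hX8
  have hs : √(X : ℝ) * √(X : ℝ) = X := Real.mul_self_sqrt (by linarith)
  have hs1 : 1 ≤ √(X : ℝ) := by rw [Real.one_le_sqrt]; linarith
  have hL0 : 0 ≤ Real.log X := Real.log_nonneg (by linarith)
  have h1 := Chebyshev.psi_ge X
  have h2 := Chebyshev.psi_le (x := (X : ℝ) / 8) (by linarith)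
  have h3 : Real.log (X + 1) ≤ 1 + Real.log X := by
    have : Real.log (X + 1) ≤ Real.log (2 * X) := Real.log_le_log (by linarith) (by linarith)
    rw [Real.log_mul (by norm_num) (by linarith)] at this
    linarith [Real.log_two_lt_d9]
  have h4 : √((X : ℝ) / 8) * Real.log ((X : ℝ) / 8) ≤ √(X : ℝ) * Real.log X := by
    refine mul_le_mul (Real.sqrt_le_sqrt (by linarith)) (Real.log_le_log (by linarith) (by linarith))
      (Real.log_nonneg (by linarith)) (Real.sqrt_nonneg _)
  have h5 : Real.log 4 = 2 * Real.log 2 := by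
    rw [show (4 : ℝ) = 2 ^ 2 by norm_num, Real.log_pow]
    norm_num
  have h6 : Chebyshev.psi X = Chebyshev.psi ((X : ℝ) / 8) +
      ∑ n ∈ (Icc 1 X).filter (fun n => X < 8 * n), vonMangoldt n := by
    rw [Chebyshev.psi, Chebyshev.psi, Nat.floor_natCast, ← sum_filter_not_add_sum_filter (Ioc 0 X) (fun n => X < 8 * n)]
    have h7 : ⌊(X : ℝ) / 8⌋₊ = X / 8 := by
      exact_mod_cast Nat.floor_div_eq_div (K := ℝ) X 8
    congr 1
    · rw [h7]
      refine sum_congr ?_ fun _ _ => rfl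
      ext n
      simp only [mem_filter, mem_Ioc]
      omega
  have h8 := Real.log_two_gt_d9
  have h9 : 100 * ((1 + Real.log X) * √(X : ℝ)) ≤ X := by nlinarith
  nlinarith

lemma sum_window_vonMangoldt_not_prime_le {X : ℕ} (hX : 1 ≤ X) :
    ∑ n ∈ ((Icc 1 X).filter (fun n => X < 8 * n)).filter (fun n => ¬ n.Prime), vonMangoldt n ≤
      2 * √(X : ℝ) * Real.log X := by
  refine le_trans ?_ (Chebyshev.psi_sub_theta_le (x := X) (by exact_mod_cast hX))
  rw [Chebyshev.psi_sub_theta_eq_sum_not_prime, Nat.floor_natCast]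
  refine sum_le_sum_of_subset_of_nonneg ?_ fun _ _ _ => vonMangoldt_nonneg
  intro n
  simp only [mem_filter, mem_Icc, mem_Ioc]
  exact fun hn => ⟨⟨by omega, hn.1.1.2⟩, hn.2⟩

end ArithmeticFunction

namespace ArithmeticFunction

lemma eventually_exists_prime_nint_lt {η γ θ : ℝ} (hη0 : 0 < η) (hγ : γ = 1 - η) (hθ : 0 < θ)
    (h : 9 * η + 10 * θ < 1) : ∀ᶠ X : ℕ in atTop, ∀ (q : ℕ) (a : ℤ) (α β s : ℝ), 0 < q →
      IsCoprime a (q : ℤ) → |α - a / q| ≤ 1 / (q : ℝ) ^ 2 → (X : ℝ) ^ (3 / 4 : ℝ) ≤ q →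
      (q : ℝ) ≤ 2 * (X : ℝ) ^ (3 / 4 : ℝ) → ∃ p : ℕ, p.Prime ∧ X < 8 * p ∧ p ≤ X ∧
        nint ((p : ℝ) ^ γ + s) < (X : ℝ) ^ (-η) / 8 ∧ nint (α * p + β) < (X : ℝ) ^ (-θ) := by
  obtain ⟨ε, hε, hε1, hev⟩ := norm_windowSum_vonMangoldt_rpow_le hη0 hγ hθ h
  filter_upwards [eventually_ge_atTop 1, hev, eventually_exists_fejer hε hη0, eventually_exists_fejer hε hθ,
    eventually_le_sum_window_vonMangoldt, eventually_log_pow_le 10 1 hε, eventually_const_le 100 hε]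
    with X hX1 hX hF₁ hF₂ hmain hlog h100 q a α β s hq hcop hα hq1 hq2
  obtain ⟨i, g₁, G₁, hi, h₁, b₁, p₁, e₁, u₁, d₁⟩ := hF₁
  obtain ⟨j, g₂, G₂, hj, h₂, b₂, p₂, e₂, u₂, d₂⟩ := hF₂
  have hX1' : (1 : ℝ) ≤ X := by exact_mod_cast hX1
  have hX0 : (0 : ℝ) < X := by linarith
  have hL0 : 0 ≤ Real.log X := Real.log_nonneg hX1'
  rw [pow_one] at hlog
  push_cast at hi hj
  set W := (Icc 1 X).filter (fun n => X < 8 * n) with hW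
  have hdiff := abs_windowSum_fejer_sub_le (γ := γ) (α := α) (β := β) (s := s) (X := X) (i := i) (j := j)
    (f := vonMangoldt) (B := (X : ℝ) ^ (1 - θ - 7 * ε))
    (fun H ξ c hH hHi hc => hX.1 H ξ c hH (by
      have : (H : ℝ) ≤ i := by exact_mod_cast hHi
      linarith) hc) (by positivity)
    (fun l hl hlj => hX.2 l j q a α hl hlj (by linarith) hq hcop hα hq1 hq2) h₁ h₂ b₁ b₂ e₁ e₂
  have hlogi : Real.log i ≤ Real.log X := by
    rcases Nat.eq_zero_or_pos i with rfl | hi0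
    · simpa using hL0
    · refine Real.log_le_log (by exact_mod_cast hi0) ?_
      have : (X : ℝ) ^ (η + ε) ≤ (X : ℝ) ^ (1 : ℝ) := Real.rpow_le_rpow_of_exponent_le hX1' (by linarith)
      rw [Real.rpow_one] at this
      linarith
  have herr : (2 * j + 1) * (5 * (1 + Real.log i) * (X : ℝ) ^ (1 - θ - 7 * ε)) ≤ (X : ℝ) ^ (1 - ε) := by
    calc (2 * j + 1) * (5 * (1 + Real.log i) * (X : ℝ) ^ (1 - θ - 7 * ε)) ≤
          (2 * (j + 1)) * (5 * (1 + Real.log X) * (X : ℝ) ^ (1 - θ - 7 * ε)) := by gcongr; linarith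
      _ = (j + 1) * ((10 * (1 + Real.log X)) * (X : ℝ) ^ (1 - θ - 7 * ε)) := by ring
      _ ≤ _ := mul_le_rpow hX1' (by positivity) hj (mul_le_rpow hX1' (by positivity) hlog le_rfl le_rfl) (by linarith)
  have hone : (X : ℝ) ^ (1 - ε) * 100 ≤ X := by
    have := mul_le_rpow hX1' (by norm_num) (le_refl ((X : ℝ) ^ (1 - ε))) h100 (show 1 - ε + ε ≤ 1 by linarith)
    rwa [Real.rpow_one] at this
  by_contra! hcon
  have hsplit : ∑ n ∈ W, vonMangoldt n * (G₁ ((n : ℝ) ^ γ + s) * G₂ (α * n + β)) ≤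
      ∑ n ∈ W, (Real.log X * (2 * (X : ℝ) ^ (-1 : ℝ))) +
      ∑ n ∈ W.filter (fun n => ¬ n.Prime), vonMangoldt n * (4 * (X : ℝ) ^ (η + θ + 2 * ε)) := by
    rw [sum_filter (fun n : ℕ => ¬ n.Prime), ← sum_add_distrib]
    refine sum_le_sum fun n hn => ?_
    rw [hW, mem_filter, mem_Icc] at hn
    have hn1 : (1 : ℝ) ≤ n := by exact_mod_cast hn.1.1
    have hnX : (n : ℝ) ≤ X := by exact_mod_cast hn.1.2
    have hΛ0 : 0 ≤ vonMangoldt n := vonMangoldt_nonneg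
    by_cases hp : n.Prime
    · rw [if_neg (not_not.2 hp), add_zero]
      have hΛ : vonMangoldt n ≤ Real.log X := vonMangoldt_le_log.trans (Real.log_le_log (by linarith) hnX)
      refine mul_le_mul hΛ ?_ (mul_nonneg (p₁ _) (p₂ _)) hL0
      rcases lt_or_ge (nint ((n : ℝ) ^ γ + s)) ((X : ℝ) ^ (-η) / 8) with h1 | h1
      · have h2 := d₂ _ ((div_le_self (by positivity) (by norm_num)).trans (hcon n hp hn.2 hn.1.2 h1))
        calc _ ≤ (2 * (X : ℝ) ^ (η + ε)) * (X : ℝ) ^ (-2 : ℝ) := mul_le_mul (u₁ _) h2 (p₂ _) (by positivity)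
          _ = 2 * ((X : ℝ) ^ (η + ε) * (X : ℝ) ^ (-2 : ℝ)) := by ring
          _ ≤ _ := by
            gcongr
            exact mul_le_rpow hX1' (by positivity) le_rfl le_rfl (by linarith)
      · have h2 := d₁ _ h1
        calc _ ≤ (X : ℝ) ^ (-2 : ℝ) * (2 * (X : ℝ) ^ (θ + ε)) := mul_le_mul h2 (u₂ _) (p₂ _) (by positivity)
          _ = 2 * ((X : ℝ) ^ (-2 : ℝ) * (X : ℝ) ^ (θ + ε)) := by ring
          _ ≤ _ := by
            gcongr
            exact mul_le_rpow hX1' (by positivity) le_rfl le_rfl (by linarith)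
    · rw [if_pos hp]
      have : vonMangoldt n * (G₁ ((n : ℝ) ^ γ + s) * G₂ (α * n + β)) ≤
          vonMangoldt n * (4 * (X : ℝ) ^ (η + θ + 2 * ε)) := by
        refine mul_le_mul_of_nonneg_left ?_ hΛ0
        calc _ ≤ (2 * (X : ℝ) ^ (η + ε)) * (2 * (X : ℝ) ^ (θ + ε)) :=
              mul_le_mul (u₁ _) (u₂ _) (p₂ _) (by positivity)
          _ = 4 * ((X : ℝ) ^ (η + ε) * (X : ℝ) ^ (θ + ε)) := by ring
          _ ≤ _ := by
            gcongr
            exact mul_le_rpow hX1' (by positivity) le_rfl le_rfl (by linarith)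
      have h0 : 0 ≤ Real.log X * (2 * (X : ℝ) ^ (-1 : ℝ)) := by positivity
      linarith
  have hA : ∑ n ∈ W, (Real.log X * (2 * (X : ℝ) ^ (-1 : ℝ))) ≤ (X : ℝ) ^ (1 - ε) := by
    rw [sum_const, nsmul_eq_mul]
    have hcard : (#W : ℝ) ≤ X := by
      have : #W ≤ #(Icc 1 X) := card_filter_le _ _
      rw [Nat.card_Icc, Nat.add_sub_cancel] at this
      exact_mod_cast this
    calc _ ≤ (X : ℝ) * (Real.log X * (2 * (X : ℝ) ^ (-1 : ℝ))) := by gcongr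
      _ = 2 * Real.log X := by
        rw [Real.rpow_neg_one]
        field_simp
      _ ≤ (X : ℝ) ^ ε := by linarith
      _ ≤ _ := Real.rpow_le_rpow_of_exponent_le hX1' (by linarith)
  have hB : ∑ n ∈ W.filter (fun n => ¬ n.Prime), vonMangoldt n * (4 * (X : ℝ) ^ (η + θ + 2 * ε)) ≤
      (X : ℝ) ^ (1 - ε) := by
    rw [← sum_mul]
    calc _ ≤ (2 * √(X : ℝ) * Real.log X) * (4 * (X : ℝ) ^ (η + θ + 2 * ε)) := by
          gcongr
          exact sum_window_vonMangoldt_not_prime_le hX1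
      _ = √(X : ℝ) * ((8 * Real.log X) * (X : ℝ) ^ (η + θ + 2 * ε)) := by ring
      _ ≤ _ := by
        rw [Real.sqrt_eq_rpow]
        exact mul_le_rpow hX1' (by positivity) le_rfl
          (mul_le_rpow hX1' (by positivity) (show _ ≤ (X : ℝ) ^ ε by linarith) le_rfl le_rfl) (by linarith)
  have := (abs_le.1 hdiff).1
  linarith

end ArithmeticFunction

lemma exists_eq_floor_rpow_of_nint_lt {c : ℝ} (hc : 1 < c) (hc2 : c < 2) {p X : ℕ} (hp : 0 < p) (hpX : p ≤ X)
    (h : nint ((p : ℝ) ^ (1 / c) + (X : ℝ) ^ (-(1 - 1 / c)) / 8) < (X : ℝ) ^ (-(1 - 1 / c)) / 8) :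
    ∃ n : ℕ, 0 < n ∧ (p : ℤ) = ⌊(n : ℝ) ^ c⌋ := by
  obtain ⟨γ, hγ⟩ : ∃ γ, γ = 1 / c := ⟨_, rfl⟩
  have hc0 : 0 < c := by linarith
  have hγ0 : 0 < γ := by rw [hγ]; positivity
  have hγ1 : γ < 1 := by rw [hγ, div_lt_one hc0]; exact hc
  have hp1 : (1 : ℝ) ≤ p := by exact_mod_cast hp
  have hpX' : (p : ℝ) ≤ X := by exact_mod_cast hpX
  rw [← hγ, nint, abs_lt] at h
  set δ := (X : ℝ) ^ (-(1 - γ)) / 8 with hδ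
  set N := round ((p : ℝ) ^ γ + δ) with hN
  have h1 : (p : ℝ) ^ γ < N := by linarith
  have h2 : (N : ℝ) < (p : ℝ) ^ γ + 2 * δ := by linarith
  have hb := rpow_one_add_le_one_add_mul_self (s := -(1 / ((p : ℝ) + 1))) (p := γ)
    (by rw [neg_le_neg_iff, div_le_one (by linarith)]; linarith) hγ0.le hγ1.le
  have h3 : (p : ℝ) ^ γ ≤ ((p : ℝ) + 1) ^ γ - γ * ((p : ℝ) + 1) ^ (γ - 1) := by
    have e1 : (p : ℝ) = ((p : ℝ) + 1) * (1 + -(1 / ((p : ℝ) + 1))) := by field_simp; ring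
    have e2 : 0 ≤ 1 + -(1 / ((p : ℝ) + 1)) := by
      rw [← sub_eq_add_neg, sub_nonneg, div_le_one (by linarith)]
      linarith
    have e3 : ((p : ℝ) + 1) ^ (γ - 1) = ((p : ℝ) + 1) ^ γ / (p + 1) := Real.rpow_sub_one (by linarith) _
    calc (p : ℝ) ^ γ = ((p : ℝ) + 1) ^ γ * (1 + -(1 / ((p : ℝ) + 1))) ^ γ := by
          conv_lhs => rw [e1]
          exact Real.mul_rpow (by linarith) e2
      _ ≤ ((p : ℝ) + 1) ^ γ * (1 + γ * -(1 / ((p : ℝ) + 1))) := by gcongr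
      _ = _ := by rw [e3]; ring
  have h4 : 2 * δ ≤ γ * ((p : ℝ) + 1) ^ (γ - 1) := by
    have e1 : (2 * (X : ℝ)) ^ (γ - 1) ≤ ((p : ℝ) + 1) ^ (γ - 1) :=
      Real.rpow_le_rpow_of_nonpos (by linarith) (by linarith) (by linarith)
    have e2 : (2 : ℝ) ^ (-1 : ℝ) ≤ 2 ^ (γ - 1) := Real.rpow_le_rpow_of_exponent_le (by norm_num) (by linarith)
    rw [Real.rpow_neg_one] at e2
    rw [Real.mul_rpow (by norm_num) (by linarith)] at e1
    have e3 : 1 / 2 ≤ γ := by rw [hγ]; exact one_div_le_one_div_of_le hc0 hc2.le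
    have e4 : 0 ≤ (X : ℝ) ^ (γ - 1) := by positivity
    rw [hδ, neg_sub]
    calc 2 * ((X : ℝ) ^ (γ - 1) / 8) = 1 / 2 * (2⁻¹ * (X : ℝ) ^ (γ - 1)) := by ring
      _ ≤ γ * ((2 : ℝ) ^ (γ - 1) * (X : ℝ) ^ (γ - 1)) := by gcongr
      _ ≤ _ := by gcongr
  have hN0 : (0 : ℝ) < N := lt_of_le_of_lt (by positivity) h1
  have hcast : ((N.toNat : ℕ) : ℝ) = N := by
    have : ((N.toNat : ℕ) : ℤ) = N := Int.toNat_of_nonneg (by exact_mod_cast hN0.le)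
    exact_mod_cast congrArg (Int.cast (R := ℝ)) this
  have hinv : ∀ x : ℝ, 0 ≤ x → (x ^ γ) ^ c = x := by
    intro x hx
    rw [← Real.rpow_mul hx, hγ, one_div_mul_cancel hc0.ne', Real.rpow_one]
  refine ⟨N.toNat, by simpa using (show 0 < N by exact_mod_cast hN0), ?_⟩
  rw [eq_comm, Int.floor_eq_iff, hcast, Int.cast_natCast]
  constructor
  · rw [← hinv p (by linarith)]
    exact Real.rpow_le_rpow (by positivity) h1.le hc0.le
  · rw [← hinv (p + 1) (by linarith)]
    exact Real.rpow_lt_rpow hN0.le (by linarith) hc0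

lemma exists_den_gt {α : ℝ} (hα : Irrational α) (B : ℕ) :
    ∃ r : ℚ, B < r.den ∧ |α - r| < 1 / (r.den : ℝ) ^ 2 := by
  by_contra! hcon
  refine Real.infinite_rat_abs_sub_lt_one_div_den_sq_of_irrational hα ?_
  have hfin : ((Set.Icc (⌊-((|α| + 1) * B)⌋) ⌈(|α| + 1) * B⌉) ×ˢ (Set.Icc 0 B : Set ℕ)).Finite :=
    (Set.finite_Icc _ _).prod (Set.finite_Icc _ _)
  refine Set.Finite.of_injOn (f := fun r : ℚ => (r.num, r.den)) ?_ ?_ hfin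
  · intro r hr
    rw [Set.mem_ofPred_eq] at hr
    have hB : r.den ≤ B := by
      by_contra! h
      exact absurd hr (not_lt.2 (hcon r h))
    have hd : (1 : ℝ) ≤ r.den := by exact_mod_cast r.den_pos
    have hB' : (r.den : ℝ) ≤ B := by exact_mod_cast hB
    have h1 : |α - r| < 1 := hr.trans_le (by
      rw [div_le_one (by positivity)]
      nlinarith)
    have h2 : |(r : ℝ)| ≤ |α| + 1 := by
      have := abs_sub_abs_le_abs_sub (r : ℝ) α
      rw [abs_sub_comm] at this
      linarith
    have h3 : (r.num : ℝ) = r * r.den := by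
      exact_mod_cast (Rat.mul_den_eq_num r).symm
    have h4 : |(r.num : ℝ)| ≤ (|α| + 1) * B := by
      rw [h3, abs_mul, Nat.abs_cast]
      gcongr
    obtain ⟨h5, h6⟩ := abs_le.1 h4
    refine ⟨⟨?_, ?_⟩, Nat.zero_le _, hB⟩
    · exact_mod_cast (Int.floor_le _).trans h5
    · exact_mod_cast h6.trans (Int.le_ceil _)
  · intro r _ t _ hrt
    rw [Prod.mk.injEq] at hrt
    exact Rat.ext hrt.1 hrt.2

lemma exists_window_of_den (q : ℕ) (hq : 0 < q) :
    ∃ X : ℕ, q ≤ X ∧ (X : ℝ) ^ (3 / 4 : ℝ) ≤ q ∧ (q : ℝ) ≤ 2 * (X : ℝ) ^ (3 / 4 : ℝ) := by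
  have hq1 : (1 : ℝ) ≤ q := by exact_mod_cast hq
  have hY : (q : ℝ) ≤ (q : ℝ) ^ (4 / 3 : ℝ) := by
    conv_lhs => rw [← Real.rpow_one (q : ℝ)]
    exact Real.rpow_le_rpow_of_exponent_le hq1 (by norm_num)
  have hinv : ((q : ℝ) ^ (4 / 3 : ℝ)) ^ (3 / 4 : ℝ) = q := by
    rw [← Real.rpow_mul (by linarith)]
    norm_num
  have hX : q ≤ ⌊(q : ℝ) ^ (4 / 3 : ℝ)⌋₊ := Nat.le_floor hY
  refine ⟨_, hX, ?_, ?_⟩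
  · conv_rhs => rw [← hinv]
    gcongr
    exact Nat.floor_le (by linarith)
  · have h1 := Nat.lt_floor_add_one ((q : ℝ) ^ (4 / 3 : ℝ))
    have h2 : (1 : ℝ) ≤ ⌊(q : ℝ) ^ (4 / 3 : ℝ)⌋₊ := by exact_mod_cast (show 1 ≤ q from hq).trans hX
    calc (q : ℝ) = ((q : ℝ) ^ (4 / 3 : ℝ)) ^ (3 / 4 : ℝ) := hinv.symm
      _ ≤ (2 * ⌊(q : ℝ) ^ (4 / 3 : ℝ)⌋₊ : ℝ) ^ (3 / 4 : ℝ) := by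
        gcongr
        linarith
      _ = 2 ^ (3 / 4 : ℝ) * (⌊(q : ℝ) ^ (4 / 3 : ℝ)⌋₊ : ℝ) ^ (3 / 4 : ℝ) :=
        Real.mul_rpow (by norm_num) (by positivity)
      _ ≤ 2 * _ := by
        gcongr
        conv_rhs => rw [← Real.rpow_one (2 : ℝ)]
        exact Real.rpow_le_rpow_of_exponent_le (by norm_num) (by norm_num)

theorem main_thm (α : ℝ) (hα : Irrational α) (β c θ : ℝ)
    (hc1 : 1 < c) (hc2 : c < 9/8) (hθ1 : 0 < θ) (hθ2 : θ < (9/c - 8)/10) :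
    {p : ℕ | p.Prime ∧ (∃ n : ℕ, 0 < n ∧ (p : ℤ) = ⌊(n:ℝ)^c⌋) ∧
      nint (α * p + β) < (p:ℝ)^(-θ)}.Infinite := by
  have hc0 : 0 < c := by linarith
  have hη : 0 < 1 - 1 / c := by
    rw [sub_pos, div_lt_one hc0]
    exact hc1
  have hcond : 9 * (1 - 1 / c) + 10 * θ < 1 := by
    have : 9 / c = 9 * (1 / c) := by ring
    linarith
  obtain ⟨X₀, hX₀⟩ := eventually_atTop.1
    (ArithmeticFunction.eventually_exists_prime_nint_lt (γ := 1 / c) hη (by ring) hθ1 hcond)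
  rw [Set.infinite_iff_exists_gt]
  intro B
  obtain ⟨r, hr, hrα⟩ := exists_den_gt hα (8 * B + X₀)
  obtain ⟨X, hqX, hX1, hX2⟩ := exists_window_of_den r.den r.den_pos
  have hcast : (r : ℝ) = r.num / r.den := by exact_mod_cast (Rat.num_div_den r).symm
  rw [hcast] at hrα
  obtain ⟨p, hp, hXp, hpX, h1, h2⟩ := hX₀ X (by omega) r.den r.num α β ((X : ℝ) ^ (-(1 - 1 / c)) / 8) r.den_pos
    (by simpa [Int.isCoprime_iff_gcd_eq_one, Int.gcd] using r.reduced) hrα.le hX1 hX2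
  refine ⟨p, ⟨hp, exists_eq_floor_rpow_of_nint_lt hc1 (by linarith) hp.pos hpX h1, h2.trans_le ?_⟩, by omega⟩
  exact Real.rpow_le_rpow_of_nonpos (by exact_mod_cast hp.pos) (by exact_mod_cast hpX) (by linarith)
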